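/- (Lower bound on the free energy) Assume ν satisfies Condition M. Then for all sufficiently large β and every ε > 0, there exist constants c, C > 0 (depending on ε) such that for all N, P{(1/N)·log Z_{N,β} < Λ_{Z,β}(−E_0(q⋆), q⋆) − ε} ≤ C·e^{−cN}. -/

import Mathlib

open MeasureTheory ProbabilityTheory Real Filter Set Matrix
open scoped ENNReal

noncomputable section

namespace SpinGlass


/-- Coefficient decay: `limsup p⁻¹ log γ_p < 0`. -/
def GammaDecay (γ : ℕ → ℝ) : Prop :=
  (∀ p, 0 ≤ γ p) ∧ ∃ ρ : ℝ, 0 < ρ ∧ ρ < 1 ∧ ∀ᶠ p in atTop, γ p ≤ ρ ^ p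

/-- ν(x) = Σ_{p≥2} γ_p² xᵖ. -/
def nuF (γ : ℕ → ℝ) (x : ℝ) : ℝ := ∑' p : ℕ, if 2 ≤ p then γ p ^ 2 * x ^ p else 0

/-- ν′(x), termwise. -/
def nuD1 (γ : ℕ → ℝ) (x : ℝ) : ℝ :=
  ∑' p : ℕ, if 2 ≤ p then γ p ^ 2 * p * x ^ (p - 1) else 0

/-- ν″(x), termwise. -/
def nuD2 (γ : ℕ → ℝ) (x : ℝ) : ℝ :=
  ∑' p : ℕ, if 2 ≤ p then γ p ^ 2 * p * ((p : ℝ) - 1) * x ^ (p - 2) else 0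

/-- ν is mixed (not a monomial). -/
def Mixed (γ : ℕ → ℝ) : Prop :=
  ∃ p q : ℕ, 2 ≤ p ∧ 2 ≤ q ∧ p ≠ q ∧ γ p ≠ 0 ∧ γ q ≠ 0

/-- The logarithmic potential Ω of the semicircle law. -/
def Omega (x : ℝ) : ℝ :=
  if |x| ≤ 2 then x ^ 2 / 4 - 1 / 2
  else x ^ 2 / 4 - 1 / 2 -
    (|x| / 4 * Real.sqrt (x ^ 2 - 4) - Real.log (Real.sqrt (x ^ 2 / 4 - 1) + |x| / 2))

/-- The 2×2 covariance matrix Σ_q. -/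
def SigmaQ (γ : ℕ → ℝ) (q : ℝ) : Matrix (Fin 2) (Fin 2) ℝ :=
  !![nuF γ (q ^ 2), q ^ 2 * nuD1 γ (q ^ 2);
     q ^ 2 * nuD1 γ (q ^ 2), q ^ 4 * nuD2 γ (q ^ 2) + q ^ 2 * nuD1 γ (q ^ 2)]

/-- The complexity function Θ_{ν,q}(u,x). -/
def Theta (γ : ℕ → ℝ) (q u x : ℝ) : ℝ :=
  1 / 2 + 1 / 2 * Real.log (q ^ 2 * nuD2 γ (q ^ 2) / nuD1 γ (q ^ 2))
    - 1 / 2 * (![u, x] ⬝ᵥ ((SigmaQ γ q)⁻¹ *ᵥ ![u, x]))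
    + Omega (x / (q * Real.sqrt (nuD2 γ (q ^ 2))))

/-- −E₀(ν) is the minimal E with sup_x Θ_{ν,1}(E,x) = 0. -/
def E0 (γ : ℕ → ℝ) : ℝ := - sInf {E : ℝ | (⨆ x : ℝ, Theta γ 1 E x) = 0}

/-- −x₀(ν) is the (unique) maximizer of x ↦ Θ_{ν,1}(−E₀(ν),x). -/
def x0 (γ : ℕ → ℝ) : ℝ :=
  - sSup {x : ℝ | ∀ y : ℝ, Theta γ 1 (-(E0 γ)) y ≤ Theta γ 1 (-(E0 γ)) x}

/-- The coefficients of ν_q(x) = Σ γ_p² q^{2p} xᵖ. -/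
def gammaScale (γ : ℕ → ℝ) (q : ℝ) : ℕ → ℝ := fun p => γ p * q ^ p

def E0q (γ : ℕ → ℝ) (q : ℝ) : ℝ := E0 (gammaScale γ q)

def x0q (γ : ℕ → ℝ) (q : ℝ) : ℝ := q⁻¹ * x0 (gammaScale γ q)

/-- d(r,q₁,q₂) = rν′(q₁q₂r) − q₁q₂ν″(q₁q₂r)(1−r²). -/
def dA (γ : ℕ → ℝ) (r q1 q2 : ℝ) : ℝ :=
  r * nuD1 γ (q1 * q2 * r) - q1 * q2 * nuD2 γ (q1 * q2 * r) * (1 - r ^ 2)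

def a2 (γ : ℕ → ℝ) (r q1 q2 : ℝ) : ℝ :=
  nuD1 γ (q2 ^ 2) / (nuD1 γ (q1 ^ 2) * nuD1 γ (q2 ^ 2) - dA γ r q1 q2 ^ 2)

def a4 (γ : ℕ → ℝ) (r q1 q2 : ℝ) : ℝ :=
  -dA γ r q1 q2 / (nuD1 γ (q1 ^ 2) * nuD1 γ (q2 ^ 2) - dA γ r q1 q2 ^ 2)

/-- υ(r,q₁,q₂) = q₁q₂rν″(q₁q₂r) + ν′(q₁q₂r). -/
def ups (γ : ℕ → ℝ) (r q1 q2 : ℝ) : ℝ :=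
  q1 * q2 * r * nuD2 γ (q1 * q2 * r) + nuD1 γ (q1 * q2 * r)

def SigmaU (γ : ℕ → ℝ) (r q1 q2 : ℝ) : Matrix (Fin 2) (Fin 2) ℝ :=
  !![nuF γ (q1 ^ 2) - q1 ^ 2 * a2 γ r q2 q1 * nuD1 γ (q1 * q2 * r) ^ 2 * (1 - r ^ 2),
     nuF γ (q1 * q2 * r) + q1 * q2 * a4 γ r q1 q2 * nuD1 γ (q1 * q2 * r) ^ 2 * (1 - r ^ 2);
     nuF γ (q1 * q2 * r) + q1 * q2 * a4 γ r q1 q2 * nuD1 γ (q1 * q2 * r) ^ 2 * (1 - r ^ 2),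
     nuF γ (q2 ^ 2) - q2 ^ 2 * a2 γ r q1 q2 * nuD1 γ (q1 * q2 * r) ^ 2 * (1 - r ^ 2)]

def SigmaX (γ : ℕ → ℝ) (r q1 q2 : ℝ) : Matrix (Fin 2) (Fin 2) ℝ :=
  !![q1 ^ 2 * nuD2 γ (q1 ^ 2) + nuD1 γ (q1 ^ 2)
        - ups γ r q1 q2 ^ 2 * (1 - r ^ 2) * a2 γ r q2 q1,
     q1 * q2 * r ^ 2 * nuD2 γ (q1 * q2 * r) + r * nuD1 γ (q1 * q2 * r)
        + ups γ r q1 q2 ^ 2 * (1 - r ^ 2) * a4 γ r q1 q2;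
     q1 * q2 * r ^ 2 * nuD2 γ (q1 * q2 * r) + r * nuD1 γ (q1 * q2 * r)
        + ups γ r q1 q2 ^ 2 * (1 - r ^ 2) * a4 γ r q1 q2,
     q2 ^ 2 * nuD2 γ (q2 ^ 2) + nuD1 γ (q2 ^ 2)
        - ups γ r q1 q2 ^ 2 * (1 - r ^ 2) * a2 γ r q1 q2]

def SigmaB (γ : ℕ → ℝ) (r q1 q2 : ℝ) : Matrix (Fin 2) (Fin 2) ℝ :=
  !![q1 * nuD1 γ (q1 ^ 2)
        - q1 * (1 - r ^ 2) * nuD1 γ (q1 * q2 * r) * ups γ r q1 q2 * a2 γ r q2 q1,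
     q1 * r * nuD1 γ (q1 * q2 * r)
        + q1 * (1 - r ^ 2) * nuD1 γ (q1 * q2 * r) * ups γ r q1 q2 * a4 γ r q1 q2;
     q2 * r * nuD1 γ (q1 * q2 * r)
        + q2 * (1 - r ^ 2) * nuD1 γ (q1 * q2 * r) * ups γ r q2 q1 * a4 γ r q2 q1,
     q2 * nuD1 γ (q2 ^ 2)
        - q2 * (1 - r ^ 2) * nuD1 γ (q1 * q2 * r) * ups γ r q2 q1 * a2 γ r q1 q2]

/-- The 4×4 covariance matrix Σ_{U,X}(r,q₁,q₂), as a block matrix. -/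
def SigmaUX (γ : ℕ → ℝ) (r q1 q2 : ℝ) :
    Matrix (Fin 2 ⊕ Fin 2) (Fin 2 ⊕ Fin 2) ℝ :=
  Matrix.fromBlocks (SigmaU γ r q1 q2) (SigmaB γ r q1 q2)
    (SigmaB γ r q1 q2)ᵀ (SigmaX γ r q1 q2)

/-- The pair complexity Ψ_{ν,q₁,q₂}(r,u₁,u₂,x₁,x₂). -/
def Psi (γ : ℕ → ℝ) (q1 q2 r u1 u2 x1 x2 : ℝ) : ℝ :=
  1 + 1 / 2 * Real.log ((1 - r ^ 2) *
        (q1 ^ 2 * q2 ^ 2 * nuD2 γ (q1 ^ 2) * nuD2 γ (q2 ^ 2)) /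
        (nuD1 γ (q1 ^ 2) * nuD1 γ (q2 ^ 2) - nuD1 γ (q1 * q2 * r) ^ 2))
    - 1 / 2 * ((Sum.elim ![u1, u2] ![x1, x2]) ⬝ᵥ
        ((SigmaUX γ r q1 q2)⁻¹ *ᵥ (Sum.elim ![u1, u2] ![x1, x2])))
    + Omega (x1 / (q1 * Real.sqrt (nuD2 γ (q1 ^ 2))))
    + Omega (x2 / (q2 * Real.sqrt (nuD2 γ (q2 ^ 2))))

/-- Ψ⁰_ν(r). -/
def Psi0 (γ : ℕ → ℝ) (r : ℝ) : ℝ :=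
  Psi γ 1 1 r (-(E0 γ)) (-(E0 γ)) (-(x0 γ)) (-(x0 γ))

/-- G(ν). -/
def Gfun (γ : ℕ → ℝ) : ℝ :=
  Real.log (nuD2 γ 1 / nuD1 γ 1) -
    (nuD2 γ 1 + nuD1 γ 1) * (nuD2 γ 1 * nuF γ 1 + nuD1 γ 1 ^ 2 - nuD1 γ 1 * nuF γ 1) /
      (nuD2 γ 1 * nuD1 γ 1 ^ 2)

/-- ν is pure-like. -/
def PureLike (γ : ℕ → ℝ) : Prop := 0 < Gfun γ

/-- Condition M. -/
def ConditionM (γ : ℕ → ℝ) : Prop :=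
  Mixed γ ∧ PureLike γ ∧
    iteratedDeriv 2 (Psi0 γ) 0 < 0 ∧
    (∀ r ∈ Set.Ioo (-1 : ℝ) 1, r ≠ 0 → Psi0 γ r < Psi0 γ 0) ∧
    Filter.limsup (fun r : ℝ => (Psi0 γ r : EReal)) (nhdsWithin 1 (Set.Ioo (-1 : ℝ) 1))
      < ((Psi0 γ 0 : ℝ) : EReal) ∧
    Filter.limsup (fun r : ℝ => (Psi0 γ r : EReal)) (nhdsWithin (-1) (Set.Ioo (-1 : ℝ) 1))
      < ((Psi0 γ 0 : ℝ) : EReal)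
abbrev Idx : Type := ℕ × ((p : ℕ) × (Fin p → ℕ))

variable {ΩS : Type*} [MeasurableSpace ΩS]

/-- The mixed p-spin Hamiltonian of size `N` built from the disorder `J`. -/
def HamN (γ : ℕ → ℝ) (J : Idx → ΩS → ℝ) (N : ℕ) (ω : ΩS)
    (σ : EuclideanSpace ℝ (Fin N)) : ℝ :=
  ∑' p : ℕ, if 2 ≤ p then
    γ p * (Real.sqrt ((N : ℝ) ^ (p - 1)))⁻¹ *
      ∑ i : Fin p → Fin N, J (N, ⟨p, fun k => (i k : ℕ)⟩) ω * ∏ k, σ (i k)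
  else 0

/-- Disorder: independent standard Gaussians. -/
def StdGaussianDisorder (J : Idx → ΩS → ℝ) (P : Measure ΩS) : Prop :=
  (∀ i, Measurable (J i)) ∧
    iIndepFun J P ∧
    ∀ i, Measure.map (J i) P = gaussianReal 0 1

/-- σ is a critical point of `H` restricted to the sphere through σ. -/
def IsCritPt (γ : ℕ → ℝ) (J : Idx → ΩS → ℝ) (N : ℕ) (ω : ΩS)
    (σ : EuclideanSpace ℝ (Fin N)) : Prop :=
  ∀ v : EuclideanSpace ℝ (Fin N), (inner ℝ v σ : ℝ) = 0 → fderiv ℝ (HamN γ J N ω) σ v = 0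

/-- The radial derivative (d/dR)H_N(σ). -/
def radDeriv (γ : ℕ → ℝ) (J : Idx → ΩS → ℝ) (N : ℕ) (ω : ΩS)
    (σ : EuclideanSpace ℝ (Fin N)) : ℝ :=
  ‖σ‖⁻¹ * deriv (fun t : ℝ => HamN γ J N ω (t • σ)) 1

/-- The set 𝒞_{N,q}(N·B, √N·D) of q-critical points with constrained value and
radial derivative. -/
def CritSet (γ : ℕ → ℝ) (J : Idx → ΩS → ℝ) (N : ℕ) (q : ℝ) (B D : Set ℝ) (ω : ΩS) :
    Set (EuclideanSpace ℝ (Fin N)) :=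
  {σ | ‖σ‖ = q * Real.sqrt N ∧ IsCritPt γ J N ω σ ∧
    HamN γ J N ω σ / N ∈ B ∧ radDeriv γ J N ω σ / Real.sqrt N ∈ D}

/-- The overlap R(σ,σ′). -/
def overlap {N : ℕ} (σ τ : EuclideanSpace ℝ (Fin N)) : ℝ := (inner ℝ σ τ : ℝ) / (‖σ‖ * ‖τ‖)

/-- The uniform probability measure on the unit sphere of ℝᴺ. -/
def unifSphere (N : ℕ) : Measure (Metric.sphere (0 : EuclideanSpace ℝ (Fin N)) 1) :=
  ((volume : Measure (EuclideanSpace ℝ (Fin N))).toSphere Set.univ)⁻¹ •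
    (volume : Measure (EuclideanSpace ℝ (Fin N))).toSphere

/-- The partition function Z_{N,β} (in unit-sphere coordinates σ = √N·u). -/
def ZN (γ : ℕ → ℝ) (J : Idx → ΩS → ℝ) (N : ℕ) (β : ℝ) (ω : ΩS) : ℝ :=
  ∫ u : Metric.sphere (0 : EuclideanSpace ℝ (Fin N)) 1,
    Real.exp (-β * HamN γ J N ω (Real.sqrt N • (u : EuclideanSpace ℝ (Fin N))))
      ∂(unifSphere N)

/-- The partition function restricted to a subset of the sphere. -/
def ZNset (γ : ℕ → ℝ) (J : Idx → ΩS → ℝ) (N : ℕ) (β : ℝ) (ω : ΩS)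
    (S : Set (Metric.sphere (0 : EuclideanSpace ℝ (Fin N)) 1)) : ℝ :=
  ∫ u in S,
    Real.exp (-β * HamN γ J N ω (Real.sqrt N • (u : EuclideanSpace ℝ (Fin N))))
      ∂(unifSphere N)

/-- The Gibbs measure G_{N,β} (in unit-sphere coordinates). -/
def Gibbs (γ : ℕ → ℝ) (J : Idx → ΩS → ℝ) (N : ℕ) (β : ℝ) (ω : ΩS) :
    Measure (Metric.sphere (0 : EuclideanSpace ℝ (Fin N)) 1) :=
  (unifSphere N).withDensity fun u =>
    ENNReal.ofReal
      (Real.exp (-β * HamN γ J N ω (Real.sqrt N • (u : EuclideanSpace ℝ (Fin N)))) /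
        ZN γ J N β ω)

/-- `√N·u ∈ Band(σ₀, ε)`. -/
def InBand {N : ℕ} (u : Metric.sphere (0 : EuclideanSpace ℝ (Fin N)) 1)
    (σ0 : EuclideanSpace ℝ (Fin N)) (ε : ℝ) : Prop :=
  |overlap (Real.sqrt N • (u : EuclideanSpace ℝ (Fin N))) σ0 - ‖σ0‖ / Real.sqrt N| ≤ ε

/-- The ground state GS_N = min_{σ∈S^{N-1}(√N)} H_N(σ). -/
def GS (γ : ℕ → ℝ) (J : Idx → ΩS → ℝ) (N : ℕ) (ω : ΩS) : ℝ :=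
  sInf (HamN γ J N ω '' {σ : EuclideanSpace ℝ (Fin N) | ‖σ‖ = Real.sqrt N})

/-- α_k(q)² = (1−q²)^k · Σ_{p ≥ max(k,2)} γ_p² C(p,k) q^{2(p−k)}. -/
def alphaSq (γ : ℕ → ℝ) (k : ℕ) (q : ℝ) : ℝ :=
  (1 - q ^ 2) ^ k *
    ∑' p : ℕ, if max k 2 ≤ p then γ p ^ 2 * (p.choose k) * q ^ (2 * (p - k)) else 0

/-- Λ_{Z,β}(E,q) = −βE + ½log(1−q²) + (β²/2)(ν(1) − α₀(q)² − α₁(q)²). -/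
def LambdaZ (γ : ℕ → ℝ) (β E q : ℝ) : ℝ :=
  -β * E + 1 / 2 * Real.log (1 - q ^ 2)
    + β ^ 2 / 2 * (nuF γ 1 - alphaSq γ 0 q - alphaSq γ 1 q)

/-- t₋ = (x₀(1) − √(x₀(1)² − 4ν″(1)))/(4ν″(1)). -/
def tMinus (γ : ℕ → ℝ) : ℝ :=
  (x0 γ - Real.sqrt (x0 γ ^ 2 - 4 * nuD2 γ 1)) / (4 * nuD2 γ 1)

/-- `qstar` is the local-maximum point q⋆(β) of q ↦ Λ_{Z,β}(−E₀(q),q) near 1: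
for large β it lies in (0,1), is a local maximum of that map, and satisfies
q⋆(β) = 1 − t₋/β + o(1/β). -/
def IsQStar (γ : ℕ → ℝ) (qstar : ℝ → ℝ) : Prop :=
  (∀ᶠ β in atTop, qstar β ∈ Set.Ioo (0 : ℝ) 1 ∧
      IsLocalMax (fun q : ℝ => LambdaZ γ β (-(E0q γ q)) q) (qstar β)) ∧
    Tendsto (fun β : ℝ => β * (1 - qstar β)) atTop (nhds (tMinus γ))

lemma log_upper {t : ℝ} (ht : 1 < t) : Real.log t < (t - 1 / t) / 2 := by
  have h0 : (0:ℝ) < t := by linarith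
  have hd : ∀ x : ℝ, 0 < x → HasDerivAt (fun x => (x - 1 / x) / 2 - Real.log x)
      ((1 + 1 / x ^ 2) / 2 - 1 / x) x := by
    intro x hx
    have h1 := ((hasDerivAt_id x).sub (hasDerivAt_inv hx.ne')).div_const 2
    have h2 := h1.sub (Real.hasDerivAt_log hx.ne')
    have h3 : HasDerivAt (fun x => (x - x⁻¹) / 2 - Real.log x) _ x := h2
    simp only [one_div]
    exact h3.congr_deriv (by simp)
  have hm : StrictMonoOn (fun x => (x - 1 / x) / 2 - Real.log x) (Set.Ici 1) := by
    apply strictMonoOn_of_deriv_pos (convex_Ici 1)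
    · intro x hx
      exact (hd x (by have := Set.mem_Ici.1 hx; linarith)).continuousAt.continuousWithinAt
    · intro x hx
      simp only [interior_Ici, Set.mem_Ioi] at hx
      rw [(hd x (by linarith)).deriv]
      have : (1 + 1 / x ^ 2) / 2 - 1 / x = (1 - 1 / x) ^ 2 / 2 := by
        field_simp
        ring
      rw [this]
      have : 1 / x < 1 := by rw [div_lt_one (by linarith)]; exact hx
      have : 0 < 1 - 1 / x := by linarith
      positivity
  have := hm (Set.mem_Ici.2 le_rfl) (Set.mem_Ici.2 ht.le) ht
  simp at this
  simpa using this

lemma log_upper' {t : ℝ} (ht : 1 ≤ t) : Real.log t ≤ (t - 1 / t) / 2 := by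
  rcases ht.eq_or_lt with rfl | h
  · simp
  · exact (log_upper h).le

lemma log_lower {t : ℝ} (ht : 1 ≤ t) : 2 * (t - 1) / (t + 1) ≤ Real.log t := by
  have hd : ∀ x : ℝ, 0 < x → HasDerivAt (fun x => Real.log x - 2 * (x - 1) / (x + 1))
      (1 / x - 4 / (x + 1) ^ 2) x := by
    intro x hx
    have h1 := ((((hasDerivAt_id x).sub_const 1).const_mul 2).div
      ((hasDerivAt_id x).add_const 1) (by simp; linarith))
    have h2 := (Real.hasDerivAt_log hx.ne').sub h1
    have h3 : HasDerivAt (fun x => Real.log x - 2 * (x - 1) / (x + 1)) _ x := h2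
    refine h3.congr_deriv ?_
    have : x + 1 ≠ 0 := by linarith
    simp only [id]
    field_simp
    ring
  have hm : MonotoneOn (fun x => Real.log x - 2 * (x - 1) / (x + 1)) (Set.Ici 1) := by
    apply monotoneOn_of_deriv_nonneg (convex_Ici 1)
    · intro x hx
      exact (hd x (by have := Set.mem_Ici.1 hx; linarith)).continuousAt.continuousWithinAt
    · intro x hx
      simp only [interior_Ici, Set.mem_Ioi] at hx
      exact (hd x (by linarith)).differentiableAt.differentiableWithinAt
    · intro x hx
      simp only [interior_Ici, Set.mem_Ioi] at hx
      rw [(hd x (by linarith)).deriv]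
      have : 1 / x - 4 / (x + 1) ^ 2 = (x - 1) ^ 2 / (x * (x + 1) ^ 2) := by
        field_simp
        ring
      rw [this]
      positivity
  have := hm (Set.mem_Ici.2 le_rfl) (Set.mem_Ici.2 ht) ht
  simp at this
  simpa using this

lemma Omega_abs (x : ℝ) : Omega |x| = Omega x := by
  simp [Omega]

lemma Omega_neg (x : ℝ) : Omega (-x) = Omega x := by
  simp [Omega]

lemma Omega_eq_max (x : ℝ) : Omega x = x ^ 2 / 4 - 1 / 2 -
    (max |x| 2 / 4 * Real.sqrt ((max |x| 2) ^ 2 - 4) -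
      Real.log (Real.sqrt ((max |x| 2) ^ 2 / 4 - 1) + max |x| 2 / 2)) := by
  unfold Omega
  split_ifs with h
  · rw [max_eq_right h]; norm_num
  · rw [max_eq_left (by linarith)]; simp

lemma continuous_Omega : Continuous Omega := by
  have : Omega = fun x : ℝ => x ^ 2 / 4 - 1 / 2 -
    (max |x| 2 / 4 * Real.sqrt ((max |x| 2) ^ 2 - 4) -
      Real.log (Real.sqrt ((max |x| 2) ^ 2 / 4 - 1) + max |x| 2 / 2)) := by
    ext x; exact Omega_eq_max x
  rw [this]
  have hm : Continuous fun x : ℝ => max |x| 2 := by fun_prop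
  refine Continuous.sub (by fun_prop) (Continuous.sub (by fun_prop) ?_)
  refine Continuous.log (by fun_prop) ?_
  intro x
  have : (2:ℝ) ≤ max |x| 2 := le_max_right _ _
  have := Real.sqrt_nonneg ((max |x| 2) ^ 2 / 4 - 1)
  positivity

lemma Omega_param {s : ℝ} (hs : 1 ≤ s) : Omega (s + 1 / s) = Real.log s + 1 / (2 * s ^ 2) := by
  have h0 : (0:ℝ) < s := by linarith
  have h2 : 2 ≤ s + 1 / s := by
    have : s + 1 / s - 2 = (s - 1) ^ 2 / s := by field_simp; ring
    have : 0 ≤ (s - 1) ^ 2 / s := by positivity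
    linarith
  have hinv : 1 / s ≤ s := by
    rw [div_le_iff₀ h0]; nlinarith
  rw [Omega_eq_max, abs_of_pos (by linarith), max_eq_left h2]
  have e1 : Real.sqrt ((s + 1 / s) ^ 2 - 4) = s - 1 / s := by
    have : (s + 1 / s) ^ 2 - 4 = (s - 1 / s) ^ 2 := by field_simp; ring
    rw [this, Real.sqrt_sq (by linarith)]
  have e2 : Real.sqrt ((s + 1 / s) ^ 2 / 4 - 1) = (s - 1 / s) / 2 := by
    have : (s + 1 / s) ^ 2 / 4 - 1 = ((s - 1 / s) / 2) ^ 2 := by field_simp; ring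
    rw [this, Real.sqrt_sq (by linarith)]
  rw [e1, e2]
  have : (s - 1 / s) / 2 + (s + 1 / s) / 2 = s := by ring
  rw [this]
  field_simp
  ring

lemma exists_param {z : ℝ} (hz : 2 ≤ |z|) : ∃ s : ℝ, 1 ≤ s ∧ |z| = s + 1 / s := by
  set y := |z|
  have h4 : 0 ≤ y ^ 2 - 4 := by nlinarith
  have hs := Real.sq_sqrt h4
  have hs0 := Real.sqrt_nonneg (y ^ 2 - 4)
  refine ⟨(y + Real.sqrt (y ^ 2 - 4)) / 2, by linarith, ?_⟩
  have : 0 < (y + Real.sqrt (y ^ 2 - 4)) := by linarith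
  field_simp
  nlinarith

/-- Ω1 -/
lemma Omega_le {z w : ℝ} (hw : 1 ≤ w) :
    Omega z ≤ 1 / 2 * Real.log w + z ^ 2 / (2 * (1 + w)) - 1 / 2 := by
  rcases le_or_gt |z| 2 with h | h
  · have hl := log_lower hw
    have : Omega z = z ^ 2 / 4 - 1 / 2 := by simp [Omega, h]
    rw [this]
    have hz : z ^ 2 ≤ 4 := by
      have := abs_nonneg z
      rw [← sq_abs]; nlinarith
    have e : z ^ 2 / 4 - z ^ 2 / (2 * (1 + w)) = z ^ 2 * ((w - 1) / (4 * (w + 1))) := by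
      field_simp; ring
    have e2 : 2 * (w - 1) / (w + 1) = 4 * ((w - 1) / (4 * (w + 1))) * 2 := by
      field_simp
    have : 0 ≤ (w - 1) / (4 * (w + 1)) := div_nonneg (by linarith) (by linarith)
    nlinarith
  · obtain ⟨s, hs, hzs⟩ := exists_param h.le
    have h0 : (0:ℝ) < s := by linarith
    rw [← Omega_abs, hzs, Omega_param hs, ← sq_abs z, hzs]
    set S := s ^ 2 with hS
    have hS1 : 1 ≤ S := by nlinarith
    have hlogS : Real.log s = 1 / 2 * Real.log S := by
      rw [hS, Real.log_pow]; push_cast; ring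
    have e : (s + 1 / s) ^ 2 = (S + 1) ^ 2 / S := by rw [hS]; field_simp
    rw [hlogS, e]
    have key : (1 + S) * (w - S) / (S * (1 + w)) ≤ Real.log w - Real.log S := by
      rcases le_total S w with hv | hv
      · have := log_lower (t := w / S) (by rw [le_div_iff₀ (by linarith)]; linarith)
        rw [Real.log_div (by linarith) (by linarith)] at this
        refine le_trans ?_ this
        have e3 : 2 * (w / S - 1) / (w / S + 1) = 2 * (w - S) / (w + S) := by
          field_simp
        rw [e3, div_le_div_iff₀ (by positivity) (by positivity)]
        nlinarith [mul_nonneg (sub_nonneg.2 hv) (sub_nonneg.2 hS1), mul_nonneg (mul_nonneg (sub_nonneg.2 hv) (sub_nonneg.2 hS1)) (sub_nonneg.2 hv)]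
      · have := log_upper' (t := S / w) (by rw [le_div_iff₀ (by linarith)]; linarith)
        rw [Real.log_div (by linarith) (by linarith)] at this
        have e3 : (S / w - 1 / (S / w)) / 2 = (S - w) * (S + w) / (2 * S * w) := by
          field_simp
          ring
        rw [e3] at this
        have : (S - w) * (S + w) / (2 * S * w) ≤ (1 + S) * (S - w) / (S * (1 + w)) := by
          rw [div_le_div_iff₀ (by positivity) (by positivity)]
          have : 0 ≤ (S - w) * S * ((S - w) * (w - 1)) := by
            apply mul_nonneg
            · exact mul_nonneg (by linarith) (by linarith)
            · exact mul_nonneg (by linarith) (by linarith)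
          nlinarith
        have e4 : (1 + S) * (w - S) / (S * (1 + w)) = -((1 + S) * (S - w) / (S * (1 + w))) := by
          ring
        linarith
    have e5 : (S + 1) ^ 2 / S / (2 * (1 + w)) - 1 / 2 - 1 / (2 * S) =
        - (1 / 2) * ((1 + S) * (w - S) / (S * (1 + w))) := by
      field_simp; ring
    linarith

/-- Ω2 -/
lemma Omega_eq (z : ℝ) : ∃ w : ℝ, 1 ≤ w ∧
    Omega z = 1 / 2 * Real.log w + z ^ 2 / (2 * (1 + w)) - 1 / 2 := by
  rcases le_or_gt |z| 2 with h | h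
  · refine ⟨1, le_rfl, ?_⟩
    simp [Omega, h]; ring
  · obtain ⟨s, hs, hzs⟩ := exists_param h.le
    have h0 : (0:ℝ) < s := by linarith
    refine ⟨s ^ 2, by nlinarith, ?_⟩
    rw [← Omega_abs, hzs, Omega_param hs, ← sq_abs z, hzs, Real.log_pow]
    push_cast
    field_simp
    ring

lemma Omega_eq_of {w : ℝ} (hw : 1 ≤ w) :
    Omega ((1 + w) / √w) = 1 / 2 * Real.log w + ((1 + w) / √w) ^ 2 / (2 * (1 + w)) - 1 / 2 := by
  have h0 : 0 < √w := Real.sqrt_pos.2 (by linarith)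
  have hs : √w ^ 2 = w := Real.sq_sqrt (by linarith)
  have h1 : 1 ≤ √w := by rw [Real.one_le_sqrt]; exact hw
  have e : (1 + w) / √w = √w + 1 / √w := by
    field_simp; linarith
  rw [e, Omega_param h1, Real.log_sqrt (by linarith)]
  have e2 : (√w + 1 / √w) ^ 2 = (1 + w) ^ 2 / w := by
    rw [← e, div_pow, hs]
  rw [e2, hs]
  field_simp
  ring

/-- Ω3 -/
lemma Omega_lt {z : ℝ} (hz : 2 < |z|) : Omega z < z ^ 2 / 4 - 1 / 2 := by
  obtain ⟨s, hs, hzs⟩ := exists_param hz.le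
  have h0 : (0:ℝ) < s := by linarith
  have h1 : 1 < s := by
    rcases hs.eq_or_lt with h | h
    · rw [← h] at hzs; norm_num at hzs; linarith
    · exact h
  rw [← Omega_abs, hzs, Omega_param hs, ← sq_abs z, hzs]
  have := log_upper (t := s ^ 2) (by nlinarith)
  rw [Real.log_pow] at this
  push_cast at this
  have e : (s + 1 / s) ^ 2 / 4 - 1 / 2 - 1 / (2 * s ^ 2) = (s ^ 2 - 1 / s ^ 2) / 4 := by
    field_simp; ring
  linarith

/-- ½+Ω ≤ z²/4 always -/
lemma Omega_le_quad (z : ℝ) : Omega z ≤ z ^ 2 / 4 - 1 / 2 := by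
  have := Omega_le (z := z) (w := 1) le_rfl
  simp at this
  linarith

lemma Omega_zero : Omega 0 = -1 / 2 := by
  simp [Omega]; norm_num

/-- dominated coefficient sequences -/
def Dom (γ : ℕ → ℝ) : Set (ℕ → ℝ) := {c | ∀ p, 0 ≤ c p ∧ c p ≤ γ p}

/-- weighted series -/
def Ser (h : ℕ → ℝ → ℝ) (c : ℕ → ℝ) (r : ℝ) : ℝ :=
  ∑' p : ℕ, if 2 ≤ p then c p ^ 2 * h p r else 0

def h0 : ℕ → ℝ → ℝ := fun p r => r ^ (p - 2)
def h1 : ℕ → ℝ → ℝ := fun p r => p * r ^ (p - 2)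
def h2 : ℕ → ℝ → ℝ := fun p r => p * ((p : ℝ) - 1) * r ^ (p - 2)
def hd : ℕ → ℝ → ℝ := fun p r => p * ∑ j ∈ Finset.range (p - 1), r ^ j

def G0 := Ser h0
def G1 := Ser h1
def G2 := Ser h2
def Gd := Ser hd

lemma nuF_eq (c : ℕ → ℝ) (r : ℝ) : nuF c r = r ^ 2 * G0 c r := by
  unfold nuF G0 Ser h0
  rw [← tsum_mul_left]
  congr 1; ext p
  split_ifs with h
  · obtain ⟨k, rfl⟩ := Nat.exists_eq_add_of_le h
    rw [Nat.add_sub_cancel_left, pow_add]; ring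
  · simp

lemma nuD1_eq (c : ℕ → ℝ) (r : ℝ) : nuD1 c r = r * G1 c r := by
  unfold nuD1 G1 Ser h1
  rw [← tsum_mul_left]
  congr 1; ext p
  split_ifs with h
  · obtain ⟨k, rfl⟩ := Nat.exists_eq_add_of_le h
    rw [Nat.add_sub_cancel_left, show 2 + k - 1 = k + 1 by omega, pow_succ]; ring
  · simp

lemma nuD2_eq (c : ℕ → ℝ) (r : ℝ) : nuD2 c r = G2 c r := by
  unfold nuD2 G2 Ser h2
  congr 1; ext p
  split_ifs with h
  · ring
  · simp

lemma nuF_one (c : ℕ → ℝ) : nuF c 1 = G0 c 1 := by simp [nuF_eq]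
lemma nuD1_one (c : ℕ → ℝ) : nuD1 c 1 = G1 c 1 := by simp [nuD1_eq]
lemma nuD2_one (c : ℕ → ℝ) : nuD2 c 1 = G2 c 1 := by simp [nuD2_eq]

lemma GammaDecay.summable {γ : ℕ → ℝ} (hγ : GammaDecay γ) :
    Summable fun p : ℕ => γ p ^ 2 * (p : ℝ) ^ 2 := by
  obtain ⟨h0, ρ, hρ0, hρ1, hev⟩ := hγ
  have hs : Summable fun p : ℕ => (p : ℝ) ^ 2 * (ρ ^ 2) ^ p :=
    summable_pow_mul_geometric_of_norm_lt_one 2 (by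
      rw [Real.norm_of_nonneg (by positivity)]; nlinarith)
  refine Summable.of_norm_bounded_eventually_nat hs ?_
  filter_upwards [hev] with p hp
  rw [Real.norm_of_nonneg (by positivity), mul_comm, ← pow_mul, mul_comm 2 p, pow_mul]
  have := h0 p
  gcongr

/-- the weights are bounded by p² on [-1,1] -/
def HB (h : ℕ → ℝ → ℝ) : Prop :=
  ∀ p, 2 ≤ p → Continuous (h p) ∧ ∀ r ∈ Icc (-1 : ℝ) 1, |h p r| ≤ (p : ℝ) ^ 2

lemma abs_pow_le_one' {r : ℝ} (hr : r ∈ Icc (-1 : ℝ) 1) (k : ℕ) : |r ^ k| ≤ 1 := by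
  rw [abs_pow]
  exact pow_le_one₀ (abs_nonneg _) (abs_le.2 hr)

lemma HB_h0 : HB h0 := by
  intro p hp
  refine ⟨by unfold h0; fun_prop, fun r hr => ?_⟩
  unfold h0
  have : (2:ℝ) ≤ p := by exact_mod_cast hp
  have := abs_pow_le_one' hr (p - 2)
  nlinarith

lemma HB_h1 : HB h1 := by
  intro p hp
  refine ⟨by unfold h1; fun_prop, fun r hr => ?_⟩
  unfold h1
  have h2 : (2:ℝ) ≤ p := by exact_mod_cast hp
  have := abs_pow_le_one' hr (p - 2)
  rw [abs_mul, abs_of_nonneg (by linarith : (0:ℝ) ≤ p)]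
  nlinarith

lemma HB_h2 : HB h2 := by
  intro p hp
  refine ⟨by unfold h2; fun_prop, fun r hr => ?_⟩
  unfold h2
  have h2 : (2:ℝ) ≤ p := by exact_mod_cast hp
  have := abs_pow_le_one' hr (p - 2)
  rw [abs_mul, abs_of_nonneg (by nlinarith : (0:ℝ) ≤ p * ((p:ℝ) - 1))]
  nlinarith [abs_nonneg (r ^ (p - 2))]

lemma HB_hd : HB hd := by
  intro p hp
  refine ⟨by unfold hd; fun_prop, fun r hr => ?_⟩
  unfold hd
  have h2 : (2:ℝ) ≤ p := by exact_mod_cast hp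
  have h3 : |∑ j ∈ Finset.range (p - 1), r ^ j| ≤ (p - 1 : ℕ) := by
    refine (Finset.abs_sum_le_sum_abs _ _).trans ?_
    refine (Finset.sum_le_card_nsmul _ _ 1 (fun j _ => abs_pow_le_one' hr j)).trans ?_
    simp
  rw [Nat.cast_sub (by omega)] at h3
  rw [abs_mul, abs_of_nonneg (by linarith : (0:ℝ) ≤ p)]
  push_cast at h3
  nlinarith

section
variable {γ : ℕ → ℝ} (hγ : GammaDecay γ)

lemma ser_bound {h : ℕ → ℝ → ℝ} (hh : HB h) {c : ℕ → ℝ} (hc : c ∈ Dom γ) {r : ℝ}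
    (hr : r ∈ Icc (-1 : ℝ) 1) (p : ℕ) :
    ‖if 2 ≤ p then c p ^ 2 * h p r else 0‖ ≤ γ p ^ 2 * (p : ℝ) ^ 2 := by
  split_ifs with h2
  · rw [norm_mul, Real.norm_of_nonneg (by positivity)]
    have := (hh p h2).2 r hr
    have h3 := hc p
    gcongr
    · exact h3.1
    · exact h3.2
    · exact this
  · rw [norm_zero]; positivity

include hγ

lemma ser_summable {h : ℕ → ℝ → ℝ} (hh : HB h) {c : ℕ → ℝ} (hc : c ∈ Dom γ) {r : ℝ}
    (hr : r ∈ Icc (-1 : ℝ) 1) : Summable fun p => if 2 ≤ p then c p ^ 2 * h p r else 0 :=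
  Summable.of_norm_bounded hγ.summable (fun p => ser_bound hh hc hr p)

lemma ser_continuousOn {h : ℕ → ℝ → ℝ} (hh : HB h) :
    ContinuousOn (fun z : (ℕ → ℝ) × ℝ => Ser h z.1 z.2) (Dom γ ×ˢ Icc (-1 : ℝ) 1) := by
  unfold Ser
  refine continuousOn_tsum (u := fun p : ℕ => γ p ^ 2 * (p : ℝ) ^ 2) ?_ hγ.summable ?_
  · intro p
    split_ifs with h2
    · have := (hh p h2).1
      fun_prop
    · exact continuousOn_const
  · intro p z hz
    exact ser_bound hh hz.1 hz.2 p

lemma Dom_self : γ ∈ Dom γ := fun p => ⟨hγ.1 p, le_rfl⟩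

/-- comparison of series -/
lemma ser_le_ser {h h' : ℕ → ℝ → ℝ} (hh : HB h) (hh' : HB h') {c : ℕ → ℝ} (hc : c ∈ Dom γ)
    {r r' : ℝ} (hr : r ∈ Icc (-1 : ℝ) 1) (hr' : r' ∈ Icc (-1 : ℝ) 1)
    (hle : ∀ p, 2 ≤ p → h p r ≤ h' p r') : Ser h c r ≤ Ser h' c r' := by
  unfold Ser
  refine Summable.tsum_le_tsum ?_ (ser_summable hγ hh hc hr) (ser_summable hγ hh' hc hr')
  intro p
  split_ifs with h2
  · exact mul_le_mul_of_nonneg_left (hle p h2) (by positivity)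
  · exact le_rfl

lemma ser_lt_ser {h h' : ℕ → ℝ → ℝ} (hh : HB h) (hh' : HB h') {c : ℕ → ℝ} (hc : c ∈ Dom γ)
    {r r' : ℝ} (hr : r ∈ Icc (-1 : ℝ) 1) (hr' : r' ∈ Icc (-1 : ℝ) 1)
    (hle : ∀ p, 2 ≤ p → h p r ≤ h' p r') (p0 : ℕ) (hp0 : 2 ≤ p0) (hc0 : c p0 ≠ 0)
    (hlt : h p0 r < h' p0 r') : Ser h c r < Ser h' c r' := by
  unfold Ser
  refine Summable.tsum_lt_tsum (i := p0) ?_ ?_ (ser_summable hγ hh hc hr)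
    (ser_summable hγ hh' hc hr')
  · intro p
    dsimp only
    split_ifs with h2
    · exact mul_le_mul_of_nonneg_left (hle p h2) (by positivity)
    · exact le_rfl
  · simp only [hp0, if_true]
    exact mul_lt_mul_of_pos_left hlt (by positivity)

lemma G1_abs_le {c : ℕ → ℝ} (hc : c ∈ Dom γ) {r : ℝ} (hr : r ∈ Icc (-1 : ℝ) 1) :
    |G1 c r| ≤ G1 c 1 := by
  have h1m : (1:ℝ) ∈ Icc (-1 : ℝ) 1 := by simp
  have hneg : HB (fun p r => - h1 p r) := fun p hp =>
    ⟨(HB_h1 p hp).1.neg, fun r hr => by rw [abs_neg]; exact (HB_h1 p hp).2 r hr⟩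
  have key : ∀ p : ℕ, |h1 p r| ≤ h1 p 1 := by
    intro p
    unfold h1
    rw [abs_mul, abs_of_nonneg (by positivity : (0:ℝ) ≤ p)]
    have := abs_pow_le_one' hr (p - 2)
    simp only [one_pow]
    gcongr
  rw [abs_le']
  constructor
  · exact ser_le_ser hγ HB_h1 HB_h1 hc hr h1m (fun p _ => (le_abs_self _).trans (key p))
  · have e : -(G1 c r) = Ser (fun p r => - h1 p r) c r := by
      unfold G1 Ser
      rw [← tsum_neg]
      congr 1; ext p; split_ifs <;> simp
    rw [e]
    exact ser_le_ser hγ hneg HB_h1 hc hr h1m (fun p _ => (neg_le_abs _).trans (key p))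

lemma G0_pos {c : ℕ → ℝ} (hc : c ∈ Dom γ) (hm : Mixed c) : 0 < G0 c 1 := by
  obtain ⟨p, q, hp, hq, hpq, h1, h2⟩ := hm
  have h1m : (1:ℝ) ∈ Icc (-1 : ℝ) 1 := by simp
  have hz : HB (fun _ _ => (0:ℝ)) := fun p hp => ⟨continuous_const, fun r hr => by simp⟩
  have := ser_lt_ser hγ hz HB_h0 hc h1m h1m (by intro p _; simp [h0]) p hp h1 (by simp [h0])
  simpa [Ser, G0] using this

lemma G1_ge {c : ℕ → ℝ} (hc : c ∈ Dom γ) : 2 * G0 c 1 ≤ G1 c 1 := by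
  have h1m : (1:ℝ) ∈ Icc (-1 : ℝ) 1 := by simp
  have hz : HB (fun p r => 2 * h0 p r) := fun p hp => ⟨continuous_const.mul (HB_h0 p hp).1,
    fun r hr => by
      have h2 : (2:ℝ) ≤ p := by exact_mod_cast hp
      have := abs_pow_le_one' hr (p - 2)
      simp only [h0]
      rw [abs_mul, abs_two]
      nlinarith⟩
  have := ser_le_ser hγ hz HB_h1 hc h1m h1m (by
    intro p hp
    have h2 : (2:ℝ) ≤ p := by exact_mod_cast hp
    simpa [h0, h1] using h2)
  refine le_trans (le_of_eq ?_) this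
  unfold G0 Ser
  rw [← tsum_mul_left]
  congr 1; ext p; split_ifs <;> ring

lemma G2_gt {c : ℕ → ℝ} (hc : c ∈ Dom γ) (hm : Mixed c) : G1 c 1 < G2 c 1 := by
  have h1m : (1:ℝ) ∈ Icc (-1 : ℝ) 1 := by simp
  have : ∃ p, 3 ≤ p ∧ c p ≠ 0 := by
    obtain ⟨p, q, hp, hq, hpq, h1, h2⟩ := hm
    rcases lt_or_ge p 3 with h | h
    · exact ⟨q, by omega, h2⟩
    · exact ⟨p, h, h1⟩
  obtain ⟨p, hp, h⟩ := this
  refine ser_lt_ser hγ HB_h1 HB_h2 hc h1m h1m ?_ p (by omega) h ?_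
  · intro p hp
    have h2 : (2:ℝ) ≤ p := by exact_mod_cast hp
    simp only [h1, SpinGlass.h2, one_pow]
    nlinarith
  · have h2 : (3:ℝ) ≤ p := by exact_mod_cast hp
    simp only [h1, SpinGlass.h2, one_pow]
    nlinarith

lemma Delta_pos {c : ℕ → ℝ} (hc : c ∈ Dom γ) (hm : Mixed c) :
    0 < G0 c 1 * (G2 c 1 + G1 c 1) - G1 c 1 ^ 2 := by
  have h1m : (1:ℝ) ∈ Icc (-1 : ℝ) 1 := by simp
  have hg0 := G0_pos hγ hc hm
  set m := G1 c 1 / G0 c 1 with hmdef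
  have s0 := ser_summable hγ HB_h0 hc h1m
  have s1 := ser_summable hγ HB_h1 hc h1m
  have s2 := ser_summable hγ HB_h2 hc h1m
  have hs : HasSum (fun p : ℕ => if 2 ≤ p then c p ^ 2 * ((p:ℝ) - m) ^ 2 else 0)
      ((G2 c 1 + G1 c 1) - 2 * m * G1 c 1 + m ^ 2 * G0 c 1) := by
    have := ((s2.hasSum.add s1.hasSum).sub (s1.hasSum.mul_left (2 * m))).add
      (s0.hasSum.mul_left (m ^ 2))
    refine (congrArg (fun f => HasSum f _) (funext fun p => ?_)).mpr this
    split_ifs with h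
    · simp [h0, h1, h2]; ring
    · simp
  have hpos : 0 < (G2 c 1 + G1 c 1) - 2 * m * G1 c 1 + m ^ 2 * G0 c 1 := by
    rw [← hs.tsum_eq]
    have hnn : ∀ p : ℕ, 0 ≤ (if 2 ≤ p then c p ^ 2 * ((p:ℝ) - m) ^ 2 else 0) := by
      intro p; split_ifs <;> positivity
    have : ∃ p, 2 ≤ p ∧ c p ≠ 0 ∧ (p:ℝ) ≠ m := by
      obtain ⟨p, q, hp, hq, hpq, h1, h2⟩ := hm
      by_cases h : (p:ℝ) = m
      · exact ⟨q, hq, h2, fun h' => hpq (by exact_mod_cast h.trans h'.symm)⟩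
      · exact ⟨p, hp, h1, h⟩
    obtain ⟨p, hp, h1, h2⟩ := this
    refine hs.summable.tsum_pos hnn p ?_
    rw [if_pos hp]
    have := sub_ne_zero.2 h2
    positivity
  have : G0 c 1 * ((G2 c 1 + G1 c 1) - 2 * m * G1 c 1 + m ^ 2 * G0 c 1) =
      G0 c 1 * (G2 c 1 + G1 c 1) - G1 c 1 ^ 2 := by
    rw [hmdef]; field_simp; ring
  rw [← this]
  positivity

lemma Gd_eq {c : ℕ → ℝ} (hc : c ∈ Dom γ) {r : ℝ} (hr : r ∈ Icc (-1 : ℝ) 1) :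
    G1 c 1 - r * G1 c r = (1 - r) * Gd c r := by
  have h1m : (1:ℝ) ∈ Icc (-1 : ℝ) 1 := by simp
  have s1 := (ser_summable hγ HB_h1 hc h1m).hasSum
  have s2 := (ser_summable hγ HB_h1 hc hr).hasSum.mul_left r
  have s3 := (ser_summable hγ HB_hd hc hr).hasSum.mul_left (1 - r)
  refine (s1.sub s2).unique ?_
  refine (congrArg (fun f => HasSum f _) (funext fun p => ?_)).mpr s3
  split_ifs with h
  · have := geom_sum_mul r (p - 1)
    simp only [h1, hd, one_pow]
    have e : r * r ^ (p - 2) = r ^ (p - 1) := by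
      rw [← pow_succ']; congr 1; omega
    have : (1 - r) * ∑ j ∈ Finset.range (p - 1), r ^ j = 1 - r ^ (p - 1) := by
      rw [mul_comm]; linarith
    calc _ = c p ^ 2 * p * (1 - r * r ^ (p - 2)) := by ring
      _ = c p ^ 2 * p * ((1 - r) * ∑ j ∈ Finset.range (p - 1), r ^ j) := by rw [e, this]
      _ = _ := by ring
  · simp

end

lemma Gd_one (c : ℕ → ℝ) : Gd c 1 = G2 c 1 := by
  unfold Gd G2 Ser
  congr 1; ext p
  split_ifs with h
  · simp [hd, h2, Nat.cast_sub (by omega : 1 ≤ p)]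
  · rfl

lemma Mixed_nhds {c : ℕ → ℝ} (h : Mixed c) : ∀ᶠ c' in nhds c, Mixed c' := by
  obtain ⟨p, q, hp, hq, hpq, h1, h2⟩ := h
  have e1 : ∀ᶠ c' : ℕ → ℝ in nhds c, c' p ≠ 0 :=
    (continuous_apply p).continuousAt.eventually_ne h1
  have e2 : ∀ᶠ c' : ℕ → ℝ in nhds c, c' q ≠ 0 :=
    (continuous_apply q).continuousAt.eventually_ne h2
  filter_upwards [e1, e2] with c' h1 h2
  exact ⟨p, q, hp, hq, hpq, h1, h2⟩

lemma ser_even {h : ℕ → ℝ → ℝ} {c : ℕ → ℝ} (hc : ∀ p, Odd p → c p = 0) (r : ℝ)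
    (hh : ∀ p, 2 ≤ p → Even p → h p (-r) = h p r) : Ser h c (-r) = Ser h c r := by
  unfold Ser
  congr 1; ext p
  split_ifs with h2
  · rcases Nat.even_or_odd p with he | ho
    · rw [hh p h2 he]
    · rw [hc p ho]; simp
  · rfl

lemma ser_odd {h : ℕ → ℝ → ℝ} {c : ℕ → ℝ} (hc : ∀ p, Even p → c p = 0) (r : ℝ)
    (hh : ∀ p, 2 ≤ p → Odd p → h p (-r) = - h p r) : Ser h c (-r) = - Ser h c r := by
  unfold Ser
  rw [← tsum_neg]
  congr 1; ext p
  split_ifs with h2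
  · rcases Nat.even_or_odd p with he | ho
    · rw [hc p he]; simp
    · rw [hh p h2 ho]; ring
  · simp

def theta (g0 g1 g2 u x : ℝ) : ℝ :=
  1 / 2 + 1 / 2 * Real.log (g2 / g1)
    - 1 / 2 * ((u ^ 2 * (g2 + g1) - 2 * u * x * g1 + x ^ 2 * g0) / (g0 * (g2 + g1) - g1 ^ 2))
    + Omega (x / √g2)

lemma Theta_eq_theta (c : ℕ → ℝ) (u x : ℝ) :
    Theta c 1 u x = theta (G0 c 1) (G1 c 1) (G2 c 1) u x := by
  unfold Theta theta SigmaQ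
  simp only [one_pow, one_mul, nuF_one, nuD1_one, nuD2_one]
  congr 3
  rw [Matrix.inv_def, Matrix.det_fin_two_of, Matrix.adjugate_fin_two_of, Ring.inverse_eq_inv']
  simp [Matrix.mulVec, dotProduct, Fin.sum_univ_two]
  rw [div_eq_mul_inv, show G0 c 1 * (G2 c 1 + G1 c 1) - G1 c 1 ^ 2 =
    G0 c 1 * (G2 c 1 + G1 c 1) - G1 c 1 * G1 c 1 by ring]
  ring

structure Good (g0 g1 g2 : ℝ) : Prop where
  p0 : 0 < g0
  h1 : 2 * g0 ≤ g1
  h2 : g1 < g2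
  hd : 0 < g0 * (g2 + g1) - g1 ^ 2

lemma Good.p1 {g0 g1 g2 : ℝ} (h : Good g0 g1 g2) : 0 < g1 := by linarith [h.p0, h.h1]
lemma Good.p2 {g0 g1 g2 : ℝ} (h : Good g0 g1 g2) : 0 < g2 := by linarith [h.p1, h.h2]

lemma good_of {γ : ℕ → ℝ} (hγ : GammaDecay γ) {c : ℕ → ℝ} (hc : c ∈ Dom γ) (hm : Mixed c) :
    Good (G0 c 1) (G1 c 1) (G2 c 1) :=
  ⟨G0_pos hγ hc hm, G1_ge hγ hc, G2_gt hγ hc hm, Delta_pos hγ hc hm⟩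

lemma theta_tendsto {ι : Type*} {l : Filter ι} {g0 g1 g2 u x : ι → ℝ} {a0 a1 a2 U X : ℝ}
    (hg : Good a0 a1 a2) (h0 : Tendsto g0 l (nhds a0)) (h1 : Tendsto g1 l (nhds a1))
    (h2 : Tendsto g2 l (nhds a2)) (hu : Tendsto u l (nhds U)) (hx : Tendsto x l (nhds X)) :
    Tendsto (fun i => theta (g0 i) (g1 i) (g2 i) (u i) (x i)) l (nhds (theta a0 a1 a2 U X)) := by
  have p1 := hg.p1
  have p2 := hg.p2
  have pd := hg.hd
  unfold theta
  have hs : √a2 ≠ 0 := (Real.sqrt_pos.2 p2).ne'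
  refine Tendsto.add (Tendsto.sub ((tendsto_const_nhds).add (((h2.div h1 p1.ne').log
    (by positivity)).const_mul _)) ((Tendsto.div ?_ ?_ pd.ne').const_mul _))
    ((continuous_Omega.tendsto _).comp (hx.div (h2.sqrt) hs))
  · exact (((hu.pow 2).mul (h2.add h1)).sub (((hu.const_mul 2).mul hx).mul h1)).add
      ((hx.pow 2).mul h0)
  · exact (h0.mul (h2.add h1)).sub (h1.pow 2)

lemma theta_continuous {a0 a1 a2 : ℝ} (hg : Good a0 a1 a2) :
    Continuous fun z : ℝ × ℝ => theta a0 a1 a2 z.1 z.2 := by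
  rw [continuous_iff_continuousAt]
  intro z
  exact theta_tendsto hg tendsto_const_nhds tendsto_const_nhds tendsto_const_nhds
    (continuous_fst.tendsto z) (continuous_snd.tendsto z)

section
variable {g0 g1 g2 : ℝ} (hg : Good g0 g1 g2)
include hg

lemma theta_coercive (u x : ℝ) :
    theta g0 g1 g2 u x ≤ 1 / 2 * Real.log (2 * (g0 + g1 + g2) / g1)
      - (u ^ 2 + x ^ 2) / (4 * (g0 + g1 + g2)) := by
  have p0 := hg.p0
  have p1 := hg.p1
  have p2 := hg.p2
  have pd := hg.hd
  set T := g0 + g1 + g2 with hT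
  have pT : 0 < T := by positivity
  have hw : 1 ≤ 2 * T / g2 := by rw [le_div_iff₀ p2]; linarith
  have ho := Omega_le (z := x / √g2) hw
  rw [div_pow, Real.sq_sqrt p2.le] at ho
  have h1 : x ^ 2 / g2 / (2 * (1 + 2 * T / g2)) ≤ x ^ 2 / (4 * T) := by
    rw [div_div]
    have : g2 * (2 * (1 + 2 * T / g2)) = 2 * g2 + 4 * T := by field_simp; ring
    rw [this]
    exact div_le_div_of_nonneg_left (sq_nonneg x) (by positivity) (by linarith)
  have h2 : (u ^ 2 + x ^ 2) / T ≤
      (u ^ 2 * (g2 + g1) - 2 * u * x * g1 + x ^ 2 * g0) / (g0 * (g2 + g1) - g1 ^ 2) := by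
    rw [div_le_div_iff₀ pT pd]
    have : (u ^ 2 * (g2 + g1) - 2 * u * x * g1 + x ^ 2 * g0) * T -
      (u ^ 2 + x ^ 2) * (g0 * (g2 + g1) - g1 ^ 2) =
      ((g2 + g1) * u - g1 * x) ^ 2 + (g0 * x - g1 * u) ^ 2 := by rw [hT]; ring
    nlinarith [sq_nonneg ((g2 + g1) * u - g1 * x), sq_nonneg (g0 * x - g1 * u)]
  have h3 : Real.log (g2 / g1) + Real.log (2 * T / g2) = Real.log (2 * T / g1) := by
    rw [← Real.log_mul (by positivity) (by positivity)]
    congr 1; field_simp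
  have h4 : (u ^ 2 + x ^ 2) / (4 * T) = (u ^ 2 + x ^ 2) / T / 4 := by field_simp
  have h5 : x ^ 2 / (4 * T) ≤ (u ^ 2 + x ^ 2) / (4 * T) := by
    gcongr; nlinarith [sq_nonneg u]
  unfold theta
  linarith

lemma theta_bdd {u x : ℝ} (h : 0 ≤ theta g0 g1 g2 u x) :
    u ^ 2 + x ^ 2 ≤ 2 * (g0 + g1 + g2) * Real.log (2 * (g0 + g1 + g2) / g1) := by
  have p0 := hg.p0
  have p1 := hg.p1
  have p2 := hg.p2
  have h1 := theta_coercive hg u x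
  have : (u ^ 2 + x ^ 2) / (4 * (g0 + g1 + g2)) ≤ 1 / 2 * Real.log (2 * (g0 + g1 + g2) / g1) := by
    linarith
  rw [div_le_iff₀ (by positivity)] at this
  linarith

lemma theta_zero_pos : 0 < theta g0 g1 g2 0 0 := by
  have p1 := hg.p1
  have : 0 < Real.log (g2 / g1) := Real.log_pos (by rw [lt_div_iff₀ p1]; linarith [hg.h2])
  simp [theta, Omega_zero]
  linarith

/-- scaling -/
lemma theta_scale {u x s : ℝ} (h : 0 ≤ theta g0 g1 g2 u x) (hs0 : 0 ≤ s) (hs : s < 1) :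
    0 < theta g0 g1 g2 (s * u) (s * x) := by
  have p1 := hg.p1
  have hl : 0 < Real.log (g2 / g1) := Real.log_pos (by rw [lt_div_iff₀ p1]; linarith [hg.h2])
  obtain ⟨w, hw, he⟩ := Omega_eq (s * x / √g2)
  have ho := Omega_le (z := x / √g2) hw
  have hlw := Real.log_nonneg hw
  have hs2 : s ^ 2 < 1 := by nlinarith
  have e : (s * x / √g2) ^ 2 / (2 * (1 + w)) = s ^ 2 * ((x / √g2) ^ 2 / (2 * (1 + w))) := by ring
  rw [e] at he
  unfold theta at h ⊢
  rw [he]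
  have e2 : (((s * u) ^ 2 * (g2 + g1) - 2 * (s * u) * (s * x) * g1 + (s * x) ^ 2 * g0) /
    (g0 * (g2 + g1) - g1 ^ 2)) = s ^ 2 * ((u ^ 2 * (g2 + g1) - 2 * u * x * g1 + x ^ 2 * g0) /
    (g0 * (g2 + g1) - g1 ^ 2)) := by ring
  rw [e2]
  nlinarith [sq_nonneg s, mul_nonneg (sub_nonneg.2 hs2.le) hlw, mul_pos (sub_pos.2 hs2) hl,
    mul_le_mul_of_nonneg_left ho (sq_nonneg s), mul_nonneg (sq_nonneg s) h]

lemma theta_mid {u x y : ℝ} (hxy : x ≠ y) :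
    theta g0 g1 g2 u x + theta g0 g1 g2 u y < 2 * theta g0 g1 g2 u ((x + y) / 2) := by
  have p0 := hg.p0
  have p1 := hg.p1
  have p2 := hg.p2
  have pd := hg.hd
  obtain ⟨w, hw, he⟩ := Omega_eq ((x + y) / 2 / √g2)
  have ho := Omega_le (z := x / √g2) hw
  have ho' := Omega_le (z := y / √g2) hw
  simp only [div_pow, Real.sq_sqrt p2.le] at he ho ho'
  have hpos : 0 < (x - y) ^ 2 := by
    have := sub_ne_zero.2 hxy; positivity
  set D := g0 * (g2 + g1) - g1 ^ 2 with hD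
  have k1 : 1 / (4 * g2) * (x - y) ^ 2 < g0 / D / 2 * (x - y) ^ 2 := by
    apply mul_lt_mul_of_pos_right _ hpos
    rw [div_div, div_lt_div_iff₀ (by positivity) (by positivity)]
    nlinarith [hg.h1]
  have k2 : x ^ 2 / g2 / (2 * (1 + w)) + y ^ 2 / g2 / (2 * (1 + w))
      - 2 * ((x + y) ^ 2 / 2 ^ 2 / g2 / (2 * (1 + w))) ≤ 1 / (8 * g2) * (x - y) ^ 2 := by
    have : x ^ 2 / g2 / (2 * (1 + w)) + y ^ 2 / g2 / (2 * (1 + w))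
      - 2 * ((x + y) ^ 2 / 2 ^ 2 / g2 / (2 * (1 + w))) = 1 / (4 * g2 * (1 + w)) * (x - y) ^ 2 := by
      field_simp; ring
    rw [this]
    apply mul_le_mul_of_nonneg_right _ hpos.le
    apply one_div_le_one_div_of_le (by positivity)
    nlinarith
  have k3 : (u ^ 2 * (g2 + g1) - 2 * u * x * g1 + x ^ 2 * g0) / D
      + (u ^ 2 * (g2 + g1) - 2 * u * y * g1 + y ^ 2 * g0) / D
      - 2 * ((u ^ 2 * (g2 + g1) - 2 * u * ((x + y) / 2) * g1 + ((x + y) / 2) ^ 2 * g0) / D)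
      = g0 / D / 2 * (x - y) ^ 2 := by
    field_simp; ring
  unfold theta
  rw [he, ← hD]
  have k4 : 1 / (8 * g2) * (x - y) ^ 2 = 1 / (4 * g2) * (x - y) ^ 2 / 2 := by field_simp; ring
  linarith

end

structure IsOpt (g0 g1 g2 u x : ℝ) : Prop where
  zero : theta g0 g1 g2 u x = 0
  min : ∀ u' x', 0 ≤ theta g0 g1 g2 u' x' → u ≤ u'

section
variable {g0 g1 g2 : ℝ} (hg : Good g0 g1 g2)
include hg

lemma IsOpt.max {u x : ℝ} (h : IsOpt g0 g1 g2 u x) (y : ℝ) : theta g0 g1 g2 u y ≤ 0 := by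
  by_contra! hc
  have ht : Tendsto (fun v => theta g0 g1 g2 v y) (nhds u) (nhds (theta g0 g1 g2 u y)) :=
    theta_tendsto hg tendsto_const_nhds tendsto_const_nhds tendsto_const_nhds
      tendsto_id tendsto_const_nhds
  have hev := ht.eventually (lt_mem_nhds hc)
  have hev2 : ∀ᶠ v in nhdsWithin u (Iio u), 0 < theta g0 g1 g2 v y ∧ v < u :=
    (hev.filter_mono nhdsWithin_le_nhds).and self_mem_nhdsWithin
  obtain ⟨v, h1, h2⟩ := hev2.exists
  linarith [h.min v y h1.le]

lemma IsOpt.unique {u x y : ℝ} (h : IsOpt g0 g1 g2 u x) (hy : 0 ≤ theta g0 g1 g2 u y) :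
    y = x := by
  by_contra hne
  have := theta_mid hg (u := u) hne
  linarith [h.zero, h.max hg ((y + x) / 2)]

lemma exists_opt : ∃ u x, IsOpt g0 g1 g2 u x := by
  set S := {z : ℝ × ℝ | 0 ≤ theta g0 g1 g2 z.1 z.2} with hS
  have hcl : IsClosed S := isClosed_le continuous_const (theta_continuous hg)
  set R := 2 * (g0 + g1 + g2) * Real.log (2 * (g0 + g1 + g2) / g1) with hR
  have hcomp : IsCompact S := by
    refine IsCompact.of_isClosed_subset (isCompact_Icc.prod isCompact_Icc
      (s := Icc (-(R+1)) (R+1)) (t := Icc (-(R+1)) (R+1))) hcl ?_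
    rintro ⟨u, x⟩ hz
    have := theta_bdd hg hz
    simp only [mem_prod, mem_Icc]
    refine ⟨⟨?_, ?_⟩, ?_, ?_⟩ <;> nlinarith [sq_nonneg u, sq_nonneg x, sq_nonneg (u + 1), sq_nonneg (u-1), sq_nonneg (x+1), sq_nonneg (x-1)]
  obtain ⟨z, hz, hmin⟩ := hcomp.exists_isMinOn ⟨(0, 0), (theta_zero_pos hg).le⟩
    continuous_fst.continuousOn
  have hmin' : ∀ u' x', 0 ≤ theta g0 g1 g2 u' x' → z.1 ≤ u' := fun u' x' h => hmin (a := (u', x')) h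
  refine ⟨z.1, z.2, ?_, hmin'⟩
  refine le_antisymm ?_ hz
  by_contra! hc
  have ht : Tendsto (fun v => theta g0 g1 g2 v z.2) (nhds z.1) (nhds (theta g0 g1 g2 z.1 z.2)) :=
    theta_tendsto hg tendsto_const_nhds tendsto_const_nhds tendsto_const_nhds
      tendsto_id tendsto_const_nhds
  have hev := ht.eventually (lt_mem_nhds hc)
  have hev2 : ∀ᶠ v in nhdsWithin z.1 (Iio z.1), 0 < theta g0 g1 g2 v z.2 ∧ v < z.1 :=
    (hev.filter_mono nhdsWithin_le_nhds).and self_mem_nhdsWithin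
  obtain ⟨v, h1, h2⟩ := hev2.exists
  linarith [hmin' v z.2 h1.le]

lemma IsOpt.neg {u x : ℝ} (h : IsOpt g0 g1 g2 u x) : u < 0 := by
  have ht : Tendsto (fun v => theta g0 g1 g2 v 0) (nhds 0) (nhds (theta g0 g1 g2 0 0)) :=
    theta_tendsto hg tendsto_const_nhds tendsto_const_nhds tendsto_const_nhds
      tendsto_id tendsto_const_nhds
  have hev := ht.eventually (lt_mem_nhds (theta_zero_pos hg))
  have hev2 : ∀ᶠ v in nhdsWithin (0:ℝ) (Iio 0), 0 < theta g0 g1 g2 v 0 ∧ v < 0 :=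
    (hev.filter_mono nhdsWithin_le_nhds).and self_mem_nhdsWithin
  obtain ⟨v, h1, h2⟩ := hev2.exists
  linarith [h.min v 0 h1.le]

lemma sup_theta_attained (u : ℝ) : ∃ x, ∀ y, theta g0 g1 g2 u y ≤ theta g0 g1 g2 u x := by
  have p0 := hg.p0
  have p1 := hg.p1
  have p2 := hg.p2
  have hc : Continuous fun x => theta g0 g1 g2 u x :=
    continuous_iff_continuousAt.2 fun z => theta_tendsto hg tendsto_const_nhds
      tendsto_const_nhds tendsto_const_nhds tendsto_const_nhds tendsto_id
  obtain ⟨T, hT⟩ : ∃ T, T = g0 + g1 + g2 := ⟨_, rfl⟩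
  obtain ⟨L, hL⟩ : ∃ L, L = 1 / 2 * Real.log (2 * T / g1) := ⟨_, rfl⟩
  have pT : 0 < T := by rw [hT]; positivity
  have hco : ∀ x, theta g0 g1 g2 u x ≤ L - (u ^ 2 + x ^ 2) / (4 * T) := by
    intro x; rw [hL, hT]; exact theta_coercive hg u x
  obtain ⟨v, hv⟩ : ∃ v, v = theta g0 g1 g2 u 0 := ⟨_, rfl⟩
  obtain ⟨R, hR⟩ : ∃ R, R = 4 * T * |L - v| + 1 := ⟨_, rfl⟩
  have hR1 : 1 ≤ R := by rw [hR]; have : 0 ≤ 4 * T * |L - v| := by positivity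
                         linarith
  obtain ⟨x, hx, hmax⟩ := (isCompact_Icc (a := -R) (b := R)).exists_isMaxOn ⟨0, by simp; linarith⟩
    hc.continuousOn
  refine ⟨x, fun y => ?_⟩
  by_cases hy : y ∈ Icc (-R) R
  · exact hmax hy
  · have h1 : R ≤ |y| := by
      rw [mem_Icc, ← abs_le] at hy; linarith
    have h2 : R ≤ y ^ 2 := by rw [← sq_abs]; nlinarith
    have h3 : |L - v| ≤ (u ^ 2 + y ^ 2) / (4 * T) := by
      rw [le_div_iff₀ (by positivity)]
      nlinarith [sq_nonneg u]
    have h4 : v ≤ theta g0 g1 g2 u x := by rw [hv]; exact hmax (by simp; linarith)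
    linarith [hco y, le_abs_self (L - v)]

end

lemma E0_eq {γ : ℕ → ℝ} {u x : ℝ} (hg : Good (G0 γ 1) (G1 γ 1) (G2 γ 1))
    (h : IsOpt (G0 γ 1) (G1 γ 1) (G2 γ 1) u x) : -(E0 γ) = u := by
  unfold E0
  rw [neg_neg]
  have hl : IsLeast {E : ℝ | (⨆ x : ℝ, Theta γ 1 E x) = 0} u := by
    constructor
    · simp only [Set.mem_ofPred_eq, Theta_eq_theta]
      apply le_antisymm
      · exact ciSup_le fun y => h.max hg y
      · rw [← h.zero]
        exact le_ciSup (f := fun y => theta (G0 γ 1) (G1 γ 1) (G2 γ 1) u y)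
          ⟨0, by rintro _ ⟨y, rfl⟩; exact h.max hg y⟩ x
    · intro E hE
      simp only [Set.mem_ofPred_eq, Theta_eq_theta] at hE
      obtain ⟨y, hy⟩ := sup_theta_attained hg E
      apply h.min E y
      rw [← hE]
      exact ciSup_le hy
  exact hl.csInf_eq

lemma x0_eq {γ : ℕ → ℝ} {u x : ℝ} (hg : Good (G0 γ 1) (G1 γ 1) (G2 γ 1))
    (h : IsOpt (G0 γ 1) (G1 γ 1) (G2 γ 1) u x) : -(x0 γ) = x := by
  unfold x0
  rw [neg_neg, E0_eq hg h]
  simp only [Theta_eq_theta]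
  have : {x : ℝ | ∀ y : ℝ, theta (G0 γ 1) (G1 γ 1) (G2 γ 1) u y ≤
      theta (G0 γ 1) (G1 γ 1) (G2 γ 1) u x} = {x} := by
    ext z
    simp only [Set.mem_ofPred_eq, mem_singleton_iff]
    constructor
    · intro hz
      apply h.unique hg
      rw [← h.zero]; exact hz x
    · rintro rfl y
      rw [h.zero]; exact h.max hg y
  rw [this, csSup_singleton]

section
variable {g0 g1 g2 : ℝ} (hg : Good g0 g1 g2)
include hg

lemma opt_hmax {w U X : ℝ} (hw : 1 ≤ w) (hX : X = -((1 + w) / √w) * √g2)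
    (hUe : U * g1 = X * (g0 - (g0 * (g2 + g1) - g1 ^ 2) / (g2 * (1 + w)))) (y : ℝ) :
    theta g0 g1 g2 U y ≤ theta g0 g1 g2 U X := by
  have p0 := hg.p0
  have p1 := hg.p1
  have p2 := hg.p2
  have pd := hg.hd
  have pr : 0 < √g2 := Real.sqrt_pos.2 p2
  have ho := Omega_le (z := y / √g2) hw
  have he := Omega_eq_of hw
  have e1 : X / √g2 = -((1 + w) / √w) := by rw [hX]; field_simp
  rw [← Omega_neg, ← neg_sq, ← e1] at he
  rw [div_pow, Real.sq_sqrt p2.le] at ho he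
  unfold theta
  obtain ⟨D, hD⟩ : ∃ D, D = g0 * (g2 + g1) - g1 ^ 2 := ⟨_, rfl⟩
  rw [← hD] at pd hUe ⊢
  have key : 1 / 2 * ((U ^ 2 * (g2 + g1) - 2 * U * y * g1 + y ^ 2 * g0) / D)
      - y ^ 2 / g2 / (2 * (1 + w)) -
      (1 / 2 * ((U ^ 2 * (g2 + g1) - 2 * U * X * g1 + X ^ 2 * g0) / D)
      - X ^ 2 / g2 / (2 * (1 + w))) =
      1 / 2 * (g0 - D / (g2 * (1 + w))) / D * (y - X) ^ 2 := by
    have : (U ^ 2 * (g2 + g1) - 2 * U * y * g1 + y ^ 2 * g0) / D -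
      (U ^ 2 * (g2 + g1) - 2 * U * X * g1 + X ^ 2 * g0) / D =
      (- 2 * (U * g1) * (y - X) + (y ^ 2 - X ^ 2) * g0) / D := by ring
    rw [hUe] at this
    have e2 : y ^ 2 / g2 / (2 * (1 + w)) - X ^ 2 / g2 / (2 * (1 + w)) =
      1 / 2 * (D / (g2 * (1 + w))) / D * (y ^ 2 - X ^ 2) := by
      have : (1 + w) ≠ 0 := by linarith
      field_simp
    linear_combination (1/2) * this - e2
  have hnn : 0 ≤ 1 / 2 * (g0 - D / (g2 * (1 + w))) / D * (y - X) ^ 2 := by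
    have : 0 ≤ g0 - D / (g2 * (1 + w)) := by
      rw [sub_nonneg, div_le_iff₀ (by positivity)]
      nlinarith [mul_pos p0 p2, mul_nonneg (mul_pos p0 p2).le (sub_nonneg.2 hw), hg.h1]
    positivity
  linarith

lemma opt_hval {U X : ℝ} (hX : X = -2 * √g2)
    (hUe : U * g1 = X * (g0 - (g0 * (g2 + g1) - g1 ^ 2) / (g2 * (1 + 1))))
    (hP : 0 < Real.log (g2 / g1) - (g2 + g1) * (g2 * g0 + g1 ^ 2 - g1 * g0) / (g2 * g1 ^ 2)) :
    0 < theta g0 g1 g2 U X := by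
  have p0 := hg.p0
  have p1 := hg.p1
  have p2 := hg.p2
  have pd := hg.hd
  obtain ⟨r, hr⟩ : ∃ r, r = √g2 := ⟨_, rfl⟩
  have pr : 0 < r := by rw [hr]; exact Real.sqrt_pos.2 p2
  have r2 : r ^ 2 = g2 := by rw [hr]; exact Real.sq_sqrt p2.le
  obtain ⟨P, hPd⟩ : ∃ P, P = g0 * g2 - g0 * g1 + g1 ^ 2 := ⟨_, rfl⟩
  rw [← hr] at hX
  have hU1 : U = -2 * r * (P / (2 * g1 * g2)) := by
    rw [hX] at hUe
    have : U = -2 * r * (g0 - (g0 * (g2 + g1) - g1 ^ 2) / (g2 * (1 + 1))) / g1 := by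
      rw [← hUe]; field_simp
    rw [this, hPd]
    field_simp
    ring
  have hO : Omega (X / √g2) = 1 / 2 := by
    rw [hX, ← hr, show -2 * r / r = -2 by field_simp, Omega_neg]
    simp [Omega]; norm_num
  unfold theta
  rw [hO, hU1, hX]
  have e : ((-2 * r * (P / (2 * g1 * g2))) ^ 2 * (g2 + g1) -
      2 * (-2 * r * (P / (2 * g1 * g2))) * (-2 * r) * g1 + (-2 * r) ^ 2 * g0)
        / (g0 * (g2 + g1) - g1 ^ 2) =
      2 + P * (g2 - g1) / (g1 ^ 2 * g2) := by
    have : ((-2 * r * (P / (2 * g1 * g2))) ^ 2 * (g2 + g1) -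
      2 * (-2 * r * (P / (2 * g1 * g2))) * (-2 * r) * g1 + (-2 * r) ^ 2 * g0) =
      4 * r ^ 2 * ((P / (2 * g1 * g2)) ^ 2 * (g2 + g1) - 2 * (P / (2 * g1 * g2)) * g1 + g0) := by
      ring
    rw [this, r2]
    rw [div_eq_iff pd.ne', hPd]
    field_simp
    ring
  rw [e]
  have : (g2 + g1) * (g2 * g0 + g1 ^ 2 - g1 * g0) / (g2 * g1 ^ 2) =
    P * (g2 + g1) / (g1 ^ 2 * g2) := by rw [hPd]; ring
  rw [this] at hP
  have h3 : P * (g2 - g1) / (g1 ^ 2 * g2) ≤ P * (g2 + g1) / (g1 ^ 2 * g2) := by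
    have : 0 ≤ P := by rw [hPd]; nlinarith [mul_pos p0 (sub_pos.2 hg.h2)]
    apply div_le_div_of_nonneg_right _ (by positivity)
    exact mul_le_mul_of_nonneg_left (by linarith) this
  linarith

lemma opt_x_lt_aux {u x U X : ℝ} (h : IsOpt g0 g1 g2 u x)
    (hmax : ∀ y, theta g0 g1 g2 U y ≤ theta g0 g1 g2 U X)
    (hpos : 0 < theta g0 g1 g2 U X) : x ≤ X := by
  have hu : u ≤ U := h.min _ _ hpos.le
  have hune : u ≠ U := by
    intro he
    have := h.max hg X
    rw [he] at this; linarith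
  have hlt : u < U := lt_of_le_of_ne hu hune
  have c1 := hmax x
  have c2 : theta g0 g1 g2 u X ≤ theta g0 g1 g2 u x := by rw [h.zero]; exact h.max hg _
  have cross : theta g0 g1 g2 u x + theta g0 g1 g2 U X - theta g0 g1 g2 u X -
      theta g0 g1 g2 U x = g1 / (g0 * (g2 + g1) - g1 ^ 2) * ((u - U) * (x - X)) := by
    unfold theta
    ring
  have hprod : 0 ≤ g1 / (g0 * (g2 + g1) - g1 ^ 2) * ((u - U) * (x - X)) := by
    rw [← cross]; linarith
  by_contra! hc
  have : (u - U) * (x - X) < 0 := mul_neg_of_neg_of_pos (by linarith) (by linarith)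
  have : g1 / (g0 * (g2 + g1) - g1 ^ 2) * ((u - U) * (x - X)) < 0 :=
    mul_neg_of_pos_of_neg (div_pos hg.p1 hg.hd) this
  linarith

lemma opt_x_lt' {u x : ℝ} (h : IsOpt g0 g1 g2 u x)
    (hP : 0 < Real.log (g2 / g1) - (g2 + g1) * (g2 * g0 + g1 ^ 2 - g1 * g0) / (g2 * g1 ^ 2)) :
    x < -2 * √g2 := by
  have p0 := hg.p0
  have p1 := hg.p1
  have p2 := hg.p2
  have pr : 0 < √g2 := Real.sqrt_pos.2 p2
  obtain ⟨X, hX⟩ : ∃ X : ℝ → ℝ, X = fun w => -((1 + w) / √w) * √g2 := ⟨_, rfl⟩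
  obtain ⟨U, hU⟩ : ∃ U : ℝ → ℝ, U = fun w =>
    X w * (g0 - (g0 * (g2 + g1) - g1 ^ 2) / (g2 * (1 + w))) / g1 := ⟨_, rfl⟩
  have hXw : ∀ w, X w = -((1 + w) / √w) * √g2 := fun w => by rw [hX]
  have hUw : ∀ w, U w * g1 = X w * (g0 - (g0 * (g2 + g1) - g1 ^ 2) / (g2 * (1 + w))) :=
    fun w => by rw [hU]; exact div_mul_cancel₀ _ p1.ne'
  have hval : 0 < theta g0 g1 g2 (U 1) (X 1) :=
    opt_hval hg (by rw [hXw]; simp; norm_num) (hUw 1) hP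
  have hcX : ContinuousAt X 1 := by
    rw [hX]
    have : ContinuousAt (fun w : ℝ => √w) 1 := Real.continuous_sqrt.continuousAt
    have : ContinuousAt (fun w : ℝ => (1 + w) / √w) 1 :=
      ContinuousAt.div (continuousAt_const.add continuousAt_id) this (by simp)
    exact this.neg.mul continuousAt_const
  have hcU : ContinuousAt U 1 := by
    rw [hU]
    have : ContinuousAt (fun w : ℝ => (g0 * (g2 + g1) - g1 ^ 2) / (g2 * (1 + w))) 1 :=
      ContinuousAt.div continuousAt_const (continuousAt_const.mul
        (continuousAt_const.add continuousAt_id)) (by positivity)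
    exact (hcX.mul (continuousAt_const.sub this)).div_const _
  have hev := (theta_tendsto hg tendsto_const_nhds tendsto_const_nhds tendsto_const_nhds
    hcU hcX).eventually (lt_mem_nhds hval)
  have hev2 := (hev.filter_mono (nhdsWithin_le_nhds (s := Ioi (1:ℝ)))).and self_mem_nhdsWithin
  obtain ⟨w, hw, hw1⟩ := hev2.exists
  have hw1' : 1 < w := hw1
  have hx := opt_x_lt_aux hg h (opt_hmax hg hw1'.le (hXw w) (hUw w)) hw
  have hs : 0 < √w := Real.sqrt_pos.2 (by linarith)
  have : 2 < (1 + w) / √w := by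
    rw [lt_div_iff₀ hs]
    have h2 : √w ^ 2 = w := Real.sq_sqrt (by linarith)
    have h3 : 1 < √w := by rw [Real.lt_sqrt (by norm_num)]; linarith
    nlinarith
  rw [hXw] at hx
  nlinarith

end

lemma opt_x_lt {γ : ℕ → ℝ} {u x : ℝ} (hg : Good (G0 γ 1) (G1 γ 1) (G2 γ 1))
    (h : IsOpt (G0 γ 1) (G1 γ 1) (G2 γ 1) u x) (hP : PureLike γ) : x < -2 * √(G2 γ 1) := by
  unfold PureLike Gfun at hP
  simp only [nuF_one, nuD1_one, nuD2_one] at hP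
  exact opt_x_lt' hg h hP

/-- convergence of optimizers -/
lemma opt_tendsto {ι : Type*} {l : Filter ι} {g0 g1 g2 u x : ι → ℝ} {a0 a1 a2 U X : ℝ}
    (hg : Good a0 a1 a2) (h0 : Tendsto g0 l (nhds a0)) (h1 : Tendsto g1 l (nhds a1))
    (h2 : Tendsto g2 l (nhds a2)) (hgi : ∀ᶠ i in l, Good (g0 i) (g1 i) (g2 i))
    (hopt : ∀ᶠ i in l, IsOpt (g0 i) (g1 i) (g2 i) (u i) (x i)) (hO : IsOpt a0 a1 a2 U X) :
    Tendsto (fun i => (u i, x i)) l (nhds (U, X)) := by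
  rw [tendsto_iff_ultrafilter]
  intro F hF
  have p0 := hg.p0
  have p1 := hg.p1
  have p2 := hg.p2
  set R := 2 * (a0 + a1 + a2) * Real.log (2 * (a0 + a1 + a2) / a1) + 1 with hR
  have hT : Tendsto (fun i => g0 i + g1 i + g2 i) l (nhds (a0 + a1 + a2)) := (h0.add h1).add h2
  have hRt : ∀ᶠ i in l, 2 * (g0 i + g1 i + g2 i) * Real.log (2 * (g0 i + g1 i + g2 i) / g1 i) < R := by
    refine Tendsto.eventually_lt_const (by rw [hR]; linarith) ((hT.const_mul 2).mul
      (Tendsto.log ((hT.const_mul 2).div h1 p1.ne') (by positivity)))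
  have hmem : ∀ᶠ i in l, (u i, x i) ∈ Icc (-(R+1)) (R+1) ×ˢ Icc (-(R+1)) (R+1) := by
    filter_upwards [hRt, hgi, hopt] with i hi hgi ho
    have := theta_bdd hgi (u := u i) (x := x i) ho.zero.ge
    simp only [mem_prod, mem_Icc]
    refine ⟨⟨?_, ?_⟩, ?_, ?_⟩ <;> nlinarith [sq_nonneg (u i), sq_nonneg (x i), sq_nonneg (u i + 1), sq_nonneg (u i-1), sq_nonneg (x i+1), sq_nonneg (x i-1)]
  have hK : IsCompact (Icc (-(R+1)) (R+1) ×ˢ Icc (-(R+1)) (R+1)) := isCompact_Icc.prod isCompact_Icc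
  obtain ⟨z, hz, hzF⟩ := hK.ultrafilter_le_nhds (F.map fun i => (u i, x i))
    (by rw [le_principal_iff]; exact hF hmem)
  have hzF' : Tendsto (fun i => (u i, x i)) F (nhds z) := hzF
  have tu : Tendsto u F (nhds z.1) := (continuous_fst.tendsto z).comp hzF'
  have tx : Tendsto x F (nhds z.2) := (continuous_snd.tendsto z).comp hzF'
  have t1 := theta_tendsto hg (h0.mono_left hF) (h1.mono_left hF) (h2.mono_left hF) tu tx
  have hz0 : theta a0 a1 a2 z.1 z.2 = 0 := by
    refine tendsto_nhds_unique t1 (tendsto_const_nhds.congr' ?_)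
    filter_upwards [hF hopt] with i hi using hi.zero.symm
  have hle : U ≤ z.1 := hO.min _ _ hz0.ge
  have hge : ∀ s : ℝ, 0 ≤ s → s < 1 → z.1 ≤ s * U := by
    intro s hs0 hs
    have hp := theta_scale hg hO.zero.ge hs0 hs
    have := (theta_tendsto hg (h0.mono_left hF) (h1.mono_left hF) (h2.mono_left hF)
      (tendsto_const_nhds (x := s * U)) (tendsto_const_nhds (x := s * X))).eventually (lt_mem_nhds hp)
    refine le_of_tendsto tu ?_
    filter_upwards [this, hF hopt] with i h1 h2
    exact h2.min _ _ h1.le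
  have hle2 : z.1 ≤ U := by
    have hU := hO.neg hg
    have : Tendsto (fun s : ℝ => s * U) (nhdsWithin 1 (Iio 1)) (nhds (1 * U)) :=
      (tendsto_id.mul_const U).mono_left nhdsWithin_le_nhds
    rw [one_mul] at this
    refine ge_of_tendsto this ?_
    have h3 : ∀ᶠ s : ℝ in nhdsWithin 1 (Iio 1), 0 ≤ s :=
      nhdsWithin_le_nhds (le_mem_nhds (by norm_num))
    filter_upwards [h3, self_mem_nhdsWithin] with s hs0 hs using hge s hs0 hs
  have e1 : z.1 = U := le_antisymm hle2 hle
  have e2 : z.2 = X := hO.unique hg (by rw [← e1, hz0])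
  have : z = (U, X) := Prod.ext e1 e2
  rw [← this]; exact hzF

def Ksq (g0 g1 g2 u x : ℝ) : ℝ :=
  (u ^ 2 * (g2 + g1) - 2 * u * x * g1 + x ^ 2 * g0) / (g0 * (g2 + g1) - g1 ^ 2)

def sigSq (g0 g1 g2 a b : ℝ) : ℝ := a ^ 2 * g0 + 2 * a * b * g1 + b ^ 2 * (g2 + g1)

/-- quadratic part -/
def QQ (g0 g1 g2 k0 k1 k2 δ r u x a b S : ℝ) : ℝ :=
  (1 + δ ^ 2) * (sigSq g0 g1 g2 a b + g1 * S ^ 2)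
    + r ^ 2 * sigSq k0 k1 k2 a b
    + 2 * S * √(1 - r ^ 2) * (r * (a * k1 + b * (k2 + k1)))
    + S ^ 2 * (k2 * (1 - r ^ 2) - r ^ 2 * k1) - 2 * (a * u + b * x)

def FF (g0 g1 g2 k0 k1 k2 δ r u x a b S : ℝ) : ℝ :=
  1 / 2 * Real.log (1 - r ^ 2) - 1 / 2 * Real.log (1 - (r * k1 / g1) ^ 2 / (1 + δ ^ 2) ^ 2)
    + Ksq g0 g1 g2 u x + QQ g0 g1 g2 k0 k1 k2 δ r u x a b S

/-- swap symmetric 4x4 quadratic forms -/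
lemma quad_sym (U1 U2 B1 B2 X1 X2 u x : ℝ) :
    ∃ a b : ℝ, (Sum.elim ![u, u] ![x, x]) ⬝ᵥ ((Matrix.fromBlocks !![U1, U2; U2, U1]
        !![B1, B2; B2, B1] (!![B1, B2; B2, B1])ᵀ !![X1, X2; X2, X1])⁻¹ *ᵥ
          (Sum.elim ![u, u] ![x, x])) = 2 * (a * u + b * x) ∧
      a ^ 2 * (U1 + U2) + 2 * a * b * (B1 + B2) + b ^ 2 * (X1 + X2) = a * u + b * x ∧
      ((U1 + U2) * (X1 + X2) - (B1 + B2) ^ 2 ≠ 0 → (U1 - U2) * (X1 - X2) - (B1 - B2) ^ 2 ≠ 0 →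
        (U1 + U2) * a + (B1 + B2) * b = u ∧ (B1 + B2) * a + (X1 + X2) * b = x) := by
  obtain ⟨M, hM⟩ : ∃ M, M = Matrix.fromBlocks !![U1, U2; U2, U1]
        !![B1, B2; B2, B1] (!![B1, B2; B2, B1])ᵀ !![X1, X2; X2, X1] := ⟨_, rfl⟩
  obtain ⟨v, hv⟩ : ∃ v : Fin 2 ⊕ Fin 2 → ℝ, v = Sum.elim ![u, u] ![x, x] := ⟨_, rfl⟩
  rw [← hM, ← hv]
  have hMt : ∀ t : Fin 2 ⊕ Fin 2 → ℝ,
      (M *ᵥ t) (Sum.inl 0) = U1 * t (Sum.inl 0) + U2 * t (Sum.inl 1) +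
        (B1 * t (Sum.inr 0) + B2 * t (Sum.inr 1)) ∧
      (M *ᵥ t) (Sum.inl 1) = U2 * t (Sum.inl 0) + U1 * t (Sum.inl 1) +
        (B2 * t (Sum.inr 0) + B1 * t (Sum.inr 1)) ∧
      (M *ᵥ t) (Sum.inr 0) = B1 * t (Sum.inl 0) + B2 * t (Sum.inl 1) +
        (X1 * t (Sum.inr 0) + X2 * t (Sum.inr 1)) ∧
      (M *ᵥ t) (Sum.inr 1) = B2 * t (Sum.inl 0) + B1 * t (Sum.inl 1) +
        (X2 * t (Sum.inr 0) + X1 * t (Sum.inr 1)) := by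
    intro t
    rw [hM]
    simp [Matrix.mulVec, dotProduct, Fin.sum_univ_two]
  have hvt : ∀ t : Fin 2 ⊕ Fin 2 → ℝ, v ⬝ᵥ t = u * t (Sum.inl 0) + u * t (Sum.inl 1) +
      (x * t (Sum.inr 0) + x * t (Sum.inr 1)) := by
    intro t; rw [hv]; simp [dotProduct, Fin.sum_univ_two]
  by_cases hdet : M.det = 0
  · refine ⟨0, 0, ?_, by ring, ?_⟩
    · rw [Matrix.inv_def, hdet]
      simp
    · intro h1 h2
      exfalso
      obtain ⟨t, ht, hMt0⟩ := Matrix.exists_mulVec_eq_zero_iff.2 hdet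
      obtain ⟨e1, e2, e3, e4⟩ := hMt t
      rw [hMt0] at e1 e2 e3 e4
      simp only [Pi.zero_apply] at e1 e2 e3 e4
      apply ht
      have s1 : ((U1 + U2) * (X1 + X2) - (B1 + B2) ^ 2) * (t (Sum.inl 0) + t (Sum.inl 1)) = 0 := by
        linear_combination (-(X1 + X2)) * (e1 + e2) + (B1 + B2) * (e3 + e4)
      have s2 : ((U1 + U2) * (X1 + X2) - (B1 + B2) ^ 2) * (t (Sum.inr 0) + t (Sum.inr 1)) = 0 := by
        linear_combination ((B1 + B2)) * (e1 + e2) - (U1 + U2) * (e3 + e4)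
      have s3 : ((U1 - U2) * (X1 - X2) - (B1 - B2) ^ 2) * (t (Sum.inl 0) - t (Sum.inl 1)) = 0 := by
        linear_combination (-(X1 - X2)) * (e1 - e2) + (B1 - B2) * (e3 - e4)
      have s4 : ((U1 - U2) * (X1 - X2) - (B1 - B2) ^ 2) * (t (Sum.inr 0) - t (Sum.inr 1)) = 0 := by
        linear_combination ((B1 - B2)) * (e1 - e2) - (U1 - U2) * (e3 - e4)
      have s1' := (mul_eq_zero.1 s1).resolve_left h1
      have s2' := (mul_eq_zero.1 s2).resolve_left h1
      have s3' := (mul_eq_zero.1 s3).resolve_left h2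
      have s4' := (mul_eq_zero.1 s4).resolve_left h2
      ext i
      rcases i with i | i <;> fin_cases i <;> simp <;> linarith
  · obtain ⟨t, ht⟩ : ∃ t, t = M⁻¹ *ᵥ v := ⟨_, rfl⟩
    have hu : IsUnit M.det := isUnit_iff_ne_zero.2 hdet
    have hMtv : M *ᵥ t = v := by
      rw [ht, Matrix.mulVec_mulVec, Matrix.mul_nonsing_inv _ hu, Matrix.one_mulVec]
    obtain ⟨e1, e2, e3, e4⟩ := hMt t
    rw [hMtv, hv] at e1 e2 e3 e4
    simp only [Sum.elim_inl, Sum.elim_inr, Matrix.cons_val_zero, Matrix.cons_val_one] at e1 e2 e3 e4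
    rw [← ht, hvt]
    have q1 : (U1 + U2) * ((t (Sum.inl 0) + t (Sum.inl 1)) / 2)
        + (B1 + B2) * ((t (Sum.inr 0) + t (Sum.inr 1)) / 2) = u := by linarith
    have q2 : (B1 + B2) * ((t (Sum.inl 0) + t (Sum.inl 1)) / 2)
        + (X1 + X2) * ((t (Sum.inr 0) + t (Sum.inr 1)) / 2) = x := by linarith
    refine ⟨(t (Sum.inl 0) + t (Sum.inl 1)) / 2, (t (Sum.inr 0) + t (Sum.inr 1)) / 2, by ring, ?_,
      fun _ _ => ⟨q1, q2⟩⟩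
    linear_combination ((t (Sum.inl 0) + t (Sum.inl 1)) / 2) * q1 +
      ((t (Sum.inr 0) + t (Sum.inr 1)) / 2) * q2

section
variable {γ : ℕ → ℝ} (hγ : GammaDecay γ)
include hγ

lemma mu_lt {c : ℕ → ℝ} (hc : c ∈ Dom γ) (hm : Mixed c) {r : ℝ} (hr : r ∈ Ioo (-1 : ℝ) 1) :
    (r * G1 c r / G1 c 1) ^ 2 < 1 := by
  have hp := (good_of hγ hc hm).p1
  have h1 := G1_abs_le hγ hc (Ioo_subset_Icc_self hr)
  have hr' : |r| < 1 := abs_lt.2 hr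
  rw [sq_lt_one_iff_abs_lt_one, abs_div, abs_mul, abs_of_pos hp, div_lt_one hp]
  have := abs_nonneg r
  nlinarith [abs_nonneg (G1 c r)]

end

/-- the test point at δ = 0 realizing Psi0 -/
lemma psi_test {γ : ℕ → ℝ} (hγ : GammaDecay γ) (hm : Mixed γ) {u x : ℝ}
    (ho : IsOpt (G0 γ 1) (G1 γ 1) (G2 γ 1) u x) {r : ℝ} (hr : r ∈ Ioo (-1 : ℝ) 1) :
    ∃ U1 U2 B1 B2 X1 X2 : ℝ,
      Psi0 γ r = 1 / 2 * Real.log (1 - r ^ 2) - 1 / 2 * Real.log (1 - (r * G1 γ r / G1 γ 1) ^ 2)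
        + Ksq (G0 γ 1) (G1 γ 1) (G2 γ 1) u x - 1 / 2 * ((Sum.elim ![u, u] ![x, x]) ⬝ᵥ
        ((Matrix.fromBlocks !![U1, U2; U2, U1]
        !![B1, B2; B2, B1] (!![B1, B2; B2, B1])ᵀ !![X1, X2; X2, X1])⁻¹ *ᵥ
          (Sum.elim ![u, u] ![x, x]))) ∧
      (∀ a b : ℝ, ∃ S : ℝ, (a ^ 2 * (U1 + U2) + 2 * a * b * (B1 + B2) + b ^ 2 * (X1 + X2))
          - 2 * (a * u + b * x)
        = QQ (G0 γ 1) (G1 γ 1) (G2 γ 1) (G0 γ r) (G1 γ r) (G2 γ r) 0 r u x a b S) ∧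
      (G1 γ 1 - (r ^ 2 * G1 γ r - G2 γ r * (1 - r ^ 2)) ≠ 0 →
        G1 γ 1 + (r ^ 2 * G1 γ r - G2 γ r * (1 - r ^ 2)) ≠ 0 →
       U1 + U2 = G0 γ 1 + r ^ 2 * (G0 γ r - G1 γ r ^ 2 * (1 - r ^ 2) /
         (G1 γ 1 - (r ^ 2 * G1 γ r - G2 γ r * (1 - r ^ 2)))) ∧
       U1 - U2 = G0 γ 1 + r ^ 2 * (- G0 γ r - G1 γ r ^ 2 * (1 - r ^ 2) /
         (G1 γ 1 + (r ^ 2 * G1 γ r - G2 γ r * (1 - r ^ 2)))) ∧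
       B1 + B2 = G1 γ 1 + r ^ 2 * (G1 γ r - G1 γ r * (G2 γ r + G1 γ r) * (1 - r ^ 2) /
         (G1 γ 1 - (r ^ 2 * G1 γ r - G2 γ r * (1 - r ^ 2)))) ∧
       B1 - B2 = G1 γ 1 + r ^ 2 * (- G1 γ r - G1 γ r * (G2 γ r + G1 γ r) * (1 - r ^ 2) /
         (G1 γ 1 + (r ^ 2 * G1 γ r - G2 γ r * (1 - r ^ 2)))) ∧
       X1 + X2 = G2 γ 1 + G1 γ 1 + r ^ 2 * (G2 γ r + G1 γ r - (G2 γ r + G1 γ r) ^ 2 * (1 - r ^ 2) /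
         (G1 γ 1 - (r ^ 2 * G1 γ r - G2 γ r * (1 - r ^ 2)))) ∧
       X1 - X2 = G2 γ 1 + G1 γ 1 + r ^ 2 * (-(G2 γ r + G1 γ r) -
         (G2 γ r + G1 γ r) ^ 2 * (1 - r ^ 2) /
         (G1 γ 1 + (r ^ 2 * G1 γ r - G2 γ r * (1 - r ^ 2))))) := by
  have hg := good_of hγ (Dom_self hγ) hm
  have hmu := mu_lt hγ (Dom_self hγ) hm hr
  have hE := E0_eq hg ho
  have hX := x0_eq hg ho
  have hz := ho.zero
  have hr2 : 0 < 1 - r ^ 2 := by nlinarith [hr.1, hr.2]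
  have hP : Psi0 γ r = Psi γ 1 1 r u u x x := by unfold Psi0; rw [hE, hX]
  rw [hP]
  unfold Psi SigmaUX SigmaU SigmaB SigmaX a2 a4 ups dA
  simp only [one_pow, one_mul, mul_one, nuF_eq, nuD1_eq, nuD2_eq]
  have p1 := hg.p1
  have p2 := hg.p2
  unfold theta at hz
  generalize G0 γ 1 = g0 at *
  generalize G1 γ 1 = g1 at *
  generalize G2 γ 1 = g2 at *
  generalize G0 γ r = k0 at *
  generalize G1 γ r = k1 at *
  generalize G2 γ r = k2 at *
  obtain ⟨d, hd⟩ : ∃ d, d = r ^ 2 * k1 - k2 * (1 - r ^ 2) := ⟨_, rfl⟩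
  have hd' : r * (r * k1) - k2 * (1 - r ^ 2) = d := by rw [hd]; ring
  simp only [hd', ← hd]
  refine ⟨g0 - g1/(g1*g1-d^2)*(r*k1)^2*(1-r^2), r^2*k0 + -d/(g1*g1-d^2)*(r*k1)^2*(1-r^2),
    g1 - (1-r^2)*(r*k1)*(r*k2+r*k1)*(g1/(g1*g1-d^2)),
    r*(r*k1) + (1-r^2)*(r*k1)*(r*k2+r*k1)*(-d/(g1*g1-d^2)),
    g2+g1-(r*k2+r*k1)^2*(1-r^2)*(g1/(g1*g1-d^2)),
    r^2*k2+r*(r*k1)+(r*k2+r*k1)^2*(1-r^2)*(-d/(g1*g1-d^2)), ?_, ?_, ?_⟩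
  · have hlog : Real.log ((1 - r ^ 2) * (g2 * g2) / (g1 * g1 - (r * k1) ^ 2)) =
        Real.log (1 - r ^ 2) - Real.log (1 - (r * k1 / g1) ^ 2) + 2 * Real.log (g2 / g1) := by
      have e : (1 - r ^ 2) * (g2 * g2) / (g1 * g1 - (r * k1) ^ 2) =
        (1 - r ^ 2) / (1 - (r * k1 / g1) ^ 2) * (g2 / g1) ^ 2 := by
        have : g1 * g1 - (r * k1) ^ 2 = g1 ^ 2 * (1 - (r * k1 / g1) ^ 2) := by
          field_simp
        rw [this]
        have : 1 - (r * k1 / g1) ^ 2 ≠ 0 := by linarith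
        field_simp
      rw [e, Real.log_mul (by
        have : 0 < 1 - (r * k1 / g1) ^ 2 := by linarith
        positivity) (by positivity), Real.log_div hr2.ne' (by linarith), Real.log_pow]
      push_cast; ring
    rw [hlog]
    unfold Ksq
    linear_combination 2 * hz
  · intro a b
    have hsq : √(1 - r ^ 2) ^ 2 = 1 - r ^ 2 := Real.sq_sqrt hr2.le
    obtain ⟨y, hy⟩ : ∃ y, y = √(1 - r ^ 2) := ⟨_, rfl⟩
    unfold QQ sigSq
    rw [← hy] at hsq ⊢
    have hk : k2 * (1 - r ^ 2) - r ^ 2 * k1 = -d := by rw [hd]; ring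
    rw [hk]
    by_cases hD : g1 * g1 - d ^ 2 = 0
    · refine ⟨0, ?_⟩
      rw [hD]
      simp only [div_zero]
      ring
    · have h3 : g1 - d ≠ 0 := fun h => hD (by linear_combination (g1 + d) * h)
      have h4 : g1 + d ≠ 0 := fun h => hD (by linear_combination (g1 - d) * h)
      have e : g1 * g1 - d ^ 2 = (g1 - d) * (g1 + d) := by ring
      refine ⟨-(y * (r * (a * k1 + b * (k2 + k1)))) / (g1 - d), ?_⟩
      rw [← hsq, e]
      field_simp
      ring
  · intro h3 h4
    have e : g1 * g1 - d ^ 2 = (g1 - d) * (g1 + d) := by ring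
    rw [e]
    refine ⟨?_, ?_, ?_, ?_, ?_, ?_⟩ <;> (field_simp; ring)

abbrev ZZ := (ℕ → ℝ) × ℝ × ℝ

def DS (γ : ℕ → ℝ) : Set ZZ := Dom γ ×ˢ univ

def Fc (c : ℕ → ℝ) (u x δ r a b S : ℝ) : ℝ :=
  FF (G0 c 1) (G1 c 1) (G2 c 1) (G0 c r) (G1 c r) (G2 c r) δ r u x a b S

/-- the limit scheme -/
structure Lim {ι : Type*} (γ : ℕ → ℝ) (l : Filter ι) (c : ι → ℕ → ℝ) (u x δ r : ι → ℝ)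
    (C : ℕ → ℝ) (U X R : ℝ) : Prop where
  hc : ∀ᶠ i in l, c i ∈ Dom γ
  hcl : Tendsto c l (nhds C)
  hC : C ∈ Dom γ
  hr : ∀ᶠ i in l, r i ∈ Icc (-1 : ℝ) 1
  hrl : Tendsto r l (nhds R)
  hR : R ∈ Icc (-1 : ℝ) 1
  hu : Tendsto u l (nhds U)
  hx : Tendsto x l (nhds X)
  hδ : Tendsto δ l (nhds 0)

section
variable {γ : ℕ → ℝ} (hγ : GammaDecay γ) {ι : Type*} {l : Filter ι} {c : ι → ℕ → ℝ}
  {u x δ r : ι → ℝ} {C : ℕ → ℝ} {U X R : ℝ}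
include hγ

lemma Ser_tendsto {h : ℕ → ℝ → ℝ} (hh : HB h) (hc : ∀ᶠ i in l, c i ∈ Dom γ)
    (hcl : Tendsto c l (nhds C)) (hC : C ∈ Dom γ) (hr : ∀ᶠ i in l, r i ∈ Icc (-1 : ℝ) 1)
    (hrl : Tendsto r l (nhds R)) (hR : R ∈ Icc (-1 : ℝ) 1) :
    Tendsto (fun i => Ser h (c i) (r i)) l (nhds (Ser h C R)) := by
  have h1 := (ser_continuousOn hγ hh) (C, R) ⟨hC, hR⟩
  have h2 : Tendsto (fun i => (c i, r i)) l (nhdsWithin (C, R) (Dom γ ×ˢ Icc (-1 : ℝ) 1)) := by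
    refine tendsto_nhdsWithin_iff.2 ⟨hcl.prodMk_nhds hrl, ?_⟩
    filter_upwards [hc, hr] with i h3 h4 using ⟨h3, h4⟩
  have h3 : Tendsto (fun z : (ℕ → ℝ) × ℝ => Ser h z.1 z.2)
      (nhdsWithin (C, R) (Dom γ ×ˢ Icc (-1 : ℝ) 1)) (nhds (Ser h C R)) := h1
  have h4 := h3.comp h2
  simp only [Function.comp_def] at h4
  exact h4

lemma Lim.ser {h : ℕ → ℝ → ℝ} (hh : HB h) (L : Lim γ l c u x δ r C U X R) :
    Tendsto (fun i => Ser h (c i) (r i)) l (nhds (Ser h C R)) :=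
  Ser_tendsto hγ hh L.hc L.hcl L.hC L.hr L.hrl L.hR

lemma Lim.ser1 {h : ℕ → ℝ → ℝ} (hh : HB h) (L : Lim γ l c u x δ r C U X R) :
    Tendsto (fun i => Ser h (c i) 1) l (nhds (Ser h C 1)) :=
  Ser_tendsto hγ hh L.hc L.hcl L.hC (by simp) tendsto_const_nhds (by simp)

lemma Lim.all (L : Lim γ l c u x δ r C U X R) :
    Tendsto (fun i => (G0 (c i) 1, G1 (c i) 1, G2 (c i) 1, G0 (c i) (r i), G1 (c i) (r i),
      G2 (c i) (r i), r i, u i, x i, δ i)) l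
      (nhds (G0 C 1, G1 C 1, G2 C 1, G0 C R, G1 C R, G2 C R, R, U, X, 0)) :=
  (L.ser1 hγ HB_h0).prodMk_nhds <| (L.ser1 hγ HB_h1).prodMk_nhds <|
    (L.ser1 hγ HB_h2).prodMk_nhds <| (L.ser hγ HB_h0).prodMk_nhds <| (L.ser hγ HB_h1).prodMk_nhds <|
    (L.ser hγ HB_h2).prodMk_nhds <| L.hrl.prodMk_nhds <| L.hu.prodMk_nhds <|
    L.hx.prodMk_nhds L.hδ

omit hγ in
lemma Lim.mixed (L : Lim γ l c u x δ r C U X R) (hm : Mixed C) : ∀ᶠ i in l, Mixed (c i) :=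
  L.hcl.eventually (Mixed_nhds hm)

/-- convergence of `FF` at a fixed test point -/
lemma Lim.FF (L : Lim γ l c u x δ r C U X R) (hm : Mixed C) (hR : R ∈ Ioo (-1 : ℝ) 1)
    (a b S : ℝ) : Tendsto (fun i => Fc (c i) (u i) (x i) (δ i) (r i) a b S) l
      (nhds (Fc C U X 0 R a b S)) := by
  have hg := good_of hγ L.hC hm
  have hmu := mu_lt hγ L.hC hm hR
  have hR2 : 1 - R ^ 2 ≠ 0 := by nlinarith [hR.1, hR.2]
  have hall := L.all hγ
  have hp1 := hg.p1.ne'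
  have hpd := hg.hd.ne'
  unfold Fc
  generalize G0 C 1 = g0 at *
  generalize G1 C 1 = g1 at *
  generalize G2 C 1 = g2 at *
  generalize G0 C R = k0 at *
  generalize G1 C R = k1 at *
  generalize G2 C R = k2 at *
  have hcont : ContinuousAt (fun v : ℝ × ℝ × ℝ × ℝ × ℝ × ℝ × ℝ × ℝ × ℝ × ℝ =>
      SpinGlass.FF v.1 v.2.1 v.2.2.1 v.2.2.2.1 v.2.2.2.2.1 v.2.2.2.2.2.1 v.2.2.2.2.2.2.2.2.2
        v.2.2.2.2.2.2.1 v.2.2.2.2.2.2.2.1 v.2.2.2.2.2.2.2.2.1 a b S)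
      (g0, g1, g2, k0, k1, k2, R, U, X, 0) := by
    unfold SpinGlass.FF QQ Ksq sigSq
    have h1 : 1 - (R * k1 / g1) ^ 2 / (1 + (0:ℝ) ^ 2) ^ 2 ≠ 0 := by
      norm_num; linarith
    refine ContinuousAt.add (ContinuousAt.add (ContinuousAt.sub ?_ ?_) ?_) ?_
    · refine continuousAt_const.mul (ContinuousAt.log (by fun_prop) hR2)
    · refine continuousAt_const.mul (ContinuousAt.log ?_ h1)
      refine continuousAt_const.sub (ContinuousAt.div (ContinuousAt.pow (ContinuousAt.div
        (by fun_prop) (by fun_prop) hp1) 2) (by fun_prop) (by norm_num))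
    · exact ContinuousAt.div (by fun_prop) (by fun_prop) hpd
    · fun_prop
  have h4 := hcont.tendsto.comp hall
  simp only [Function.comp_def] at h4
  exact h4

end

/-- strong region property at base point `z1` -/
def RegS (γ : ℕ → ℝ) (z1 : ZZ) (A : Set ℝ) : Prop :=
  ∃ M : ℝ, ∀ᶠ w in nhdsWithin z1 (DS γ) ×ˢ nhdsWithin (0 : ℝ) (Ioi 0), ∀ r ∈ A,
    ∃ a b S, Fc w.1.1 w.1.2.1 w.1.2.2 w.2 r a b S ≤ M * w.2 ^ 2

/-- region property -/
def Reg (γ : ℕ → ℝ) (z : ZZ) (A : Set ℝ) : Prop :=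
  ∀ η > (0 : ℝ), ∀ᶠ w in nhdsWithin z (DS γ) ×ˢ nhdsWithin (0 : ℝ) (Ioi 0), ∀ r ∈ A,
    ∃ a b S, Fc w.1.1 w.1.2.1 w.1.2.2 w.2 r a b S ≤ η

lemma RegS.mono {γ : ℕ → ℝ} {z : ZZ} {A B : Set ℝ} (h : RegS γ z B) (hAB : A ⊆ B) :
    RegS γ z A := by
  obtain ⟨M, hM⟩ := h
  exact ⟨M, hM.mono fun w hw r hr => hw r (hAB hr)⟩

lemma RegS.union {γ : ℕ → ℝ} {z : ZZ} {A B : Set ℝ} (hA : RegS γ z A) (hB : RegS γ z B) :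
    RegS γ z (A ∪ B) := by
  obtain ⟨M, hM⟩ := hA
  obtain ⟨M', hM'⟩ := hB
  refine ⟨max M M', ?_⟩
  filter_upwards [hM, hM'] with w h1 h2 r hr
  rcases hr with hr | hr
  · obtain ⟨a, b, S, h⟩ := h1 r hr
    exact ⟨a, b, S, h.trans (mul_le_mul_of_nonneg_right (le_max_left _ _) (sq_nonneg _))⟩
  · obtain ⟨a, b, S, h⟩ := h2 r hr
    exact ⟨a, b, S, h.trans (mul_le_mul_of_nonneg_right (le_max_right _ _) (sq_nonneg _))⟩

lemma Reg.union {γ : ℕ → ℝ} {z : ZZ} {A B : Set ℝ} (hA : Reg γ z A) (hB : Reg γ z B) :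
    Reg γ z (A ∪ B) := by
  intro η hη
  filter_upwards [hA η hη, hB η hη] with w h1 h2 r hr
  rcases hr with hr | hr
  · exact h1 r hr
  · exact h2 r hr

lemma Reg.mono {γ : ℕ → ℝ} {z : ZZ} {A B : Set ℝ} (h : Reg γ z B) (hAB : A ⊆ B) :
    Reg γ z A := fun η hη => (h η hη).mono fun w hw r hr => hw r (hAB hr)

lemma RegS.reg {γ : ℕ → ℝ} {z1 : ZZ} {A : Set ℝ} (h : RegS γ z1 A) :
    ∀ᶠ z in nhdsWithin z1 (DS γ), Reg γ z A := by
  obtain ⟨M, hM⟩ := h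
  rw [Filter.eventually_iff, mem_prod_iff] at hM
  obtain ⟨A1, hA1, B1, hB1, hAB⟩ := hM
  have h1 : ∀ᶠ z in nhdsWithin z1 (DS γ), ∀ᶠ z' in nhdsWithin z (DS γ), z' ∈ A1 :=
    eventually_eventually_nhdsWithin.2 hA1
  filter_upwards [h1] with z hz η hη
  have h2 : ∀ᶠ δ in nhdsWithin (0:ℝ) (Ioi 0), M * δ ^ 2 ≤ η := by
    have : Tendsto (fun δ : ℝ => M * δ ^ 2) (nhdsWithin (0:ℝ) (Ioi 0)) (nhds (M * 0 ^ 2)) :=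
      (Continuous.tendsto (by fun_prop) 0).mono_left nhdsWithin_le_nhds
    exact (this.eventually (gt_mem_nhds (by simpa using hη))).mono fun _ h => h.le
  have h3 := hz.prod_mk (h2.and hB1)
  filter_upwards [h3] with w hw r hr
  obtain ⟨a, b, S, h⟩ := hAB (show w ∈ A1 ×ˢ B1 from ⟨hw.1, hw.2.2⟩) r hr
  exact ⟨a, b, S, h.trans hw.2.1⟩

/-- local to compact -/
lemma RegS_compact {γ : ℕ → ℝ} {z : ZZ} {K : Set ℝ} (hK : IsCompact K)
    (h : ∀ r ∈ K, ∃ A ∈ nhdsWithin r K, RegS γ z A) : RegS γ z K := by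
  refine hK.induction_on (p := RegS γ z) ⟨0, by simp⟩ (fun s t hst ht => ht.mono hst)
    (fun s t hs ht => hs.union ht) h

/-- from eventual statements along a product filter to RegS near a point -/
lemma RegS_of_prod {γ : ℕ → ℝ} {z : ZZ} {r0 : ℝ} {B : Set ℝ} (M : ℝ)
    (h : ∀ᶠ v in (nhdsWithin z (DS γ) ×ˢ nhdsWithin (0 : ℝ) (Ioi 0)) ×ˢ nhdsWithin r0 B,
      ∃ a b S, Fc v.1.1.1 v.1.1.2.1 v.1.1.2.2 v.1.2 v.2 a b S ≤ M * v.1.2 ^ 2) :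
    ∃ A ∈ nhdsWithin r0 B, RegS γ z A := by
  rw [Filter.eventually_iff, mem_prod_iff] at h
  obtain ⟨A1, hA1, B1, hB1, hAB⟩ := h
  refine ⟨B1, hB1, M, ?_⟩
  filter_upwards [hA1] with w hw r hr
  have h5 := hAB (show (w, r) ∈ A1 ×ˢ B1 from ⟨hw, hr⟩)
  simp only [Set.mem_ofPred_eq] at h5
  exact h5

/-- the basic limit scheme of a product filter -/
lemma Lim_prod {γ : ℕ → ℝ} {z : ZZ} (hz : z.1 ∈ Dom γ) {r0 : ℝ}
    (hr0 : r0 ∈ Icc (-1 : ℝ) 1) {B : Set ℝ} (hB : B ⊆ Icc (-1 : ℝ) 1) :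
    Lim γ ((nhdsWithin z (DS γ) ×ˢ nhdsWithin (0 : ℝ) (Ioi 0)) ×ˢ nhdsWithin r0 B)
      (fun v => v.1.1.1) (fun v => v.1.1.2.1) (fun v => v.1.1.2.2) (fun v => v.1.2)
      (fun v => v.2) z.1 z.2.1 z.2.2 r0 := by
  have e1 : Tendsto (fun v : (ZZ × ℝ) × ℝ => v.1.1)
      ((nhdsWithin z (DS γ) ×ˢ nhdsWithin (0 : ℝ) (Ioi 0)) ×ˢ nhdsWithin r0 B)
      (nhdsWithin z (DS γ)) := tendsto_fst.comp tendsto_fst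
  have e1' := e1.mono_right nhdsWithin_le_nhds
  have e2 : Tendsto (fun v : (ZZ × ℝ) × ℝ => v.1.2)
      ((nhdsWithin z (DS γ) ×ˢ nhdsWithin (0 : ℝ) (Ioi 0)) ×ˢ nhdsWithin r0 B)
      (nhdsWithin (0 : ℝ) (Ioi 0)) := tendsto_snd.comp tendsto_fst
  have e3 : Tendsto (fun v : (ZZ × ℝ) × ℝ => v.2)
      ((nhdsWithin z (DS γ) ×ˢ nhdsWithin (0 : ℝ) (Ioi 0)) ×ˢ nhdsWithin r0 B)
      (nhdsWithin r0 B) := tendsto_snd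
  have s1 : Tendsto (fun w : ZZ => w.1) (nhds z) (nhds z.1) := continuous_fst.tendsto z
  have s2 : Tendsto (fun w : ZZ => w.2.1) (nhds z) (nhds z.2.1) :=
    (continuous_fst.comp continuous_snd).tendsto z
  have s3 : Tendsto (fun w : ZZ => w.2.2) (nhds z) (nhds z.2.2) :=
    (continuous_snd.comp continuous_snd).tendsto z
  refine ⟨?_, s1.comp e1', hz, ?_, e3.mono_right nhdsWithin_le_nhds, hr0, s2.comp e1', s3.comp e1',
    e2.mono_right nhdsWithin_le_nhds⟩
  · have : ∀ᶠ w in nhdsWithin z (DS γ), w ∈ DS γ := self_mem_nhdsWithin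
    exact (e1.eventually this).mono fun v hv => hv.1
  · have : ∀ᶠ w in nhdsWithin r0 B, w ∈ B := self_mem_nhdsWithin
    exact (e3.eventually this).mono fun v hv => hB hv

section
variable {γ : ℕ → ℝ} (hγ : GammaDecay γ) (hm : Mixed γ) {u x : ℝ}
    (ho : IsOpt (G0 γ 1) (G1 γ 1) (G2 γ 1) u x)
include hγ hm ho

lemma psi_fc {r : ℝ} (hr : r ∈ Ioo (-1 : ℝ) 1) : ∃ a b S, Fc γ u x 0 r a b S = Psi0 γ r := by
  obtain ⟨U1, U2, B1, B2, X1, X2, h1, h2, -⟩ := psi_test hγ hm ho hr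
  obtain ⟨a, b, q1, q2, -⟩ := quad_sym U1 U2 B1 B2 X1 X2 u x
  obtain ⟨S, hS⟩ := h2 a b
  refine ⟨a, b, S, ?_⟩
  unfold Fc FF
  rw [← hS, h1, q1, q2]
  norm_num
  ring

lemma RegS_mid {K : Set ℝ} (hK : IsCompact K) (hK1 : K ⊆ Ioo (-1 : ℝ) 1)
    (hneg : ∀ r ∈ K, Psi0 γ r < 0) : RegS γ (γ, u, x) K := by
  refine RegS_compact hK fun r0 hr0 => ?_
  obtain ⟨a, b, S, h⟩ := psi_fc hγ hm ho (hK1 hr0)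
  refine RegS_of_prod 0 ?_
  have L := Lim_prod (γ := γ) (z := (γ, u, x)) (Dom_self hγ) (Ioo_subset_Icc_self (hK1 hr0))
    (hK1.trans Ioo_subset_Icc_self)
  have h1 := L.FF hγ hm (hK1 hr0) a b S
  have h2 : Fc γ u x 0 r0 a b S < 0 := by rw [h]; exact hneg r0 hr0
  filter_upwards [h1.eventually (gt_mem_nhds h2)] with v hv
  refine ⟨a, b, S, ?_⟩
  rw [zero_mul]
  exact hv.le

end

def astar (g0 g1 g2 u x : ℝ) : ℝ := (u * (g2 + g1) - x * g1) / (g0 * (g2 + g1) - g1 ^ 2)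
def bstar (g0 g1 g2 u x : ℝ) : ℝ := (x * g0 - u * g1) / (g0 * (g2 + g1) - g1 ^ 2)

lemma star_eqs {g0 g1 g2 : ℝ} (hd : g0 * (g2 + g1) - g1 ^ 2 ≠ 0) (u x : ℝ) :
    g0 * astar g0 g1 g2 u x + g1 * bstar g0 g1 g2 u x = u ∧
    g1 * astar g0 g1 g2 u x + (g2 + g1) * bstar g0 g1 g2 u x = x ∧
    Ksq g0 g1 g2 u x = astar g0 g1 g2 u x * u + bstar g0 g1 g2 u x * x := by
  unfold astar bstar Ksq
  refine ⟨?_, ?_, ?_⟩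
  · rw [← mul_div_assoc, ← mul_div_assoc, ← add_div, div_eq_iff hd]; ring
  · rw [← mul_div_assoc, ← mul_div_assoc, ← add_div, div_eq_iff hd]; ring
  · rw [div_mul_eq_mul_div, div_mul_eq_mul_div, ← add_div]; ring

lemma FF_delta_le {g0 g1 g2 k0 k1 k2 δ r u x a b S : ℝ} (hmu : (r * k1 / g1) ^ 2 < 1) :
    FF g0 g1 g2 k0 k1 k2 δ r u x a b S ≤ FF g0 g1 g2 k0 k1 k2 0 r u x a b S
      + δ ^ 2 * (sigSq g0 g1 g2 a b + g1 * S ^ 2) := by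
  unfold FF QQ
  have h1 : Real.log (1 - (r * k1 / g1) ^ 2 / (1 + 0 ^ 2) ^ 2)
      ≤ Real.log (1 - (r * k1 / g1) ^ 2 / (1 + δ ^ 2) ^ 2) := by
    have h2 : (1:ℝ) ≤ (1 + δ ^ 2) ^ 2 := one_le_pow₀ (by nlinarith [sq_nonneg δ])
    have h3 : (r * k1 / g1) ^ 2 / (1 + δ ^ 2) ^ 2 ≤ (r * k1 / g1) ^ 2 :=
      div_le_self (sq_nonneg _) h2
    have h4 : (r * k1 / g1) ^ 2 / (1 + (0:ℝ) ^ 2) ^ 2 = (r * k1 / g1) ^ 2 := by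
      rw [zero_pow two_ne_zero, add_zero, one_pow, div_one]
    rw [h4]
    refine Real.log_le_log (by linarith) ?_
    linarith
  nlinarith

/-- the coefficient near zero -/
def C0 (g0 g1 g2 k0 k1 k2 r u x : ℝ) : ℝ :=
  -(1 / 2) * ((1 - (k1 / g1) ^ 2) / (1 - r ^ 2 * (k1 / g1) ^ 2))
    + sigSq k0 k1 k2 (astar g0 g1 g2 u x) (bstar g0 g1 g2 u x)
    - (1 - r ^ 2) * (astar g0 g1 g2 u x * k1 + bstar g0 g1 g2 u x * (k2 + k1)) ^ 2
      / (g1 - (r ^ 2 * k1 - k2 * (1 - r ^ 2)))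

def S0 (g0 g1 g2 k1 k2 r u x : ℝ) : ℝ :=
  -(√(1 - r ^ 2) * (r * (astar g0 g1 g2 u x * k1 + bstar g0 g1 g2 u x * (k2 + k1))))
      / (g1 - (r ^ 2 * k1 - k2 * (1 - r ^ 2)))

lemma FF_near0 {g0 g1 g2 k0 k1 k2 r u x : ℝ} (hg : Good g0 g1 g2) (hr : r ∈ Ioo (-1 : ℝ) 1)
    (hmu : (r * k1 / g1) ^ 2 < 1) (he : g1 - (r ^ 2 * k1 - k2 * (1 - r ^ 2)) ≠ 0) :
    FF g0 g1 g2 k0 k1 k2 0 r u x (astar g0 g1 g2 u x) (bstar g0 g1 g2 u x)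
      (S0 g0 g1 g2 k1 k2 r u x) ≤ r ^ 2 * C0 g0 g1 g2 k0 k1 k2 r u x := by
  obtain ⟨e1, e2, e3⟩ := star_eqs hg.hd.ne' u x
  have hr2 : 0 < 1 - r ^ 2 := by nlinarith [hr.1, hr.2]
  unfold FF C0 S0 QQ
  rw [e3]
  generalize astar g0 g1 g2 u x = a at *
  generalize bstar g0 g1 g2 u x = b at *
  have hsq : √(1 - r ^ 2) ^ 2 = 1 - r ^ 2 := Real.sq_sqrt hr2.le
  have hsig : sigSq g0 g1 g2 a b = a * u + b * x := by
    unfold sigSq; linear_combination a * e1 + b * e2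
  rw [hsig]
  have hmu' : (r * k1 / g1) ^ 2 = r ^ 2 * (k1 / g1) ^ 2 := by ring
  have hlog : 1 / 2 * Real.log (1 - r ^ 2) - 1 / 2 * Real.log (1 - (r * k1 / g1) ^ 2 / (1 + 0 ^ 2) ^ 2)
      ≤ r ^ 2 * (-(1 / 2) * ((1 - (k1 / g1) ^ 2) / (1 - r ^ 2 * (k1 / g1) ^ 2))) := by
    have e : 1 - (r * k1 / g1) ^ 2 / (1 + (0:ℝ) ^ 2) ^ 2 = 1 - r ^ 2 * (k1 / g1) ^ 2 := by
      rw [hmu']; norm_num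
    rw [e]
    rw [hmu'] at hmu
    generalize (k1 / g1) ^ 2 = m at *
    have hp : 0 < 1 - r ^ 2 * m := by linarith
    have h1 := Real.log_le_sub_one_of_pos (div_pos hr2 hp)
    rw [Real.log_div hr2.ne' hp.ne'] at h1
    have h2 : (1 - r ^ 2) / (1 - r ^ 2 * m) - 1 = -(r ^ 2 * ((1 - m) / (1 - r ^ 2 * m))) := by
      field_simp; ring
    linarith
  generalize hy : √(1 - r ^ 2) = y at *
  have hQ : (1 + (0:ℝ) ^ 2) * (a * u + b * x + g1 * (-(y * (r * (a * k1 + b * (k2 + k1)))) /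
        (g1 - (r ^ 2 * k1 - k2 * (1 - r ^ 2)))) ^ 2)
      + r ^ 2 * sigSq k0 k1 k2 a b
      + 2 * (-(y * (r * (a * k1 + b * (k2 + k1)))) / (g1 - (r ^ 2 * k1 - k2 * (1 - r ^ 2)))) * y
        * (r * (a * k1 + b * (k2 + k1)))
      + (-(y * (r * (a * k1 + b * (k2 + k1)))) / (g1 - (r ^ 2 * k1 - k2 * (1 - r ^ 2)))) ^ 2
        * (k2 * (1 - r ^ 2) - r ^ 2 * k1) - 2 * (a * u + b * x)
      = r ^ 2 * sigSq k0 k1 k2 a b - (a * u + b * x)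
        - r ^ 2 * ((1 - r ^ 2) * (a * k1 + b * (k2 + k1)) ^ 2
          / (g1 - (r ^ 2 * k1 - k2 * (1 - r ^ 2)))) := by
    clear hlog hmu hmu'
    have hD : k2 * (1 - r ^ 2) - r ^ 2 * k1 = (g1 - (r ^ 2 * k1 - k2 * (1 - r ^ 2))) - g1 := by ring
    rw [hD]
    generalize g1 - (r ^ 2 * k1 - k2 * (1 - r ^ 2)) = D at *
    rw [← hsq]
    generalize a * k1 + b * (k2 + k1) = t at *
    field_simp
    ring
  rw [hQ]
  linarith

/-- convergence of the near-zero quantities -/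
lemma C0_continuousAt {g0 g1 g2 k0 k1 k2 u x : ℝ} (hg : Good g0 g1 g2)
    (he : g1 + k2 ≠ 0) :
    ContinuousAt (fun v : ℝ × ℝ × ℝ × ℝ × ℝ × ℝ × ℝ × ℝ × ℝ × ℝ =>
      C0 v.1 v.2.1 v.2.2.1 v.2.2.2.1 v.2.2.2.2.1 v.2.2.2.2.2.1
        v.2.2.2.2.2.2.1 v.2.2.2.2.2.2.2.1 v.2.2.2.2.2.2.2.2.1)
      (g0, g1, g2, k0, k1, k2, 0, u, x, 0) ∧
    ContinuousAt (fun v : ℝ × ℝ × ℝ × ℝ × ℝ × ℝ × ℝ × ℝ × ℝ × ℝ =>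
      sigSq v.1 v.2.1 v.2.2.1 (astar v.1 v.2.1 v.2.2.1 v.2.2.2.2.2.2.2.1 v.2.2.2.2.2.2.2.2.1)
        (bstar v.1 v.2.1 v.2.2.1 v.2.2.2.2.2.2.2.1 v.2.2.2.2.2.2.2.2.1) + v.2.1 *
      (S0 v.1 v.2.1 v.2.2.1 v.2.2.2.2.1 v.2.2.2.2.2.1
        v.2.2.2.2.2.2.1 v.2.2.2.2.2.2.2.1 v.2.2.2.2.2.2.2.2.1) ^ 2)
      (g0, g1, g2, k0, k1, k2, 0, u, x, 0) := by
  have hp1 := hg.p1.ne'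
  have hpd := hg.hd.ne'
  have ha : ContinuousAt (fun v : ℝ × ℝ × ℝ × ℝ × ℝ × ℝ × ℝ × ℝ × ℝ × ℝ =>
      astar v.1 v.2.1 v.2.2.1 v.2.2.2.2.2.2.2.1 v.2.2.2.2.2.2.2.2.1)
      (g0, g1, g2, k0, k1, k2, 0, u, x, 0) := by
    unfold astar
    exact ContinuousAt.div (by fun_prop) (by fun_prop) hpd
  have hb : ContinuousAt (fun v : ℝ × ℝ × ℝ × ℝ × ℝ × ℝ × ℝ × ℝ × ℝ × ℝ =>
      bstar v.1 v.2.1 v.2.2.1 v.2.2.2.2.2.2.2.1 v.2.2.2.2.2.2.2.2.1)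
      (g0, g1, g2, k0, k1, k2, 0, u, x, 0) := by
    unfold bstar
    exact ContinuousAt.div (by fun_prop) (by fun_prop) hpd
  have hm : ContinuousAt (fun v : ℝ × ℝ × ℝ × ℝ × ℝ × ℝ × ℝ × ℝ × ℝ × ℝ =>
      v.2.2.2.2.1 / v.2.1) (g0, g1, g2, k0, k1, k2, 0, u, x, 0) :=
    ContinuousAt.div (by fun_prop) (by fun_prop) hp1
  have hee : g1 - ((0:ℝ) ^ 2 * k1 - k2 * (1 - 0 ^ 2)) ≠ 0 := by
    intro h; apply he; linarith
  constructor
  · unfold C0 sigSq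
    refine ContinuousAt.sub (ContinuousAt.add (continuousAt_const.mul (ContinuousAt.div
      (by fun_prop) (by fun_prop) (by norm_num))) (by fun_prop)) (ContinuousAt.div (by fun_prop)
      (by fun_prop) hee)
  · unfold S0 sigSq
    refine ContinuousAt.add (by fun_prop) (ContinuousAt.mul (by fun_prop) (ContinuousAt.pow ?_ 2))
    exact ContinuousAt.div (by fun_prop) (by fun_prop) hee

section
variable {γ : ℕ → ℝ} (hγ : GammaDecay γ) (hm : Mixed γ)
include hγ

lemma ser_contAt {h : ℕ → ℝ → ℝ} (hh : HB h) {r : ℝ} (hr : r ∈ Ioo (-1 : ℝ) 1) :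
    ContinuousAt (fun r => Ser h γ r) r := by
  have hev : ∀ᶠ r' in nhds r, r' ∈ Icc (-1 : ℝ) 1 :=
    Icc_mem_nhds hr.1 hr.2
  exact Ser_tendsto hγ hh (c := fun _ => γ) (Eventually.of_forall fun _ => Dom_self hγ)
    tendsto_const_nhds (Dom_self hγ) hev tendsto_id (Ioo_subset_Icc_self hr)

include hm in
lemma G2_zero_lt : |G2 γ 0| < G1 γ 1 := by
  obtain ⟨p0, hp0, hc0⟩ : ∃ p, 3 ≤ p ∧ γ p ≠ 0 := by
    obtain ⟨p, q, hp, hq, hpq, h1, h2⟩ := hm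
    rcases lt_or_ge p 3 with h | h
    · exact ⟨q, by omega, h2⟩
    · exact ⟨p, h, h1⟩
  have h0m : (0:ℝ) ∈ Icc (-1 : ℝ) 1 := by simp
  have h1m : (1:ℝ) ∈ Icc (-1 : ℝ) 1 := by simp
  have key : ∀ p : ℕ, 3 ≤ p → h2 p 0 = 0 := by
    intro p hp; unfold h2; rw [zero_pow (by omega), mul_zero]
  have hnn : 0 ≤ G2 γ 0 := by
    refine tsum_nonneg fun p => ?_
    split_ifs with hp
    · rcases hp.eq_or_lt with rfl | h
      · simp [h2]; positivity
      · rw [key p h, mul_zero]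
    · exact le_rfl
  rw [abs_of_nonneg hnn]
  refine ser_lt_ser hγ HB_h2 HB_h1 (Dom_self hγ) h0m h1m ?_ p0 (by omega) hc0 ?_
  · intro p hp
    rcases hp.eq_or_lt with rfl | h
    · simp [h2, h1]; norm_num
    · rw [key p h]; unfold h1; positivity
  · rw [key p0 hp0]; unfold h1
    have : (0:ℝ) < p0 := by positivity
    simp; omega

end

lemma psi_near0_alg {g0 g1 g2 u x k1 r a b A0 B0 R0 R1 R2 : ℝ}
    (hr : r ∈ Ioo (-1 : ℝ) 1) (hmu : (r * k1 / g1) ^ 2 < 1)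
    (e1 : g0 * A0 + g1 * B0 = u) (e2 : g1 * A0 + (g2 + g1) * B0 = x)
    (q1 : (g0 + r ^ 2 * R0) * a + (g1 + r ^ 2 * R1) * b = u)
    (q2 : (g1 + r ^ 2 * R1) * a + (g2 + g1 + r ^ 2 * R2) * b = x) :
    r ^ 2 * (-(1 / 2) * ((1 - (k1 / g1) ^ 2) / (1 - r ^ 2)) +
      (A0 * a * R0 + (A0 * b + B0 * a) * R1 + B0 * b * R2)) ≤
    1 / 2 * Real.log (1 - r ^ 2) - 1 / 2 * Real.log (1 - (r * k1 / g1) ^ 2)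
      + (A0 * u + B0 * x) - 1 / 2 * (2 * (a * u + b * x)) := by
  have hr2 : 0 < 1 - r ^ 2 := by nlinarith [hr.1, hr.2]
  have hmu' : (r * k1 / g1) ^ 2 = r ^ 2 * (k1 / g1) ^ 2 := by ring
  rw [hmu'] at hmu ⊢
  generalize (k1 / g1) ^ 2 = m at *
  have hp : 0 < 1 - r ^ 2 * m := by linarith
  have h1 := Real.log_le_sub_one_of_pos (div_pos hp hr2)
  rw [Real.log_div hp.ne' hr2.ne'] at h1
  have h2 : (1 - r ^ 2 * m) / (1 - r ^ 2) - 1 = (r ^ 2 * ((1 - m) / (1 - r ^ 2))) := by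
    field_simp; ring
  have h3 : (A0 * u + B0 * x) - (a * u + b * x) =
      r ^ 2 * (A0 * a * R0 + (A0 * b + B0 * a) * R1 + B0 * b * R2) := by
    linear_combination (-A0) * q1 - B0 * q2 + a * e1 + b * e2
  rw [mul_add, ← h3]
  linarith

lemma psi_near0 {γ : ℕ → ℝ} (hγ : GammaDecay γ) (hm : Mixed γ) {u x : ℝ}
    (ho : IsOpt (G0 γ 1) (G1 γ 1) (G2 γ 1) u x) :
    ∃ f : ℝ → ℝ, Tendsto f (nhds 0) (nhds (C0 (G0 γ 1) (G1 γ 1) (G2 γ 1) (G0 γ 0) (G1 γ 0)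
      (G2 γ 0) 0 u x)) ∧ ∀ᶠ r in nhds 0, r ^ 2 * f r ≤ Psi0 γ r := by
  have hg := good_of hγ (Dom_self hγ) hm
  have h0m : (0:ℝ) ∈ Ioo (-1 : ℝ) 1 := by simp
  have c0 : ContinuousAt (fun r => G0 γ r) 0 := ser_contAt hγ HB_h0 h0m
  have c1 : ContinuousAt (fun r => G1 γ r) 0 := ser_contAt hγ HB_h1 h0m
  have c2 : ContinuousAt (fun r => G2 γ r) 0 := ser_contAt hγ HB_h2 h0m
  obtain ⟨hl1, hl2⟩ := abs_lt.1 (G2_zero_lt hγ hm)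
  obtain ⟨e, he⟩ : ∃ e : ℝ → ℝ, e = fun r => G1 γ 1 - (r ^ 2 * G1 γ r - G2 γ r * (1 - r ^ 2)) :=
    ⟨_, rfl⟩
  obtain ⟨e', he'⟩ : ∃ e' : ℝ → ℝ, e' = fun r => G1 γ 1 + (r ^ 2 * G1 γ r - G2 γ r * (1 - r ^ 2)) :=
    ⟨_, rfl⟩
  have ce : ContinuousAt e 0 := by rw [he]; fun_prop
  have ce' : ContinuousAt e' 0 := by rw [he']; fun_prop
  have ne : e 0 ≠ 0 := by rw [he]; simp; intro h; linarith
  have ne' : e' 0 ≠ 0 := by rw [he']; simp; intro h; linarith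
  obtain ⟨R0, hR0⟩ : ∃ f : ℝ → ℝ, f = fun r => G0 γ r - G1 γ r ^ 2 * (1 - r ^ 2) / e r := ⟨_, rfl⟩
  obtain ⟨R1, hR1⟩ : ∃ f : ℝ → ℝ, f = fun r => G1 γ r - G1 γ r * (G2 γ r + G1 γ r) * (1 - r ^ 2) / e r :=
    ⟨_, rfl⟩
  obtain ⟨R2, hR2⟩ : ∃ f : ℝ → ℝ, f = fun r => G2 γ r + G1 γ r - (G2 γ r + G1 γ r) ^ 2 * (1 - r ^ 2) / e r :=
    ⟨_, rfl⟩
  obtain ⟨T0, hT0⟩ : ∃ f : ℝ → ℝ, f = fun r => - G0 γ r - G1 γ r ^ 2 * (1 - r ^ 2) / e' r := ⟨_, rfl⟩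
  obtain ⟨T1, hT1⟩ : ∃ f : ℝ → ℝ, f = fun r => - G1 γ r - G1 γ r * (G2 γ r + G1 γ r) * (1 - r ^ 2) / e' r :=
    ⟨_, rfl⟩
  obtain ⟨T2, hT2⟩ : ∃ f : ℝ → ℝ, f = fun r => -(G2 γ r + G1 γ r) - (G2 γ r + G1 γ r) ^ 2 * (1 - r ^ 2) / e' r :=
    ⟨_, rfl⟩
  have cR0 : ContinuousAt R0 0 := by rw [hR0]; fun_prop (disch := assumption)
  have cR1 : ContinuousAt R1 0 := by rw [hR1]; fun_prop (disch := assumption)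
  have cR2 : ContinuousAt R2 0 := by rw [hR2]; fun_prop (disch := assumption)
  have cT0 : ContinuousAt T0 0 := by rw [hT0]; fun_prop (disch := assumption)
  have cT1 : ContinuousAt T1 0 := by rw [hT1]; fun_prop (disch := assumption)
  have cT2 : ContinuousAt T2 0 := by rw [hT2]; fun_prop (disch := assumption)
  obtain ⟨D, hD⟩ : ∃ f : ℝ → ℝ, f = fun r => (G0 γ 1 + r ^ 2 * R0 r) *
    (G2 γ 1 + G1 γ 1 + r ^ 2 * R2 r) - (G1 γ 1 + r ^ 2 * R1 r) ^ 2 := ⟨_, rfl⟩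
  obtain ⟨D', hD'⟩ : ∃ f : ℝ → ℝ, f = fun r => (G0 γ 1 + r ^ 2 * T0 r) *
    (G2 γ 1 + G1 γ 1 + r ^ 2 * T2 r) - (G1 γ 1 + r ^ 2 * T1 r) ^ 2 := ⟨_, rfl⟩
  have cD : ContinuousAt D 0 := by rw [hD]; fun_prop
  have cD' : ContinuousAt D' 0 := by rw [hD']; fun_prop
  have D0 : D 0 = G0 γ 1 * (G2 γ 1 + G1 γ 1) - G1 γ 1 ^ 2 := by rw [hD]; simp
  have nD : D 0 ≠ 0 := by rw [D0]; exact hg.hd.ne'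
  have nD' : D' 0 ≠ 0 := by rw [hD']; simp; exact hg.hd.ne'
  obtain ⟨ta, hta⟩ : ∃ f : ℝ → ℝ, f = fun r => (u * (G2 γ 1 + G1 γ 1 + r ^ 2 * R2 r) -
    x * (G1 γ 1 + r ^ 2 * R1 r)) / D r := ⟨_, rfl⟩
  obtain ⟨tb, htb⟩ : ∃ f : ℝ → ℝ, f = fun r => (x * (G0 γ 1 + r ^ 2 * R0 r) -
    u * (G1 γ 1 + r ^ 2 * R1 r)) / D r := ⟨_, rfl⟩
  have cta : ContinuousAt ta 0 := by rw [hta]; fun_prop (disch := assumption)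
  have ctb : ContinuousAt tb 0 := by rw [htb]; fun_prop (disch := assumption)
  have ta0 : ta 0 = astar (G0 γ 1) (G1 γ 1) (G2 γ 1) u x := by
    rw [hta]; simp only [D0, astar]; simp
  have tb0 : tb 0 = bstar (G0 γ 1) (G1 γ 1) (G2 γ 1) u x := by
    rw [htb]; simp only [D0, bstar]; simp
  obtain ⟨e1, e2, e3⟩ := star_eqs hg.hd.ne' u x
  refine ⟨fun r => (-(1 / 2) * ((1 - (G1 γ r / G1 γ 1) ^ 2) / (1 - r ^ 2)) +
      (ta 0 * ta r * R0 r + (ta 0 * tb r + tb 0 * ta r) * R1 r + tb 0 * tb r * R2 r)), ?_, ?_⟩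
  · have p1 := hg.p1.ne'
    have hz : (1 - (0:ℝ) ^ 2) ≠ 0 := by norm_num
    have hc : ContinuousAt (fun r => (-(1 / 2) * ((1 - (G1 γ r / G1 γ 1) ^ 2) / (1 - r ^ 2)) +
      (ta 0 * ta r * R0 r + (ta 0 * tb r + tb 0 * ta r) * R1 r + tb 0 * tb r * R2 r))) 0 := by
      fun_prop (disch := assumption)
    have := hc.tendsto
    have hv : (-(1 / 2) * ((1 - (G1 γ 0 / G1 γ 1) ^ 2) / (1 - (0:ℝ) ^ 2)) +
      (ta 0 * ta 0 * R0 0 + (ta 0 * tb 0 + tb 0 * ta 0) * R1 0 + tb 0 * tb 0 * R2 0)) =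
       C0 (G0 γ 1) (G1 γ 1) (G2 γ 1) (G0 γ 0) (G1 γ 0) (G2 γ 0) 0 u x := by
      have hee : e 0 = G1 γ 1 + G2 γ 0 := by rw [he]; simp
      simp only [hR0, hR1, hR2, hee, C0, sigSq, ← ta0, ← tb0]
      norm_num
      ring
    rw [hv] at this
    exact this
  · have hev : ∀ᶠ r in nhds (0:ℝ), r ∈ Ioo (-1 : ℝ) 1 := Ioo_mem_nhds (by norm_num) (by norm_num)
    filter_upwards [hev, ce.eventually_ne ne, ce'.eventually_ne ne', cD.eventually_ne nD,
      cD'.eventually_ne nD'] with r hr ner ner' nDr nDr'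
    obtain ⟨U1, U2, B1, B2, X1, X2, hP, -, h3⟩ := psi_test hγ hm ho hr
    have ner0 : G1 γ 1 - (r ^ 2 * G1 γ r - G2 γ r * (1 - r ^ 2)) ≠ 0 := by
      rw [he] at ner; exact ner
    have ner0' : G1 γ 1 + (r ^ 2 * G1 γ r - G2 γ r * (1 - r ^ 2)) ≠ 0 := by
      rw [he'] at ner'; exact ner'
    obtain ⟨s1, s2, s3, s4, s5, s6⟩ := h3 ner0 ner0'
    obtain ⟨a, b, q1, -, q2⟩ := quad_sym U1 U2 B1 B2 X1 X2 u x
    have r0 : U1 + U2 = G0 γ 1 + r ^ 2 * R0 r := by rw [s1, hR0, he]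
    have r1 : B1 + B2 = G1 γ 1 + r ^ 2 * R1 r := by rw [s3, hR1, he]
    have r2 : X1 + X2 = G2 γ 1 + G1 γ 1 + r ^ 2 * R2 r := by rw [s5, hR2, he]
    have t0 : U1 - U2 = G0 γ 1 + r ^ 2 * T0 r := by rw [s2, hT0, he']
    have t1 : B1 - B2 = G1 γ 1 + r ^ 2 * T1 r := by rw [s4, hT1, he']
    have t2 : X1 - X2 = G2 γ 1 + G1 γ 1 + r ^ 2 * T2 r := by rw [s6, hT2, he']
    rw [r0, r1, r2, t0, t1, t2] at q2
    have nDr0 : (G0 γ 1 + r ^ 2 * R0 r) *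
      (G2 γ 1 + G1 γ 1 + r ^ 2 * R2 r) - (G1 γ 1 + r ^ 2 * R1 r) ^ 2 ≠ 0 := by
      rw [hD] at nDr; exact nDr
    obtain ⟨w1, w2⟩ := q2 nDr0 (by rw [hD'] at nDr'; exact nDr')
    have ea : a = ta r := by
      rw [hta]; simp only [hD]
      rw [eq_div_iff nDr0]
      linear_combination (G2 γ 1 + G1 γ 1 + r ^ 2 * R2 r) * w1 - (G1 γ 1 + r ^ 2 * R1 r) * w2
    have eb : b = tb r := by
      rw [htb]; simp only [hD]
      rw [eq_div_iff nDr0]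
      linear_combination (G0 γ 1 + r ^ 2 * R0 r) * w2 - (G1 γ 1 + r ^ 2 * R1 r) * w1
    rw [hP, q1, e3, ← ta0, ← tb0, ← ea, ← eb]
    rw [← ta0, ← tb0] at e1 e2
    exact psi_near0_alg hr (mu_lt hγ (Dom_self hγ) hm hr) e1 e2 w1 w2

section
variable {γ : ℕ → ℝ} (hγ : GammaDecay γ) (hm : Mixed γ) {u x : ℝ}
    (ho : IsOpt (G0 γ 1) (G1 γ 1) (G2 γ 1) u x)
include hγ hm ho

lemma psi_zero : Psi0 γ 0 = 0 := by
  have hg := good_of hγ (Dom_self hγ) hm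
  obtain ⟨hl1, hl2⟩ := abs_lt.1 (G2_zero_lt hγ hm)
  obtain ⟨U1, U2, B1, B2, X1, X2, hP, -, h3⟩ := psi_test hγ hm ho (r := 0) (by simp)
  obtain ⟨s1, s2, s3, s4, s5, s6⟩ := h3 (by norm_num; intro h; linarith)
    (by norm_num; intro h; linarith)
  norm_num at s1 s2 s3 s4 s5 s6
  obtain ⟨a, b, q1, -, q2⟩ := quad_sym U1 U2 B1 B2 X1 X2 u x
  rw [s1, s2, s3, s4, s5, s6] at q2
  obtain ⟨w1, w2⟩ := q2 hg.hd.ne' hg.hd.ne'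
  obtain ⟨e1, e2, e3⟩ := star_eqs hg.hd.ne' u x
  rw [hP, q1, e3]
  norm_num
  linear_combination (-astar (G0 γ 1) (G1 γ 1) (G2 γ 1) u x) * w1
    - bstar (G0 γ 1) (G1 γ 1) (G2 γ 1) u x * w2 + a * e1 + b * e2

lemma c2_neg (h2 : iteratedDeriv 2 (Psi0 γ) 0 < 0)
    (hmax : ∀ r ∈ Set.Ioo (-1 : ℝ) 1, r ≠ 0 → Psi0 γ r < Psi0 γ 0) :
    C0 (G0 γ 1) (G1 γ 1) (G2 γ 1) (G0 γ 0) (G1 γ 0) (G2 γ 0) 0 u x < 0 := by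
  have hz := psi_zero hγ hm ho
  obtain ⟨f, hf, hev⟩ := psi_near0 hγ hm ho
  generalize C0 (G0 γ 1) (G1 γ 1) (G2 γ 1) (G0 γ 0) (G1 γ 0) (G2 γ 0) 0 u x = c2 at *
  rw [iteratedDeriv_succ, iteratedDeriv_one] at h2
  generalize hD : deriv (deriv (Psi0 γ)) 0 = D at *
  have hloc : IsLocalMax (Psi0 γ) 0 := by
    filter_upwards [Ioo_mem_nhds (show (-1:ℝ) < 0 by norm_num) (show (0:ℝ) < 1 by norm_num)] with r hr
    rcases eq_or_ne r 0 with rfl | h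
    · exact le_rfl
    · exact (hmax r hr h).le
  have hd0 := hloc.deriv_eq_zero
  have hdd : DifferentiableAt ℝ (deriv (Psi0 γ)) 0 := by
    by_contra h
    rw [deriv_zero_of_not_differentiableAt h] at hD
    linarith
  have hda : HasDerivAt (deriv (Psi0 γ)) D 0 := hD ▸ hdd.hasDerivAt
  have hsl := hasDerivAt_iff_tendsto_slope_zero.1 hda
  have h1 : ∀ᶠ t in nhdsWithin (0:ℝ) (Ioi 0), t⁻¹ • (deriv (Psi0 γ) (0 + t) - deriv (Psi0 γ) 0) < D / 2 := by
    have := (hsl.eventually (gt_mem_nhds (show D < D / 2 by linarith)))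
    exact nhdsWithin_mono 0 (fun t (ht : 0 < t) => ht.ne') this
  obtain ⟨ε, hε, hεs⟩ := mem_nhdsGT_iff_exists_Ioo_subset.1 h1
  have hder : ∀ t ∈ Ioo 0 ε, deriv (Psi0 γ) t ≤ D / 2 * t := by
    intro t ht
    have h5 := hεs ht
    simp only [Set.mem_ofPred_eq, hd0, sub_zero, zero_add, smul_eq_mul] at h5
    rw [inv_mul_lt_iff₀ ht.1] at h5
    linarith
  have hup : ∀ r ∈ Ioo 0 (min ε 1), Psi0 γ r ≤ D / 4 * r ^ 2 := by
    intro r hr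
    have hr1 : r < ε := lt_of_lt_of_le hr.2 (min_le_left _ _)
    have hr2 : r < 1 := lt_of_lt_of_le hr.2 (min_le_right _ _)
    have hs : ∀ s ∈ Ioo 0 r, Psi0 γ r ≤ D / 4 * (r ^ 2 - s ^ 2) := by
      intro s hs
      have hdiff : ∀ t ∈ Icc s r, DifferentiableAt ℝ (Psi0 γ) t := by
        intro t ht
        by_contra h
        have h5 := hder t ⟨hs.1.trans_le ht.1, ht.2.trans_lt hr1⟩
        rw [deriv_zero_of_not_differentiableAt h] at h5
        have : 0 < t := hs.1.trans_le ht.1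
        nlinarith
      have hanti : AntitoneOn (fun t => Psi0 γ t - D / 4 * t ^ 2) (Icc s r) := by
        have hdt : ∀ t ∈ Icc s r, HasDerivAt (fun t => Psi0 γ t - D / 4 * t ^ 2)
            (deriv (Psi0 γ) t - D / 4 * (2 * t)) t := by
          intro t ht
          have h6 := (hdiff t ht).hasDerivAt
          have h7 : HasDerivAt (fun t : ℝ => D / 4 * t ^ 2) (D / 4 * (2 * t)) t := by
            have := (hasDerivAt_pow 2 t).const_mul (D / 4)
            simpa using this
          exact h6.sub h7
        refine antitoneOn_of_deriv_nonpos (convex_Icc s r)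
          (fun t ht => (hdt t ht).continuousAt.continuousWithinAt)
          (fun t ht => (hdt t (interior_subset ht)).differentiableAt.differentiableWithinAt) ?_
        intro t ht
        have ht' := interior_subset ht
        rw [(hdt t ht').deriv]
        have := hder t ⟨hs.1.trans_le ht'.1, ht'.2.trans_lt hr1⟩
        linarith
      have := hanti (left_mem_Icc.2 hs.2.le) (right_mem_Icc.2 hs.2.le) hs.2.le
      simp only at this
      have h8 := hmax s ⟨by linarith [hs.1], hs.2.trans hr2⟩ hs.1.ne'
      rw [hz] at h8
      linarith
    have hlim : Tendsto (fun s : ℝ => D / 4 * (r ^ 2 - s ^ 2)) (nhdsWithin 0 (Ioi 0))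
        (nhds (D / 4 * (r ^ 2 - 0 ^ 2))) :=
      (Continuous.tendsto (by fun_prop) 0).mono_left nhdsWithin_le_nhds
    have := ge_of_tendsto hlim (by
      filter_upwards [Ioo_mem_nhdsGT hr.1] with s hs' using hs s hs')
    simpa using this
  have hmin : (0:ℝ) < min ε 1 := lt_min hε one_pos
  have hf' : Tendsto f (nhdsWithin 0 (Ioi 0)) (nhds c2) := hf.mono_left nhdsWithin_le_nhds
  have : c2 ≤ D / 4 := by
    refine le_of_tendsto hf' ?_
    filter_upwards [Ioo_mem_nhdsGT hmin, hev.filter_mono nhdsWithin_le_nhds] with r hr hr'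
    have h9 := hup r hr
    have : 0 < r ^ 2 := by have := hr.1; positivity
    nlinarith
  linarith

lemma RegS_near0 (hc2 : C0 (G0 γ 1) (G1 γ 1) (G2 γ 1) (G0 γ 0) (G1 γ 0) (G2 γ 0) 0 u x < 0) :
    ∃ A ∈ nhds (0:ℝ), RegS γ (γ, u, x) A := by
  have hg := good_of hγ (Dom_self hγ) hm
  obtain ⟨hl1, hl2⟩ := abs_lt.1 (G2_zero_lt hγ hm)
  have L := Lim_prod (γ := γ) (z := (γ, u, x)) (Dom_self hγ) (r0 := 0) (B := Ioo (-1 : ℝ) 1) (by simp)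
    Ioo_subset_Icc_self
  have hall := L.all hγ
  have hpe : G1 γ 1 + G2 γ 0 ≠ 0 := by intro h; linarith
  obtain ⟨k1, k2⟩ := C0_continuousAt (k0 := G0 γ 0) (k1 := G1 γ 0) (u := u) (x := x) hg hpe
  have t1 := k1.tendsto.comp hall
  have t2 := k2.tendsto.comp hall
  simp only [Function.comp_def] at t1 t2
  have ev1 := t1.eventually (gt_mem_nhds hc2)
  have ev2 := t2.eventually (gt_mem_nhds (lt_add_one _))
  have c3 : ContinuousAt (fun v : ℝ × ℝ × ℝ × ℝ × ℝ × ℝ × ℝ × ℝ × ℝ × ℝ =>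
      v.2.1 - (v.2.2.2.2.2.2.1 ^ 2 * v.2.2.2.2.1 - v.2.2.2.2.2.1 * (1 - v.2.2.2.2.2.2.1 ^ 2)))
      (G0 γ 1, G1 γ 1, G2 γ 1, G0 γ 0, G1 γ 0, G2 γ 0, 0, u, x, 0) := by fun_prop
  have t3 := c3.tendsto.comp hall
  simp only [Function.comp_def] at t3
  have ev3 := t3.eventually_ne (by simpa using hpe)
  have hev : ∀ᶠ v in ((nhdsWithin (γ, u, x) (DS γ) ×ˢ nhdsWithin (0 : ℝ) (Ioi 0)) ×ˢ
      nhdsWithin 0 (Ioo (-1 : ℝ) 1)), v.2 ∈ Ioo (-1 : ℝ) 1 :=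
    tendsto_snd.eventually self_mem_nhdsWithin
  have hreg := RegS_of_prod (γ := γ) (z := (γ, u, x)) (r0 := 0) (B := Ioo (-1 : ℝ) 1)
    (sigSq (G0 γ 1) (G1 γ 1) (G2 γ 1) (astar (G0 γ 1) (G1 γ 1) (G2 γ 1) u x)
        (bstar (G0 γ 1) (G1 γ 1) (G2 γ 1) u x) + G1 γ 1 *
      (S0 (G0 γ 1) (G1 γ 1) (G2 γ 1) (G1 γ 0) (G2 γ 0) 0 u x) ^ 2 + 1) (by
    filter_upwards [ev1, ev2, ev3, hev, L.hc, L.mixed hm] with v h1 h2 h3 h4 h5 h6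
    have hgv := good_of hγ h5 h6
    have hmu := mu_lt hγ h5 h6 h4
    refine ⟨_, _, _, (FF_delta_le hmu).trans (add_le_add (FF_near0 hgv h4 hmu h3) le_rfl) |>.trans ?_⟩
    nlinarith [sq_nonneg v.2, sq_nonneg v.1.2])
  obtain ⟨A, hA, hAr⟩ := hreg
  refine ⟨A, ?_, hAr⟩
  rwa [nhdsWithin_eq_nhds.2 (Ioo_mem_nhds (by norm_num) (by norm_num))] at hA

end

/-- error terms near `r = 1` -/
def Err1 (g0 g1 g2 k0 k1 k2 D δ r u x : ℝ) : ℝ :=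
  (|astar g0 g1 g2 u x| / 2) ^ 2 * |δ ^ 2 * g0 + (r ^ 2 * k0 - g0)|
    + 2 * (|astar g0 g1 g2 u x| / 2) * ((|bstar g0 g1 g2 u x| + |x| / (2 * g2)) / 2)
        * |δ ^ 2 * g1 + (r ^ 2 * k1 - g1)|
    + ((|bstar g0 g1 g2 u x| + |x| / (2 * g2)) / 2) ^ 2
        * |δ ^ 2 * (g2 + g1) + (r ^ 2 * (k2 + k1) - (g2 + g1))|
    + 2 * (|x| / (2 * g2)) * ((|astar g0 g1 g2 u x| / 2) * |r * k1 - g1|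
        + ((|bstar g0 g1 g2 u x| + |x| / (2 * g2)) / 2) * |r * (k2 + k1) - (g2 + g1)|)
    + (|x| / (2 * g2)) ^ 2 * |k2 - g2 + ((D + r * k1) / (1 + r) - (g2 + g1) / 2)|

def Err2 (g1 g2 k1 D δ r : ℝ) : ℝ :=
  1 / 2 * Real.log ((1 + δ ^ 2) ^ 2 * (1 + r) /
    ((1 + δ ^ 2 + r * k1 / g1) * min (D / g2) ((1 + r) / 2)))

lemma abs_sum5 {A b k MA MB M D0 D1 D2 E1 E2 E3 : ℝ} (hA : |A| ≤ MA) (hb : |b| ≤ MB)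
    (hk : |k| ≤ M) :
    A ^ 2 * D0 + 2 * A * b * D1 + b ^ 2 * D2 + 2 * k * (A * E1 + b * E2) + k ^ 2 * E3 ≤
    MA ^ 2 * |D0| + 2 * MA * MB * |D1| + MB ^ 2 * |D2| + 2 * M * (MA * |E1| + MB * |E2|)
      + M ^ 2 * |E3| := by
  have aux : ∀ {s t S T E : ℝ}, |s| ≤ S → |t| ≤ T → s * t * E ≤ S * T * |E| := by
    intro s t S T E h1 h2
    calc s * t * E ≤ |s * t * E| := le_abs_self _
      _ = |s| * |t| * |E| := by rw [abs_mul, abs_mul]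
      _ ≤ S * T * |E| := by
        have := abs_nonneg s
        have := abs_nonneg t
        gcongr
        exact (abs_nonneg s).trans h1
  have t1 := aux (E := D0) hA hA
  have t2 := aux (E := D1) hA hb
  have t3 := aux (E := D2) hb hb
  have t4 := aux (E := E1) hk hA
  have t5 := aux (E := E2) hk hb
  have t6 := aux (E := E3) hk hk
  nlinarith

lemma log_near1 {g1 g2 k1 D δ r w : ℝ} (p1 : 0 < g1) (p2 : 0 < g2) (hδ : 0 < δ)
    (hr : 0 < r) (hr1 : r < 1) (hk1 : 0 ≤ k1) (hD0 : 0 < D) (hD : g1 - r * k1 = (1 - r) * D)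
    (hw : w = 1 + 2 * δ ^ 2 * g1 / (g2 * (1 - r ^ 2))) :
    1 / 2 * Real.log (1 - r ^ 2) - 1 / 2 * Real.log (1 - (r * k1 / g1) ^ 2 / (1 + δ ^ 2) ^ 2)
      ≤ 1 / 2 * Real.log (g1 / g2) - 1 / 2 * Real.log w + Err2 g1 g2 k1 D δ r := by
  have hX : 0 < 1 - r ^ 2 := by nlinarith
  have hm : 0 < min (D / g2) ((1 + r) / 2) := lt_min (by positivity) (by positivity)
  unfold Err2
  have m1 : min (D / g2) ((1 + r) / 2) ≤ D / g2 := min_le_left _ _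
  have m2 : min (D / g2) ((1 + r) / 2) ≤ (1 + r) / 2 := min_le_right _ _
  generalize min (D / g2) ((1 + r) / 2) = m at *
  have hw1 : 1 ≤ w := by rw [hw]; have : 0 ≤ 2 * δ ^ 2 * g1 / (g2 * (1 - r ^ 2)) := by positivity
                         linarith
  obtain ⟨μ, hμ⟩ : ∃ μ, μ = r * k1 / g1 := ⟨_, rfl⟩
  have hμ0 : 0 ≤ μ := by rw [hμ]; positivity
  have hμg : μ * g1 = r * k1 := by rw [hμ]; field_simp
  have hPμ : 0 < 1 + δ ^ 2 - μ := by
    have : 0 < (1 + δ ^ 2 - μ) * g1 := by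
      have : (1 + δ ^ 2 - μ) * g1 = δ ^ 2 * g1 + (1 - r) * D := by rw [← hD, ← hμg]; ring
      rw [this]
      have : 0 < 1 - r := by linarith
      positivity
    exact pos_of_mul_pos_left this p1.le
  rw [← hμ]
  have hY : 1 - μ ^ 2 / (1 + δ ^ 2) ^ 2 = (1 + δ ^ 2 - μ) * (1 + δ ^ 2 + μ) / (1 + δ ^ 2) ^ 2 := by
    field_simp
    ring
  have hYp : 0 < 1 - μ ^ 2 / (1 + δ ^ 2) ^ 2 := by rw [hY]; positivity
  have hLp : 0 < (1 + δ ^ 2) ^ 2 * (1 + r) / ((1 + δ ^ 2 + μ) * m) := by positivity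
  have key : (1 - r ^ 2) * (g2 * w) ≤ (1 - μ ^ 2 / (1 + δ ^ 2) ^ 2) * (g1 *
      ((1 + δ ^ 2) ^ 2 * (1 + r) / ((1 + δ ^ 2 + μ) * m))) := by
    have e1 : (1 - μ ^ 2 / (1 + δ ^ 2) ^ 2) * (g1 *
      ((1 + δ ^ 2) ^ 2 * (1 + r) / ((1 + δ ^ 2 + μ) * m))) =
        (1 + r) * ((1 + δ ^ 2 - μ) * g1) / m := by
      rw [hY]; field_simp
    have e2 : (1 + δ ^ 2 - μ) * g1 = δ ^ 2 * g1 + (1 - r) * D := by rw [← hD, ← hμg]; ring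
    have e3 : (1 - r ^ 2) * (g2 * w) = (1 - r ^ 2) * g2 + 2 * δ ^ 2 * g1 := by
      rw [hw]; field_simp
    rw [e1, e2, e3, le_div_iff₀ hm]
    rw [le_div_iff₀ p2] at m1
    have f1 : (1 - r ^ 2) * (m * g2) ≤ (1 - r ^ 2) * D := mul_le_mul_of_nonneg_left m1 hX.le
    have f2 : (2 * δ ^ 2 * g1) * m ≤ (2 * δ ^ 2 * g1) * ((1 + r) / 2) :=
      mul_le_mul_of_nonneg_left m2 (by positivity)
    nlinarith
  have hl := Real.log_le_log (by positivity) key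
  rw [Real.log_mul hX.ne' (by positivity), Real.log_mul p2.ne' (by positivity),
    Real.log_mul hYp.ne' (by positivity), Real.log_mul p1.ne' hLp.ne'] at hl
  rw [Real.log_div p1.ne' p2.ne']
  linarith

lemma FF_near1 {g0 g1 g2 k0 k1 k2 D δ r u x w : ℝ} (hg : Good g0 g1 g2) (hδ : 0 < δ)
    (hr : 0 < r) (hr1 : r < 1) (hk1 : 0 ≤ k1) (hD0 : 0 < D) (hD : g1 - r * k1 = (1 - r) * D)
    (hw : w = 1 + 2 * δ ^ 2 * g1 / (g2 * (1 - r ^ 2))) :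
    ∃ a b S, FF g0 g1 g2 k0 k1 k2 δ r u x a b S ≤ - theta g0 g1 g2 u x
      + (1 / 2 + Omega (x / √g2) - 1 / 2 * Real.log w - (x / √g2) ^ 2 / (2 * (1 + w)))
      + (Err1 g0 g1 g2 k0 k1 k2 D δ r u x + Err2 g1 g2 k1 D δ r) := by
  have p1 := hg.p1
  have p2 := hg.p2
  have hX : 0 < 1 - r ^ 2 := by nlinarith
  have hlog := log_near1 p1 p2 hδ hr hr1 hk1 hD0 hD hw
  have hw1 : 1 ≤ w := by rw [hw]; have : 0 ≤ 2 * δ ^ 2 * g1 / (g2 * (1 - r ^ 2)) := by positivity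
                         linarith
  obtain ⟨e1, e2, e3⟩ := star_eqs hg.hd.ne' u x
  obtain ⟨k, hk⟩ : ∃ k, k = -x / (g2 * (1 + w)) := ⟨_, rfl⟩
  have hkM : |k| ≤ |x| / (2 * g2) := by
    rw [hk, abs_div, abs_neg, abs_of_pos (show 0 < g2 * (1 + w) by positivity)]
    exact div_le_div_of_nonneg_left (abs_nonneg x) (by positivity) (by nlinarith)
  refine ⟨astar g0 g1 g2 u x / 2, (bstar g0 g1 g2 u x - k) / 2, k / √(1 - r ^ 2), ?_⟩
  unfold FF
  have hth : -theta g0 g1 g2 u x + (1 / 2 + Omega (x / √g2)) =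
      1 / 2 * Real.log (g1 / g2) + 1 / 2 * Ksq g0 g1 g2 u x := by
    unfold theta Ksq
    rw [Real.log_div p1.ne' p2.ne', Real.log_div p2.ne' p1.ne']
    ring
  have hQ : QQ g0 g1 g2 k0 k1 k2 δ r u x (astar g0 g1 g2 u x / 2) ((bstar g0 g1 g2 u x - k) / 2)
      (k / √(1 - r ^ 2)) ≤ - (1 / 2) * Ksq g0 g1 g2 u x - (x / √g2) ^ 2 / (2 * (1 + w))
        + Err1 g0 g1 g2 k0 k1 k2 D δ r u x := by
    have hA : |astar g0 g1 g2 u x / 2| ≤ |astar g0 g1 g2 u x| / 2 := by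
      rw [abs_div, abs_two]
    have hB : |(bstar g0 g1 g2 u x - k) / 2| ≤ (|bstar g0 g1 g2 u x| + |x| / (2 * g2)) / 2 := by
      rw [abs_div, abs_two]
      have := abs_sub (bstar g0 g1 g2 u x) k
      linarith
    have hE := abs_sum5 (D0 := δ ^ 2 * g0 + (r ^ 2 * k0 - g0))
      (D1 := δ ^ 2 * g1 + (r ^ 2 * k1 - g1))
      (D2 := δ ^ 2 * (g2 + g1) + (r ^ 2 * (k2 + k1) - (g2 + g1))) (E1 := r * k1 - g1)
      (E2 := r * (k2 + k1) - (g2 + g1))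
      (E3 := k2 - g2 + ((D + r * k1) / (1 + r) - (g2 + g1) / 2)) hA hB hkM
    refine le_trans (le_of_eq ?_) (add_le_add le_rfl hE)
    rw [e3]
    generalize astar g0 g1 g2 u x = A at *
    generalize bstar g0 g1 g2 u x = B at *
    have hy : √(1 - r ^ 2) ≠ 0 := (Real.sqrt_pos.2 hX).ne'
    have hy2 : √(1 - r ^ 2) ^ 2 = 1 - r ^ 2 := Real.sq_sqrt hX.le
    have s1 : k / √(1 - r ^ 2) * √(1 - r ^ 2) = k := by field_simp
    have s2 : (k / √(1 - r ^ 2)) ^ 2 = k ^ 2 / (1 - r ^ 2) := by rw [div_pow, hy2]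
    have hz : (x / √g2) ^ 2 = x ^ 2 / g2 := by rw [div_pow, Real.sq_sqrt p2.le]
    have hxk : x = - k * (g2 * (1 + w)) := by rw [hk]; field_simp
    have hwg : δ ^ 2 * g1 / (1 - r ^ 2) = (w - 1) * g2 / 2 := by
      rw [hw]; field_simp; ring
    have hDr : (g1 - r ^ 2 * k1) / (1 - r ^ 2) = (D + r * k1) / (1 + r) := by
      rw [div_eq_div_iff hX.ne' (by positivity)]
      linear_combination (1 + r) * hD
    have hxz : x ^ 2 / g2 / (2 * (1 + w)) = - k * x / 2 := by
      rw [div_div, div_eq_iff (by positivity)]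
      linear_combination x * hxk
    rw [hz, hxz]
    unfold QQ sigSq
    rw [s2, ← hDr]
    have : 2 * (k / √(1 - r ^ 2)) * √(1 - r ^ 2) = 2 * k := by rw [mul_assoc, s1]
    rw [this]
    have hk2 : k ^ 2 / (1 - r ^ 2) * (k2 * (1 - r ^ 2) - r ^ 2 * k1) + g1 * (k ^ 2 / (1 - r ^ 2)) +
      δ ^ 2 * g1 * (k ^ 2 / (1 - r ^ 2)) = k ^ 2 * k2 + k ^ 2 * ((g1 - r ^ 2 * k1) / (1 - r ^ 2)) +
        k ^ 2 * ((w - 1) * g2 / 2) := by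
      rw [← hwg]; field_simp; ring
    generalize (g1 - r ^ 2 * k1) / (1 - r ^ 2) = T at *
    generalize k ^ 2 / (1 - r ^ 2) = V at *
    linear_combination hk2 + (A / 2) * e1 + (B / 2) * e2 + (k / 2) * hxk
  linarith

def wfun (c : ℕ → ℝ) (δ r : ℝ) : ℝ := 1 + 2 * δ ^ 2 * G1 c 1 / (G2 c 1 * (1 - r ^ 2))

def main1 (z w : ℝ) : ℝ := 1 / 2 + Omega z - 1 / 2 * Real.log w - z ^ 2 / (2 * (1 + w))

lemma main1_nonpos {z w : ℝ} (hw : 1 ≤ w) : main1 z w ≤ 0 := by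
  have := Omega_le (z := z) hw
  unfold main1
  linarith

section
variable {γ : ℕ → ℝ} (hγ : GammaDecay γ)
include hγ

lemma near1_ev {ι : Type*} {l : Filter ι} {c : ι → ℕ → ℝ}
    {u x δ r : ι → ℝ} {C : ℕ → ℝ} {U X : ℝ} (L : Lim γ l c u x δ r C U X 1) (hm : Mixed C)
    (hδ : ∀ᶠ i in l, 0 < δ i) (hr1 : ∀ᶠ i in l, r i < 1) :
    ∃ e : ι → ℝ, Tendsto e l (nhds 0) ∧ ∀ᶠ i in l, ∃ a b S,
      Fc (c i) (u i) (x i) (δ i) (r i) a b S ≤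
        - theta (G0 (c i) 1) (G1 (c i) 1) (G2 (c i) 1) (u i) (x i)
        + main1 (x i / √(G2 (c i) 1)) (wfun (c i) (δ i) (r i)) + e i := by
  have hg := good_of hγ L.hC hm
  have hall := (L.all hγ).prodMk_nhds (L.ser hγ HB_hd)
  have hDD : Ser hd C 1 = G2 C 1 := Gd_one C
  rw [hDD] at hall
  refine ⟨fun i => Err1 (G0 (c i) 1) (G1 (c i) 1) (G2 (c i) 1) (G0 (c i) (r i)) (G1 (c i) (r i))
      (G2 (c i) (r i)) (Gd (c i) (r i)) (δ i) (r i) (u i) (x i) +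
      Err2 (G1 (c i) 1) (G2 (c i) 1) (G1 (c i) (r i)) (Gd (c i) (r i)) (δ i) (r i), ?_, ?_⟩
  · have p1 := hg.p1
    have p2 := hg.p2
    have pd := hg.hd
    have hcont : ContinuousAt (fun v : (ℝ × ℝ × ℝ × ℝ × ℝ × ℝ × ℝ × ℝ × ℝ × ℝ) × ℝ =>
        Err1 v.1.1 v.1.2.1 v.1.2.2.1 v.1.2.2.2.1 v.1.2.2.2.2.1 v.1.2.2.2.2.2.1 v.2
          v.1.2.2.2.2.2.2.2.2.2 v.1.2.2.2.2.2.2.1 v.1.2.2.2.2.2.2.2.1 v.1.2.2.2.2.2.2.2.2.1 +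
        Err2 v.1.2.1 v.1.2.2.1 v.1.2.2.2.2.1 v.2 v.1.2.2.2.2.2.2.2.2.2 v.1.2.2.2.2.2.2.1)
        ((G0 C 1, G1 C 1, G2 C 1, G0 C 1, G1 C 1, G2 C 1, 1, U, X, 0), G2 C 1) := by
      generalize G0 C 1 = g0 at *
      generalize G1 C 1 = g1 at *
      generalize G2 C 1 = g2 at *
      have hd' : g0 * (g2 + g1) - g1 ^ 2 ≠ 0 := pd.ne'
      have h2' : 2 * g2 ≠ 0 := by positivity
      have h11 : (1:ℝ) + 1 ≠ 0 := by norm_num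
      unfold Err1 Err2 astar bstar
      refine ContinuousAt.add (by fun_prop (disch := assumption)) ?_
      refine continuousAt_const.mul (ContinuousAt.log (ContinuousAt.div (by fun_prop) ?_ ?_) ?_)
      · refine ContinuousAt.mul (by fun_prop (disch := first | assumption | exact p1.ne')) ?_
        refine Filter.Tendsto.min (ContinuousAt.tendsto (by fun_prop (disch := first | assumption | exact p2.ne'))) (ContinuousAt.tendsto (by fun_prop))
      · simp [p1.ne', p2.ne']
      · simp [p1.ne', p2.ne']
    have h4 := hcont.tendsto.comp hall
    simp only [Function.comp_def] at h4
    have hz : Err1 (G0 C 1) (G1 C 1) (G2 C 1) (G0 C 1) (G1 C 1) (G2 C 1) (G2 C 1) 0 1 U X +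
        Err2 (G1 C 1) (G2 C 1) (G1 C 1) (G2 C 1) 0 1 = 0 := by
      unfold Err1 Err2
      have : (1:ℝ) + 1 = 2 := by norm_num
      simp [p1.ne', p2.ne', this]
    rw [hz] at h4
    exact h4
  · have t1 : Tendsto (fun i => G1 (c i) (r i)) l (nhds (G1 C 1)) := L.ser hγ HB_h1
    have t2 : Tendsto (fun i => Gd (c i) (r i)) l (nhds (G2 C 1)) := by
      rw [← Gd_one]; exact L.ser hγ HB_hd
    filter_upwards [hδ, hr1, L.hrl.eventually (lt_mem_nhds one_pos), L.hc, L.mixed hm,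
      t1.eventually (lt_mem_nhds hg.p1), t2.eventually (lt_mem_nhds hg.p2)]
      with i h1 h2 h3 h4 h5 h6 h7
    have hgi := good_of hγ h4 h5
    have hD := Gd_eq hγ h4 (r := r i) ⟨by linarith, h2.le⟩
    exact FF_near1 hgi h1 h3 h2 h6.le h7 hD rfl

end

lemma prod3 {α β κ : Type*} {f : Filter α} {g : Filter β} {h : Filter κ} {p : (α × β) × κ → Prop}
    (H : ∀ᶠ v in (f ×ˢ g) ×ˢ h, p v) : ∃ A ∈ f, ∃ B ∈ g, ∃ C ∈ h,
      ∀ a ∈ A, ∀ b ∈ B, ∀ c ∈ C, p ((a, b), c) := by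
  rw [Filter.eventually_iff, mem_prod_iff] at H
  obtain ⟨T, hT, C, hC, hTC⟩ := H
  rw [mem_prod_iff] at hT
  obtain ⟨A, hA, B, hB, hAB⟩ := hT
  refine ⟨A, hA, B, hB, C, hC, fun a ha b hb c hc => ?_⟩
  have h5 := hTC (show ((a, b), c) ∈ T ×ˢ C from ⟨hAB ⟨ha, hb⟩, hc⟩)
  simp only [Set.mem_ofPred_eq] at h5
  exact h5

section
variable {γ : ℕ → ℝ} (hγ : GammaDecay γ)
include hγ

omit hγ in
lemma near1_side (z : ZZ) : (∀ᶠ v in ((nhdsWithin z (DS γ) ×ˢ nhdsWithin (0 : ℝ) (Ioi 0)) ×ˢ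
      nhdsWithin 1 (Ioo (-1 : ℝ) 1)), 0 < v.1.2) ∧
    (∀ᶠ v in ((nhdsWithin z (DS γ) ×ˢ nhdsWithin (0 : ℝ) (Ioi 0)) ×ˢ
      nhdsWithin 1 (Ioo (-1 : ℝ) 1)), v.2 < 1) := by
  constructor
  · exact (tendsto_snd.comp tendsto_fst).eventually
      (self_mem_nhdsWithin : Ioi (0:ℝ) ∈ nhdsWithin (0 : ℝ) (Ioi 0))
  · have h : ∀ᶠ v in ((nhdsWithin z (DS γ) ×ˢ nhdsWithin (0 : ℝ) (Ioi 0)) ×ˢ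
      nhdsWithin 1 (Ioo (-1 : ℝ) 1)), v.2 ∈ Ioo (-1 : ℝ) 1 :=
      tendsto_snd.eventually self_mem_nhdsWithin
    exact h.mono fun v hv => hv.2

lemma Lim.theta {ι : Type*} {l : Filter ι} {c : ι → ℕ → ℝ}
    {u x δ r : ι → ℝ} {C : ℕ → ℝ} {U X R : ℝ} (L : Lim γ l c u x δ r C U X R) (hm : Mixed C) :
    Tendsto (fun i => theta (G0 (c i) 1) (G1 (c i) 1) (G2 (c i) 1) (u i) (x i)) l
      (nhds (theta (G0 C 1) (G1 C 1) (G2 C 1) U X)) :=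
  theta_tendsto (good_of hγ L.hC hm) (L.ser1 hγ HB_h0) (L.ser1 hγ HB_h1) (L.ser1 hγ HB_h2) L.hu L.hx

lemma near1_A (hm : Mixed γ) {u x : ℝ} (hz : theta (G0 γ 1) (G1 γ 1) (G2 γ 1) u x = 0)
    (hx : x < -2 * √(G2 γ 1)) : ∃ ε > (0:ℝ),
    ∀ᶠ v in ((nhdsWithin (γ, u, x) (DS γ) ×ˢ nhdsWithin (0 : ℝ) (Ioi 0)) ×ˢ
      nhdsWithin 1 (Ioo (-1 : ℝ) 1)), wfun v.1.1.1 v.1.2 v.2 ≤ 1 + ε →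
      1 ≤ wfun v.1.1.1 v.1.2 v.2 →
      ∃ a b S, Fc v.1.1.1 v.1.1.2.1 v.1.1.2.2 v.1.2 v.2 a b S ≤ 0 := by
  have hg := good_of hγ (Dom_self hγ) hm
  have L := Lim_prod (γ := γ) (z := (γ, u, x)) (Dom_self hγ) (r0 := 1) (B := Ioo (-1 : ℝ) 1)
    (by simp) Ioo_subset_Icc_self
  obtain ⟨s1, s2⟩ := near1_side (γ := γ) (γ, u, x)
  obtain ⟨e, he, hev⟩ := near1_ev hγ L hm s1 s2
  have hth := L.theta hγ hm
  simp only at hth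
  rw [hz] at hth
  have hsq : 0 < √(G2 γ 1) := Real.sqrt_pos.2 hg.p2
  have hzz : 2 < |x / √(G2 γ 1)| := by
    rw [abs_div, abs_of_pos hsq, lt_div_iff₀ hsq, abs_of_neg (by linarith)]
    linarith
  have hOm := Omega_lt hzz
  have hneg : main1 (x / √(G2 γ 1)) 1 < 0 := by
    unfold main1; norm_num; norm_num at hOm; linarith
  have hcm : ContinuousAt (fun p : ℝ × ℝ => main1 p.1 p.2) (x / √(G2 γ 1), 1) := by
    unfold main1
    have := continuous_Omega
    have h2 : (2:ℝ) * (1 + 1) ≠ 0 := by norm_num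
    have h1 : (1:ℝ) ≠ 0 := by norm_num
    fun_prop (disch := assumption)
  obtain ⟨κ, hκ0, hκ⟩ : ∃ κ > 0, main1 (x / √(G2 γ 1)) 1 < - κ :=
    ⟨-main1 (x / √(G2 γ 1)) 1 / 2, by linarith, by linarith⟩
  have hev2 := hcm.tendsto.eventually (gt_mem_nhds hκ)
  rw [nhds_prod_eq] at hev2
  obtain ⟨pa, hpa, pb, hpb, hab⟩ := eventually_prod_iff.1 hev2
  obtain ⟨ε, hε, hεb⟩ := Metric.eventually_nhds_iff.1 hpb
  refine ⟨ε / 2, by positivity, ?_⟩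
  have t2 : Tendsto (fun v : (ZZ × ℝ) × ℝ => v.1.1.2.2 / √(G2 v.1.1.1 1))
      ((nhdsWithin (γ, u, x) (DS γ) ×ˢ nhdsWithin (0 : ℝ) (Ioi 0)) ×ˢ
      nhdsWithin 1 (Ioo (-1 : ℝ) 1)) (nhds (x / √(G2 γ 1))) :=
    L.hx.div ((L.ser1 hγ HB_h2).sqrt) hsq.ne'
  filter_upwards [hev, t2.eventually hpa, hth.eventually (lt_mem_nhds (show -(κ / 2) < 0 by linarith)),
    he.eventually (gt_mem_nhds (show 0 < κ / 2 by linarith))] with v h1 h2 h3 h4 h5 h6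
  obtain ⟨a, b, S, h7⟩ := h1
  refine ⟨a, b, S, h7.trans ?_⟩
  have h8 : pb (wfun v.1.1.1 v.1.2 v.2) := hεb (by
    rw [Real.dist_eq, abs_lt]; constructor <;> linarith)
  have h9 := hab h2 h8
  linarith

lemma near1_B {z : ZZ} (hzd : z.1 ∈ Dom γ) (hm : Mixed z.1)
    (hz : theta (G0 z.1 1) (G1 z.1 1) (G2 z.1 1) z.2.1 z.2.2 = 0) {η : ℝ} (hη : 0 < η) :
    ∀ᶠ v in ((nhdsWithin z (DS γ) ×ˢ nhdsWithin (0 : ℝ) (Ioi 0)) ×ˢ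
      nhdsWithin 1 (Ioo (-1 : ℝ) 1)), 1 ≤ wfun v.1.1.1 v.1.2 v.2 →
      ∃ a b S, Fc v.1.1.1 v.1.1.2.1 v.1.1.2.2 v.1.2 v.2 a b S ≤ η := by
  have L := Lim_prod (γ := γ) (z := z) hzd (r0 := 1) (B := Ioo (-1 : ℝ) 1)
    (by simp) Ioo_subset_Icc_self
  obtain ⟨s1, s2⟩ := near1_side (γ := γ) z
  obtain ⟨e, he, hev⟩ := near1_ev hγ L hm s1 s2
  have hth := L.theta hγ hm
  rw [hz] at hth
  filter_upwards [hev, hth.eventually (lt_mem_nhds (show -(η / 2) < 0 by linarith)),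
    he.eventually (gt_mem_nhds (show 0 < η / 2 by linarith))] with v h1 h3 h4 h6
  obtain ⟨a, b, S, h7⟩ := h1
  refine ⟨a, b, S, h7.trans ?_⟩
  have := main1_nonpos (z := v.1.1.2.2 / √(G2 v.1.1.1 1)) h6
  linarith

lemma wfun_ge {c : ℕ → ℝ} (hc : c ∈ Dom γ) (hm : Mixed c) {δ r : ℝ} (hr : r ∈ Ioo (-1 : ℝ) 1) :
    1 ≤ wfun c δ r := by
  have hg := good_of hγ hc hm
  have p1 := hg.p1
  have p2 := hg.p2
  have : 0 < 1 - r ^ 2 := by nlinarith [hr.1, hr.2]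
  unfold wfun
  have : 0 ≤ 2 * δ ^ 2 * G1 c 1 / (G2 c 1 * (1 - r ^ 2)) := by positivity
  linarith

lemma Reg_near1 (hm : Mixed γ) {u x : ℝ} (hz : theta (G0 γ 1) (G1 γ 1) (G2 γ 1) u x = 0)
    (hx : x < -2 * √(G2 γ 1)) : ∃ A ∈ nhdsWithin 1 (Ioo (-1 : ℝ) 1),
    ∀ᶠ z in nhdsWithin ((γ, u, x) : ZZ) (DS γ),
      theta (G0 z.1 1) (G1 z.1 1) (G2 z.1 1) z.2.1 z.2.2 = 0 → Reg γ z A := by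
  obtain ⟨ε, hε, hA⟩ := near1_A hγ hm hz hx
  obtain ⟨Z1, hZ1, D1, hD1, R1, hR1, H1⟩ := prod3 hA
  have hpos : Ioo (0:ℝ) 1 ∈ nhdsWithin (1:ℝ) (Ioo (-1 : ℝ) 1) := by
    have h1 : Ioi (0:ℝ) ∈ nhdsWithin (1:ℝ) (Ioo (-1 : ℝ) 1) :=
      mem_nhdsWithin_of_mem_nhds (Ioi_mem_nhds one_pos)
    filter_upwards [h1, self_mem_nhdsWithin] with r h2 h3 using ⟨h2, h3.2⟩
  refine ⟨R1 ∩ Ioo 0 1, inter_mem hR1 hpos, ?_⟩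
  have hmix : ∀ᶠ z in nhdsWithin ((γ, u, x) : ZZ) (DS γ), Mixed z.1 := by
    have : Tendsto (fun z : ZZ => z.1) (nhdsWithin ((γ, u, x) : ZZ) (DS γ)) (nhds γ) :=
      (continuous_fst.tendsto (((γ, u, x) : ZZ))).mono_left nhdsWithin_le_nhds
    exact this.eventually (Mixed_nhds hm)
  have e1 := eventually_eventually_nhdsWithin.2 hZ1
  have e2 := eventually_eventually_nhdsWithin.2 hmix
  filter_upwards [e1, e2, hmix, self_mem_nhdsWithin] with z h1 h2 h3 h4 h5 η hη
  obtain ⟨Z2, hZ2, D2, hD2, R2, hR2, H2⟩ := prod3 (near1_B hγ h4.1 h3 h5 hη)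
  obtain ⟨τ, hτ, hτR⟩ : ∃ τ > 0, Ioo (1 - τ) 1 ⊆ R2 := by
    obtain ⟨τ, hτ, h6⟩ := Metric.mem_nhdsWithin_iff.1 hR2
    refine ⟨min τ 1, lt_min hτ one_pos, fun r hr => h6 ⟨?_, ?_, hr.2⟩⟩
    · rw [Metric.mem_ball, Real.dist_eq, abs_lt]
      constructor <;> linarith [hr.1, hr.2, min_le_left τ 1]
    · linarith [hr.1, min_le_right τ 1]
  have hδ : ∀ᶠ δ in nhdsWithin (0:ℝ) (Ioi 0), 2 * δ ^ 2 < ε * τ := by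
    have : Tendsto (fun δ : ℝ => 2 * δ ^ 2) (nhdsWithin (0:ℝ) (Ioi 0)) (nhds (2 * 0 ^ 2)) :=
      (Continuous.tendsto (by fun_prop) 0).mono_left nhdsWithin_le_nhds
    exact this.eventually (gt_mem_nhds (by simp; positivity))
  have hd : ∀ᶠ z' in nhdsWithin z (DS γ), z' ∈ DS γ := self_mem_nhdsWithin
  have hprod := (((h1.and h2).and hd).and hZ2).prod_mk ((hδ.and hD1).and hD2)
  filter_upwards [hprod] with w hw r hr
  obtain ⟨⟨⟨⟨q1, q2⟩, q3⟩, q4⟩, ⟨q5, q6⟩, q7⟩ := hw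
  have hr' : r ∈ Ioo (-1 : ℝ) 1 := ⟨by linarith [hr.2.1], hr.2.2⟩
  have hw1 := wfun_ge hγ q3.1 q2 (δ := w.2) hr'
  by_cases hcase : wfun w.1.1 w.2 r ≤ 1 + ε
  · obtain ⟨a, b, S, h⟩ := H1 w.1 q1 w.2 q6 r hr.1 hcase hw1
    exact ⟨a, b, S, h.trans hη.le⟩
  · refine H2 w.1 q4 w.2 q7 r (hτR ⟨?_, hr.2.2⟩) hw1
    have hg := good_of hγ q3.1 q2
    have p1 := hg.p1
    have p2 := hg.p2
    have hX : 0 < 1 - r ^ 2 := by nlinarith [hr.2.1, hr.2.2]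
    unfold wfun at hcase
    push Not at hcase
    have : ε < 2 * w.2 ^ 2 * G1 w.1.1 1 / (G2 w.1.1 1 * (1 - r ^ 2)) := by linarith
    rw [lt_div_iff₀ (by positivity)] at this
    have h6 : 2 * w.2 ^ 2 * G1 w.1.1 1 ≤ ε * τ * G2 w.1.1 1 :=
      mul_le_mul q5.le hg.h2.le p1.le (by positivity)
    have h7 : (1 - r ^ 2) * (ε * G2 w.1.1 1) < τ * (ε * G2 w.1.1 1) := by linarith
    have h8 := lt_of_mul_lt_mul_right h7 (by positivity)
    nlinarith [hr.2.1, hr.2.2]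

end

lemma ser_even' {h : ℕ → ℝ → ℝ} {c : ℕ → ℝ} (hc : ∀ p, 2 ≤ p → Odd p → c p = 0) (r : ℝ)
    (hh : ∀ p, 2 ≤ p → Even p → h p (-r) = h p r) : Ser h c (-r) = Ser h c r := by
  unfold Ser
  congr 1; ext p
  split_ifs with h2
  · rcases Nat.even_or_odd p with he | ho
    · rw [hh p h2 he]
    · rw [hc p h2 ho]; simp
  · rfl

lemma ser_odd' {h : ℕ → ℝ → ℝ} {c : ℕ → ℝ} (hc : ∀ p, 2 ≤ p → Even p → c p = 0) (r : ℝ)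
    (hh : ∀ p, 2 ≤ p → Odd p → h p (-r) = - h p r) : Ser h c (-r) = - Ser h c r := by
  unfold Ser
  rw [← tsum_neg]
  congr 1; ext p
  split_ifs with h2
  · rcases Nat.even_or_odd p with he | ho
    · rw [hc p h2 he]; simp
    · rw [hh p h2 ho]; ring
  · simp

lemma Fc_even {c : ℕ → ℝ} (hc : ∀ p, 2 ≤ p → Odd p → c p = 0) (u x δ r a b S : ℝ) :
    Fc c u x δ (-r) a b (-S) = Fc c u x δ r a b S := by
  have hev : ∀ p : ℕ, 2 ≤ p → Even p → Even (p - 2) := fun p h2 he => by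
    rw [Nat.even_sub h2]; simp [he]
  have e0 : G0 c (-r) = G0 c r := ser_even' hc r fun p h2 he => by simp [h0, (hev p h2 he).neg_pow]
  have e1 : G1 c (-r) = G1 c r := ser_even' hc r fun p h2 he => by simp [h1, (hev p h2 he).neg_pow]
  have e2 : G2 c (-r) = G2 c r := ser_even' hc r fun p h2 he => by
    simp [SpinGlass.h2, (hev p h2 he).neg_pow]
  unfold Fc FF QQ
  rw [e0, e1, e2]
  have : (-r * G1 c r / G1 c 1) ^ 2 = (r * G1 c r / G1 c 1) ^ 2 := by ring
  rw [this, neg_sq, neg_sq]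
  ring

lemma log_part_nonpos {μ r δ : ℝ} (h : μ ^ 2 ≤ r ^ 2) (hr : r ^ 2 < 1) :
    1 / 2 * Real.log (1 - r ^ 2) - 1 / 2 * Real.log (1 - μ ^ 2 / (1 + δ ^ 2) ^ 2) ≤ 0 := by
  have h2 : (1:ℝ) ≤ (1 + δ ^ 2) ^ 2 := one_le_pow₀ (by nlinarith [sq_nonneg δ])
  have h3 : μ ^ 2 / (1 + δ ^ 2) ^ 2 ≤ μ ^ 2 := div_le_self (sq_nonneg _) h2
  have := Real.log_le_log (show 0 < 1 - r ^ 2 by linarith)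
    (show 1 - r ^ 2 ≤ 1 - μ ^ 2 / (1 + δ ^ 2) ^ 2 by linarith)
  linarith

lemma Ksq_pos {g0 g1 g2 u x : ℝ} (hg : Good g0 g1 g2) (hu : u ≠ 0) : 0 < Ksq g0 g1 g2 u x := by
  unfold Ksq
  have p0 := hg.p0
  have pd := hg.hd
  refine div_pos ?_ pd
  have h : 0 < g0 * (u ^ 2 * (g2 + g1) - 2 * u * x * g1 + x ^ 2 * g0) := by
    have : g0 * (u ^ 2 * (g2 + g1) - 2 * u * x * g1 + x ^ 2 * g0) =
      (g0 * x - g1 * u) ^ 2 + u ^ 2 * (g0 * (g2 + g1) - g1 ^ 2) := by ring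
    rw [this]
    positivity
  exact pos_of_mul_pos_right h p0.le

section
variable {γ : ℕ → ℝ} (hγ : GammaDecay γ) (hm : Mixed γ)
include hγ hm

lemma RegS_m1_odd (hc : ∀ p, 2 ≤ p → Even p → γ p = 0) {u x : ℝ} (hu : u ≠ 0) :
    ∃ A ∈ nhdsWithin (-1) (Ioo (-1 : ℝ) 1), RegS γ (γ, u, x) A := by
  have hg := good_of hγ (Dom_self hγ) hm
  have L := Lim_prod (γ := γ) (z := (γ, u, x)) (Dom_self hγ) (r0 := -1) (B := Ioo (-1 : ℝ) 1)
    (by simp) Ioo_subset_Icc_self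
  refine RegS_of_prod 0 ?_
  have hall := L.all hγ
  have hev : ∀ p : ℕ, 2 ≤ p → Odd p → Odd (p - 2) := fun p h2 he => by
    rw [Nat.odd_sub h2]; simp [he]
  have e0 : G0 γ (-1) = - G0 γ 1 := ser_odd' hc 1 fun p h2 he => by simp [h0, (hev p h2 he).neg_pow]
  have e1 : G1 γ (-1) = - G1 γ 1 := ser_odd' hc 1 fun p h2 he => by simp [h1, (hev p h2 he).neg_pow]
  have e2 : G2 γ (-1) = - G2 γ 1 := ser_odd' hc 1 fun p h2 he => by
    simp [SpinGlass.h2, (hev p h2 he).neg_pow]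
  rw [e0, e1, e2] at hall
  obtain ⟨q1, q2, q3⟩ := star_eqs hg.hd.ne' u x
  have hK := Ksq_pos (x := x) hg hu
  have hmem : ∀ᶠ v in ((nhdsWithin (γ, u, x) (DS γ) ×ˢ nhdsWithin (0 : ℝ) (Ioi 0)) ×ˢ
      nhdsWithin (-1) (Ioo (-1 : ℝ) 1)), v.2 ∈ Ioo (-1 : ℝ) 1 :=
    tendsto_snd.eventually self_mem_nhdsWithin
  obtain ⟨a, ha⟩ : ∃ a, a = astar (G0 γ 1) (G1 γ 1) (G2 γ 1) u x := ⟨_, rfl⟩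
  obtain ⟨b, hb⟩ : ∃ b, b = bstar (G0 γ 1) (G1 γ 1) (G2 γ 1) u x := ⟨_, rfl⟩
  rw [← ha, ← hb] at q1 q2 q3
  have hlim : ∀ᶠ v in ((nhdsWithin (γ, u, x) (DS γ) ×ˢ nhdsWithin (0 : ℝ) (Ioi 0)) ×ˢ
      nhdsWithin (-1) (Ioo (-1 : ℝ) 1)), Ksq (G0 v.1.1.1 1) (G1 v.1.1.1 1) (G2 v.1.1.1 1)
        v.1.1.2.1 v.1.1.2.2 + QQ (G0 v.1.1.1 1) (G1 v.1.1.1 1) (G2 v.1.1.1 1)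
        (G0 v.1.1.1 v.2) (G1 v.1.1.1 v.2) (G2 v.1.1.1 v.2) v.1.2 v.2 v.1.1.2.1 v.1.1.2.2 a b 0 < 0 := by
    have pd := hg.hd.ne'
    clear ha hb e0 e1 e2
    simp only at hall
    generalize G0 γ 1 = g0 at *
    generalize G1 γ 1 = g1 at *
    generalize G2 γ 1 = g2 at *
    have hcont : ContinuousAt (fun v : ℝ × ℝ × ℝ × ℝ × ℝ × ℝ × ℝ × ℝ × ℝ × ℝ =>
        Ksq v.1 v.2.1 v.2.2.1 v.2.2.2.2.2.2.2.1 v.2.2.2.2.2.2.2.2.1 +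
        QQ v.1 v.2.1 v.2.2.1 v.2.2.2.1 v.2.2.2.2.1 v.2.2.2.2.2.1 v.2.2.2.2.2.2.2.2.2
        v.2.2.2.2.2.2.1 v.2.2.2.2.2.2.2.1 v.2.2.2.2.2.2.2.2.1 a b 0)
      (g0, g1, g2, -g0, -g1, -g2, -1, u, x, 0) := by
      unfold QQ Ksq sigSq
      refine ContinuousAt.add (ContinuousAt.div (by fun_prop) (by fun_prop) pd) (by fun_prop)
    have h4 := hcont.tendsto.comp hall
    simp only [Function.comp_def] at h4
    refine h4.eventually (gt_mem_nhds ?_)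
    have : Ksq g0 g1 g2 u x + QQ g0 g1 g2 (-g0) (-g1) (-g2) 0 (-1) u x a b 0 =
        - Ksq g0 g1 g2 u x := by
      unfold QQ sigSq
      rw [q3]; ring
    rw [this]; linarith
  filter_upwards [hlim, hmem, L.hc, L.mixed hm] with v h1 h2 h3 h4
  refine ⟨a, b, 0, ?_⟩
  have hgv := good_of hγ h3 h4
  have p1 := hgv.p1
  have hk := G1_abs_le hγ h3 (Ioo_subset_Icc_self h2)
  have hμ : (v.2 * G1 v.1.1.1 v.2 / G1 v.1.1.1 1) ^ 2 ≤ v.2 ^ 2 := by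
    rw [mul_div_assoc, mul_pow]
    have : (G1 v.1.1.1 v.2 / G1 v.1.1.1 1) ^ 2 ≤ 1 := by
      rw [sq_le_one_iff_abs_le_one, abs_div, abs_of_pos p1]
      exact (div_le_one p1).2 hk
    nlinarith [sq_nonneg v.2]
  have := log_part_nonpos (δ := v.1.2) hμ (by nlinarith [h2.1, h2.2])
  unfold Fc FF
  linarith

lemma RegS_m1_mixed {p q : ℕ} (hp : 2 ≤ p) (hpo : Odd p) (hp0 : γ p ≠ 0) (hq : 2 ≤ q)
    (hqe : Even q) (hq0 : γ q ≠ 0) (u x : ℝ) :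
    ∃ A ∈ nhdsWithin (-1) (Ioo (-1 : ℝ) 1), RegS γ (γ, u, x) A := by
  have hg := good_of hγ (Dom_self hγ) hm
  have L := Lim_prod (γ := γ) (z := (γ, u, x)) (Dom_self hγ) (r0 := -1) (B := Ioo (-1 : ℝ) 1)
    (by simp) Ioo_subset_Icc_self
  refine RegS_of_prod 0 ?_
  have hall := L.all hγ
  have hm1 : (-1:ℝ) ∈ Icc (-1 : ℝ) 1 := by simp
  have h11 : (1:ℝ) ∈ Icc (-1 : ℝ) 1 := by simp
  have habs : |G1 γ (-1)| < G1 γ 1 := by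
    have hb : ∀ p : ℕ, |h1 p (-1)| ≤ h1 p 1 := by
      intro p
      unfold h1
      rw [abs_mul, abs_pow]; simp
    rw [abs_lt]
    constructor
    · have hneg : HB (fun p r => - h1 p r) := fun p hp =>
        ⟨(HB_h1 p hp).1.neg, fun r hr => by rw [abs_neg]; exact (HB_h1 p hp).2 r hr⟩
      have := ser_lt_ser hγ hneg HB_h1 (Dom_self hγ) hm1 h11
        (fun p _ => (neg_le_abs _).trans (hb p)) q hq hq0 (by
          unfold h1
          have : Even (q - 2) := by rw [Nat.even_sub hq]; simp [hqe]
          rw [this.neg_one_pow, one_pow]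
          have : (0:ℝ) < q := by exact_mod_cast (by omega : 0 < q)
          linarith)
      have e : Ser (fun p r => - h1 p r) γ (-1) = - G1 γ (-1) := by
        unfold G1 Ser
        rw [← tsum_neg]
        congr 1; ext p; split_ifs <;> simp
      rw [e] at this
      change - G1 γ (-1) < G1 γ 1 at this
      linarith
    · have := ser_lt_ser hγ HB_h1 HB_h1 (Dom_self hγ) hm1 h11
        (fun p _ => (le_abs_self _).trans (hb p)) p hp hp0 (by
          unfold h1
          have : Odd (p - 2) := by rw [Nat.odd_sub hp]; simp [hpo]
          rw [this.neg_one_pow, one_pow]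
          have : (0:ℝ) < p := by exact_mod_cast (by omega : 0 < p)
          linarith)
      exact this
  have hmem : ∀ᶠ v in ((nhdsWithin (γ, u, x) (DS γ) ×ˢ nhdsWithin (0 : ℝ) (Ioi 0)) ×ˢ
      nhdsWithin (-1) (Ioo (-1 : ℝ) 1)), v.2 ∈ Ioo (-1 : ℝ) 1 :=
    tendsto_snd.eventually self_mem_nhdsWithin
  have hmu1 : 1 - ((-1) * G1 γ (-1) / G1 γ 1) ^ 2 ≠ 0 := by
    have : ((-1) * G1 γ (-1) / G1 γ 1) ^ 2 < 1 := by
      rw [sq_lt_one_iff_abs_lt_one, abs_div, abs_of_pos hg.p1, div_lt_one hg.p1]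
      simpa using habs
    linarith
  obtain ⟨B, hB⟩ : ∃ B : ℝ, ∀ᶠ v in ((nhdsWithin (γ, u, x) (DS γ) ×ˢ nhdsWithin (0 : ℝ) (Ioi 0)) ×ˢ
      nhdsWithin (-1) (Ioo (-1 : ℝ) 1)), Ksq (G0 v.1.1.1 1) (G1 v.1.1.1 1) (G2 v.1.1.1 1)
        v.1.1.2.1 v.1.1.2.2 - 1 / 2 * Real.log (1 - (v.2 * G1 v.1.1.1 v.2 / G1 v.1.1.1 1) ^ 2) < B := by
    have pd := hg.hd.ne'
    have p1 := hg.p1.ne'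
    simp only at hall
    generalize G0 γ 1 = g0 at *
    generalize G1 γ 1 = g1 at *
    generalize G2 γ 1 = g2 at *
    generalize G1 γ (-1) = k1 at *
    have hcont : ContinuousAt (fun v : ℝ × ℝ × ℝ × ℝ × ℝ × ℝ × ℝ × ℝ × ℝ × ℝ =>
        Ksq v.1 v.2.1 v.2.2.1 v.2.2.2.2.2.2.2.1 v.2.2.2.2.2.2.2.2.1
        - 1 / 2 * Real.log (1 - (v.2.2.2.2.2.2.1 * v.2.2.2.2.1 / v.2.1) ^ 2))
      (g0, g1, g2, G0 γ (-1), k1, G2 γ (-1), -1, u, x, 0) := by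
      unfold Ksq
      refine ContinuousAt.sub (ContinuousAt.div (by fun_prop) (by fun_prop) pd)
        (continuousAt_const.mul (ContinuousAt.log ?_ hmu1))
      refine continuousAt_const.sub (ContinuousAt.pow (ContinuousAt.div (by fun_prop) (by fun_prop) p1) 2)
    have h4 := hcont.tendsto.comp hall
    simp only [Function.comp_def] at h4
    exact ⟨_, h4.eventually (gt_mem_nhds (lt_add_one _))⟩
  have hlog : Tendsto (fun v : (ZZ × ℝ) × ℝ => Real.log (1 - v.2 ^ 2))
      ((nhdsWithin (γ, u, x) (DS γ) ×ˢ nhdsWithin (0 : ℝ) (Ioi 0)) ×ˢ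
      nhdsWithin (-1) (Ioo (-1 : ℝ) 1)) atBot := by
    have h1 : Tendsto (fun r : ℝ => 1 - r ^ 2) (nhdsWithin (-1) (Ioo (-1 : ℝ) 1))
        (nhdsWithin 0 (Ioi 0)) := by
      refine tendsto_nhdsWithin_iff.2 ⟨?_, ?_⟩
      · have : Tendsto (fun r : ℝ => 1 - r ^ 2) (nhds (-1)) (nhds (1 - (-1) ^ 2)) :=
          Continuous.tendsto (by fun_prop) _
        norm_num at this
        exact this.mono_left nhdsWithin_le_nhds
      · filter_upwards [self_mem_nhdsWithin] with r hr
        have : 0 < 1 - r ^ 2 := by nlinarith [hr.1, hr.2]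
        exact this
    exact (Real.tendsto_log_nhdsGT_zero.comp h1).comp tendsto_snd
  filter_upwards [hB, hmem, L.hc, L.mixed hm, hlog.eventually (eventually_le_atBot (-2 * B))]
    with v h1 h2 h3 h4 h5
  refine ⟨0, 0, 0, ?_⟩
  have hmu := mu_lt hγ h3 h4 h2
  refine (FF_delta_le hmu).trans ?_
  unfold FF QQ sigSq
  norm_num
  norm_num at h1
  linarith

lemma Reg_nearm1 {u x : ℝ} (hu : u ≠ 0)
    (hz : theta (G0 γ 1) (G1 γ 1) (G2 γ 1) u x = 0)
    (hx : x < -2 * √(G2 γ 1)) : ∃ A ∈ nhdsWithin (-1) (Ioo (-1 : ℝ) 1),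
    ∀ᶠ z in nhdsWithin ((γ, u, x) : ZZ) (DS γ),
      theta (G0 z.1 1) (G1 z.1 1) (G2 z.1 1) z.2.1 z.2.2 = 0 → Reg γ z A := by
  by_cases hodd : ∀ p, 2 ≤ p → Even p → γ p = 0
  · obtain ⟨A, hA, hR⟩ := RegS_m1_odd hγ hm hodd (x := x) hu
    exact ⟨A, hA, hR.reg.mono fun z hz _ => hz⟩
  by_cases heven : ∀ p, 2 ≤ p → Odd p → γ p = 0
  · obtain ⟨A, hA, hR⟩ := Reg_near1 hγ hm hz hx
    refine ⟨(fun r => -r) ⁻¹' A, ?_, hR.mono fun z h h5 η hη => ?_⟩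
    · have : Tendsto (fun r : ℝ => -r) (nhdsWithin (-1) (Ioo (-1 : ℝ) 1))
          (nhdsWithin 1 (Ioo (-1 : ℝ) 1)) := by
        refine tendsto_nhdsWithin_iff.2 ⟨?_, ?_⟩
        · have : Tendsto (fun r : ℝ => -r) (nhds (-1)) (nhds (- -1)) :=
            Continuous.tendsto (by fun_prop) _
          rw [neg_neg] at this
          exact this.mono_left nhdsWithin_le_nhds
        · filter_upwards [self_mem_nhdsWithin] with r hr
          exact ⟨by linarith [hr.2], by linarith [hr.1]⟩
      exact this hA
    · have hd : ∀ᶠ w in nhdsWithin z (DS γ) ×ˢ nhdsWithin (0 : ℝ) (Ioi 0), w.1 ∈ DS γ :=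
        tendsto_fst.eventually self_mem_nhdsWithin
      filter_upwards [h h5 η hη, hd] with w hw hwd r hr
      obtain ⟨a, b, S, h⟩ := hw (-r) hr
      refine ⟨a, b, -S, ?_⟩
      have hce : ∀ p, 2 ≤ p → Odd p → w.1.1 p = 0 := fun p h2 ho => by
        have := hwd.1 p
        rw [heven p h2 ho] at this
        exact le_antisymm this.2 this.1
      have := Fc_even hce w.1.2.1 w.1.2.2 w.2 (-r) a b S
      rw [neg_neg] at this
      rw [this]; exact h
  · push Not at hodd heven
    obtain ⟨q, hq, hqe, hq0⟩ := hodd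
    obtain ⟨p, hp, hpo, hp0⟩ := heven
    obtain ⟨A, hA, hR⟩ := RegS_m1_mixed hγ hm hp hpo hp0 hq hqe hq0 u x
    exact ⟨A, hA, hR.reg.mono fun z hz _ => hz⟩

/-- **Lemma A** -/
theorem lemmaA (hM : ConditionM γ) {u x : ℝ} (ho : IsOpt (G0 γ 1) (G1 γ 1) (G2 γ 1) u x) :
    ∀ᶠ z in nhdsWithin ((γ, u, x) : ZZ) (DS γ),
      theta (G0 z.1 1) (G1 z.1 1) (G2 z.1 1) z.2.1 z.2.2 = 0 → Reg γ z (Ioo (-1) 1) := by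
  have hg := good_of hγ (Dom_self hγ) hm
  have hx := opt_x_lt hg ho hM.2.1
  obtain ⟨A1, hA1, R1⟩ := Reg_near1 hγ hm ho.zero hx
  obtain ⟨A2, hA2, R2⟩ := Reg_nearm1 hγ hm (ho.neg hg).ne ho.zero hx
  have hc2 := c2_neg hγ hm ho hM.2.2.1 hM.2.2.2.1
  obtain ⟨A0, hA0, R0⟩ := RegS_near0 hγ hm ho hc2
  obtain ⟨τ1, hτ1, h1⟩ := Metric.mem_nhdsWithin_iff.1 hA1
  obtain ⟨τ2, hτ2, h2⟩ := Metric.mem_nhdsWithin_iff.1 hA2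
  obtain ⟨τ0, hτ0, h0⟩ := Metric.mem_nhds_iff.1 hA0
  obtain ⟨s1, hs1, hs1', hs1''⟩ : ∃ s, 0 < s ∧ s < τ1 ∧ s < 1 :=
    ⟨min τ1 1 / 2, by positivity, by linarith [min_le_left τ1 1], by linarith [min_le_right τ1 1]⟩
  obtain ⟨s2, hs2, hs2', hs2''⟩ : ∃ s, 0 < s ∧ s < τ2 ∧ s < 1 :=
    ⟨min τ2 1 / 2, by positivity, by linarith [min_le_left τ2 1], by linarith [min_le_right τ2 1]⟩
  have Rm := RegS_mid hγ hm ho (K := Icc τ0 (1 - s1) ∪ Icc (-1 + s2) (-τ0))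
    (isCompact_Icc.union isCompact_Icc) (by
      rintro r (hr | hr)
      · exact ⟨by linarith [hr.1], by linarith [hr.2]⟩
      · exact ⟨by linarith [hr.1], by linarith [hr.2]⟩) (by
      intro r hr
      rw [← psi_zero hγ hm ho]
      refine hM.2.2.2.1 r ?_ ?_
      · rcases hr with hr | hr
        · exact ⟨by linarith [hr.1], by linarith [hr.2]⟩
        · exact ⟨by linarith [hr.1], by linarith [hr.2]⟩
      · rcases hr with hr | hr
        · exact (by linarith [hr.1] : 0 < r).ne'
        · exact (by linarith [hr.2] : r < 0).ne)
  filter_upwards [R1, R2, R0.reg, Rm.reg] with z k1 k2 k3 k4 k5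
  refine ((((k1 k5).union (k2 k5)).union k3).union k4).mono fun r hr => ?_
  by_cases c1 : 1 - s1 < r
  · left; left; left
    refine h1 ⟨?_, hr⟩
    rw [Metric.mem_ball, Real.dist_eq, abs_lt]; constructor <;> linarith [hr.2]
  by_cases c2 : r < -1 + s2
  · left; left; right
    refine h2 ⟨?_, hr⟩
    rw [Metric.mem_ball, Real.dist_eq, abs_lt]; constructor <;> linarith [hr.1]
  by_cases c3 : |r| < τ0
  · left; right
    refine h0 ?_
    rw [Metric.mem_ball, Real.dist_eq, sub_zero]; exact c3
  · right
    push Not at c1 c2 c3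
    rcases le_abs.1 c3 with h | h
    · left; exact ⟨h, c1⟩
    · right; exact ⟨c2, by linarith⟩

end

/-- Extended exponential. -/
def ee (x : ℝ) : ℝ≥0∞ := ENNReal.ofReal (rexp x)

lemma ee_add (x y : ℝ) : ee (x + y) = ee x * ee y := by
  unfold ee; rw [Real.exp_add, ENNReal.ofReal_mul (exp_pos x).le]

lemma ee_ne_top (x : ℝ) : ee x ≠ ⊤ := ENNReal.ofReal_ne_top

lemma ee_pos (x : ℝ) : 0 < ee x := ENNReal.ofReal_pos.mpr (exp_pos x)

lemma ee_ne_zero (x : ℝ) : ee x ≠ 0 := (ee_pos x).ne'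

lemma ee_zero : ee 0 = 1 := by simp [ee]

lemma ee_le_ee {x y : ℝ} : ee x ≤ ee y ↔ x ≤ y := by
  unfold ee; rw [ENNReal.ofReal_le_ofReal_iff (exp_pos y).le, Real.exp_le_exp]

lemma ee_mono {x y : ℝ} (h : x ≤ y) : ee x ≤ ee y := ee_le_ee.mpr h

lemma ee_le_one {x : ℝ} (h : x ≤ 0) : ee x ≤ 1 := by
  rw [← ee_zero]; exact ee_mono h

lemma ee_sum {ι : Type*} (s : Finset ι) (f : ι → ℝ) : ee (∑ i ∈ s, f i) = ∏ i ∈ s, ee (f i) := by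
  classical
  induction s using Finset.induction_on with
  | empty => simp [ee_zero]
  | insert a s ha ih => rw [Finset.sum_insert ha, Finset.prod_insert ha, ee_add, ih]

lemma ee_log {x : ℝ} (h : 0 < x) : ee (Real.log x) = ENNReal.ofReal x := by
  unfold ee; rw [Real.exp_log h]

lemma measurable_ee : Measurable ee :=
  ENNReal.measurable_ofReal.comp Real.measurable_exp

lemma continuous_ee : Continuous ee := ENNReal.continuous_ofReal.comp Real.continuous_exp

lemma ee_mul_neg (x : ℝ) : ee x * ee (-x) = 1 := by rw [← ee_add]; simp [ee_zero]

/-- One-dimensional Gaussian integral. -/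
lemma gauss1 (l c a : ℝ) (hl : -1 < l) :
    ∫⁻ x, ee (-(1/2) * l * (x - c) ^ 2 + a * x) ∂(gaussianReal 0 1)
      = ee (-(1/2) * Real.log (1 + l) + (1/2 * a ^ 2 + a * l * c - 1/2 * l * c ^ 2) / (1 + l)) := by
  have h1 : 0 < 1 + l := by linarith
  have hm1 : Measurable fun x : ℝ => ee (-(1/2) * l * (x - c) ^ 2 + a * x) :=
    measurable_ee.comp (by fun_prop)
  rw [gaussianReal_of_var_ne_zero _ one_ne_zero,
    lintegral_withDensity_eq_lintegral_mul _ (measurable_gaussianPDF _ _) hm1]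
  obtain ⟨v, hv⟩ : ∃ v : NNReal, (v : ℝ) = (1 + l)⁻¹ := ⟨⟨(1+l)⁻¹, by positivity⟩, rfl⟩
  have hv0 : v ≠ 0 := by
    intro h; rw [h] at hv; have := inv_pos.mpr h1; rw [← hv] at this; simp at this
  have key : ∀ x : ℝ, (gaussianPDF 0 1 * fun x : ℝ => ee (-(1/2) * l * (x - c) ^ 2 + a * x)) x
      = ee (-(1/2) * Real.log (1 + l) + (1/2 * a ^ 2 + a * l * c - 1/2 * l * c ^ 2) / (1 + l))
        * gaussianPDF ((a + l * c) / (1 + l)) v x := by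
    intro x
    simp only [Pi.mul_apply, gaussianPDF, gaussianPDFReal, ee]
    rw [← ENNReal.ofReal_mul (by positivity), ← ENNReal.ofReal_mul (by positivity)]
    congr 1
    rw [hv]
    have e1 : √(2 * π * (1 + l)⁻¹) = √(2 * π) * rexp (-(1/2) * Real.log (1 + l)) := by
      rw [Real.sqrt_mul (by positivity)]
      congr 1
      rw [Real.sqrt_eq_rpow, ← Real.exp_log (inv_pos.mpr h1), ← Real.exp_mul, Real.log_inv]
      ring_nf
    rw [e1, mul_inv, ← Real.exp_neg]
    have e2 : √(2 * π * ((1 : NNReal) : ℝ)) = √(2 * π) := by simp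
    rw [e2]
    have e3 : ∀ A B C : ℝ, rexp A * (( √(2 * π))⁻¹ * rexp B * rexp C) = (√(2 * π))⁻¹ * rexp (A + B + C) := by
      intro A B C; rw [Real.exp_add, Real.exp_add]; ring
    rw [e3, mul_assoc, ← Real.exp_add]
    congr 2
    simp only [NNReal.coe_one]
    field_simp
    ring
  rw [lintegral_congr key, lintegral_const_mul _ (measurable_gaussianPDF _ _),
    lintegral_gaussianPDF_eq_one _ hv0, mul_one]

section
variable {E : Type*} [NormedAddCommGroup E] [InnerProductSpace ℝ E] [FiniteDimensional ℝ E]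
  [MeasurableSpace E] [BorelSpace E]

lemma gauss_prod {ι : Type*} [Fintype ι] (b : OrthonormalBasis ι ℝ E) (F : ι → ℝ → ℝ≥0∞)
    (hF : ∀ i, Measurable (F i)) :
    ∫⁻ J, ∏ i, F i (inner ℝ J (b i)) ∂(stdGaussian E) = ∏ i, ∫⁻ x, F i x ∂(gaussianReal 0 1) := by
  classical
  rw [stdGaussian_eq_map_pi_orthonormalBasis b, lintegral_map]
  · have h1 : ∀ x : ι → ℝ, ∏ i, F i (inner ℝ (∑ j, x j • b j) (b i)) = ∏ i, F i (x i) := by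
      intro x
      refine Finset.prod_congr rfl fun i _ => ?_
      congr 1
      rw [sum_inner]
      simp [real_inner_smul_left, OrthonormalBasis.inner_eq_ite]
    simp only [h1]
    have h2 := lintegral_prod_eq_prod_lintegral_of_indepFun (μ := Measure.pi fun _ : ι => gaussianReal 0 1)
      Finset.univ (fun i (x : ι → ℝ) => F i (x i)) (iIndepFun_pi fun i => (hF i).aemeasurable)
      (fun i => (hF i).comp (measurable_pi_apply i))
    rw [h2]
    refine Finset.prod_congr rfl fun i _ => ?_
    exact (measurePreserving_eval (fun _ : ι => gaussianReal 0 1) i).lintegral_comp (hF i)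
  · exact Finset.measurable_fun_prod _ fun i _ => (hF i).comp (by fun_prop)
  · fun_prop

omit [MeasurableSpace E] [BorelSpace E] in
lemma exists_extend {ι : Type*} [Fintype ι] {e : ι → E} (he : Orthonormal ℝ e) :
    ∃ (k : ℕ) (b : OrthonormalBasis (ι ⊕ Fin k) ℝ E), ∀ i, b (Sum.inl i) = e i := by
  classical
  have hc : Fintype.card ι ≤ Module.finrank ℝ E := he.linearIndependent.fintype_card_le_finrank
  refine ⟨Module.finrank ℝ E - Fintype.card ι, ?_⟩
  have h1 : Module.finrank ℝ E = Fintype.card (ι ⊕ Fin (Module.finrank ℝ E - Fintype.card ι)) := by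
    simp; omega
  obtain ⟨b, hb⟩ := Orthonormal.exists_orthonormalBasis_extension_of_card_eq (𝕜 := ℝ) (E := E) h1
    (v := Sum.elim e (fun _ => 0)) (s := Set.range Sum.inl) (by
      have h2 : ∀ y : Set.range (Sum.inl : ι → ι ⊕ Fin (Module.finrank ℝ E - Fintype.card ι)),
        ∃ i, y.1 = Sum.inl i := by rintro ⟨_, i, rfl⟩; exact ⟨i, rfl⟩
      choose g hg using h2
      have h3 : (Set.range (Sum.inl : ι → ι ⊕ Fin (Module.finrank ℝ E - Fintype.card ι))).domRestrict
          (Sum.elim e (fun _ => 0)) = e ∘ g := by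
        funext y; simp [Set.domRestrict, hg]
      rw [h3]
      refine he.comp g ?_
      intro y z hyz
      apply Subtype.ext
      rw [hg y, hg z, hyz])
  exact ⟨b, fun i => by rw [hb _ ⟨i, rfl⟩]; rfl⟩

/-- Lemma G. -/
lemma lemmaG {ι : Type*} [Fintype ι] {e : ι → E} (he : Orthonormal ℝ e) (l c : ι → ℝ)
    (hl : ∀ i, -1 < l i) (a : E) :
    ∫⁻ J, ee ((∑ i, -(1/2) * l i * (inner ℝ J (e i) - c i) ^ 2) + inner ℝ J a) ∂(stdGaussian E)
      = ee ((∑ i, -(1/2) * Real.log (1 + l i)) + 1/2 * ‖a‖ ^ 2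
        + ∑ i, (-(1/2) * l i * c i ^ 2 + inner ℝ a (e i) * l i * c i
            - 1/2 * inner ℝ a (e i) ^ 2 * l i) / (1 + l i)) := by
  classical
  obtain ⟨k, b, hb⟩ := exists_extend he
  let L : ι ⊕ Fin k → ℝ := Sum.elim l (fun _ => 0)
  let C : ι ⊕ Fin k → ℝ := Sum.elim c (fun _ => 0)
  have hL : ∀ i, -1 < L i := by
    rintro (i | i)
    · exact hl i
    · simp [L]
  have h1 : ∀ J : E, ee ((∑ i, -(1/2) * l i * (inner ℝ J (e i) - c i) ^ 2) + inner ℝ J a)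
      = ∏ j, ee (-(1/2) * L j * (inner ℝ J (b j) - C j) ^ 2 + inner ℝ a (b j) * inner ℝ J (b j)) := by
    intro J
    rw [← ee_sum, Finset.sum_add_distrib]
    congr 1
    congr 1
    · rw [Fintype.sum_sum_type]; simp [L, C, hb]
    · rw [← b.sum_inner_mul_inner J a]
      exact Finset.sum_congr rfl fun j _ => by rw [real_inner_comm a (b j)]; ring
  simp only [h1]
  rw [gauss_prod b (fun j x => ee (-(1/2) * L j * (x - C j) ^ 2 + inner ℝ a (b j) * x))
    (fun j => measurable_ee.comp (by fun_prop))]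
  rw [Finset.prod_congr rfl fun j _ => gauss1 (L j) (C j) (inner ℝ a (b j)) (hL j), ← ee_sum]
  congr 1
  rw [← b.sum_sq_inner_left a, Finset.sum_add_distrib, Fintype.sum_sum_type, Fintype.sum_sum_type,
    Fintype.sum_sum_type]
  simp only [L, C, Sum.elim_inl, Sum.elim_inr, hb, add_zero, Real.log_one, mul_zero, zero_mul,
    Finset.sum_const_zero, sub_zero, div_one, zero_add]
  rw [mul_add, Finset.mul_sum, Finset.mul_sum]
  have h2 : ∀ i, (1/2 * inner ℝ a (e i) ^ 2 + inner ℝ a (e i) * l i * c i - 1/2 * l i * c i ^ 2) / (1 + l i)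
      = 1/2 * inner ℝ a (e i) ^ 2 + (-(1/2) * l i * c i ^ 2 + inner ℝ a (e i) * l i * c i
            - 1/2 * inner ℝ a (e i) ^ 2 * l i) / (1 + l i) := by
    intro i
    have : (1 + l i) ≠ 0 := by have := hl i; intro h; linarith
    field_simp
    ring
  rw [Finset.sum_congr rfl fun i _ => h2 i, Finset.sum_add_distrib]
  simp
  ring
end

abbrev VN (N : ℕ) : Type := EuclideanSpace ℝ (Fin N)

lemma lint_fin : ∀ (n : ℕ) (F : Fin n → ℝ → ℝ≥0∞) (_ : ∀ i, Measurable (F i)),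
    ∫⁻ x : Fin n → ℝ, ∏ i, F i (x i) = ∏ i, ∫⁻ x, F i x
  | 0, F, _ => by
      simp only [Finset.univ_eq_empty, Finset.prod_empty, lintegral_const, one_mul]
      simp [volume_pi]
  | n + 1, F, hF => by
      have h := (volume_preserving_piFinSuccAbove (fun _ : Fin (n+1) => ℝ) 0).symm
      rw [← h.lintegral_comp_emb (MeasurableEquiv.measurableEmbedding _)]
      simp only [MeasurableEquiv.piFinSuccAbove_symm_apply, Fin.insertNthEquiv_zero,
        Fin.prod_univ_succ, Fin.consEquiv_apply, Fin.cons_zero, Fin.cons_succ]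
      rw [← lint_fin n (fun i => F i.succ) (fun i => hF _)]
      rw [Measure.volume_eq_prod]
      exact lintegral_prod_mul (hF 0).aemeasurable
        (Finset.measurable_fun_prod _ fun (i : Fin n) _ => (hF i.succ).comp (measurable_pi_apply i)).aemeasurable

lemma lint_pi {ι : Type*} [Fintype ι] (F : ι → ℝ → ℝ≥0∞) (hF : ∀ i, Measurable (F i)) :
    ∫⁻ x : ι → ℝ, ∏ i, F i (x i) = ∏ i, ∫⁻ x, F i x := by
  have e := (Fintype.equivFin ι).symm
  have h := volume_measurePreserving_piCongrLeft (fun _ : ι => ℝ) e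
  rw [← h.lintegral_comp_emb (MeasurableEquiv.measurableEmbedding _)]
  have h1 : ∀ a : Fin (Fintype.card ι) → ℝ,
     ∏ i, F i ((MeasurableEquiv.piCongrLeft (fun _ => ℝ) e) a i) = ∏ j, F (e j) (a j) := by
    intro a
    rw [← e.prod_comp]
    refine Finset.prod_congr rfl fun j _ => ?_
    congr 1
    exact MeasurableEquiv.piCongrLeft_apply_apply (β := fun _ : ι => ℝ) e a j
  simp only [h1]
  rw [lint_fin _ (fun j => F (e j)) (fun j => hF _), ← e.prod_comp]

lemma vol_prod {V : Type*} [NormedAddCommGroup V] [InnerProductSpace ℝ V] [FiniteDimensional ℝ V]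
    [MeasurableSpace V] [BorelSpace V] {ι : Type*} [Fintype ι] (b : OrthonormalBasis ι ℝ V)
    (F : ι → ℝ → ℝ≥0∞) (hF : ∀ i, Measurable (F i)) :
    ∫⁻ x : V, ∏ i, F i (inner ℝ x (b i)) = ∏ i, ∫⁻ x, F i x := by
  rw [← lint_pi F hF]
  have h := (PiLp.volume_preserving_ofLp ι).comp b.measurePreserving_repr
  have hm : Measurable fun x : ι → ℝ => ∏ i, F i (x i) :=
    Finset.measurable_fun_prod _ fun i _ => (hF i).comp (measurable_pi_apply i)
  rw [← h.lintegral_comp hm]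
  refine lintegral_congr fun x => Finset.prod_congr rfl fun i _ => ?_
  congr 1
  simp only [Function.comp_apply]
  rw [real_inner_comm]
  exact (b.repr_apply_apply x i).symm

lemma gauss0 (k : ℝ) (hk : 0 < k) :
    ∫⁻ x : ℝ, ee (-(1/2) * k * x ^ 2) = ee (1/2 * Real.log (2 * π) - 1/2 * Real.log k) := by
  have h1 := integrable_exp_neg_mul_sq (b := k / 2) (by positivity)
  have h2 := integral_gaussian (k/2)
  unfold ee
  have e : ∀ x : ℝ, -(1/2) * k * x ^ 2 = -(k/2) * x ^ 2 := fun x => by ring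
  simp only [e]
  rw [← ofReal_integral_eq_lintegral_ofReal h1 (ae_of_all _ fun x => (exp_pos _).le), h2]
  congr 1
  rw [Real.sqrt_eq_rpow, Real.rpow_def_of_pos (by positivity)]
  congr 1
  rw [show π / (k/2) = (2 * π) / k by field_simp, Real.log_div (by positivity) hk.ne']
  ring

section
variable {N : ℕ}

/-- radial integral -/
def radI (N : ℕ) (k : ℝ) : ℝ≥0∞ := ∫⁻ r in Ioi (0:ℝ), ENNReal.ofReal (r ^ (N-1)) * ee (-(1/2) * k * r ^ 2)

lemma radI_eq (hN : 1 ≤ N) (k : ℝ) (hk : 0 < k) : radI N k = ee (-(N/2) * Real.log k) * radI N 1 := by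
  have hs : 0 < √k := Real.sqrt_pos.mpr hk
  unfold radI
  have h := lintegral_image_eq_lintegral_abs_deriv_mul (s := Ioi (0:ℝ)) measurableSet_Ioi
    (f := fun r => (√k)⁻¹ * r) (f' := fun _ => (√k)⁻¹)
    (fun x _ => by simpa using ((hasDerivAt_id x).const_mul (√k)⁻¹).hasDerivWithinAt)
    (fun x _ y _ hxy => by
      have : (√k)⁻¹ ≠ 0 := by positivity
      exact mul_left_cancel₀ this hxy)
    (fun r => ENNReal.ofReal (r ^ (N-1)) * ee (-(1/2) * k * r ^ 2))
  have him : (fun r => (√k)⁻¹ * r) '' Ioi (0:ℝ) = Ioi 0 := by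
    ext y
    constructor
    · rintro ⟨r, hr, rfl⟩
      have : (0:ℝ) < r := hr
      show (0:ℝ) < _
      positivity
    · intro hy
      have hy' : (0:ℝ) < y := hy
      exact ⟨√k * y, by show (0:ℝ) < _; positivity, by field_simp⟩
  rw [him] at h
  rw [h, ← lintegral_const_mul' _ _ (ee_ne_top _)]
  refine setLIntegral_congr_fun measurableSet_Ioi fun r hr => ?_
  have hr' : (0:ℝ) < r := hr
  rw [← mul_assoc, ← mul_assoc]
  congr 1
  · unfold ee
    rw [← ENNReal.ofReal_mul (by positivity), ← ENNReal.ofReal_mul (by positivity)]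
    congr 1
    rw [abs_of_pos (by positivity), mul_pow, ← mul_assoc]
    congr 1
    rw [← pow_succ', Nat.sub_add_cancel hN, ← Real.exp_log hs, ← Real.exp_neg, ← Real.exp_nat_mul,
      Real.log_sqrt hk.le]
    congr 1; ring
  · congr 1
    rw [mul_pow, inv_pow, Real.sq_sqrt hk.le]
    field_simp

lemma polar0 (hN : 1 ≤ N) (G : (VN N) → ℝ≥0∞) (hG : Measurable G)
    (hGh : ∀ r > (0:ℝ), ∀ x : (VN N), G (r • x) = G x) (Q : (VN N) → ℝ) (hQ : Measurable Q)
    (hQh : ∀ r > (0:ℝ), ∀ x : (VN N), Q (r • x) = r ^ 2 * Q x) (hQp : ∀ x : (VN N), ‖x‖ = 1 → 0 < Q x) :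
    ∫⁻ x : (VN N), G x * ee (-(1/2) * Q x)
      = (∫⁻ t : Metric.sphere (0 : (VN N)) 1, G t * ee (-(N/2) * Real.log (Q t))
          ∂((volume : Measure (VN N)).toSphere)) * radI N 1 := by
  have hne : Nontrivial (VN N) := by
    have : Nonempty (Fin N) := ⟨⟨0, hN⟩⟩
    infer_instance
  have hmeas : Measurable fun x : (VN N) => G x * ee (-(1/2) * Q x) :=
    hG.mul (measurable_ee.comp (by fun_prop))
  have h1 : ∫⁻ x : (VN N), G x * ee (-(1/2) * Q x)
      = ∫⁻ x : ({(0)}ᶜ : Set (VN N)), G x * ee (-(1/2) * Q x) ∂((volume : Measure (VN N)).comap (↑)) := by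
    rw [lintegral_subtype_comap (measurableSet_singleton _).compl (fun x : (VN N) => G x * ee (-(1/2) * Q x)),
        restrict_compl_singleton]
  have hmp := (volume : Measure (VN N)).measurePreserving_homeomorphUnitSphereProd
  rw [h1, ← hmp.symm (e := (homeomorphUnitSphereProd (VN N)).toMeasurableEquiv) |>.lintegral_comp_emb
    (MeasurableEquiv.measurableEmbedding _)]
  have hd : Module.finrank ℝ (VN N) = N := by simp
  rw [hd]
  have hmeas2 : Measurable fun z : Metric.sphere (0 : VN N) 1 × Ioi (0:ℝ) =>
      G z.1 * ee (-(1/2) * Q z.1 * (z.2 : ℝ) ^ 2) := by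
    refine (hG.comp (by fun_prop)).mul (measurable_ee.comp ?_)
    have : Measurable fun z : Metric.sphere (0 : VN N) 1 × Ioi (0:ℝ) => Q z.1 := hQ.comp (by fun_prop)
    fun_prop
  have hcong : ∀ z : Metric.sphere (0 : VN N) 1 × Ioi (0:ℝ),
      G ((homeomorphUnitSphereProd (VN N)).toMeasurableEquiv.symm z) *
        ee (-(1/2) * Q ((homeomorphUnitSphereProd (VN N)).toMeasurableEquiv.symm z))
      = G z.1 * ee (-(1/2) * Q z.1 * (z.2 : ℝ) ^ 2) := by
    rintro ⟨t, r⟩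
    have hr : (0:ℝ) < r := r.2
    have e : (((homeomorphUnitSphereProd (VN N)).toMeasurableEquiv.symm (t, r) : ({0}ᶜ : Set (VN N))) : VN N)
      = (r : ℝ) • (t : VN N) := rfl
    rw [e, hGh _ hr, hQh _ hr]
    congr 2; ring
  simp only [hcong]
  rw [lintegral_prod _ hmeas2.aemeasurable]
  have hm3 : Measurable fun t : Metric.sphere (0 : VN N) 1 => G t * ee (-(N/2) * Real.log (Q t)) := by
    refine (hG.comp (by fun_prop)).mul (measurable_ee.comp ?_)
    have : Measurable fun z : Metric.sphere (0 : VN N) 1 => Q z := hQ.comp (by fun_prop)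
    fun_prop
  rw [← lintegral_mul_const _ hm3]
  refine lintegral_congr fun t => ?_
  have ht : ‖(t : VN N)‖ = 1 := by simp
  rw [mul_assoc, ← radI_eq hN _ (hQp _ ht)]
  unfold radI Measure.volumeIoiPow
  have hm4 : Measurable fun r : Ioi (0:ℝ) => ee (-(1/2) * Q t * (r : ℝ) ^ 2) :=
    measurable_ee.comp (by fun_prop)
  rw [lintegral_withDensity_eq_lintegral_mul _ (by fun_prop) (by fun_prop)]
  rw [← lintegral_const_mul _ (by
    refine Measurable.mul (by fun_prop) (measurable_ee.comp (by fun_prop)))]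
  rw [← lintegral_subtype_comap measurableSet_Ioi]
  refine lintegral_congr fun r => ?_
  simp only [Pi.mul_apply]
  ring

/-- the Gaussian quadratic form -/
def QF {ι : Type*} [Fintype ι] (e : ι → VN N) (s : ι → ℝ) (x : VN N) : ℝ :=
  ‖x‖ ^ 2 - ∑ i, s i * inner ℝ x (e i) ^ 2

lemma QF_pos {ι : Type*} [Fintype ι] {e : ι → VN N} (he : Orthonormal ℝ e) {s : ι → ℝ}
    (hs : ∀ i, s i < 1) (x : VN N) (hx : ‖x‖ = 1) : 0 < QF e s x := by
  unfold QF
  have h1 : ∑ i, inner ℝ x (e i) ^ 2 ≤ ‖x‖ ^ 2 := by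
    have := he.sum_inner_products_le (x := x) (s := Finset.univ)
    refine le_trans (le_of_eq ?_) this
    refine Finset.sum_congr rfl fun i _ => ?_
    rw [real_inner_comm]; simp
  rw [hx] at *
  by_cases h : ∀ i, inner ℝ x (e i) = 0
  · simp [h]
  · push Not at h
    obtain ⟨j, hj⟩ := h
    have h2 : ∑ i, s i * inner ℝ x (e i) ^ 2 < ∑ i, inner ℝ x (e i) ^ 2 := by
      refine Finset.sum_lt_sum (fun i _ => ?_) ⟨j, Finset.mem_univ _, ?_⟩
      · nlinarith [sq_nonneg (inner ℝ x (e i)), hs i]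
      · have : 0 < inner ℝ x (e j) ^ 2 := by positivity
        nlinarith [hs j]
    linarith

lemma QF_hom {ι : Type*} [Fintype ι] (e : ι → VN N) (s : ι → ℝ) (r : ℝ) (x : VN N) :
    QF e s (r • x) = r ^ 2 * QF e s x := by
  unfold QF
  rw [norm_smul, mul_pow, mul_sub, Finset.mul_sum]
  congr 1
  · simp
  · refine Finset.sum_congr rfl fun i _ => ?_
    rw [real_inner_smul_left]; ring

lemma QF_cont {ι : Type*} [Fintype ι] (e : ι → VN N) (s : ι → ℝ) : Continuous (QF e s) := by
  unfold QF; fun_prop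

lemma vol_QF {ι : Type*} [Fintype ι] {e : ι → VN N} (he : Orthonormal ℝ e) {s : ι → ℝ}
    (hs : ∀ i, s i < 1) :
    ∫⁻ x : VN N, ee (-(1/2) * QF e s x)
      = ee (N * (1/2 * Real.log (2 * π)) + ∑ i, -(1/2) * Real.log (1 - s i)) := by
  obtain ⟨k, b, hb⟩ := exists_extend he
  let S : ι ⊕ Fin k → ℝ := Sum.elim s (fun _ => 0)
  have hS : ∀ j, 0 < 1 - S j := by
    rintro (i | i)
    · exact sub_pos.mpr (hs i)
    · simp [S]
  have h1 : ∀ x : VN N, ee (-(1/2) * QF e s x) = ∏ j, ee (-(1/2) * (1 - S j) * inner ℝ x (b j) ^ 2) := by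
    intro x
    rw [← ee_sum]; congr 1
    unfold QF
    rw [← b.sum_sq_inner_left x, Fintype.sum_sum_type, Fintype.sum_sum_type]
    simp only [S, Sum.elim_inl, Sum.elim_inr, hb, Finset.mul_sum]
    rw [mul_sub, mul_add, Finset.mul_sum, Finset.mul_sum, Finset.mul_sum]
    rw [add_sub_right_comm, ← Finset.sum_sub_distrib]
    congr 1
    · exact Finset.sum_congr rfl fun i _ => by ring
    · exact Finset.sum_congr rfl fun i _ => by ring
  simp only [h1]
  rw [vol_prod b (fun j x => ee (-(1/2) * (1 - S j) * x ^ 2)) (fun j => measurable_ee.comp (by fun_prop)),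
    Finset.prod_congr rfl fun j _ => gauss0 _ (hS j), ← ee_sum]
  congr 1
  have hcard : (Fintype.card (ι ⊕ Fin k) : ℝ) = N := by
    have := Module.finrank_eq_card_basis b.toBasis
    rw [← this]; simp
  rw [Finset.sum_sub_distrib]
  rw [Finset.sum_const, Finset.card_univ, nsmul_eq_mul, hcard, Fintype.sum_sum_type]
  simp [S]
  ring

lemma unif_univ (hN : 1 ≤ N) : unifSphere N univ = 1 := by
  have : Nonempty (Fin N) := ⟨⟨0, hN⟩⟩
  have hne : Nontrivial (VN N) := inferInstance
  unfold unifSphere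
  rw [Measure.smul_apply, smul_eq_mul]
  refine ENNReal.inv_mul_cancel ?_ (measure_ne_top _ _)
  intro h
  rw [Measure.measure_univ_eq_zero] at h
  exact Measure.toSphere_ne_zero _ h

/-- polar identity -/
lemma polar (hN : 1 ≤ N) {ι : Type*} [Fintype ι] {e : ι → VN N} (he : Orthonormal ℝ e) {s : ι → ℝ}
    (hs : ∀ i, s i < 1) (G : VN N → ℝ≥0∞) (hG : Measurable G)
    (hGh : ∀ r > (0:ℝ), ∀ x : VN N, G (r • x) = G x) :
    ∫⁻ x : VN N, G x * ee (-(1/2) * QF e s x)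
      = ee (N * (1/2 * Real.log (2 * π))) *
        ∫⁻ t : Metric.sphere (0 : VN N) 1, G t * ee (-(N/2) * Real.log (QF e s t)) ∂(unifSphere N) := by
  have : Nonempty (Fin N) := ⟨⟨0, hN⟩⟩
  have hne : Nontrivial (VN N) := inferInstance
  have h0 := polar0 hN (fun _ => 1) measurable_const (fun _ _ _ => rfl) (QF (Fin.elim0 : Fin 0 → VN N) Fin.elim0)
    (QF_cont _ _).measurable (fun r _ x => QF_hom _ _ r x) (QF_pos (by
      constructor
      · intro i; exact i.elim0
      · intro i; exact i.elim0) (fun i => i.elim0))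
  simp only [one_mul] at h0
  rw [vol_QF (by
      constructor
      · intro i; exact i.elim0
      · intro i; exact i.elim0) (fun i => i.elim0)] at h0
  have h1 : ∫⁻ t : Metric.sphere (0 : VN N) 1, ee (-(N/2) * Real.log (QF (Fin.elim0 : Fin 0 → VN N) Fin.elim0 t))
      ∂((volume : Measure (VN N)).toSphere) = (volume : Measure (VN N)).toSphere univ := by
    rw [← lintegral_one]
    refine lintegral_congr fun t => ?_
    have ht : ‖(t : VN N)‖ = 1 := by simp
    simp [QF, ee_zero]
  rw [h1] at h0
  rw [polar0 hN G hG hGh (QF e s) (QF_cont _ _).measurable (fun r _ x => QF_hom _ _ r x) (QF_pos he hs)]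
  have h3 : ee (N * (1/2 * Real.log (2 * π))) = (volume : Measure (VN N)).toSphere univ * radI N 1 := by
    rw [← h0]; simp
  have hT0 : (volume : Measure (VN N)).toSphere univ ≠ 0 := by
    intro h
    rw [Measure.measure_univ_eq_zero] at h
    exact Measure.toSphere_ne_zero _ h
  have hTt : (volume : Measure (VN N)).toSphere univ ≠ ⊤ := measure_ne_top _ _
  rw [h3]
  unfold unifSphere
  rw [lintegral_smul_measure, smul_eq_mul]
  rw [mul_comm ((volume : Measure (VN N)).toSphere univ), mul_assoc, ← mul_assoc _ (_)⁻¹,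
    ENNReal.mul_inv_cancel hT0 hTt, one_mul, mul_comm]

/-- sphere exponential moments -/
lemma sphere_int (hN : 1 ≤ N) {ι : Type*} [Fintype ι] {e : ι → VN N} (he : Orthonormal ℝ e) {s : ι → ℝ}
    (hs : ∀ i, s i < 1) :
    ∫⁻ t : Metric.sphere (0 : VN N) 1, ee (-(N/2) * Real.log (QF e s t)) ∂(unifSphere N)
      = ee (∑ i, -(1/2) * Real.log (1 - s i)) := by
  have h := polar hN he hs (fun _ => 1) measurable_const (fun _ _ _ => rfl)
  simp only [one_mul] at h
  rw [vol_QF he hs, ee_add] at h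
  exact ((ENNReal.mul_right_inj (ee_ne_zero _) (ee_ne_top _)).mp h).symm
end

section
variable {N : ℕ}

lemma orth1 {n : VN N} (hn : ‖n‖ = 1) : Orthonormal ℝ (fun _ : Fin 1 => n) := by
  constructor
  · intro _; exact hn
  · intro i j hij; exact absurd (Subsingleton.elim i j) hij

/-- law of the overlap: upper bound -/
lemma pair_law (hN : 1 ≤ N) {ι : Type*} [Fintype ι] {e : ι → VN N} (he : Orthonormal ℝ e) {s : ι → ℝ}
    (hs : ∀ i, s i < 1) (G : Metric.sphere (0 : VN N) 1 → ℝ≥0∞) (M : ℝ)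
    (hG : ∀ t : Metric.sphere (0 : VN N) 1, G t ≤ ee (M - (N/2) * Real.log (QF e s t))) :
    ∫⁻ t, G t ∂(unifSphere N) ≤ ee (M + ∑ i, -(1/2) * Real.log (1 - s i)) := by
  rw [ee_add, ← sphere_int hN he hs, ← lintegral_const_mul' _ _ (ee_ne_top _)]
  refine lintegral_mono fun t => (hG t).trans (le_of_eq ?_)
  rw [← ee_add]; congr 1; ring

lemma cone_cont (q κ : ℝ) (hq0 : 0 < q) (hq : q < 1) (hκ : 0 < κ) :
    ∃ κ1 > 0, ∀ ξ ρ : ℝ, |ξ - q / √(1 - q^2)| < κ1 → |ρ - 1| < κ1 → |ξ / √(ξ^2 + ρ) - q| < κ := by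
  have h1 : 0 < 1 - q ^ 2 := by nlinarith
  have hs : 0 < √(1 - q^2) := Real.sqrt_pos.mpr h1
  have e1 : (q / √(1 - q^2)) ^ 2 + 1 = 1 / (1 - q^2) := by
    rw [div_pow, Real.sq_sqrt h1.le]; field_simp; ring
  have hc : ContinuousAt (fun z : ℝ × ℝ => z.1 / √(z.1 ^ 2 + z.2)) (q / √(1 - q^2), 1) := by
    refine ContinuousAt.div (by fun_prop) (by fun_prop) ?_
    simp only
    rw [e1]
    exact (Real.sqrt_pos.mpr (by positivity)).ne'
  have hv : (q / √(1 - q^2)) / √((q / √(1 - q^2)) ^ 2 + 1) = q := by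
    rw [e1, Real.sqrt_div (by norm_num), Real.sqrt_one]; field_simp
  obtain ⟨d, hd, h⟩ := Metric.continuousAt_iff.mp hc κ hκ
  refine ⟨d, hd, fun ξ ρ h2 h3 => ?_⟩
  have := h (x := (ξ, ρ)) (by rw [Prod.dist_eq]; exact max_lt (by rwa [Real.dist_eq]) (by rwa [Real.dist_eq]))
  rw [Real.dist_eq] at this
  simp only [hv] at this
  exact this

lemma chern_ex {κ1 : ℝ} (h0 : 0 < κ1) : ∃ a : ℝ, 0 < a ∧ a < 1 ∧
    -Real.log (1 - a) ≤ a * (1 + κ1/2) ∧ -Real.log (1 + a) ≤ - a * (1 - κ1/2) := by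
  obtain ⟨b, hb0, hb1, hb2⟩ : ∃ b : ℝ, 0 < b ∧ b ≤ 1 ∧ b ≤ κ1 :=
    ⟨min 1 κ1, lt_min one_pos h0, min_le_left _ _, min_le_right _ _⟩
  refine ⟨b / 4, by positivity, by linarith, ?_, ?_⟩
  · have h1 : 0 < 1 - b/4 := by linarith
    have h2 := Real.log_le_sub_one_of_pos (inv_pos.mpr h1)
    rw [Real.log_inv] at h2
    refine h2.trans ?_
    rw [sub_le_iff_le_add, inv_le_iff_one_le_mul₀ h1]
    nlinarith [mul_pos hb0 hb0, mul_nonneg hb0.le (sub_nonneg.mpr hb2), mul_nonneg hb0.le (mul_nonneg hb0.le hb0.le), mul_nonneg (mul_nonneg hb0.le (sub_nonneg.mpr hb2)) (sub_nonneg.mpr hb1), mul_nonneg (mul_nonneg hb0.le (sub_nonneg.mpr hb2)) hb0.le]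
  · have h1 : 0 < 1 + b/4 := by linarith
    have h2 := Real.log_le_sub_one_of_pos (inv_pos.mpr h1)
    rw [Real.log_inv] at h2
    refine h2.trans ?_
    rw [sub_le_iff_le_add, inv_le_iff_one_le_mul₀ h1]
    nlinarith [mul_pos hb0 hb0, mul_nonneg hb0.le (sub_nonneg.mpr hb2), mul_nonneg hb0.le (mul_nonneg hb0.le hb0.le), mul_nonneg (mul_nonneg hb0.le (sub_nonneg.mpr hb2)) (sub_nonneg.mpr hb1), mul_nonneg (mul_nonneg hb0.le (sub_nonneg.mpr hb2)) hb0.le]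

lemma ee_neg_two : ee (-2) ≤ 1/4 := by
  have : rexp (-2) ≤ 1/4 := by
    have h := Real.add_one_le_exp (1:ℝ)
    have h2 : rexp (-2) = (rexp 1 * rexp 1)⁻¹ := by rw [← Real.exp_add, ← Real.exp_neg]; norm_num
    rw [h2, one_div]
    gcongr; nlinarith
  unfold ee
  refine (ENNReal.ofReal_le_ofReal this).trans (le_of_eq ?_)
  rw [ENNReal.ofReal_div_of_pos (by norm_num)]; norm_num

lemma half_of {T X A B : ℝ≥0∞} (hT : T ≠ ⊤) (h : T ≤ X + A + B) (hA : A ≤ T * (1/4)) (hB : B ≤ T * (1/4)) :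
    T * (1/2) ≤ X := by
  have h1 : T * (1/2) + (T * (1/4) + T * (1/4)) ≤ X + (T * (1/4) + T * (1/4)) := by
    have e : T * (1/2) + (T * (1/4) + T * (1/4)) = T := by
      rw [← mul_add, ← mul_add]
      have : (1/2 + (1/4 + 1/4) : ℝ≥0∞) = 1 := by
        rw [← ENNReal.toReal_eq_toReal_iff' (by finiteness) (by finiteness)]
        rw [ENNReal.toReal_add (by finiteness) (by finiteness), ENNReal.toReal_add (by finiteness) (by finiteness)]
        norm_num
      rw [this, mul_one]
    rw [e, ← add_assoc]
    exact h.trans (add_le_add (add_le_add le_rfl hA) hB)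
  refine (ENNReal.add_le_add_iff_right ?_).mp h1
  have : T * (1/4) ≠ ⊤ := ENNReal.mul_ne_top hT (by finiteness)
  finiteness

lemma band_aux {k : ℕ} (b : OrthonormalBasis (Fin 1 ⊕ Fin k) ℝ (VN N)) (F : ℝ → ℝ≥0∞) (hF : Measurable F)
    (m : ℝ) (hm : 0 < m) :
    ∫⁻ x : VN N, F (inner ℝ x (b (Sum.inl 0))) * ee (-(1/2) * m * ∑ i : Fin k, inner ℝ x (b (Sum.inr i)) ^ 2)
      = (∫⁻ x, F x) * ee (k * (1/2 * Real.log (2 * π) - 1/2 * Real.log m)) := by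
  have h := vol_prod b (Sum.elim (fun _ : Fin 1 => F) (fun (_ : Fin k) x => ee (-(1/2) * m * x ^ 2)))
    (by rintro (i | i)
        · exact hF
        · exact measurable_ee.comp (by fun_prop))
  simp only [Fintype.prod_sum_type, Sum.elim_inl, Sum.elim_inr] at h
  rw [Finset.prod_const, gauss0 m hm, ← ee_sum] at h
  simp only [Finset.card_univ, Fintype.card_fin, pow_one, Finset.sum_const, nsmul_eq_mul,
    Finset.univ_unique, Finset.prod_singleton, Finset.card_singleton, ← ee_sum, ← Finset.mul_sum] at h
  exact h

set_option maxHeartbeats 1600000 in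
lemma band_lower (q κ η : ℝ) (hq0 : 0 < q) (hq : q < 1) (hκ : 0 < κ) (hη : 0 < η) :
    ∃ N0 : ℕ, ∀ N ≥ N0, 1 ≤ N ∧ ∀ n : VN N, ‖n‖ = 1 →
      ee (N * (1/2 * Real.log (1 - q^2) - η)) ≤
        unifSphere N {t | |inner ℝ (t : VN N) n - q| < κ} := by
  have h1 : 0 < 1 - q ^ 2 := by nlinarith
  -- shrink κ
  obtain ⟨κ', hκ'0, hκ', hκ'1, hκ'2⟩ : ∃ κ' > 0, κ' ≤ κ ∧ q + κ' < 1 ∧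
      1/2 * Real.log (1 - q^2) - η/2 < 1/2 * Real.log (1 - (q+κ')^2) := by
    have hc : ContinuousAt (fun k : ℝ => 1/2 * Real.log (1 - (q+k)^2)) 0 := by
      refine ContinuousAt.mul (by fun_prop) (ContinuousAt.log (by fun_prop) ?_)
      simp; exact h1.ne'
    have hlt : 1/2 * Real.log (1 - q^2) - η/2 < (fun k : ℝ => 1/2 * Real.log (1 - (q+k)^2)) 0 := by
      simp; linarith
    have h2 := hc.eventually (lt_mem_nhds hlt)
    have h3 : ∀ᶠ k in nhds (0:ℝ), q + k < 1 := by
      have : ContinuousAt (fun k : ℝ => q + k) 0 := by fun_prop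
      exact this.eventually (gt_mem_nhds (by simpa using hq))
    have h4 : ∀ᶠ k in nhds (0:ℝ), k ≤ κ := (gt_mem_nhds hκ).mono fun _ h => le_of_lt h
    have h5 := ((h2.and (h3.and h4)).filter_mono nhdsWithin_le_nhds :
      ∀ᶠ k in nhdsWithin (0:ℝ) (Ioi 0), _)
    obtain ⟨k, hk, hk0⟩ := (h5.and self_mem_nhdsWithin).exists
    exact ⟨k, hk0, hk.2.2, hk.2.1, hk.1⟩
  obtain ⟨κ2, hκ20, hcone⟩ := cone_cont q κ' hq0 hq hκ'0
  obtain ⟨κ1, hκ10, hκ11, hκ12⟩ : ∃ κ1 > 0, κ1 < 1 ∧ κ1 ≤ κ2 :=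
    ⟨min (1/2) κ2, lt_min (by norm_num) hκ20, lt_of_le_of_lt (min_le_left _ _) (by norm_num), min_le_right _ _⟩
  obtain ⟨a, ha0, ha1, haL, haR⟩ := chern_ex hκ10
  obtain ⟨ξ0, hξ0⟩ : ∃ ξ0, ξ0 = q / √(1 - q^2) := ⟨_, rfl⟩
  rw [← hξ0] at hcone
  have hξ0p : 0 < ξ0 := by rw [hξ0]; have := Real.sqrt_pos.mpr h1; positivity
  obtain ⟨C, hC⟩ : ∃ C, C = (ξ0 + κ1)^2/2 - Real.log (2 * κ1) + 1/2 * Real.log (2 * π) + Real.log 2 := ⟨_, rfl⟩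
  obtain ⟨N0, hN0⟩ := exists_nat_ge (max (max 1 ((4 * 5) / (a * κ1))) (2 * C / η))
  refine ⟨N0, fun N hN => ?_⟩
  have hNr : (max (max 1 ((4 * 5) / (a * κ1))) (2 * C / η)) ≤ (N:ℝ) := hN0.trans (by exact_mod_cast hN)
  have hN1r : (1:ℝ) ≤ N := (le_max_left _ _).trans ((le_max_left _ _).trans hNr)
  have hNa : 20 ≤ N * (a * κ1) := by
    have h2 : ((4 * 5) / (a * κ1)) ≤ (N:ℝ) := (le_max_right _ _).trans ((le_max_left _ _).trans hNr)
    rw [div_le_iff₀ (by positivity)] at h2; linarith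
  have hNC : C ≤ N * (η / 2) := by
    have h2 : 2 * C / η ≤ (N:ℝ) := (le_max_right _ _).trans hNr
    rw [div_le_iff₀ (by positivity)] at h2; linarith
  have hN1 : 1 ≤ N := by exact_mod_cast hN1r
  refine ⟨hN1, fun n hn => ?_⟩
  have hNp : (0:ℝ) < N := by linarith
  obtain ⟨k, b, hb⟩ := exists_extend (orth1 hn)
  have hb0 : b (Sum.inl 0) = n := hb 0
  have hk : (k:ℝ) = N - 1 := by
    have := Module.finrank_eq_card_basis b.toBasis
    simp at this
    rw [this]; push_cast; ring
  have hsN : 0 < √(N:ℝ) := Real.sqrt_pos.mpr hNp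
  let I0 : Set ℝ := {y | |y / √N - ξ0| < κ1}
  have hI0 : MeasurableSet I0 := by
    apply measurableSet_lt <;> fun_prop
  let F : ℝ → ℝ≥0∞ := I0.indicator (fun y => ee (-(1/2) * (1/N) * y^2))
  have hF : Measurable F := (measurable_ee.comp (by fun_prop)).indicator hI0
  let S : Set (VN N) := {x | |inner ℝ x n - q * ‖x‖| < κ' * ‖x‖}
  have hS : MeasurableSet S := by
    apply measurableSet_lt <;> fun_prop
  let G : VN N → ℝ≥0∞ := S.indicator 1
  have hG : Measurable G := measurable_one.indicator hS
  have hGh : ∀ r > (0:ℝ), ∀ x : VN N, G (r • x) = G x := by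
    intro r hr x
    have : (r • x ∈ S) ↔ x ∈ S := by
      show |inner ℝ (r • x) n - q * ‖r • x‖| < κ' * ‖r • x‖ ↔ |inner ℝ x n - q * ‖x‖| < κ' * ‖x‖
      rw [real_inner_smul_left, norm_smul, Real.norm_of_nonneg hr.le,
        show r * inner ℝ x n - q * (r * ‖x‖) = r * (inner ℝ x n - q * ‖x‖) by ring, abs_mul,
        abs_of_pos hr, show κ' * (r * ‖x‖) = r * (κ' * ‖x‖) by ring]
      exact mul_lt_mul_iff_right₀ hr
    simp only [G, Set.indicator, this]
    rfl
  let Y : VN N → ℝ := fun x => ∑ i : Fin k, inner ℝ x (b (Sum.inr i)) ^ 2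
  have hnorm : ∀ x, ‖x‖^2 = inner ℝ x n ^ 2 + Y x := by
    intro x
    rw [← b.sum_sq_inner_left x, Fintype.sum_sum_type]
    simp [hb0, Y]
  let s : Fin 1 → ℝ := fun _ => 1 - 1/N
  have hs : ∀ i, s i < 1 := fun i => by
    have : 0 < 1/(N:ℝ) := by positivity
    simp only [s]; linarith
  have hQ : ∀ x, QF (fun _ : Fin 1 => n) s x = (1/N) * inner ℝ x n ^ 2 + Y x := by
    intro x; simp only [QF, s]; rw [hnorm x]; simp; ring
  have hY0 : ∀ x, 0 ≤ Y x := fun x => Finset.sum_nonneg fun i _ => sq_nonneg _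
  have pw : ∀ x : VN N, F (inner ℝ x n) * ee (-(1/2) * 1 * Y x) ≤
      G x * ee (-(1/2) * QF (fun _ : Fin 1 => n) s x)
      + (F (inner ℝ x n) * ee (-(1/2) * (1 - a) * Y x)) * ee (-(1/2) * a * (1 + κ1) * N)
      + (F (inner ℝ x n) * ee (-(1/2) * (1 + a) * Y x)) * ee ((1/2) * a * (1 - κ1) * N) := by
    intro x
    by_cases hx : inner ℝ x n ∈ I0
    · rcases lt_or_ge (|Y x / N - 1|) κ1 with hy | hy
      · have hxS : x ∈ S := by
          have hx' : |inner ℝ x n / √N - ξ0| < κ1 := hx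
          have h2 := hcone _ _ (hx'.trans_le hκ12) (hy.trans_le hκ12)
          have hyp : 0 < Y x := by
            have := (abs_lt.mp hy).1
            have h3 : 0 < Y x / N := by linarith
            exact (div_pos_iff_of_pos_right hNp).mp h3
          have hxn : 0 < ‖x‖ := by
            have : 0 < ‖x‖^2 := by rw [hnorm]; positivity
            exact (sq_pos_iff.mp this).symm.lt_of_le (norm_nonneg _)
          have e1 : inner ℝ x n / √N / √((inner ℝ x n / √N)^2 + Y x / N) = inner ℝ x n / ‖x‖ := by
            have : (inner ℝ x n / √N)^2 + Y x / N = (‖x‖ / √N)^2 := by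
              rw [div_pow, div_pow, Real.sq_sqrt hNp.le, hnorm x]; ring
            rw [this, Real.sqrt_sq (by positivity)]
            field_simp
          rw [e1] at h2
          show |inner ℝ x n - q * ‖x‖| < κ' * ‖x‖
          have e2 : inner ℝ x n - q * ‖x‖ = (inner ℝ x n / ‖x‖ - q) * ‖x‖ := by field_simp
          rw [e2, abs_mul, abs_of_pos hxn]
          exact (mul_lt_mul_iff_left₀ hxn).mpr h2
        have e3 : F (inner ℝ x n) * ee (-(1/2) * 1 * Y x) = G x * ee (-(1/2) * QF (fun _ : Fin 1 => n) s x) := by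
          simp only [F, G, Set.indicator_of_mem hx, Set.indicator_of_mem hxS, Pi.one_apply, one_mul]
          rw [← ee_add, hQ]; congr 1; ring
        rw [e3, add_assoc]
        exact le_self_add
      · rcases le_abs.mp hy with hy | hy
        · have h3 : (1 + κ1) * N ≤ Y x := by
            rw [← le_div_iff₀ hNp]; linarith
          refine le_trans ?_ (le_trans le_add_self le_self_add)
          rw [mul_assoc (F _), ← ee_add]
          refine mul_le_mul_right (ee_mono ?_) _
          nlinarith
        · have h3 : Y x ≤ (1 - κ1) * N := by
            rw [← div_le_iff₀ hNp]; linarith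
          refine le_trans ?_ le_add_self
          rw [mul_assoc (F _), ← ee_add]
          refine mul_le_mul_right (ee_mono ?_) _
          nlinarith
    · have : F (inner ℝ x n) = 0 := Set.indicator_of_notMem hx _
      rw [this]; simp
  have aux := fun m hm => band_aux b F hF m hm
  rw [hb0] at aux
  have hmF : ∀ m : ℝ, Measurable fun x : VN N => F (inner ℝ x n) * ee (-(1/2) * m * Y x) := by
    intro m
    refine (hF.comp (by fun_prop)).mul (measurable_ee.comp ?_)
    simp only [Y]; fun_prop
  have hint := lintegral_mono (μ := (volume : Measure (VN N))) pw
  rw [lintegral_add_right _ ((hmF _).mul_const _),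
    lintegral_add_right _ ((hmF _).mul_const _), lintegral_mul_const _ (hmF _),
    lintegral_mul_const _ (hmF _), aux 1 one_pos, aux (1-a) (by linarith), aux (1+a) (by linarith)] at hint
  have hIF : ∫⁻ x, F x ≠ ⊤ := by
    have : ∫⁻ x, F x ≤ ∫⁻ x : ℝ, ee (-(1/2) * (1/N) * x^2) :=
      lintegral_mono fun x => Set.indicator_le_self _ _ _
    rw [gauss0 _ (by positivity)] at this
    exact ne_top_of_le_ne_top (ee_ne_top _) this
  have key := half_of (ENNReal.mul_ne_top hIF (ee_ne_top _)) hint (by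
      rw [mul_assoc (∫⁻ x, F x), mul_assoc (∫⁻ x, F x), ← ee_add]
      refine mul_le_mul_right ?_ _
      refine le_trans ?_ (mul_le_mul_right ee_neg_two _)
      rw [← ee_add]
      refine ee_mono ?_
      rw [Real.log_one, hk]
      have : 0 ≤ (N:ℝ) - 1 := by linarith
      nlinarith [mul_le_mul_of_nonneg_left haL this, mul_pos ha0 hκ10, mul_pos (mul_pos ha0 hκ10) hNp])
    (by
      rw [mul_assoc (∫⁻ x, F x), mul_assoc (∫⁻ x, F x), ← ee_add]
      refine mul_le_mul_right ?_ _
      refine le_trans ?_ (mul_le_mul_right ee_neg_two _)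
      rw [← ee_add]
      refine ee_mono ?_
      rw [Real.log_one, hk]
      have : 0 ≤ (N:ℝ) - 1 := by linarith
      nlinarith [mul_le_mul_of_nonneg_left haR this, mul_pos ha0 hκ10, mul_pos (mul_pos ha0 hκ10) hNp])
  -- lower bound on ∫F
  have hIl : ee (-((ξ0 + κ1)^2/2) + Real.log (2 * κ1)) ≤ ∫⁻ x, F x := by
    have e1 : ∫⁻ x, F x = ∫⁻ y in I0, ee (-(1/2) * (1/N) * y^2) := lintegral_indicator hI0 _
    rw [e1]
    have hsub : Ioo (√N * (ξ0 - κ1)) (√N * (ξ0 + κ1)) ⊆ I0 := by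
      intro y hy
      show |y / √N - ξ0| < κ1
      rw [abs_lt]
      constructor
      · have : ξ0 - κ1 < y / √N := by rw [lt_div_iff₀ hsN]; linarith [hy.1]
        linarith
      · have : y / √N < ξ0 + κ1 := by rw [div_lt_iff₀ hsN]; linarith [hy.2]
        linarith
    refine le_trans ?_ (lintegral_mono_set hsub)
    have e2 : ∫⁻ _ in Ioo (√N * (ξ0 - κ1)) (√N * (ξ0 + κ1)), ee (-((ξ0 + κ1)^2/2))
        ≤ ∫⁻ y in Ioo (√N * (ξ0 - κ1)) (√N * (ξ0 + κ1)), ee (-(1/2) * (1/N) * y^2) := by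
      refine setLIntegral_mono' measurableSet_Ioo fun y hy => ee_mono ?_
      have hy2 : y^2 ≤ N * (ξ0 + κ1)^2 := by
        have hx1 : y / √N < ξ0 + κ1 := by rw [div_lt_iff₀ hsN]; linarith [hy.2]
        have hx2 : ξ0 - κ1 < y / √N := by rw [lt_div_iff₀ hsN]; linarith [hy.1]
        have : (y / √N)^2 ≤ (ξ0 + κ1)^2 := by
          apply sq_le_sq' <;> linarith
        rw [div_pow, Real.sq_sqrt hNp.le, div_le_iff₀ hNp] at this
        linarith
      have : (1/N) * y^2 ≤ (ξ0 + κ1)^2 := by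
        rw [one_div, inv_mul_le_iff₀ hNp]; exact hy2
      linarith
    refine le_trans ?_ e2
    rw [setLIntegral_const, ee_add, ee_log (by positivity), Real.volume_Ioo]
    refine mul_le_mul_right (ENNReal.ofReal_le_ofReal ?_) _
    have : 1 ≤ √(N:ℝ) := Real.one_le_sqrt.mpr hN1r
    nlinarith
  rw [polar hN1 (orth1 hn) hs G hG hGh] at key
  have hup : ∫⁻ t : Metric.sphere (0 : VN N) 1, G t * ee (-(N/2) * Real.log (QF (fun _ : Fin 1 => n) s t)) ∂(unifSphere N)
      ≤ ee (-(N/2) * Real.log (1 - (q+κ')^2)) * unifSphere N {t | |inner ℝ (t : VN N) n - q| < κ} := by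
    have hb : MeasurableSet {t : Metric.sphere (0 : VN N) 1 | |inner ℝ (t : VN N) n - q| < κ} := by
      apply measurableSet_lt <;> fun_prop
    rw [← setLIntegral_const, ← lintegral_indicator hb]
    refine lintegral_mono fun t => ?_
    have ht : ‖(t : VN N)‖ = 1 := by simp
    by_cases hx : (t : VN N) ∈ S
    · have hx' : |inner ℝ (t : VN N) n - q * ‖(t : VN N)‖| < κ' * ‖(t : VN N)‖ := hx
      rw [ht, mul_one, mul_one] at hx'
      have hmem : t ∈ {t : Metric.sphere (0 : VN N) 1 | |inner ℝ (t : VN N) n - q| < κ} := hx'.trans_le hκ'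
      simp only [G]
      rw [Set.indicator_of_mem hmem, Set.indicator_of_mem hx, Pi.one_apply, one_mul]
      refine ee_mono ?_
      have hsq : inner ℝ (t : VN N) n ^ 2 ≤ (q + κ')^2 := by
        have := abs_lt.mp hx'
        apply sq_le_sq' <;> linarith
      have hpos : 0 < 1 - (q+κ')^2 := by nlinarith
      have hle : 1 - (q+κ')^2 ≤ QF (fun _ : Fin 1 => n) s t := by
        simp only [QF, s, ht]
        have h9 : 0 < 1/(N:ℝ) := by positivity
        simp only [Finset.univ_unique, Finset.sum_singleton]
        nlinarith [mul_nonneg h9.le (sq_nonneg (inner ℝ (t : VN N) n))]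
      have := Real.log_le_log hpos hle
      nlinarith
    · simp only [G]
      rw [Set.indicator_of_notMem hx]
      simp
  have hfin := key.trans (mul_le_mul_right hup _)
  have h9 : ee (-((ξ0 + κ1)^2/2) + Real.log (2 * κ1)) * ee (k * (1/2 * Real.log (2 * π) - 1/2 * Real.log 1)) * (1/2) ≤
    ee (N * (1/2 * Real.log (2 * π))) * (ee (-(N/2) * Real.log (1 - (q+κ')^2)) * unifSphere N {t | |inner ℝ (t : VN N) n - q| < κ}) :=
    le_trans (by gcongr) hfin
  have h10 : (1/2 : ℝ≥0∞) = ee (-Real.log 2) := by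
    rw [← Real.log_inv, ee_log (by norm_num)]
    rw [ENNReal.ofReal_inv_of_pos (by norm_num)]; simp
  rw [h10, ← ee_add, ← ee_add, ← mul_assoc (ee _), ← ee_add] at h9
  have h11 := mul_le_mul_right h9 (ee (-(N * (1/2 * Real.log (2 * π)) + -(N/2) * Real.log (1 - (q+κ')^2))))
  rw [← mul_assoc (ee _) (ee _) (unifSphere N _), ← ee_add, ← ee_add, neg_add_cancel, ee_zero, one_mul] at h11
  refine le_trans (ee_mono ?_) h11
  rw [Real.log_one, hk]
  have h12 := mul_le_mul_of_nonneg_left hκ'2.le hNp.le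
  linarith
end

set_option linter.unusedSectionVars false
section modl
variable {E : Type} [NormedAddCommGroup E] [InnerProductSpace ℝ E] [FiniteDimensional ℝ E]
  [MeasurableSpace E] [BorelSpace E]

lemma orth_norm {ι : Type*} [DecidableEq ι] {F : ι → E} {d : ι → ℝ} (hd : ∀ i, 0 < d i)
    (hF : ∀ i j, inner ℝ (F i) (F j) = if i = j then d i else 0) :
    Orthonormal ℝ (fun i => (√(d i))⁻¹ • F i) := by
  rw [orthonormal_iff_ite]
  intro i j
  rw [real_inner_smul_left, real_inner_smul_right, hF]
  split_ifs with h
  · subst h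
    have h1 := Real.sqrt_pos.mpr (hd i)
    rw [← mul_assoc, ← mul_inv, Real.mul_self_sqrt (hd i).le]
    exact inv_mul_cancel₀ (hd i).ne'
  · simp

lemma lemmaG' {ι : Type*} [Fintype ι] [DecidableEq ι] {F : ι → E} {d : ι → ℝ} (hd : ∀ i, 0 < d i)
    (hF : ∀ i j, inner ℝ (F i) (F j) = if i = j then d i else 0) (l c : ι → ℝ)
    (hl : ∀ i, -1 < l i) (a : E) :
    ∫⁻ J, ee ((∑ i, -(1/2) * l i * (inner ℝ J (F i) - c i) ^ 2 / d i) + inner ℝ J a) ∂(stdGaussian E)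
      = ee ((∑ i, -(1/2) * Real.log (1 + l i)) + 1/2 * ‖a‖ ^ 2
        + ∑ i, (-(1/2) * c i ^ 2 + inner ℝ a (F i) * c i
            - 1/2 * inner ℝ a (F i) ^ 2) * (l i / (1 + l i)) / d i) := by
  have h := lemmaG (orth_norm hd hF) l (fun i => (√(d i))⁻¹ * c i) hl a
  have hs : ∀ i, ((√(d i))⁻¹) ^ 2 = (d i)⁻¹ := fun i => by rw [inv_pow, Real.sq_sqrt (hd i).le]
  have e1 : ∀ J : E, ∀ i, -(1/2) * l i * (inner ℝ J ((√(d i))⁻¹ • F i) - (√(d i))⁻¹ * c i) ^ 2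
      = -(1/2) * l i * (inner ℝ J (F i) - c i) ^ 2 / d i := by
    intro J i
    rw [real_inner_smul_right, ← mul_sub, mul_pow, hs]; ring
  have e2 : ∀ i, (-(1/2) * l i * ((√(d i))⁻¹ * c i) ^ 2 + inner ℝ a ((√(d i))⁻¹ • F i) * l i * ((√(d i))⁻¹ * c i)
            - 1/2 * inner ℝ a ((√(d i))⁻¹ • F i) ^ 2 * l i) / (1 + l i) =
      (-(1/2) * c i ^ 2 + inner ℝ a (F i) * c i
            - 1/2 * inner ℝ a (F i) ^ 2) * (l i / (1 + l i)) / d i := by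
    intro i
    rw [real_inner_smul_right]
    have : ∀ A B C S : ℝ, -(1/2) * A * (S * C)^2 + S * B * A * (S * C) - 1/2 * (S * B)^2 * A =
        S^2 * (-(1/2) * A * C^2 + B * A * C - 1/2 * B^2 * A) := by intros; ring
    rw [this, hs]; ring
  simp only [e1, e2] at h
  exact h

/-- Gaussian field model with its scaled copy -/
structure Mod (N : ℕ) (E : Type) [NormedAddCommGroup E] [InnerProductSpace ℝ E]
    (K0 K1 K2 F P Q : ℝ → ℝ) where
  φ : VN N → E
  ψ : VN N → E
  T : VN N → (VN N →L[ℝ] E)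
  cφ : Continuous φ
  cψ : Continuous ψ
  cT : Continuous T
  hφ : ∀ x y, inner ℝ (φ x) (φ y) = inner ℝ x y ^ 2 * K0 (inner ℝ x y)
  hTφ : ∀ x v y, inner ℝ (T x v) (φ y) = inner ℝ x y * K1 (inner ℝ x y) * inner ℝ v y
  hTT : ∀ x v y w, inner ℝ (T x v) (T y w) = K2 (inner ℝ x y) * inner ℝ v y * inner ℝ x w
      + inner ℝ x y * K1 (inner ℝ x y) * inner ℝ v w
  hψψ : ∀ x y, inner ℝ (ψ x) (ψ y) = F (inner ℝ x y)
  hψφ : ∀ y x, inner ℝ (ψ y) (φ x) = P (inner ℝ x y)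
  hψT : ∀ y x v, inner ℝ (ψ y) (T x v) = Q (inner ℝ x y) * inner ℝ v y

variable {N : ℕ} {K0 K1 K2 F P Q : ℝ → ℝ}

def DDv (K0 K1 K2 : ℝ → ℝ) : ℝ := K0 1 * (K2 1 + K1 1) - K1 1 ^ 2

namespace Mod
variable (M : Mod N E K0 K1 K2 F P Q)

def d1 (u : ℝ) (n : VN N) (J : E) : ℝ := inner ℝ J (M.φ n) - √N * u
def d2 (x : ℝ) (n : VN N) (J : E) : ℝ := inner ℝ J (M.T n n) - √N * x
def adjT (n : VN N) (J : E) : VN N := (ContinuousLinearMap.adjoint (M.T n)) J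

lemma adjT_inner (n : VN N) (J : E) (v : VN N) : inner ℝ (M.adjT n J) v = inner ℝ J (M.T n v) :=
  ContinuousLinearMap.adjoint_inner_left _ _ _

def wExp (u x : ℝ) (n : VN N) (J : E) : ℝ :=
  (M.d1 u n J) ^ 2 / K0 1 + (M.d2 x n J - K1 1 / K0 1 * M.d1 u n J) ^ 2 * K0 1 / DDv K0 K1 K2
    + (‖M.adjT n J‖ ^ 2 - inner ℝ J (M.T n n) ^ 2) / K1 1

def wt (δ u x : ℝ) (n : VN N) (J : E) : ℝ≥0∞ := ee (-(1/2) * (1/δ^2) * M.wExp u x n J)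

def linF (u x : ℝ) (n : VN N) (h : E) : ℝ :=
  inner ℝ h (M.φ n) * u / K0 1 + (inner ℝ h (M.T n n) - K1 1 / K0 1 * inner ℝ h (M.φ n)) * (x - K1 1 / K0 1 * u) * K0 1 / DDv K0 K1 K2

def quadF (n : VN N) (h : E) : ℝ :=
  inner ℝ h (M.φ n) ^ 2 / K0 1 + (inner ℝ h (M.T n n) - K1 1 / K0 1 * inner ℝ h (M.φ n)) ^ 2 * K0 1 / DDv K0 K1 K2
   + (‖M.adjT n h‖ ^ 2 - inner ℝ h (M.T n n) ^ 2) / K1 1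

lemma adj_sum {ι : Type*} [Fintype ι] (b : OrthonormalBasis ι ℝ (VN N)) (n : VN N) (J : E) :
    ‖M.adjT n J‖ ^ 2 = ∑ i, inner ℝ J (M.T n (b i)) ^ 2 := by
  rw [← b.sum_sq_inner_left]
  refine Finset.sum_congr rfl fun i _ => ?_
  rw [adjT_inner]

variable (hg0 : 0 < K0 1) (hg1 : 0 < K1 1) (hD : 0 < DDv K0 K1 K2)
include hg0 hg1 hD

lemma single {δ : ℝ} (hδ : 0 < δ) (u x : ℝ) {n : VN N} (hn : ‖n‖ = 1) (h : E) :
    ∫⁻ J, M.wt δ u x n J * ee (inner ℝ J h) ∂(stdGaussian E)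
      = ee (-((N+1)/2) * Real.log (1 + 1/δ^2) + 1/2 * ‖h‖^2
        + (-(1/2) * N * Ksq (K0 1) (K1 1) (K2 1) u x + √N * M.linF u x n h - 1/2 * M.quadF n h) * (1/(1+δ^2))) := by
  obtain ⟨k, b, hb⟩ := exists_extend (orth1 hn)
  have hb0 : b (Sum.inl 0) = n := hb 0
  have hk : (k:ℝ) = N - 1 := by
    have := Module.finrank_eq_card_basis b.toBasis
    simp at this
    rw [this]; push_cast; ring
  have hnn : inner ℝ n n = (1:ℝ) := by rw [real_inner_self_eq_norm_sq, hn]; norm_num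
  have hbn : ∀ i, inner ℝ (b (Sum.inr i)) n = (0:ℝ) := by
    intro i; rw [← hb0, orthonormal_iff_ite.mp b.orthonormal]; simp
  have hnb : ∀ i, inner ℝ n (b (Sum.inr i)) = (0:ℝ) := by
    intro i; rw [real_inner_comm, hbn]
  have hbb : ∀ i j, inner ℝ (b (Sum.inr i)) (b (Sum.inr j)) = if i = j then (1:ℝ) else 0 := by
    intro i j; rw [orthonormal_iff_ite.mp b.orthonormal]; simp
  have hnbn : ∀ i, ‖b i‖ = 1 := fun i => b.orthonormal.1 i
  have AA : inner ℝ (M.φ n) (M.φ n) = K0 1 := by rw [M.hφ, hnn]; ring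
  have XA : inner ℝ (M.T n n) (M.φ n) = K1 1 := by rw [M.hTφ, hnn]; ring
  have AX : inner ℝ (M.φ n) (M.T n n) = K1 1 := by rw [real_inner_comm, XA]
  have XX : inner ℝ (M.T n n) (M.T n n) = K2 1 + K1 1 := by rw [M.hTT, hnn]; ring
  have TA : ∀ i, inner ℝ (M.T n (b (Sum.inr i))) (M.φ n) = (0:ℝ) := by intro i; rw [M.hTφ, hbn]; ring
  have TX : ∀ i, inner ℝ (M.T n (b (Sum.inr i))) (M.T n n) = (0:ℝ) := by intro i; rw [M.hTT, hbn]; ring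
  have AT : ∀ i, inner ℝ (M.φ n) (M.T n (b (Sum.inr i))) = (0:ℝ) := by intro i; rw [real_inner_comm, TA]
  have XT : ∀ i, inner ℝ (M.T n n) (M.T n (b (Sum.inr i))) = (0:ℝ) := by intro i; rw [real_inner_comm, TX]
  have TT : ∀ i j, inner ℝ (M.T n (b (Sum.inr i))) (M.T n (b (Sum.inr j))) = if i = j then K1 1 else 0 := by
    intro i j; rw [M.hTT, hbn, hbb, hnn]; split_ifs <;> ring
  let Fv : Fin 2 ⊕ Fin k → E := Sum.elim ![M.φ n, M.T n n - (K1 1 / K0 1) • M.φ n] (fun i => M.T n (b (Sum.inr i)))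
  let d : Fin 2 ⊕ Fin k → ℝ := Sum.elim ![K0 1, DDv K0 K1 K2 / K0 1] (fun _ => K1 1)
  let c : Fin 2 ⊕ Fin k → ℝ := Sum.elim ![√N * u, √N * (x - K1 1 / K0 1 * u)] (fun _ => 0)
  have hd : ∀ i, 0 < d i := by
    rintro (i | i)
    · fin_cases i
      · exact hg0
      · exact div_pos hD hg0
    · exact hg1
  have hF : ∀ i j, inner ℝ (Fv i) (Fv j) = if i = j then d i else 0 := by
    rintro (i | i) (j | j)
    · fin_cases i <;> fin_cases j
      · show inner ℝ (M.φ n) (M.φ n) = _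
        rw [AA]; simp [d]
      · show inner ℝ (M.φ n) (M.T n n - (K1 1 / K0 1) • M.φ n) = _
        rw [inner_sub_right, real_inner_smul_right, AA, AX]; simp; field_simp; ring
      · show inner ℝ (M.T n n - (K1 1 / K0 1) • M.φ n) (M.φ n) = _
        rw [inner_sub_left, real_inner_smul_left, AA, XA]; simp; field_simp; ring
      · show inner ℝ (M.T n n - (K1 1 / K0 1) • M.φ n) (M.T n n - (K1 1 / K0 1) • M.φ n) = _
        rw [inner_sub_left, inner_sub_right, inner_sub_right, real_inner_smul_left, real_inner_smul_left, real_inner_smul_right,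
          real_inner_smul_right, AA, XA, AX, XX]
        simp [d, DDv]; field_simp; ring
    · fin_cases i <;> simp [Fv, inner_sub_left, inner_smul_left, AT, XT]
    · fin_cases j <;> simp [Fv, inner_sub_right, inner_smul_right, TA, TX]
    · simp [Fv, d, TT]
  have hδ2 : 0 < δ^2 := by positivity
  have hL : -1 < 1/δ^2 := by have : 0 < 1/δ^2 := by positivity
                             linarith
  have key := lemmaG' hd hF (fun _ => 1/δ^2) c (fun _ => hL) h
  have e1 : ∀ J, M.wt δ u x n J * ee (inner ℝ J h) =
      ee ((∑ i, -(1/2) * (1/δ^2) * (inner ℝ J (Fv i) - c i) ^ 2 / d i) + inner ℝ J h) := by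
    intro J
    rw [wt, ← ee_add]; congr 2
    rw [Fintype.sum_sum_type, Fin.sum_univ_two, wExp, M.adj_sum b, Fintype.sum_sum_type]
    simp only [Finset.univ_unique, Finset.sum_singleton]
    have : b (Sum.inl default) = n := hb _
    rw [this]
    simp only [Fv, c, d, Sum.elim_inl, Sum.elim_inr, Matrix.cons_val_zero, Matrix.cons_val_one, d1, d2,
      inner_sub_right, inner_smul_right, sub_zero]
    rw [← Finset.sum_div, ← Finset.mul_sum]
    field_simp
    ring
  simp only [e1]
  rw [key]; congr 1
  have hLL : 1/δ^2/(1+1/δ^2) = 1/(1+δ^2) := by field_simp; ring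
  simp only [hLL]
  simp only [Fintype.sum_sum_type, Fin.sum_univ_two, Finset.sum_const, Finset.card_univ, Fintype.card_sum, Fintype.card_fin, nsmul_eq_mul, Nat.cast_add, Nat.cast_ofNat]
  rw [hk, linF, quadF, M.adj_sum b, Fintype.sum_sum_type]
  simp only [Finset.univ_unique, Finset.sum_singleton]
  have : b (Sum.inl default) = n := hb _
  rw [this]
  simp only [Fv, c, d, Sum.elim_inl, Sum.elim_inr, Matrix.cons_val_zero, Matrix.cons_val_one,
      inner_sub_right, inner_smul_right, sub_zero, mul_zero, add_zero, zero_sub, ne_eq, OfNat.ofNat_ne_zero,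
      not_false_eq_true, zero_pow]
  rw [← Finset.sum_div, ← Finset.sum_mul, Finset.sum_neg_distrib, ← Finset.mul_sum]
  generalize ∑ i : Fin k, inner ℝ h (M.T n (b (Sum.inr i))) ^ 2 = SS
  have hNs : (√(N:ℝ))^2 = N := Real.sq_sqrt (Nat.cast_nonneg _)
  have hKs : Ksq (K0 1) (K1 1) (K2 1) u x = u^2 / K0 1 + (x - K1 1 / K0 1 * u)^2 * K0 1 / DDv K0 K1 K2 := by
    unfold Ksq
    rw [show K0 1 * (K2 1 + K1 1) - K1 1 ^ 2 = DDv K0 K1 K2 from rfl]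
    rw [div_eq_iff hD.ne', add_mul, div_mul_cancel₀ _ hD.ne']
    unfold DDv
    field_simp; ring
  rw [hKs]
  simp only [mul_pow, hNs]
  generalize Real.log (1 + 1/δ^2) = LL
  generalize 1/(1+δ^2) = Y
  field_simp
  ring

end Mod
end modl

set_option linter.unusedSectionVars false
section modl2
variable {E : Type} [NormedAddCommGroup E] [InnerProductSpace ℝ E] [FiniteDimensional ℝ E]
  [MeasurableSpace E] [BorelSpace E]
variable {N : ℕ} {K0 K1 K2 F P Q : ℝ → ℝ}

lemma lin_sq {δ g p y : ℝ} (hδ : 0 < δ) (hg : 0 < g) :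
    -(1/2) * (1/δ^2) * (y^2 / g) ≤ p * y + 1/2 * δ^2 * g * p^2 := by
  have : p * y + 1/2 * δ^2 * g * p^2 + (1/2) * (1/δ^2) * (y^2 / g) = (δ^2 * g * p + y)^2 / (2 * δ^2 * g) := by
    field_simp; ring
  have h2 : 0 ≤ (δ^2 * g * p + y)^2 / (2 * δ^2 * g) := by positivity
  linarith

lemma lin_bound {δ g0 g1 g2 D a b S y1 y2 y3 m : ℝ} (hδ : 0 < δ) (hg0 : 0 < g0) (hg1 : 0 < g1)
    (hDD : D = g0 * (g2 + g1) - g1^2) (hD : 0 < D) :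
    -(1/2) * (1/δ^2) * (y1^2/g0 + (y2 - g1/g0*y1)^2 * g0 / D + y3^2/g1) ≤
      m * (a * y1 + b * y2 + S * y3) + 1/2 * m^2 * δ^2 * (sigSq g0 g1 g2 a b + g1 * S^2) := by
  have h1 := lin_sq (p := m * (a + b * g1/g0)) (y := y1) hδ hg0
  have h2 := lin_sq (p := m * b) (y := y2 - g1/g0*y1) hδ (div_pos hD hg0)
  have h3 := lin_sq (p := m * S) (y := y3) hδ hg1
  have e : (y2 - g1/g0*y1)^2 * g0 / D = (y2 - g1/g0*y1)^2 / (D/g0) := by field_simp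
  rw [e]
  refine le_trans (le_of_eq ?_) ((add_le_add (add_le_add h1 h2) h3).trans (le_of_eq ?_))
  · ring
  · unfold sigSq; subst hDD; field_simp; ring

lemma log_pair {δ μ : ℝ} (hδ : 0 < δ) (hμ : μ^2 < 1) (hp : 0 < 1 + μ) (hm : 0 < 1 - μ) :
    Real.log (1 + 1/δ^2 * (1+μ)) + Real.log (1 + 1/δ^2 * (1-μ)) = 2 * Real.log (1 + 1/δ^2) + Real.log (1 - μ^2/(1+δ^2)^2) := by
  have q1 : 0 < 1 + 1/δ^2 * (1+μ) := by positivity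
  have q2 : 0 < 1 + 1/δ^2 * (1-μ) := by positivity
  have q3 : 0 < 1 + 1/δ^2 := by positivity
  have q4 : 0 < 1 - μ^2/(1+δ^2)^2 := by
    have : μ^2/(1+δ^2)^2 < 1 := by
      rw [div_lt_one (by positivity)]
      have := sq_nonneg δ
      nlinarith [this]
    linarith
  rw [← Real.log_mul q1.ne' q2.ne']
  rw [show 2 * Real.log (1 + 1/δ^2) = Real.log ((1+1/δ^2)^2) by rw [Real.log_pow]; norm_num]
  rw [← Real.log_mul (by positivity) q4.ne']
  congr 1; field_simp; ring

namespace Mod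
variable (M : Mod N E K0 K1 K2 F P Q)
variable (hg0 : 0 < K0 1) (hg1 : 0 < K1 1) (hD : 0 < DDv K0 K1 K2)
include hg0 hg1 hD

set_option maxHeartbeats 1600000 in
lemma pairw {δ : ℝ} (hδ : 0 < δ) (u x : ℝ) {n v : VN N} (hnv : Orthonormal ℝ ![n, v]) {r s : ℝ}
    (hrs : r^2 + s^2 = 1) (hs : 0 < s) (hμ : (r * K1 r / K1 1)^2 < 1) (a b S : ℝ) :
    ∫⁻ J, M.wt δ u x n J * M.wt δ u x (r • n + s • v) J ∂(stdGaussian E)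
      ≤ ee ((N - 2) * (-Real.log (1 + 1/δ^2) - 1/2 * Real.log (1 - (r * K1 r / K1 1)^2/(1+δ^2)^2))
        + N * QQ (K0 1) (K1 1) (K2 1) (K0 r) (K1 r) (K2 r) δ r u x a b S) := by
  obtain ⟨k, B, hB⟩ := exists_extend hnv
  have hB0 : B (Sum.inl 0) = n := hB 0
  have hB1 : B (Sum.inl 1) = v := hB 1
  have hk : (k:ℝ) = N - 2 := by
    have := Module.finrank_eq_card_basis B.toBasis
    simp at this
    rw [this]; push_cast; ring
  obtain ⟨n', hn'⟩ : ∃ n', n' = r • n + s • v := ⟨_, rfl⟩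
  obtain ⟨v', hv'⟩ : ∃ v', v' = s • n - r • v := ⟨_, rfl⟩
  rw [← hn']
  obtain ⟨μ, hμd⟩ : ∃ μ, μ = r * K1 r / K1 1 := ⟨_, rfl⟩
  rw [← hμd] at hμ ⊢
  have hμg : r * K1 r = μ * K1 1 := by rw [hμd]; field_simp
  have ho := orthonormal_iff_ite.mp B.orthonormal
  have nn : inner ℝ n n = (1:ℝ) := by rw [← hB0, ho]; simp
  have vv : inner ℝ v v = (1:ℝ) := by rw [← hB1, ho]; simp
  have nv : inner ℝ n v = (0:ℝ) := by rw [← hB0, ← hB1, ho]; simp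
  have vn : inner ℝ v n = (0:ℝ) := by rw [real_inner_comm, nv]
  have bn : ∀ i, inner ℝ (B (Sum.inr i)) n = (0:ℝ) := by intro i; rw [← hB0, ho]; simp
  have bv : ∀ i, inner ℝ (B (Sum.inr i)) v = (0:ℝ) := by intro i; rw [← hB1, ho]; simp
  have nb : ∀ i, inner ℝ n (B (Sum.inr i)) = (0:ℝ) := by intro i; rw [real_inner_comm, bn]
  have vb : ∀ i, inner ℝ v (B (Sum.inr i)) = (0:ℝ) := by intro i; rw [real_inner_comm, bv]
  have bb : ∀ i j, inner ℝ (B (Sum.inr i)) (B (Sum.inr j)) = if i = j then (1:ℝ) else 0 := by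
    intro i j; rw [ho]; simp
  have nn' : inner ℝ n n' = r := by rw [hn', inner_add_right, real_inner_smul_right, real_inner_smul_right, nn, nv]; ring
  have n'n : inner ℝ n' n = r := by rw [real_inner_comm, nn']
  have vn' : inner ℝ v n' = s := by rw [hn', inner_add_right, real_inner_smul_right, real_inner_smul_right, vn, vv]; ring
  have n'v : inner ℝ n' v = s := by rw [real_inner_comm, vn']
  have nv' : inner ℝ n v' = s := by rw [hv', inner_sub_right, real_inner_smul_right, real_inner_smul_right, nn, nv]; ring
  have v'n : inner ℝ v' n = s := by rw [real_inner_comm, nv']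
  have vv' : inner ℝ v v' = -r := by rw [hv', inner_sub_right, real_inner_smul_right, real_inner_smul_right, vn, vv]; ring
  have n'n' : inner ℝ n' n' = (1:ℝ) := by
    nth_rw 1 [hn']; rw [inner_add_left, real_inner_smul_left, real_inner_smul_left, nn', vn']; linarith
  have v'v' : inner ℝ v' v' = (1:ℝ) := by
    nth_rw 1 [hv']; rw [inner_sub_left, real_inner_smul_left, real_inner_smul_left, nv', vv']; linarith
  have n'v' : inner ℝ n' v' = (0:ℝ) := by
    rw [hn', inner_add_left, real_inner_smul_left, real_inner_smul_left, nv', vv']; ring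
  have v'n' : inner ℝ v' n' = (0:ℝ) := by rw [real_inner_comm, n'v']
  have bn' : ∀ i, inner ℝ (B (Sum.inr i)) n' = (0:ℝ) := by
    intro i; rw [hn', inner_add_right, real_inner_smul_right, real_inner_smul_right, bn, bv]; ring
  have bv' : ∀ i, inner ℝ (B (Sum.inr i)) v' = (0:ℝ) := by
    intro i; rw [hv', inner_sub_right, real_inner_smul_right, real_inner_smul_right, bn, bv]; ring
  have n'b : ∀ i, inner ℝ n' (B (Sum.inr i)) = (0:ℝ) := by intro i; rw [real_inner_comm, bn']
  have v'b : ∀ i, inner ℝ v' (B (Sum.inr i)) = (0:ℝ) := by intro i; rw [real_inner_comm, bv']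
  -- expansion of wExp
  have hw : ∀ J, M.wExp u x n J = ((M.d1 u n J) ^ 2 / K0 1 + (M.d2 x n J - K1 1 / K0 1 * M.d1 u n J) ^ 2 * K0 1 / DDv K0 K1 K2
      + (inner ℝ J (M.T n v))^2 / K1 1) + (∑ i, inner ℝ J (M.T n (B (Sum.inr i))) ^ 2) / K1 1 := by
    intro J
    rw [wExp, M.adj_sum B, Fintype.sum_sum_type, Fin.sum_univ_two, hB0, hB1]; ring
  have hw' : ∀ J, M.wExp u x n' J = ((M.d1 u n' J) ^ 2 / K0 1 + (M.d2 x n' J - K1 1 / K0 1 * M.d1 u n' J) ^ 2 * K0 1 / DDv K0 K1 K2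
      + (inner ℝ J (M.T n' v'))^2 / K1 1) + (∑ i, inner ℝ J (M.T n' (B (Sum.inr i))) ^ 2) / K1 1 := by
    intro J
    rw [wExp, M.adj_sum B, Fintype.sum_sum_type, Fin.sum_univ_two, hB0, hB1]
    have e1 : M.T n' n' = r • M.T n' n + s • M.T n' v := by
      conv_lhs => rw [show M.T n' n' = M.T n' (r • n + s • v) by rw [← hn']]
      simp
    have e2 : M.T n' v' = s • M.T n' n - r • M.T n' v := by rw [hv']; simp
    have e3 : inner ℝ J (M.T n' n) ^ 2 + inner ℝ J (M.T n' v) ^ 2 = inner ℝ J (M.T n' n')^2 + inner ℝ J (M.T n' v') ^ 2 := by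
      rw [e1, e2, inner_add_right, inner_sub_right, real_inner_smul_right, real_inner_smul_right, real_inner_smul_right, real_inner_smul_right]
      linear_combination (-(inner ℝ J (M.T n' n) ^ 2 + inner ℝ J (M.T n' v) ^ 2)) * hrs
    rw [e3]; ring
  -- the linear functional
  obtain ⟨ℓ, hℓ⟩ : ∃ ℓ, ℓ = a • M.φ n + b • M.T n n + S • M.T n v := ⟨_, rfl⟩
  obtain ⟨ℓ', hℓ'⟩ : ∃ ℓ', ℓ' = a • M.φ n' + b • M.T n' n' + S • M.T n' v' := ⟨_, rfl⟩
  have hNs : (√(N:ℝ))^2 = N := Real.sq_sqrt (Nat.cast_nonneg _)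
  have hNs' : (√(N:ℝ))*√(N:ℝ) = N := Real.mul_self_sqrt (Nat.cast_nonneg _)
  obtain ⟨Cc, hCc⟩ : ∃ Cc, Cc = - N * (a * u + b * x) + 1/2 * N * δ^2 * (sigSq (K0 1) (K1 1) (K2 1) a b + K1 1 * S^2) := ⟨_, rfl⟩
  have hb : ∀ J, -(1/2) * (1/δ^2) * M.wExp u x n J ≤ √N * inner ℝ J ℓ + Cc
      + -(1/2) * (1/δ^2) * (∑ i, inner ℝ J (M.T n (B (Sum.inr i))) ^ 2) / K1 1 := by
    intro J
    have := lin_bound (a := a) (b := b) (S := S) (y1 := M.d1 u n J) (y2 := M.d2 x n J) (y3 := inner ℝ J (M.T n v)) (m := √N) (g2 := K2 1)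
      hδ hg0 hg1 rfl hD
    rw [hw, mul_add]
    rw [show K0 1 * (K2 1 + K1 1) - K1 1 ^ 2 = DDv K0 K1 K2 from rfl, hNs] at this
    have e : √N * (a * M.d1 u n J + b * M.d2 x n J + S * inner ℝ J (M.T n v)) = √N * inner ℝ J ℓ - N * (a * u + b * x) := by
      rw [hℓ, inner_add_right, inner_add_right, real_inner_smul_right, real_inner_smul_right, real_inner_smul_right, d1, d2]
      linear_combination (-(a * u + b * x)) * hNs'
    rw [e] at this
    rw [hCc, mul_div_assoc (-(1/2) * (1/δ^2))]
    linarith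
  have hb' : ∀ J, -(1/2) * (1/δ^2) * M.wExp u x n' J ≤ √N * inner ℝ J ℓ' + Cc
      + -(1/2) * (1/δ^2) * (∑ i, inner ℝ J (M.T n' (B (Sum.inr i))) ^ 2) / K1 1 := by
    intro J
    have := lin_bound (a := a) (b := b) (S := S) (y1 := M.d1 u n' J) (y2 := M.d2 x n' J) (y3 := inner ℝ J (M.T n' v')) (m := √N) (g2 := K2 1)
      hδ hg0 hg1 rfl hD
    rw [hw', mul_add]
    rw [show K0 1 * (K2 1 + K1 1) - K1 1 ^ 2 = DDv K0 K1 K2 from rfl, hNs] at this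
    have e : √N * (a * M.d1 u n' J + b * M.d2 x n' J + S * inner ℝ J (M.T n' v')) = √N * inner ℝ J ℓ' - N * (a * u + b * x) := by
      rw [hℓ', inner_add_right, inner_add_right, real_inner_smul_right, real_inner_smul_right, real_inner_smul_right, d1, d2]
      linear_combination (-(a * u + b * x)) * hNs'
    rw [e] at this
    rw [hCc, mul_div_assoc (-(1/2) * (1/δ^2))]
    linarith
  -- orthogonal family
  let Fv : Fin k ⊕ Fin k → E := Sum.elim (fun i => M.T n (B (Sum.inr i)) + M.T n' (B (Sum.inr i)))
    (fun i => M.T n (B (Sum.inr i)) - M.T n' (B (Sum.inr i)))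
  let d : Fin k ⊕ Fin k → ℝ := Sum.elim (fun _ => 2 * K1 1 * (1 + μ)) (fun _ => 2 * K1 1 * (1 - μ))
  let l : Fin k ⊕ Fin k → ℝ := Sum.elim (fun _ => (1/δ^2) * (1 + μ)) (fun _ => (1/δ^2) * (1 - μ))
  have hμ' := abs_lt.mp ((sq_lt_one_iff_abs_lt_one μ).mp hμ)
  have hp : 0 < 1 + μ := by linarith
  have hm : 0 < 1 - μ := by linarith
  have hd : ∀ i, 0 < d i := by
    rintro (i | i)
    · show 0 < 2 * K1 1 * (1 + μ); positivity
    · show 0 < 2 * K1 1 * (1 - μ); positivity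
  have hl : ∀ i, -1 < l i := by
    rintro (i | i)
    · show -1 < (1/δ^2) * (1 + μ)
      have : 0 < (1/δ^2) * (1 + μ) := by positivity
      linarith
    · show -1 < (1/δ^2) * (1 - μ)
      have : 0 < (1/δ^2) * (1 - μ) := by positivity
      linarith
  have TT : ∀ i j, inner ℝ (M.T n (B (Sum.inr i))) (M.T n (B (Sum.inr j))) = if i = j then K1 1 else 0 := by
    intro i j; rw [M.hTT, bn, bb, nn]; split_ifs <;> ring
  have T'T' : ∀ i j, inner ℝ (M.T n' (B (Sum.inr i))) (M.T n' (B (Sum.inr j))) = if i = j then K1 1 else 0 := by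
    intro i j; rw [M.hTT, bn', bb, n'n']; split_ifs <;> ring
  have TT' : ∀ i j, inner ℝ (M.T n (B (Sum.inr i))) (M.T n' (B (Sum.inr j))) = if i = j then μ * K1 1 else 0 := by
    intro i j; rw [M.hTT, bn', bb, nn', hμg]; split_ifs <;> ring
  have T'T : ∀ i j, inner ℝ (M.T n' (B (Sum.inr i))) (M.T n (B (Sum.inr j))) = if i = j then μ * K1 1 else 0 := by
    intro i j; rw [M.hTT, bn, bb, n'n, hμg]; split_ifs <;> ring
  have hF : ∀ i j, inner ℝ (Fv i) (Fv j) = if i = j then d i else 0 := by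
    rintro (i | i) (j | j) <;> simp only [Fv, d, Sum.elim_inl, Sum.elim_inr, inner_add_left, inner_add_right, inner_sub_left, inner_sub_right,
      TT, T'T', TT', T'T, Sum.inl.injEq, Sum.inr.injEq, reduceCtorEq, if_false] <;> split_ifs <;> ring
  have hFl : ∀ i, inner ℝ (√(N:ℝ) • (ℓ + ℓ')) (Fv i) = (0:ℝ) := by
    have h1 : ∀ i, inner ℝ ℓ (M.T n (B (Sum.inr i))) = (0:ℝ) := by
      intro i
      rw [real_inner_comm, hℓ, inner_add_right, inner_add_right, real_inner_smul_right, real_inner_smul_right, real_inner_smul_right,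
        M.hTφ, M.hTT, M.hTT, bn, bv]; ring
    have h2 : ∀ i, inner ℝ ℓ (M.T n' (B (Sum.inr i))) = (0:ℝ) := by
      intro i
      rw [real_inner_comm, hℓ, inner_add_right, inner_add_right, real_inner_smul_right, real_inner_smul_right, real_inner_smul_right,
        M.hTφ, M.hTT, M.hTT, bn, bv]; ring
    have h3 : ∀ i, inner ℝ ℓ' (M.T n (B (Sum.inr i))) = (0:ℝ) := by
      intro i
      rw [real_inner_comm, hℓ', inner_add_right, inner_add_right, real_inner_smul_right, real_inner_smul_right, real_inner_smul_right,
        M.hTφ, M.hTT, M.hTT, bn', bv']; ring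
    have h4 : ∀ i, inner ℝ ℓ' (M.T n' (B (Sum.inr i))) = (0:ℝ) := by
      intro i
      rw [real_inner_comm, hℓ', inner_add_right, inner_add_right, real_inner_smul_right, real_inner_smul_right, real_inner_smul_right,
        M.hTφ, M.hTT, M.hTT, bn', bv']; ring
    rintro (i | i) <;> simp only [Fv, Sum.elim_inl, Sum.elim_inr, real_inner_smul_left, inner_add_left, inner_add_right, inner_sub_right, h1, h2, h3, h4] <;> ring
  have key := lemmaG' hd hF l (fun _ => 0) hl (√(N:ℝ) • (ℓ + ℓ'))
  have pw : ∀ J, M.wt δ u x n J * M.wt δ u x n' J ≤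
      ee (2 * Cc) * ee ((∑ i, -(1/2) * l i * (inner ℝ J (Fv i) - 0) ^ 2 / d i) + inner ℝ J (√(N:ℝ) • (ℓ + ℓ'))) := by
    intro J
    rw [wt, wt, ← ee_add, ← ee_add]
    refine ee_mono ((add_le_add (hb J) (hb' J)).trans (le_of_eq ?_))
    rw [real_inner_smul_right, inner_add_right, Fintype.sum_sum_type, ← Finset.sum_add_distrib]
    simp only [Fv, l, d, Sum.elim_inl, Sum.elim_inr, inner_add_right, inner_sub_right, sub_zero]
    have e : ∀ i, -(1/2) * (1/δ^2 * (1 + μ)) * (inner ℝ J (M.T n (B (Sum.inr i))) + inner ℝ J (M.T n' (B (Sum.inr i))))^2 / (2 * K1 1 * (1 + μ))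
        + -(1/2) * (1/δ^2 * (1 - μ)) * (inner ℝ J (M.T n (B (Sum.inr i))) - inner ℝ J (M.T n' (B (Sum.inr i))))^2 / (2 * K1 1 * (1 - μ))
        = -(1/2) * (1/δ^2) / K1 1 * (inner ℝ J (M.T n (B (Sum.inr i)))^2 + inner ℝ J (M.T n' (B (Sum.inr i)))^2) := by
      intro i; field_simp; ring
    simp only [e]
    rw [← Finset.mul_sum, Finset.sum_add_distrib]; ring
  refine (lintegral_mono pw).trans ?_
  rw [lintegral_const_mul' _ _ (ee_ne_top _), key, ← ee_add]
  refine ee_mono (le_of_eq ?_)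
  have hnorm : ‖√(N:ℝ) • (ℓ + ℓ')‖^2 = N * (2 * (sigSq (K0 1) (K1 1) (K2 1) a b + K1 1 * S^2)
      + 2 * (r ^ 2 * sigSq (K0 r) (K1 r) (K2 r) a b
    + 2 * S * s * (r * (a * K1 r + b * (K2 r + K1 r)))
    + S ^ 2 * (K2 r * s^2 - r ^ 2 * K1 r))) := by
    rw [norm_smul, mul_pow, Real.norm_eq_abs, sq_abs, hNs]
    congr 1
    rw [← real_inner_self_eq_norm_sq, hℓ, hℓ']
    simp only [inner_add_left, inner_add_right, real_inner_smul_left, real_inner_smul_right]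
    have hA1 : ∀ x v y, inner ℝ (M.φ y) (M.T x v) = inner ℝ x y * K1 (inner ℝ x y) * inner ℝ v y := by
      intro x v y; rw [real_inner_comm, M.hTφ]
    simp only [M.hφ, M.hTφ, M.hTT, hA1]
    simp only [nn, vv, nv, vn, nn', n'n, vn', n'v, nv', v'n, vv', n'n', v'v', n'v', v'n', real_inner_comm v v']
    unfold sigSq
    ring
  rw [hnorm]
  have hsum : ∑ i, -(1/2) * Real.log (1 + l i) = (N - 2) * (-Real.log (1 + 1/δ^2) - 1/2 * Real.log (1 - μ^2/(1+δ^2)^2)) := by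
    rw [Fintype.sum_sum_type]
    simp only [l, Sum.elim_inl, Sum.elim_inr, Finset.sum_const, Finset.card_univ, Fintype.card_fin, nsmul_eq_mul]
    rw [hk]
    have e := log_pair hδ hμ hp hm
    linear_combination (-(1/2) * ((N:ℝ)-2)) * e
  rw [hsum]
  have hz : ∑ i, (-(1/2) * (0:ℝ) ^ 2 + inner ℝ (√(N:ℝ) • (ℓ + ℓ')) (Fv i) * 0
            - 1/2 * inner ℝ (√(N:ℝ) • (ℓ + ℓ')) (Fv i) ^ 2) * (l i / (1 + l i)) / d i = 0 := by
    refine Finset.sum_eq_zero fun i _ => ?_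
    rw [hFl]; simp
  rw [hz, hCc]
  have hs1 : 1 - r^2 = s^2 := by linarith
  unfold QQ
  rw [hs1, Real.sqrt_sq hs.le]
  ring

end Mod
end modl2

set_option linter.unusedSectionVars false
section modl3
variable {E : Type} [NormedAddCommGroup E] [InnerProductSpace ℝ E] [FiniteDimensional ℝ E]
  [MeasurableSpace E] [BorelSpace E]
variable {N : ℕ} {K0 K1 K2 F P Q : ℝ → ℝ}

def lw (N : ℕ) (δ K : ℝ) : ℝ := -((N+1)/2) * Real.log (1 + 1/δ^2) - 1/2 * N * K * (1/(1+δ^2))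

lemma log_QF_bound {N : ℕ} (hN : 1 ≤ N) {r t0 m : ℝ} (hr : r^2 ≤ 1) (ht0 : 0 < t0) (h1 : 1 - r^2 ≤ m) (h2 : t0 ≤ m) :
    - (N/2) * Real.log m ≤ 1/(2*t0) - (N/2) * Real.log (1 - (1 - 1/N) * r^2) := by
  have hN' : (0:ℝ) < N := by exact_mod_cast hN
  have hN1 : (1:ℝ) ≤ N := by exact_mod_cast hN
  have hm : 0 < m := ht0.trans_le h2
  have hq : 0 < 1 - (1 - 1/N) * r^2 := by
    have h3 : 1/(N:ℝ) ≤ 1 := by rw [div_le_one hN']; exact hN1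
    have h4 : 0 < 1/(N:ℝ) := by positivity
    nlinarith [mul_le_mul_of_nonneg_left hr (by linarith : 0 ≤ 1 - 1/(N:ℝ))]
  have hle : 1 - (1 - 1/N) * r^2 ≤ m * (1 + 1/(N*t0)) := by
    have : 1/N * r^2 ≤ m * (1/(N*t0)) := by
      have h5 : 1/N * r^2 ≤ 1/(N:ℝ) := by
        have : 0 < 1/(N:ℝ) := by positivity
        nlinarith
      have h6 : t0 * (1/(N*t0)) = 1/(N:ℝ) := by field_simp
      have h7 : t0 * (1/(N*t0)) ≤ m * (1/(N*t0)) := by gcongr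
      linarith
    linarith
  have hlog : Real.log (1 - (1 - 1/N) * r^2) ≤ Real.log m + 1/(N*t0) := by
    refine (Real.log_le_log hq hle).trans ?_
    have hp : 0 < 1/(N*t0) := by positivity
    rw [Real.log_mul hm.ne' (by positivity)]
    have := Real.log_le_sub_one_of_pos (show 0 < 1 + 1/(N*t0) by positivity)
    linarith
  have := mul_le_mul_of_nonneg_left hlog (by positivity : (0:ℝ) ≤ N/2)
  have e : (N:ℝ)/2 * (1/(N*t0)) = 1/(2*t0) := by field_simp
  rw [mul_add, e] at this
  linarith

lemma QF_one {n : VN N} (s : ℝ) (t : Metric.sphere (0 : VN N) 1) :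
    QF (fun _ : Fin 1 => n) (fun _ => s) (t : VN N) = 1 - s * inner ℝ (t : VN N) n ^ 2 := by
  unfold QF
  have : ‖(t : VN N)‖ = 1 := by simpa using t.2
  rw [this]; simp

lemma inner_sq_le {n m : VN N} (hn : ‖n‖ = 1) (hm : ‖m‖ = 1) : (inner ℝ n m : ℝ)^2 ≤ 1 := by
  have := abs_real_inner_le_norm n m
  rw [hn, hm] at this
  rw [← sq_abs]
  have h0 := abs_nonneg (inner ℝ n m : ℝ)
  nlinarith

lemma decomp {n m : VN N} (hn : ‖n‖ = 1) (hm : ‖m‖ = 1) (h : (inner ℝ n m : ℝ)^2 < 1) :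
    ∃ (s : ℝ) (v : VN N), 0 < s ∧ inner ℝ n m ^ 2 + s ^ 2 = 1 ∧ Orthonormal ℝ ![n, v] ∧ m = (inner ℝ n m : ℝ) • n + s • v := by
  obtain ⟨r, hr⟩ : ∃ r : ℝ, r = inner ℝ n m := ⟨_, rfl⟩
  rw [← hr] at h ⊢
  have hs : 0 < √(1 - r^2) := Real.sqrt_pos.mpr (by linarith)
  have hss : √(1 - r^2) ^ 2 = 1 - r^2 := Real.sq_sqrt (by linarith)
  have hnn : inner ℝ n n = (1:ℝ) := by rw [real_inner_self_eq_norm_sq, hn]; norm_num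
  have hmm : inner ℝ m m = (1:ℝ) := by rw [real_inner_self_eq_norm_sq, hm]; norm_num
  have hmn : inner ℝ m n = r := by rw [real_inner_comm, hr]
  refine ⟨√(1 - r^2), (√(1 - r^2))⁻¹ • (m - r • n), hs, by rw [hss]; ring, ?_, ?_⟩
  · have e0 : inner ℝ n ((√(1 - r^2))⁻¹ • (m - r • n)) = (0:ℝ) := by
      rw [real_inner_smul_right, inner_sub_right, real_inner_smul_right, hnn, ← hr]; ring
    have e1 : inner ℝ ((√(1 - r^2))⁻¹ • (m - r • n)) ((√(1 - r^2))⁻¹ • (m - r • n)) = (1:ℝ) := by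
      rw [real_inner_smul_right, real_inner_smul_left, inner_sub_right, inner_sub_left, inner_sub_left, real_inner_smul_right, real_inner_smul_right,
        real_inner_smul_left, real_inner_smul_left, hnn, hmm, hmn, ← hr]
      have : (√(1 - r^2))⁻¹ * (√(1 - r^2))⁻¹ = (1 - r^2)⁻¹ := by rw [← mul_inv, ← sq, hss]
      rw [← mul_assoc, this]
      have : 1 - r^2 ≠ 0 := by linarith
      field_simp; ring
    rw [orthonormal_iff_ite]
    intro i j
    fin_cases i <;> fin_cases j
    · exact hnn
    · exact e0
    · show inner ℝ ((√(1 - r^2))⁻¹ • (m - r • n)) n = (0:ℝ)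
      rw [real_inner_comm]; exact e0
    · exact e1
  · rw [smul_smul, mul_inv_cancel₀ hs.ne', one_smul]; abel

namespace Mod
variable (M : Mod N E K0 K1 K2 F P Q)
variable (hg0 : 0 < K0 1) (hg1 : 0 < K1 1) (hD : 0 < DDv K0 K1 K2)

include hg0 hg1 hD
lemma single0 {δ : ℝ} (hδ : 0 < δ) (u x : ℝ) {n : VN N} (hn : ‖n‖ = 1) :
    ∫⁻ J, M.wt δ u x n J ∂(stdGaussian E) = ee (lw N δ (Ksq (K0 1) (K1 1) (K2 1) u x)) := by
  have := M.single hg0 hg1 hD hδ u x hn 0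
  simp only [inner_zero_right, ee_zero, mul_one] at this
  rw [this]
  congr 1
  simp only [lw, linF, quadF, adjT, map_zero, norm_zero, inner_zero_left]; ring

lemma wt_le_one {δ : ℝ} (u x : ℝ) {n : VN N} (hn : ‖n‖ = 1) (J : E) : M.wt δ u x n J ≤ 1 := by
  refine ee_le_one ?_
  have h1 : inner ℝ J (M.T n n) ^ 2 ≤ ‖M.adjT n J‖^2 := by
    rw [← M.adjT_inner]
    have := abs_real_inner_le_norm (M.adjT n J) n
    rw [hn, mul_one] at this
    rw [← sq_abs]
    gcongr
  have : 0 ≤ M.wExp u x n J := by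
    unfold wExp
    have : 0 ≤ ‖M.adjT n J‖^2 - inner ℝ J (M.T n n) ^ 2 := by linarith
    positivity
  have h2 : 0 ≤ 1/δ^2 := by positivity
  nlinarith [mul_nonneg h2 this]

lemma pair_bd {δ : ℝ} (hδ : 0 < δ) {u x η : ℝ} (hη : 0 ≤ η)
    (hK : 0 ≤ Ksq (K0 1) (K1 1) (K2 1) u x)
    (hμ : ∀ r ∈ Ioo (-1:ℝ) 1, (r * K1 r / K1 1)^2 < 1)
    (hFF : ∀ r ∈ Ioo (-1:ℝ) 1, ∃ a b S, FF (K0 1) (K1 1) (K2 1) (K0 r) (K1 r) (K2 r) δ r u x a b S ≤ η)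
    {n m : VN N} (hn : ‖n‖ = 1) (hm : ‖m‖ = 1) :
    ∫⁻ J, M.wt δ u x n J * M.wt δ u x m J ∂(stdGaussian E) ≤
      ee (2 * lw N δ (Ksq (K0 1) (K1 1) (K2 1) u x) + 3 * Real.log (1 + 1/δ^2) + N * η
        - (N/2) * Real.log (max (1 - (inner ℝ n m : ℝ)^2) (rexp (-Real.log (1 + 1/δ^2) - Ksq (K0 1) (K1 1) (K2 1) u x)))) := by
  obtain ⟨K, hKd⟩ : ∃ K, K = Ksq (K0 1) (K1 1) (K2 1) u x := ⟨_, rfl⟩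
  obtain ⟨L, hL⟩ : ∃ L, L = Real.log (1 + 1/δ^2) := ⟨_, rfl⟩
  have hL0 : 0 ≤ L := by rw [hL]; exact Real.log_nonneg (by have : 0 < 1/δ^2 := by positivity
                                                            linarith)
  have hN0 : (0:ℝ) ≤ N := Nat.cast_nonneg N
  have hd1 : 0 < 1/(1+δ^2) := by positivity
  have hd2 : 1/(1+δ^2) ≤ 1 := by rw [div_le_one (by positivity)]; linarith [sq_nonneg δ]
  rw [← hKd] at hK ⊢
  rw [← hL]
  rcases lt_or_ge (1 - (inner ℝ n m : ℝ)^2) (rexp (-L - K)) with hc | hc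
  · rw [max_eq_right hc.le, Real.log_exp]
    calc _ ≤ ∫⁻ J, M.wt δ u x n J * 1 ∂(stdGaussian E) := by
          refine lintegral_mono fun J => mul_le_mul' le_rfl (M.wt_le_one hg0 hg1 hD u x hm J)
      _ = ee (lw N δ K) := by simp only [mul_one]; rw [M.single0 hg0 hg1 hD hδ u x hn, hKd]
      _ ≤ _ := by
          refine ee_mono ?_
          unfold lw; rw [← hL]
          have h1 : N * K * (1/(1+δ^2)) ≤ N * K := mul_le_of_le_one_right (by positivity) hd2
          have h2 : 0 ≤ N * η := by positivity
          nlinarith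
  · rw [max_eq_left hc]
    have hpos : 0 < 1 - (inner ℝ n m : ℝ)^2 := (Real.exp_pos _).trans_le hc
    obtain ⟨s, v, hs, hrs, hnv, hmv⟩ := decomp hn hm (by linarith)
    obtain ⟨r, hr⟩ : ∃ r : ℝ, r = inner ℝ n m := ⟨_, rfl⟩
    rw [← hr] at hc hpos hrs hmv ⊢
    have hrI : r ∈ Ioo (-1:ℝ) 1 := by
      have := abs_lt.mp ((sq_lt_one_iff_abs_lt_one r).mp (by linarith))
      exact ⟨this.1, this.2⟩
    obtain ⟨a, b, S, hF⟩ := hFF r hrI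
    nth_rw 1 [hmv]
    refine (M.pairw hg0 hg1 hD hδ u x hnv hrs hs (hμ r hrI) a b S).trans (ee_mono ?_)
    unfold FF at hF
    rw [← hKd] at hF
    rw [← hL]
    have hlog : Real.log (1 - (r * K1 r / K1 1)^2/(1+δ^2)^2) ≤ 0 := by
      refine Real.log_nonpos ?_ ?_
      · have := hμ r hrI
        have h3 : (r * K1 r / K1 1)^2/(1+δ^2)^2 ≤ (r * K1 r / K1 1)^2 := by
          refine div_le_self (sq_nonneg _) ?_
          have := sq_nonneg δ
          nlinarith
        linarith
      · have : 0 ≤ (r * K1 r / K1 1)^2/(1+δ^2)^2 := by positivity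
        linarith
    generalize Real.log (1 - (r * K1 r / K1 1)^2/(1+δ^2)^2) = A at *
    generalize QQ (K0 1) (K1 1) (K2 1) (K0 r) (K1 r) (K2 r) δ r u x a b S = q at *
    have h1 := mul_le_mul_of_nonneg_left hF hN0
    have h2 : N * K * (1/(1+δ^2)) ≤ N * K := mul_le_of_le_one_right (by positivity) hd2
    unfold lw; rw [← hL]
    generalize Real.log (1 - r^2) = A' at *
    nlinarith

lemma pair_int (hN : 1 ≤ N) {δ : ℝ} (hδ : 0 < δ) {u x η : ℝ} (hη : 0 ≤ η)
    (hK : 0 ≤ Ksq (K0 1) (K1 1) (K2 1) u x)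
    (hμ : ∀ r ∈ Ioo (-1:ℝ) 1, (r * K1 r / K1 1)^2 < 1)
    (hFF : ∀ r ∈ Ioo (-1:ℝ) 1, ∃ a b S, FF (K0 1) (K1 1) (K2 1) (K0 r) (K1 r) (K2 r) δ r u x a b S ≤ η)
    {n : VN N} (hn : ‖n‖ = 1) :
    ∫⁻ m, ∫⁻ J, M.wt δ u x n J * M.wt δ u x (m : VN N) J ∂(stdGaussian E) ∂(unifSphere N) ≤
      ee (2 * lw N δ (Ksq (K0 1) (K1 1) (K2 1) u x) + 3 * Real.log (1 + 1/δ^2) + N * η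
        + 1/(2 * rexp (-Real.log (1 + 1/δ^2) - Ksq (K0 1) (K1 1) (K2 1) u x)) + 1/2 * Real.log N) := by
  have hN' : (0:ℝ) < N := by exact_mod_cast hN
  have h := pair_law hN (orth1 hn) (s := fun _ => 1 - 1/(N:ℝ)) (fun _ => sub_lt_self _ (by positivity))
    (fun m => ∫⁻ J, M.wt δ u x n J * M.wt δ u x (m : VN N) J ∂(stdGaussian E))
    (2 * lw N δ (Ksq (K0 1) (K1 1) (K2 1) u x) + 3 * Real.log (1 + 1/δ^2) + N * η
        + 1/(2 * rexp (-Real.log (1 + 1/δ^2) - Ksq (K0 1) (K1 1) (K2 1) u x))) (by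
      intro t
      have ht : ‖(t : VN N)‖ = 1 := by simpa using t.2
      refine (M.pair_bd hg0 hg1 hD hδ hη hK hμ hFF hn ht).trans (ee_mono ?_)
      rw [QF_one, real_inner_comm n (t : VN N)]
      have := log_QF_bound hN (inner_sq_le hn ht) (Real.exp_pos (-Real.log (1 + 1/δ^2) - Ksq (K0 1) (K1 1) (K2 1) u x)) (le_max_left _ _) (le_max_right _ _)
      linarith)
  refine h.trans (ee_mono (le_of_eq ?_))
  simp

end Mod
end modl3

lemma ee_half : ee (-Real.log 2) = 2⁻¹ := by
  unfold ee; rw [Real.exp_neg, Real.exp_log (by norm_num), ENNReal.ofReal_inv_of_pos (by norm_num)]; norm_num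

lemma half2 {T X : ℝ≥0∞} (hT : T ≠ ⊤) (h : T ≤ X + T * ee (-Real.log 2)) : T * ee (-Real.log 2) ≤ X := by
  rw [ee_half] at *
  have e : T * 2⁻¹ + T * 2⁻¹ = T := by
    rw [← mul_add, ENNReal.inv_two_add_inv_two, mul_one]
  have h2 : T * 2⁻¹ + T * 2⁻¹ ≤ X + T * 2⁻¹ := by rw [e]; exact h
  exact (ENNReal.add_le_add_iff_right (ENNReal.mul_ne_top hT (by simp))).mp h2

lemma cs_set {α : Type*} [MeasurableSpace α] (μ : Measure α) {B : α → ℝ≥0∞} (hB : Measurable B) {G : Set α}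
    (hG : MeasurableSet G) : (∫⁻ a in G, B a ∂μ)^2 ≤ μ G * ∫⁻ a, B a ^ 2 ∂μ := by
  have h := ENNReal.lintegral_mul_le_Lp_mul_Lq (p := 2) (q := 2) (μ.restrict G) (by constructor <;> norm_num)
    (f := B) (g := fun _ => 1) hB.aemeasurable aemeasurable_const
  simp only [Pi.mul_apply, mul_one, ENNReal.one_rpow, lintegral_one, Measure.restrict_apply_univ] at h
  have h2 := pow_le_pow_left₀ zero_le h 2
  refine h2.trans ?_
  rw [mul_pow, ← ENNReal.rpow_natCast, ← ENNReal.rpow_natCast, ← ENNReal.rpow_mul, ← ENNReal.rpow_mul]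
  norm_num
  rw [mul_comm]
  gcongr
  exact Measure.restrict_le_self

lemma ee_le_of_mul {a b : ℝ} {X : ℝ≥0∞} (h : ee a ≤ X * ee b) : ee (a - b) ≤ X := by
  have := mul_le_mul_left h (ee (-b))
  rw [mul_assoc, ee_mul_neg, mul_one, ← ee_add] at this
  rw [sub_eq_add_neg]; exact this

lemma abs_smm {α S : Type*} [MeasurableSpace α] [MeasurableSpace S] (μ : Measure α) [SFinite μ]
    (σ : Measure S) [IsProbabilityMeasure σ] {w g : S → α → ℝ≥0∞} (hw : Measurable (Function.uncurry w))
    (hg : Measurable (Function.uncurry g)) {A : S → Set S} {l b X1 X2 : ℝ}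
    (h1 : ∀ n, ∫⁻ J, w n J ∂μ = ee l)
    (h2 : ∀ n, ee (l + b) ≤ ∫⁻ τ in A n, ∫⁻ J, w n J * g τ J ∂μ ∂σ)
    (h3 : ∀ n, ∫⁻ τ in A n, ∫⁻ τ' in A n, ∫⁻ J, w n J * (g τ J * g τ' J) ∂μ ∂σ ∂σ ≤ ee (l + 2 * b + X1))
    (h4 : ∀ n, ∫⁻ m, ∫⁻ J, w n J * w m J ∂μ ∂σ ≤ ee (2 * l + X2)) :
    ee (-2 * X1 - X2 - 4 * Real.log 2) ≤ μ {J | ee (b - Real.log 2) ≤ ∫⁻ τ, g τ J ∂σ} := by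
  have hw1 : ∀ n, Measurable (w n) := fun n => hw.comp measurable_prodMk_left
  have hg1 : ∀ n, Measurable (g n) := fun n => hg.comp measurable_prodMk_left
  have hZ : Measurable (fun J => ∫⁻ τ, g τ J ∂σ) := hg.lintegral_prod_left'
  have hB : ∀ n, Measurable (fun J => ∫⁻ τ in A n, g τ J ∂σ) := fun n => hg.lintegral_prod_left'
  have hY : Measurable (fun J => ∫⁻ n, w n J ∂σ) := hw.lintegral_prod_left'
  obtain ⟨G, hGd⟩ : ∃ G, G = {J | ee (b - Real.log 2) ≤ ∫⁻ τ, g τ J ∂σ} := ⟨_, rfl⟩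
  have hG : MeasurableSet G := by rw [hGd]; exact measurableSet_le measurable_const hZ
  rw [← hGd]
  -- for each n
  have key : ∀ n, ee (l - X1 - 2 * Real.log 2) ≤ ∫⁻ J in G, w n J ∂μ := by
    intro n
    have e1 : ∫⁻ τ in A n, ∫⁻ J, w n J * g τ J ∂μ ∂σ = ∫⁻ J, w n J * ∫⁻ τ in A n, g τ J ∂σ ∂μ := by
      rw [lintegral_lintegral_swap]
      · refine lintegral_congr fun J => ?_
        rw [lintegral_const_mul]
        exact hg.comp measurable_prodMk_right
      · exact (((hw1 n).comp measurable_snd).mul hg).aemeasurable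
    have e2 : ∫⁻ τ in A n, ∫⁻ τ' in A n, ∫⁻ J, w n J * (g τ J * g τ' J) ∂μ ∂σ ∂σ = ∫⁻ J, w n J * (∫⁻ τ in A n, g τ J ∂σ)^2 ∂μ := by
      have : ∀ τ, ∫⁻ τ' in A n, ∫⁻ J, w n J * (g τ J * g τ' J) ∂μ ∂σ = ∫⁻ J, (w n J * ∫⁻ τ' in A n, g τ' J ∂σ) * g τ J ∂μ := by
        intro τ
        rw [lintegral_lintegral_swap]
        · refine lintegral_congr fun J => ?_
          rw [lintegral_const_mul, lintegral_const_mul]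
          · ring
          · exact hg.comp measurable_prodMk_right
          · exact (hg.comp measurable_prodMk_right).const_mul _
        · exact (((hw1 n).comp measurable_snd).mul (((hg1 τ).comp measurable_snd).mul hg)).aemeasurable
      simp only [this]
      rw [lintegral_lintegral_swap]
      · refine lintegral_congr fun J => ?_
        rw [lintegral_const_mul]
        · ring
        · exact hg.comp measurable_prodMk_right
      · exact ((((hw1 n).comp measurable_snd).mul ((hB n).comp measurable_snd)).mul hg).aemeasurable
    have a1 := h2 n
    rw [e1] at a1
    have a2 := h3 n
    rw [e2] at a2
    obtain ⟨B, hBd⟩ : ∃ B, B = fun J => ∫⁻ τ in A n, g τ J ∂σ := ⟨_, rfl⟩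
    have hBm : Measurable B := by rw [hBd]; exact hB n
    have hBZ : ∀ J, B J ≤ ∫⁻ τ, g τ J ∂σ := by intro J; rw [hBd]; exact setLIntegral_le_lintegral _ _
    have hBJ : ∀ J, ∫⁻ τ in A n, g τ J ∂σ = B J := by intro J; rw [hBd]
    simp only [hBJ] at a1 a2
    -- split
    have a3 : ee (l + b) ≤ ∫⁻ J in G, w n J * B J ∂μ + ee (l + b) * ee (-Real.log 2) := by
      rw [← lintegral_add_compl _ hG] at a1
      refine a1.trans (add_le_add le_rfl ?_)
      calc ∫⁻ J in Gᶜ, w n J * B J ∂μ ≤ ∫⁻ J in Gᶜ, w n J * ee (b - Real.log 2) ∂μ := by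
            refine setLIntegral_mono' hG.compl fun J hJ => ?_
            have : ∫⁻ τ, g τ J ∂σ < ee (b - Real.log 2) := by
              rw [hGd] at hJ; simpa using hJ
            exact mul_le_mul' le_rfl ((hBZ J).trans this.le)
        _ ≤ ∫⁻ J, w n J * ee (b - Real.log 2) ∂μ := setLIntegral_le_lintegral _ _
        _ = _ := by rw [lintegral_mul_const _ (hw1 n), h1, ← ee_add, ← ee_add]; congr 1; ring
    have a4 := half2 (ee_ne_top _) a3
    rw [← ee_add] at a4
    have a5 := cs_set (μ.withDensity (w n)) hBm hG
    rw [setLIntegral_withDensity_eq_setLIntegral_mul _ (hw1 n) hBm hG, lintegral_withDensity_eq_lintegral_mul _ (hw1 n) (hBm.pow_const 2),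
      withDensity_apply _ hG] at a5
    simp only [Pi.mul_apply] at a5
    have a6 := (pow_le_pow_left₀ zero_le a4 2).trans (a5.trans (mul_le_mul' le_rfl a2))
    rw [pow_two, ← ee_add] at a6
    refine le_trans (le_of_eq ?_) (ee_le_of_mul a6)
    congr 1; ring
  have c1 : ee (l - X1 - 2 * Real.log 2) ≤ ∫⁻ J in G, ∫⁻ n, w n J ∂σ ∂μ := by
    rw [lintegral_lintegral_swap]
    · calc ee (l - X1 - 2 * Real.log 2) = ∫⁻ n, ee (l - X1 - 2 * Real.log 2) ∂σ := by simp
        _ ≤ _ := lintegral_mono key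
    · exact (hw.comp measurable_swap).aemeasurable
  have c2 := cs_set μ hY hG
  have c3 : ∫⁻ J, (∫⁻ n, w n J ∂σ)^2 ∂μ ≤ ee (2 * l + X2) := by
    have : ∀ J, (∫⁻ n, w n J ∂σ)^2 = ∫⁻ n, w n J * ∫⁻ m, w m J ∂σ ∂σ := by
      intro J
      rw [lintegral_mul_const, pow_two]
      exact hw.comp measurable_prodMk_right
    simp only [this]
    rw [lintegral_lintegral_swap]
    · calc _ ≤ ∫⁻ n, ee (2 * l + X2) ∂σ := by
            refine lintegral_mono fun n => ?_
            refine le_trans (le_of_eq ?_) (h4 n)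
            rw [lintegral_lintegral_swap]
            · refine lintegral_congr fun J => ?_
              rw [lintegral_const_mul]
              exact hw.comp measurable_prodMk_right
            · exact (((hw1 n).comp measurable_snd).mul hw).aemeasurable
        _ = _ := by simp
    · exact ((hw.comp measurable_swap).mul (hY.comp measurable_fst)).aemeasurable
  have c4 := (pow_le_pow_left₀ zero_le c1 2).trans (c2.trans (mul_le_mul' le_rfl c3))
  rw [pow_two, ← ee_add] at c4
  refine le_trans (le_of_eq ?_) (ee_le_of_mul c4)
  congr 1; ring

lemma QF_two {N : ℕ} {n v : VN N} (s s' : ℝ) (t : Metric.sphere (0 : VN N) 1) :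
    QF ![n, v] ![s, s'] (t : VN N) = 1 - s * inner ℝ (t : VN N) n ^ 2 - s' * inner ℝ (t : VN N) v ^ 2 := by
  unfold QF
  have : ‖(t : VN N)‖ = 1 := by simp
  rw [this, Fin.sum_univ_two]; simp; ring

lemma band_meas {N : ℕ} (n : VN N) (q κ : ℝ) :
    MeasurableSet {t : Metric.sphere (0 : VN N) 1 | |inner ℝ (t : VN N) n - q| < κ} := by
  refine measurableSet_lt ?_ measurable_const
  have : Continuous (fun t : Metric.sphere (0 : VN N) 1 => |inner ℝ (t : VN N) n - q|) := by fun_prop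
  exact this.measurable

lemma ev_log (c η : ℝ) (hη : 0 < η) : ∀ᶠ N : ℕ in atTop, 1/2 * Real.log N + c ≤ N * η := by
  have h1 : Tendsto (fun N : ℕ => Real.log N / N) atTop (nhds 0) := by
    have := (Real.isLittleO_log_id_atTop.tendsto_div_nhds_zero).comp tendsto_natCast_atTop_atTop
    exact this
  have h2 : Tendsto (fun N : ℕ => c / N) atTop (nhds 0) := tendsto_const_div_atTop_nhds_zero_nat c
  have h3 := (h1.const_mul (1/2)).add h2
  have h4 : (1/2) * (0:ℝ) + 0 < η := by simpa using hη
  filter_upwards [h3.eventually (gt_mem_nhds h4), eventually_ge_atTop 1] with N hN h1N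
  have hp : (0:ℝ) < N := by exact_mod_cast h1N
  have := mul_le_mul_of_nonneg_left hN.le hp.le
  refine le_trans (le_of_eq ?_) this
  field_simp

set_option maxHeartbeats 1000000 in
lemma band_quad (q A η : ℝ) (hq0 : 0 < q) (hq : q < 1) (hA0 : 0 ≤ A) (hA : A * (1 - q^2)^2 < 1) (hη : 0 < η) :
    ∃ κ0 > 0, ∀ κ ≤ κ0, ∃ N0 : ℕ, ∀ N ≥ N0, ∀ n τ : VN N, ‖n‖ = 1 → ‖τ‖ = 1 →
      |inner ℝ τ n - q| < κ →
      ∫⁻ τ' in {t | |inner ℝ (t : VN N) n - q| < κ}, ee (N * (1/2 * A * (inner ℝ τ (τ' : VN N) - inner ℝ τ n * inner ℝ (τ' : VN N) n)^2)) ∂(unifSphere N)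
       ≤ ee (N * (1/2 * Real.log (1 - q^2) + η)) := by
  have hq2 : 0 < 1 - q^2 := by nlinarith
  obtain ⟨s', hs'⟩ : ∃ s', s' = (1 + A * (1 - q^2)^2)/2 := ⟨_, rfl⟩
  have hs1 : s' < 1 := by rw [hs']; linarith
  have hs2 : A * (1 - q^2)^2 < s' := by rw [hs']; linarith
  have hs0 : 0 ≤ s' := by rw [hs']; positivity
  obtain ⟨z, hz0, hzq, hzq1, hz1, hz2⟩ : ∃ z > 0, z < q ∧ q + z < 1 ∧
      A * (1 - (q - z)^2) * (1 - (q-z)^2 + z) ≤ s' ∧ Real.log (1 - (q-z)^2 + z) ≤ Real.log (1 - q^2) + η := by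
    have c1 : ContinuousAt (fun z : ℝ => A * (1 - (q - z)^2) * (1 - (q-z)^2 + z)) 0 := by fun_prop
    have c2 : ContinuousAt (fun z : ℝ => Real.log (1 - (q-z)^2 + z)) 0 := by
      refine ContinuousAt.log (by fun_prop) ?_
      simp; exact hq2.ne'
    have e1 := c1.eventually_lt (continuousAt_const (y := s')) (by simpa [mul_assoc, ← sq] using hs2)
    have e2 := c2.eventually_lt (continuousAt_const (y := Real.log (1 - q^2) + η)) (by simpa using hη)
    have e3 : ∀ᶠ z in nhdsWithin (0:ℝ) (Ioi 0), z < q := mem_nhdsWithin_of_mem_nhds (gt_mem_nhds hq0)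
    have e4 : ∀ᶠ z in nhdsWithin (0:ℝ) (Ioi 0), z < 1 - q := mem_nhdsWithin_of_mem_nhds (gt_mem_nhds (by linarith))
    obtain ⟨z, hz⟩ := ((eventually_mem_nhdsWithin (a := (0:ℝ)) (s := Ioi 0)).and (e3.and (e4.and ((e1.filter_mono nhdsWithin_le_nhds).and (e2.filter_mono nhdsWithin_le_nhds))))).exists
    exact ⟨z, hz.1, hz.2.1, by linarith [hz.2.2.1], hz.2.2.2.1.le, hz.2.2.2.2.le⟩
  refine ⟨z, hz0, fun κ hκ => ?_⟩
  have hN1 := ev_log (-(1/2) * Real.log (1 - s')) (η/2) (by linarith)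
  have hN2 : ∀ᶠ N : ℕ in atTop, 1/(N:ℝ) < z :=
    (tendsto_const_div_atTop_nhds_zero_nat 1).eventually (gt_mem_nhds hz0)
  obtain ⟨N0, hN0⟩ := eventually_atTop.mp (hN1.and (hN2.and (eventually_ge_atTop 1)))
  refine ⟨N0, fun N hN n τ hn hτ ht => ?_⟩
  obtain ⟨b1, b2, hN1⟩ := hN0 N hN
  have hNp : (0:ℝ) < N := by exact_mod_cast hN1
  have hNi : 0 < 1/(N:ℝ) := by positivity
  obtain ⟨t, htd⟩ : ∃ t, t = inner ℝ n τ := ⟨_, rfl⟩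
  have htd' : inner ℝ τ n = t := by rw [htd, real_inner_comm]
  rw [htd'] at ht ⊢
  have ht' := abs_lt.mp ht
  have ht2 : t^2 < 1 := by nlinarith
  have ht3 : (q - z)^2 ≤ t^2 := pow_le_pow_left₀ (by linarith) (by linarith) 2
  obtain ⟨s, v, hs, hrs, hnv, hτv⟩ := decomp hn hτ (by rw [← htd]; exact ht2)
  rw [← htd] at hrs hτv
  have hfs : ∀ i, (![1 - 1/(N:ℝ), s'] : Fin 2 → ℝ) i < 1 := by
    intro i; fin_cases i
    · show 1 - 1/(N:ℝ) < 1; linarith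
    · exact hs1
  have h := pair_law hN1 hnv hfs
    (({t | |inner ℝ (t : VN N) n - q| < κ} : Set (Metric.sphere (0 : VN N) 1)).indicator
      (fun τ' => ee (N * (1/2 * A * (inner ℝ τ (τ' : VN N) - t * inner ℝ (τ' : VN N) n)^2))))
    (N/2 * (Real.log (1 - q^2) + η)) (by
      intro τ'
      by_cases hin : τ' ∈ ({t | |inner ℝ (t : VN N) n - q| < κ} : Set (Metric.sphere (0 : VN N) 1))
      · rw [indicator_of_mem hin]
        refine ee_mono ?_
        have hpos := QF_pos hnv hfs (τ' : VN N) (by simp)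
        rw [QF_two] at hpos ⊢
        have hin' : |inner ℝ (τ' : VN N) n - q| < κ := hin
        replace hin' := abs_lt.mp hin'
        have hτ' : ‖(τ' : VN N)‖ = 1 := by simp
        have e1 : inner ℝ τ (τ' : VN N) - t * inner ℝ (τ' : VN N) n = s * inner ℝ (τ' : VN N) v := by
          nth_rw 1 [hτv]
          rw [inner_add_left, real_inner_smul_left, real_inner_smul_left, real_inner_comm n, real_inner_comm v]; ring
        rw [e1]
        have hle := inner_sq_le hτ' hn
        generalize inner ℝ (τ' : VN N) n = t' at *
        generalize inner ℝ (τ' : VN N) v = y at *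
        obtain ⟨k0, hk0⟩ : ∃ k0, k0 = 1 - (1 - 1/(N:ℝ)) * t'^2 := ⟨_, rfl⟩
        rw [← hk0] at hpos ⊢
        have hk0p : 0 < k0 := by linarith [mul_nonneg hs0 (sq_nonneg y)]
        have ht3' : (q - z)^2 ≤ t'^2 := pow_le_pow_left₀ (by linarith) (by linarith) 2
        have hk0u : k0 ≤ 1 - (q-z)^2 + z := by
          have : 1/(N:ℝ) * t'^2 ≤ 1/(N:ℝ) := mul_le_of_le_one_right hNi.le hle
          rw [hk0]; linarith
        have hl1 : Real.log k0 ≤ Real.log (1 - q^2) + η := (Real.log_le_log hk0p hk0u).trans hz2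
        have hl2 : Real.log (k0 - s' * y^2) ≤ Real.log k0 - s' * y^2 / k0 := by
          have h5 := Real.log_le_sub_one_of_pos (div_pos hpos hk0p)
          rw [Real.log_div hpos.ne' hk0p.ne'] at h5
          have h6 : (k0 - s' * y^2)/k0 = 1 - s' * y^2 / k0 := by field_simp
          rw [h6] at h5
          linarith
        have hss : s^2 ≤ 1 - (q-z)^2 := by linarith
        have hk : A * s^2 * y^2 ≤ s' * y^2 / k0 := by
          rw [le_div_iff₀ hk0p]
          have h7 : A * s^2 * k0 ≤ A * (1 - (q - z)^2) * (1 - (q-z)^2 + z) := by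
            have h8 : 0 ≤ 1 - (q-z)^2 := (sq_nonneg s).trans hss
            gcongr
          linarith [mul_le_mul_of_nonneg_right (h7.trans hz1) (sq_nonneg y)]
        have hfin : A * s^2 * y^2 ≤ Real.log (1 - q^2) + η - Real.log (k0 - s' * y^2) := by linarith
        have := mul_le_mul_of_nonneg_left hfin (by positivity : (0:ℝ) ≤ N/2)
        linarith
      · rw [indicator_of_notMem hin]; exact zero_le)
  rw [lintegral_indicator (band_meas n q κ)] at h
  refine h.trans (ee_mono ?_)
  rw [Fin.sum_univ_two]
  simp only [Matrix.cons_val_zero, Matrix.cons_val_one]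
  have e : Real.log (1 - (1 - 1/(N:ℝ))) = - Real.log N := by
    rw [sub_sub_cancel, one_div, Real.log_inv]
  rw [e]
  linarith

set_option linter.unusedSectionVars false
section modl4
variable {E : Type} [NormedAddCommGroup E] [InnerProductSpace ℝ E] [FiniteDimensional ℝ E]
  [MeasurableSpace E] [BorelSpace E]
variable {N : ℕ} {K0 K1 K2 F P Q : ℝ → ℝ}

def llv (K0 K1 K2 P Q : ℝ → ℝ) (u x t : ℝ) : ℝ :=
  P t * u / K0 1 + (t * Q t - K1 1 / K0 1 * P t) * (x - K1 1 / K0 1 * u) * K0 1 / DDv K0 K1 K2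

def kkv (K0 K1 K2 P Q : ℝ → ℝ) (t t' s : ℝ) : ℝ :=
  P t * P t' / K0 1 + (t * Q t - K1 1 / K0 1 * P t) * (t' * Q t' - K1 1 / K0 1 * P t') * K0 1 / DDv K0 K1 K2
    + Q t * Q t' * (s - t * t') / K1 1

def oov (K0 K1 K2 F P Q : ℝ → ℝ) (β u x δ t : ℝ) : ℝ :=
  1/2 * β^2 * F 1 + (-β * llv K0 K1 K2 P Q u x t - 1/2 * β^2 * kkv K0 K1 K2 P Q t t 1) * (1/(1+δ^2))

def rrv (K0 K1 K2 F P Q : ℝ → ℝ) (δ t t' s : ℝ) : ℝ :=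
  F s - kkv K0 K1 K2 P Q t t' s * (1/(1+δ^2))

namespace Mod
variable (M : Mod N E K0 K1 K2 F P Q)

lemma adjT_psi (n τ : VN N) : M.adjT n (M.ψ τ) = Q (inner ℝ n τ) • τ := by
  refine ext_inner_right ℝ fun v => ?_
  rw [adjT_inner, M.hψT, real_inner_smul_left, real_inner_comm τ v]

lemma adjT_smul (n : VN N) (c : ℝ) (h : E) : M.adjT n (c • h) = c • M.adjT n h := by unfold adjT; simp
lemma adjT_add (n : VN N) (h h' : E) : M.adjT n (h + h') = M.adjT n h + M.adjT n h' := by unfold adjT; simp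

variable (hg0 : 0 < K0 1) (hg1 : 0 < K1 1) (hD : 0 < DDv K0 K1 K2)

include hg0 hg1 hD

lemma single1 {δ : ℝ} (hδ : 0 < δ) (β u x : ℝ) {n τ : VN N} (hn : ‖n‖ = 1) (hτ : ‖τ‖ = 1) :
    ∫⁻ J, M.wt δ u x n J * ee (-β * √N * inner ℝ J (M.ψ τ)) ∂(stdGaussian E)
      = ee (lw N δ (Ksq (K0 1) (K1 1) (K2 1) u x) + N * oov K0 K1 K2 F P Q β u x δ (inner ℝ n τ)) := by
  have h := M.single hg0 hg1 hD hδ u x hn ((-β * √N) • M.ψ τ)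
  simp only [real_inner_smul_right] at h
  rw [h]
  congr 1
  have hNs : (√(N:ℝ))^2 = N := Real.sq_sqrt (Nat.cast_nonneg _)
  have hττ : inner ℝ τ τ = (1:ℝ) := by rw [real_inner_self_eq_norm_sq, hτ]; norm_num
  rw [← real_inner_self_eq_norm_sq, real_inner_smul_left, real_inner_smul_right, M.hψψ, hττ]
  unfold lw linF quadF oov llv kkv
  rw [adjT_smul, adjT_psi, ← real_inner_self_eq_norm_sq]
  simp only [real_inner_smul_left, real_inner_smul_right, M.hψφ, M.hψT, hττ]
  generalize inner ℝ n τ = t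
  generalize P t = p
  generalize Q t = q
  generalize DDv K0 K1 K2 = D
  linear_combination (1/2 * β^2 * F 1 + (-β * (p * u / K0 1 + (t * q - K1 1 / K0 1 * p) * (x - K1 1 / K0 1 * u) * K0 1 / D)
    - 1/2 * β^2 * (p * p / K0 1 + (t * q - K1 1 / K0 1 * p) * (t * q - K1 1 / K0 1 * p) * K0 1 / D + q * q * (1 - t * t) / K1 1)) * (1/(1+δ^2))) * hNs

lemma single2 {δ : ℝ} (hδ : 0 < δ) (β u x : ℝ) {n τ τ' : VN N} (hn : ‖n‖ = 1) (hτ : ‖τ‖ = 1) (hτ' : ‖τ'‖ = 1) :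
    ∫⁻ J, M.wt δ u x n J * (ee (-β * √N * inner ℝ J (M.ψ τ)) * ee (-β * √N * inner ℝ J (M.ψ τ'))) ∂(stdGaussian E)
      = ee (lw N δ (Ksq (K0 1) (K1 1) (K2 1) u x) + N * (oov K0 K1 K2 F P Q β u x δ (inner ℝ n τ) + oov K0 K1 K2 F P Q β u x δ (inner ℝ n τ')
        + β^2 * rrv K0 K1 K2 F P Q δ (inner ℝ n τ) (inner ℝ n τ') (inner ℝ τ τ'))) := by
  have h := M.single hg0 hg1 hD hδ u x hn ((-β * √N) • (M.ψ τ + M.ψ τ'))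
  have e : ∀ J, ee (-β * √N * inner ℝ J (M.ψ τ)) * ee (-β * √N * inner ℝ J (M.ψ τ')) = ee (inner ℝ J ((-β * √N) • (M.ψ τ + M.ψ τ'))) := by
    intro J; rw [← ee_add, real_inner_smul_right, inner_add_right]; congr 1; ring
  simp only [e]
  rw [h]
  congr 1
  have hNs : (√(N:ℝ))^2 = N := Real.sq_sqrt (Nat.cast_nonneg _)
  have hττ : inner ℝ τ τ = (1:ℝ) := by rw [real_inner_self_eq_norm_sq, hτ]; norm_num
  have hττ' : inner ℝ τ' τ' = (1:ℝ) := by rw [real_inner_self_eq_norm_sq, hτ']; norm_num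
  have hsw : inner ℝ τ' τ = inner ℝ τ τ' := real_inner_comm _ _
  unfold lw linF quadF oov rrv llv kkv
  rw [adjT_smul, adjT_add, adjT_psi, adjT_psi, ← real_inner_self_eq_norm_sq, ← real_inner_self_eq_norm_sq]
  simp only [real_inner_smul_left, real_inner_smul_right, inner_add_left, inner_add_right, M.hψψ, M.hψφ, M.hψT, hττ, hττ', hsw]
  generalize inner ℝ n τ = t
  generalize inner ℝ n τ' = t'
  generalize inner ℝ τ τ' = s
  generalize P t = p
  generalize Q t = q
  generalize P t' = p'
  generalize Q t' = q'
  generalize DDv K0 K1 K2 = D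
  have hs : (√(N:ℝ)) * √(N:ℝ) = N := by rw [← sq, hNs]
  generalize √(N:ℝ) = m at *
  rw [← hNs]
  generalize (1/(1+δ^2)) = d
  simp only [div_eq_mul_inv]
  ring

end Mod

lemma cont_unif {β u x q a : ℝ} (hg0 : 0 < K0 1) (hg1 : 0 < K1 1) (cF : Continuous F) (cP : Continuous P) (cQ : Continuous Q)
    (hq0 : 0 < q) (hPq : P q = K0 1) (hQq : q * Q q = K1 1)
    (hT : ∀ s ∈ Icc (-1:ℝ) 1, F s ≤ K0 1 + K1 1 / q^2 * (s - q^2) + 1/2 * a * (s - q^2)^2) {η : ℝ} (hη : 0 < η)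
    {o : ℝ} (ho : o = 1/2 * β^2 * (F 1 - K0 1 - K1 1 / q^2 * (1 - q^2)) - β * u) :
    ∃ e > 0, ∀ δ t t' : ℝ, |δ| < e → |t - q| < e → |t' - q| < e →
      |oov K0 K1 K2 F P Q β u x δ t - o| < η ∧ ∀ s ∈ Icc (-1:ℝ) 1, β^2 * rrv K0 K1 K2 F P Q δ t t' s ≤ 1/2 * (β^2 * a) * (s - t * t')^2 + η := by
  have hQ : Q q = K1 1 / q := by rw [← hQq]; field_simp
  have hz : q * Q q - K1 1 / K0 1 * P q = 0 := by rw [hQq, hPq]; field_simp; ring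
  have cd : Continuous (fun δ : ℝ => 1/(1+δ^2)) := by
    refine continuous_const.div (by fun_prop) fun δ => ?_
    positivity
  have c1 : Continuous (fun z : ℝ × ℝ × ℝ => oov K0 K1 K2 F P Q β u x z.1 z.2.1) := by
    unfold oov llv kkv
    simp only [div_eq_mul_inv (_ : ℝ) (K0 1), div_eq_mul_inv (_ : ℝ) (K1 1), div_eq_mul_inv (_ : ℝ) (DDv K0 K1 K2)]
    have cd' := cd.comp (continuous_fst (X := ℝ) (Y := ℝ × ℝ))
    simp only [Function.comp_def] at cd'
    refine Continuous.add (by fun_prop) (Continuous.mul (by fun_prop) cd')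
  have c2 : Continuous (fun z : (ℝ × ℝ × ℝ) × ℝ => β^2 * rrv K0 K1 K2 F P Q z.1.1 z.1.2.1 z.1.2.2 z.2 - (1/2 * (β^2 * a) * (z.2 - z.1.2.1 * z.1.2.2)^2 + η)) := by
    unfold rrv kkv
    simp only [div_eq_mul_inv (_ : ℝ) (K0 1), div_eq_mul_inv (_ : ℝ) (K1 1), div_eq_mul_inv (_ : ℝ) (DDv K0 K1 K2)]
    have cd' := cd.comp ((continuous_fst (X := ℝ) (Y := ℝ × ℝ)).comp (continuous_fst (X := ℝ × ℝ × ℝ) (Y := ℝ)))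
    simp only [Function.comp_def] at cd'
    refine Continuous.sub (continuous_const.mul (Continuous.sub (by fun_prop) (Continuous.mul (by fun_prop) cd'))) (by fun_prop)
  have v1 : oov K0 K1 K2 F P Q β u x 0 q = o := by
    unfold oov llv kkv
    rw [hz, hPq, hQ, ho]; field_simp; ring
  have e1 : ∀ᶠ z : ℝ × ℝ × ℝ in nhds (0, q, q), |oov K0 K1 K2 F P Q β u x z.1 z.2.1 - o| < η := by
    have : ContinuousAt (fun z : ℝ × ℝ × ℝ => |oov K0 K1 K2 F P Q β u x z.1 z.2.1 - o|) (0,q,q) :=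
      (c1.sub continuous_const).abs.continuousAt
    refine this.eventually_lt continuousAt_const ?_
    show |oov K0 K1 K2 F P Q β u x 0 q - o| < η
    rw [v1]; simpa using hη
  have e2 : ∀ᶠ z : ℝ × ℝ × ℝ in nhds (0, q, q), ∀ s ∈ Icc (-1:ℝ) 1,
      β^2 * rrv K0 K1 K2 F P Q z.1 z.2.1 z.2.2 s - (1/2 * (β^2 * a) * (s - z.2.1 * z.2.2)^2 + η) < 0 := by
    refine isCompact_Icc.eventually_forall_of_forall_eventually fun s hs => ?_
    refine (c2.continuousAt (x := ((0,q,q),s))).eventually_lt continuousAt_const ?_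
    show β^2 * rrv K0 K1 K2 F P Q 0 q q s - (1/2 * (β^2 * a) * (s - q * q)^2 + η) < 0
    have : rrv K0 K1 K2 F P Q 0 q q s = F s - (K0 1 + K1 1 / q^2 * (s - q^2)) := by
      unfold rrv kkv
      rw [hz, hPq, hQ]; field_simp; ring
    rw [this]
    have h3 := mul_le_mul_of_nonneg_left (hT s hs) (sq_nonneg β)
    have e : q * q = q^2 := by ring
    rw [e]
    linarith
  obtain ⟨e, he, hh⟩ := Metric.eventually_nhds_iff.mp (e1.and e2)
  refine ⟨e, he, fun δ t t' h1 h2 h3 => ?_⟩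
  have := @hh (δ, t, t') (by
    rw [Prod.dist_eq, Prod.dist_eq, Real.dist_eq, Real.dist_eq, Real.dist_eq]
    simp [h1, h2, h3])
  exact ⟨this.1, fun s hs => by linarith [this.2 s hs]⟩

end modl4

set_option linter.unusedSectionVars false
section modl5
variable {K0 K1 K2 F P Q : ℝ → ℝ}

lemma Mod.wt_meas {N : ℕ} {E : Type} [NormedAddCommGroup E] [InnerProductSpace ℝ E] [FiniteDimensional ℝ E]
    [MeasurableSpace E] [BorelSpace E] (M : Mod N E K0 K1 K2 F P Q) (δ u x : ℝ) :
    Measurable (Function.uncurry (fun (n : Metric.sphere (0 : VN N) 1) J => M.wt δ u x (n : VN N) J)) := by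
  have c1 : Continuous (fun z : Metric.sphere (0 : VN N) 1 × E => M.φ (z.1 : VN N)) := M.cφ.comp (by fun_prop)
  have c2 : Continuous (fun z : Metric.sphere (0 : VN N) 1 × E => M.T (z.1 : VN N)) := M.cT.comp (by fun_prop)
  have c3 : Continuous (fun z : Metric.sphere (0 : VN N) 1 × E => M.T (z.1 : VN N) (z.1 : VN N)) := c2.clm_apply (by fun_prop)
  have c4 : Continuous (fun z : Metric.sphere (0 : VN N) 1 × E => M.adjT (z.1 : VN N) z.2) := by
    unfold Mod.adjT
    refine Continuous.clm_apply ?_ continuous_snd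
    exact (ContinuousLinearMap.adjoint (𝕜 := ℝ) (E := VN N) (F := E)).continuous.comp c2
  have c5 : Continuous (fun z : Metric.sphere (0 : VN N) 1 × E => M.wExp u x (z.1 : VN N) z.2) := by
    unfold Mod.wExp Mod.d1 Mod.d2
    simp only [div_eq_mul_inv]
    fun_prop
  have : Continuous (fun z : Metric.sphere (0 : VN N) 1 × E => M.wt δ u x (z.1 : VN N) z.2) := by
    unfold Mod.wt
    exact continuous_ee.comp (continuous_const.mul c5)
  exact this.measurable

lemma Mod.g_meas {N : ℕ} {E : Type} [NormedAddCommGroup E] [InnerProductSpace ℝ E] [FiniteDimensional ℝ E]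
    [MeasurableSpace E] [BorelSpace E] (M : Mod N E K0 K1 K2 F P Q) (β : ℝ) :
    Measurable (Function.uncurry (fun (τ : Metric.sphere (0 : VN N) 1) J => ee (-β * √N * inner ℝ J (M.ψ (τ : VN N))))) := by
  have c1 : Continuous (fun z : Metric.sphere (0 : VN N) 1 × E => M.ψ (z.1 : VN N)) := M.cψ.comp (by fun_prop)
  have : Continuous (fun z : Metric.sphere (0 : VN N) 1 × E => ee (-β * √N * inner ℝ z.2 (M.ψ (z.1 : VN N)))) :=
    continuous_ee.comp (by fun_prop)
  exact this.measurable

theorem key_prop {β u x q a η o : ℝ} (hg0 : 0 < K0 1) (hg1 : 0 < K1 1) (hD : 0 < DDv K0 K1 K2)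
    (cF : Continuous F) (cP : Continuous P) (cQ : Continuous Q)
    (hK : 0 ≤ Ksq (K0 1) (K1 1) (K2 1) u x)
    (hμ : ∀ r ∈ Ioo (-1:ℝ) 1, (r * K1 r / K1 1)^2 < 1)
    (hq0 : 0 < q) (hq : q < 1) (hPq : P q = K0 1) (hQq : q * Q q = K1 1) (ha : 0 ≤ a) (hA : β^2 * a * (1 - q^2)^2 < 1)
    (hT : ∀ s ∈ Icc (-1:ℝ) 1, F s ≤ K0 1 + K1 1 / q^2 * (s - q^2) + 1/2 * a * (s - q^2)^2) (hη : 0 < η)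
    (ho : o = 1/2 * β^2 * (F 1 - K0 1 - K1 1 / q^2 * (1 - q^2)) - β * u) :
    ∃ δ0 > 0, ∀ δ : ℝ, 0 < δ → δ < δ0 →
      (∀ r ∈ Ioo (-1:ℝ) 1, ∃ a b S, FF (K0 1) (K1 1) (K2 1) (K0 r) (K1 r) (K2 r) δ r u x a b S ≤ η) →
      ∃ N0 : ℕ, ∀ N ≥ N0, ∀ (E : Type) [NormedAddCommGroup E] [InnerProductSpace ℝ E] [FiniteDimensional ℝ E]
        [MeasurableSpace E] [BorelSpace E] (M : Mod N E K0 K1 K2 F P Q),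
        ee (-(N * (21 * η))) ≤ stdGaussian E {J | ee (N * (o + 1/2 * Real.log (1 - q^2) - 3 * η)) ≤
          ∫⁻ τ, ee (-β * √N * inner ℝ J (M.ψ (τ : VN N))) ∂(unifSphere N)} := by
  obtain ⟨e, he, hcu⟩ := cont_unif (K2 := K2) (x := x) hg0 hg1 cF cP cQ hq0 hPq hQq hT hη ho
  obtain ⟨κ0, hκ0, hbq⟩ := band_quad q (β^2 * a) η hq0 hq (by positivity) hA hη
  refine ⟨e, he, fun δ hδ hδe hFF => ?_⟩
  obtain ⟨κ, hκd⟩ : ∃ κ, κ = min κ0 e := ⟨_, rfl⟩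
  have hκ : 0 < κ := by rw [hκd]; positivity
  have hκe : κ ≤ e := by rw [hκd]; exact min_le_right _ _
  obtain ⟨N1, hN1⟩ := hbq κ (by rw [hκd]; exact min_le_left _ _)
  obtain ⟨N2, hN2⟩ := band_lower q κ η hq0 hq hκ hη
  obtain ⟨C, hC⟩ : ∃ C, C = 3 * Real.log (1 + 1/δ^2) + 1/(2 * rexp (-Real.log (1 + 1/δ^2) - Ksq (K0 1) (K1 1) (K2 1) u x)) := ⟨_, rfl⟩
  obtain ⟨N3, hN3⟩ := eventually_atTop.mp ((ev_log C η hη).and (ev_log (4 * Real.log 2) η hη))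
  refine ⟨max N1 (max N2 N3), fun N hN E _ _ _ _ _ M => ?_⟩
  have hNN1 := hN1 N (le_trans (le_max_left _ _) hN)
  have hNN2 := hN2 N (le_trans (le_trans (le_max_left _ _) (le_max_right _ _)) hN)
  have hNN3 := hN3 N (le_trans (le_trans (le_max_right _ _) (le_max_right _ _)) hN)
  obtain ⟨hN1', hband⟩ := hNN2
  have hlogN : 0 ≤ Real.log N := Real.log_nonneg (by exact_mod_cast hN1')
  have hN0 : (0:ℝ) ≤ N := Nat.cast_nonneg N
  haveI : IsProbabilityMeasure (unifSphere N) := ⟨unif_univ hN1'⟩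
  have hnrm : ∀ τ : Metric.sphere (0 : VN N) 1, ‖(τ : VN N)‖ = 1 := fun τ => by simp
  have hδa : |δ| < e := by rw [abs_of_pos hδ]; exact hδe
  obtain ⟨l, hl⟩ : ∃ l, l = lw N δ (Ksq (K0 1) (K1 1) (K2 1) u x) := ⟨_, rfl⟩
  obtain ⟨b, hb⟩ : ∃ b, b = N * (o + 1/2 * Real.log (1 - q^2) - 2 * η) := ⟨_, rfl⟩
  have main := abs_smm (stdGaussian E) (unifSphere N) (M.wt_meas δ u x) (M.g_meas β)
    (A := fun n => {t | |inner ℝ (t : VN N) (n : VN N) - q| < κ}) (l := l) (b := b) (X1 := 9 * N * η) (X2 := 2 * N * η)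
    (fun n => by rw [M.single0 hg0 hg1 hD hδ u x (hnrm n), hl])
    (by
      intro n
      have h1 := hband n (hnrm n)
      calc ee (l + b) = ee (l + N * (o - η)) * ee (N * (1/2 * Real.log (1 - q^2) - η)) := by
            rw [← ee_add, hb]; congr 1; ring
        _ ≤ ee (l + N * (o - η)) * unifSphere N {t | |inner ℝ (t : VN N) (n : VN N) - q| < κ} := mul_le_mul_right h1 _
        _ = ∫⁻ τ in {t | |inner ℝ (t : VN N) (n : VN N) - q| < κ}, ee (l + N * (o - η)) ∂(unifSphere N) := by
            rw [setLIntegral_const]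
        _ ≤ _ := by
            refine setLIntegral_mono' (band_meas _ _ _) fun τ hτ => ?_
            rw [M.single1 hg0 hg1 hD hδ β u x (hnrm n) (hnrm τ), ← hl]
            have hτ' : |inner ℝ (τ : VN N) (n : VN N) - q| < e := lt_of_lt_of_le hτ hκe
            rw [real_inner_comm] at hτ'
            have := (abs_lt.mp (hcu δ _ _ hδa hτ' hτ').1).1
            refine ee_mono (add_le_add le_rfl (mul_le_mul_of_nonneg_left (by linarith) hN0)))
    (by
      intro n
      have hin : ∀ τ : Metric.sphere (0 : VN N) 1, |inner ℝ (τ : VN N) (n : VN N) - q| < κ →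
          ∫⁻ τ' in {t | |inner ℝ (t : VN N) (n : VN N) - q| < κ}, ∫⁻ J, M.wt δ u x n J * (ee (-β * √N * inner ℝ J (M.ψ τ)) * ee (-β * √N * inner ℝ J (M.ψ τ'))) ∂(stdGaussian E) ∂(unifSphere N)
          ≤ ee (l + N * (2 * o + 1/2 * Real.log (1 - q^2) + 4 * η)) := by
        intro τ hτ
        calc _ ≤ ∫⁻ τ' in {t | |inner ℝ (t : VN N) (n : VN N) - q| < κ}, ee (l + N * (2 * o + 3 * η)) *
                ee (N * (1/2 * (β^2 * a) * (inner ℝ (τ : VN N) (τ' : VN N) - inner ℝ (τ : VN N) (n : VN N) * inner ℝ (τ' : VN N) (n : VN N))^2)) ∂(unifSphere N) := by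
              refine setLIntegral_mono' (band_meas _ _ _) fun τ' hτ' => ?_
              rw [M.single2 hg0 hg1 hD hδ β u x (hnrm n) (hnrm τ) (hnrm τ'), ← hl, ← ee_add]
              have h1 : |inner ℝ (τ : VN N) (n : VN N) - q| < e := lt_of_lt_of_le hτ hκe
              have h2 : |inner ℝ (τ' : VN N) (n : VN N) - q| < e := lt_of_lt_of_le hτ' hκe
              rw [real_inner_comm (τ : VN N) (n : VN N), real_inner_comm (τ' : VN N) (n : VN N)]
              have h3 := (abs_lt.mp (hcu δ _ _ hδa h1 h2).1).2
              have h4 := (abs_lt.mp (hcu δ _ _ hδa h2 h1).1).2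
              have h5 := (hcu δ _ _ hδa h1 h2).2 (inner ℝ (τ : VN N) (τ' : VN N)) (by
                have := abs_real_inner_le_norm (τ : VN N) (τ' : VN N)
                rw [hnrm, hnrm, mul_one] at this
                exact abs_le.mp this)
              refine ee_mono ?_
              have := mul_le_mul_of_nonneg_left (add_le_add (add_le_add h3.le h4.le) h5) hN0
              linarith
          _ ≤ _ := by
              rw [lintegral_const_mul' _ _ (ee_ne_top _)]
              refine (mul_le_mul_right (hNN1 n τ (hnrm n) (hnrm τ) hτ) _).trans ?_
              rw [← ee_add]
              refine ee_mono (le_of_eq ?_); ring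
      have hmeas : unifSphere N {t | |inner ℝ (t : VN N) (n : VN N) - q| < κ} ≤ ee (N * (1/2 * Real.log (1 - q^2) + η)) := by
        rcases ({t | |inner ℝ (t : VN N) (n : VN N) - q| < κ} : Set (Metric.sphere (0 : VN N) 1)).eq_empty_or_nonempty with h0 | ⟨τ, hτ⟩
        · rw [h0, measure_empty]; exact zero_le
        · refine le_trans ?_ (hNN1 n τ (hnrm n) (hnrm τ) hτ)
          rw [← setLIntegral_one]
          refine lintegral_mono fun τ' => ?_
          rw [← ee_zero]
          exact ee_mono (by positivity)
      calc _ ≤ ∫⁻ τ in {t | |inner ℝ (t : VN N) (n : VN N) - q| < κ}, ee (l + N * (2 * o + 1/2 * Real.log (1 - q^2) + 4 * η)) ∂(unifSphere N) :=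
            setLIntegral_mono' (band_meas _ _ _) fun τ hτ => hin τ hτ
        _ ≤ _ := by
            rw [setLIntegral_const]
            refine (mul_le_mul_right hmeas _).trans ?_
            rw [← ee_add, hb]
            refine ee_mono (le_of_eq ?_); ring)
    (by
      intro n
      refine (M.pair_int hg0 hg1 hD hN1' hδ hη.le hK hμ hFF (hnrm n)).trans (ee_mono ?_)
      rw [← hl]
      have := hNN3.1
      rw [hC] at this
      linarith)
  refine (ee_mono ?_).trans (main.trans (measure_mono fun J hJ => ?_))
  · linarith [hNN3.2]
  · refine le_trans (ee_mono ?_) hJ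
    rw [hb]
    have : 0 ≤ Real.log 2 := Real.log_nonneg (by norm_num)
    linarith [hNN3.2]
end modl5

/-- finite sums -/
def sS0 (K : ℕ) (a : ℕ → ℝ) (t : ℝ) : ℝ := ∑ p ∈ Finset.range K, a p * t ^ p
def sS1 (K : ℕ) (a : ℕ → ℝ) (t : ℝ) : ℝ := ∑ p ∈ Finset.range K, a p * (p * t ^ (p - 1))
def sS2 (K : ℕ) (a : ℕ → ℝ) (t : ℝ) : ℝ :=
  ∑ p ∈ Finset.range K, a p * (p * (((p - 1 : ℕ) : ℝ) * t ^ (p - 1 - 1)))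

lemma sS0_deriv (K : ℕ) (a : ℕ → ℝ) (t : ℝ) : HasDerivAt (sS0 K a) (sS1 K a t) t := by
  unfold sS0 sS1
  exact HasDerivAt.fun_sum fun p _ => (hasDerivAt_pow p t).const_mul (a p)

lemma sS1_deriv (K : ℕ) (a : ℕ → ℝ) (t : ℝ) : HasDerivAt (sS1 K a) (sS2 K a t) t := by
  unfold sS1 sS2
  exact HasDerivAt.fun_sum fun p _ => ((hasDerivAt_pow (p - 1) t).const_mul (p : ℝ)).const_mul (a p)

/-- truncation of the coefficients -/
def trc (γ : ℕ → ℝ) (K : ℕ) : ℕ → ℝ := fun p => if p < K ∧ 2 ≤ p then γ p else 0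

lemma trc_ge {γ : ℕ → ℝ} {K p : ℕ} (h : K ≤ p) : trc γ K p = 0 := by
  unfold trc; rw [if_neg]; omega

lemma trc_lt {γ : ℕ → ℝ} {K p : ℕ} (h : p < 2) : trc γ K p = 0 := by
  unfold trc; rw [if_neg]; omega

lemma trc_scale (γ : ℕ → ℝ) (q : ℝ) (K p : ℕ) :
    trc (gammaScale γ q) K p = trc γ K p * q ^ p := by
  unfold trc gammaScale; split_ifs <;> simp

lemma tsum_trc (γ : ℕ → ℝ) (K : ℕ) (f : ℕ → ℝ) :
    (∑' p : ℕ, if 2 ≤ p then trc γ K p ^ 2 * f p else 0)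
      = ∑ p ∈ Finset.range K, trc γ K p ^ 2 * f p := by
  rw [tsum_eq_sum (s := Finset.range K)]
  · refine Finset.sum_congr rfl fun p _ => ?_
    split_ifs with h
    · rfl
    · rw [trc_lt (by omega)]; simp
  · intro p hp
    rw [trc_ge (by simpa using hp)]; simp

lemma nuF_trc (γ : ℕ → ℝ) (K : ℕ) (t : ℝ) :
    nuF (trc γ K) t = sS0 K (fun p => trc γ K p ^ 2) t := by
  unfold nuF sS0
  exact tsum_trc γ K (fun p => t ^ p)

lemma nuD1_trc (γ : ℕ → ℝ) (K : ℕ) (t : ℝ) :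
    nuD1 (trc γ K) t = sS1 K (fun p => trc γ K p ^ 2) t := by
  unfold nuD1 sS1
  rw [← tsum_trc γ K (fun p => p * t ^ (p - 1))]
  simp only [mul_assoc]

lemma nuD2_trc (γ : ℕ → ℝ) (K : ℕ) (t : ℝ) :
    nuD2 (trc γ K) t = sS2 K (fun p => trc γ K p ^ 2) t := by
  unfold nuD2 sS2
  rw [← tsum_trc γ K (fun p => p * (((p - 1 : ℕ) : ℝ) * t ^ (p - 1 - 1)))]
  congr 1; ext p
  split_ifs with h
  · rw [Nat.cast_sub (by omega : 1 ≤ p), Nat.sub_sub]; push_cast; ring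
  · rfl

/-- index set -/
abbrev Ix (N K : ℕ) : Type := (p : Fin K) × (Fin (p : ℕ) → Fin N)

abbrev EN (N K : ℕ) : Type := EuclideanSpace ℝ (Ix N K)

/-- the feature map -/
def feat (N K : ℕ) (g : ℕ → ℝ) (x : VN N) : EN N K :=
  WithLp.toLp 2 fun i => g i.1 * ∏ k, x (i.2 k)

lemma inner_feat (N K : ℕ) (g h : ℕ → ℝ) (x y : VN N) :
    inner ℝ (feat N K g x) (feat N K h y) = sS0 K (fun p => g p * h p) (inner ℝ x y) := by
  have e : inner ℝ x y = ∑ j, x j * y j := by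
    rw [PiLp.inner_apply]
    refine Finset.sum_congr rfl fun j _ => ?_
    simp [mul_comm]
  rw [e, PiLp.inner_apply, Fintype.sum_sigma]
  unfold sS0
  rw [← Fin.sum_univ_eq_sum_range (fun p => g p * h p * (∑ j, x j * y j) ^ p)]
  refine Finset.sum_congr rfl fun p _ => ?_
  have : (∑ j, x j * y j) ^ (p : ℕ) = ∑ i : Fin (p:ℕ) → Fin N, ∏ k, (x (i k) * y (i k)) := by
    exact Fintype.sum_pow (fun j => x j * y j) p
  rw [this, Finset.mul_sum]
  refine Finset.sum_congr rfl fun i _ => ?_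
  simp only [feat, Finset.prod_mul_distrib]
  simp
  ring

lemma feat_contDiff (N K : ℕ) (g : ℕ → ℝ) : ContDiff ℝ 1 (feat N K g) := by
  unfold feat
  rw [contDiff_euclidean]
  intro i
  dsimp only
  refine contDiff_const.mul ?_
  refine contDiff_prod fun k _ => ?_
  exact contDiff_piLp_apply 2

/-- derivative of an inner product with the feature map along a line -/
lemma feat_line (N K : ℕ) (g : ℕ → ℝ) (x v : VN N) (w : EN N K) :
    HasDerivAt (fun t : ℝ => inner ℝ (feat N K g (x + t • v)) w)
      (inner ℝ (fderiv ℝ (feat N K g) x v) w) 0 := by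
  have h1 : HasFDerivAt (feat N K g) (fderiv ℝ (feat N K g) x) (x + (0:ℝ) • v) := by
    rw [zero_smul, add_zero]
    exact ((feat_contDiff N K g).differentiable (by norm_num) x).hasFDerivAt
  have h2 : HasDerivAt (fun t : ℝ => x + t • v) v 0 := by
    have := ((hasDerivAt_id (0:ℝ)).smul_const v).const_add x
    simpa using this
  have h3 := h1.comp_hasDerivAt (0:ℝ) h2
  have h4 := h3.inner ℝ (hasDerivAt_const (0:ℝ) w)
  refine h4.congr_deriv ?_
  simp

lemma inner_line (N : ℕ) (x v y : VN N) :
    HasDerivAt (fun t : ℝ => inner ℝ (x + t • v) y) (inner ℝ v y) 0 := by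
  have : (fun t : ℝ => inner ℝ (x + t • v) y) = fun t : ℝ => inner ℝ x y + t * inner ℝ v y := by
    ext t; rw [inner_add_left, real_inner_smul_left]
  rw [this]
  have := ((hasDerivAt_id (0:ℝ)).mul_const (inner ℝ v y)).const_add (inner ℝ x y)
  simpa using this

lemma inner_dfeat (N K : ℕ) (g h : ℕ → ℝ) (x v y : VN N) :
    inner ℝ (fderiv ℝ (feat N K g) x v) (feat N K h y)
      = sS1 K (fun p => g p * h p) (inner ℝ x y) * inner ℝ v y := by
  have h1 := feat_line N K g x v (feat N K h y)
  simp only [inner_feat] at h1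
  have h2 : HasDerivAt (sS0 K (fun p => g p * h p)) (sS1 K (fun p => g p * h p) (inner ℝ x y))
      (inner ℝ (x + (0:ℝ) • v) y) := by
    rw [zero_smul, add_zero]; exact sS0_deriv _ _ _
  have h3 := h2.comp (0:ℝ) (inner_line N x v y)
  exact h1.unique h3

lemma inner_ddfeat (N K : ℕ) (g h : ℕ → ℝ) (x v y w : VN N) :
    inner ℝ (fderiv ℝ (feat N K g) x v) (fderiv ℝ (feat N K h) y w)
      = sS2 K (fun p => g p * h p) (inner ℝ x y) * inner ℝ v y * inner ℝ x w
        + sS1 K (fun p => g p * h p) (inner ℝ x y) * inner ℝ v w := by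
  have h1 := feat_line N K h y w (fderiv ℝ (feat N K g) x v)
  have e : ∀ t : ℝ, inner ℝ (feat N K h (y + t • w)) (fderiv ℝ (feat N K g) x v)
      = sS1 K (fun p => g p * h p) (inner ℝ (y + t • w) x) * inner ℝ (y + t • w) v := by
    intro t
    rw [real_inner_comm, inner_dfeat, real_inner_comm x, real_inner_comm v]
  simp only [e] at h1
  have h2 : HasDerivAt (sS1 K (fun p => g p * h p)) (sS2 K (fun p => g p * h p) (inner ℝ y x))
      (inner ℝ (y + (0:ℝ) • w) x) := by
    rw [zero_smul, add_zero]; exact sS1_deriv _ _ _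
  have h3 := (h2.comp (0:ℝ) (inner_line N y w x)).mul (inner_line N y w v)
  have h4 := h1.unique h3
  rw [real_inner_comm, h4]
  simp only [Function.comp, zero_smul, add_zero]
  rw [real_inner_comm y x, real_inner_comm w x, real_inner_comm v y, real_inner_comm v w]
  ring

/-- the concrete model -/
def mkMod (N K : ℕ) (γ : ℕ → ℝ) (q : ℝ) :
    Mod N (EN N K) (G0 (trc (gammaScale γ q) K)) (G1 (trc (gammaScale γ q) K))
      (G2 (trc (gammaScale γ q) K)) (nuF (trc γ K)) (fun t => nuF (trc γ K) (q * t))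
      (fun t => q * nuD1 (trc γ K) (q * t)) where
  φ := feat N K (trc (gammaScale γ q) K)
  ψ := feat N K (trc γ K)
  T := fderiv ℝ (feat N K (trc (gammaScale γ q) K))
  cφ := (feat_contDiff N K _).continuous
  cψ := (feat_contDiff N K _).continuous
  cT := (feat_contDiff N K _).continuous_fderiv (by norm_num)
  hφ x y := by
    rw [inner_feat, ← nuF_eq, nuF_trc]; simp only [pow_two]
  hTφ x v y := by
    rw [inner_dfeat, ← nuD1_eq, nuD1_trc]; simp only [pow_two]
  hTT x v y w := by
    rw [inner_ddfeat, ← nuD1_eq, nuD1_trc, ← nuD2_eq, nuD2_trc]; simp only [pow_two]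
  hψψ x y := by
    rw [inner_feat, nuF_trc]; simp only [pow_two]
  hψφ y x := by
    rw [inner_feat, nuF_trc, real_inner_comm x y]
    unfold sS0
    refine Finset.sum_congr rfl fun p _ => ?_
    dsimp only; rw [trc_scale]; ring
  hψT y x v := by
    rw [real_inner_comm, inner_dfeat, nuD1_trc]
    congr 1
    unfold sS1
    rw [Finset.mul_sum]
    refine Finset.sum_congr rfl fun p _ => ?_
    dsimp only; rw [trc_scale]
    rcases p with _ | p
    · simp
    · simp only [Nat.add_sub_cancel]; rw [mul_pow]; ring

lemma tay_mono (s t : ℝ) (hs : |s| ≤ 1) (ht : |t| ≤ 1) (p : ℕ) :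
    |s ^ p - t ^ p - p * t ^ (p - 1) * (s - t)| ≤ p * ((p:ℝ) - 1) / 2 * (s - t) ^ 2 := by
  induction p with
  | zero => simp
  | succ p ih =>
    have e : s ^ (p+1) - t ^ (p+1) - ((p+1 : ℕ) : ℝ) * t ^ (p + 1 - 1) * (s - t)
        = s * (s ^ p - t ^ p - p * t ^ (p - 1) * (s - t)) + p * (t ^ (p - 1) * (s - t) ^ 2) := by
      rcases p with _ | p
      · simp
      · simp only [Nat.add_sub_cancel]; push_cast; ring
    rw [e]
    have h1 : |s * (s ^ p - t ^ p - p * t ^ (p - 1) * (s - t))| ≤ p * ((p:ℝ) - 1) / 2 * (s - t) ^ 2 := by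
      rw [abs_mul]
      calc _ ≤ 1 * |s ^ p - t ^ p - p * t ^ (p - 1) * (s - t)| := by gcongr
        _ ≤ _ := by rw [one_mul]; exact ih
    have h2 : |(p:ℝ) * (t ^ (p - 1) * (s - t) ^ 2)| ≤ p * (1 * (s - t) ^ 2) := by
      rw [abs_mul, abs_mul, Nat.abs_cast, abs_pow, abs_of_nonneg (sq_nonneg (s - t))]
      gcongr
      exact pow_le_one₀ (abs_nonneg t) ht
    refine (abs_add_le _ _).trans ((add_le_add h1 h2).trans (le_of_eq ?_))
    push_cast; ring

lemma tay_trc (γ : ℕ → ℝ) (K : ℕ) (s t : ℝ) (hs : |s| ≤ 1) (ht : |t| ≤ 1) :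
    nuF (trc γ K) s ≤ nuF (trc γ K) t + nuD1 (trc γ K) t * (s - t)
      + 1/2 * nuD2 (trc γ K) 1 * (s - t) ^ 2 := by
  rw [nuF_trc, nuF_trc, nuD1_trc, nuD2_trc]
  unfold sS0 sS1 sS2
  rw [Finset.sum_mul, Finset.mul_sum, Finset.sum_mul, ← Finset.sum_add_distrib, ← Finset.sum_add_distrib]
  refine Finset.sum_le_sum fun p _ => ?_
  have h := (abs_le.1 (tay_mono s t hs ht p)).2
  have h2 : (p : ℝ) * (((p - 1 : ℕ) : ℝ)) = p * ((p : ℝ) - 1) := by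
    rcases p with _ | p <;> simp
  have h3 := mul_le_mul_of_nonneg_left h (sq_nonneg (trc γ K p))
  rw [one_pow, mul_one, h2]
  linarith

lemma cont_nuF_trc (γ : ℕ → ℝ) (K : ℕ) : Continuous (nuF (trc γ K)) := by
  have : nuF (trc γ K) = sS0 K (fun p => trc γ K p ^ 2) := funext (nuF_trc γ K)
  rw [this]; unfold sS0; fun_prop

lemma cont_nuD1_trc (γ : ℕ → ℝ) (K : ℕ) : Continuous (nuD1 (trc γ K)) := by
  have : nuD1 (trc γ K) = sS1 K (fun p => trc γ K p ^ 2) := funext (nuD1_trc γ K)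
  rw [this]; unfold sS1; fun_prop

lemma G0_sc (γ : ℕ → ℝ) (K : ℕ) (q : ℝ) :
    G0 (trc (gammaScale γ q) K) 1 = nuF (trc γ K) (q ^ 2) := by
  rw [← nuF_one, nuF_trc, nuF_trc]
  unfold sS0
  refine Finset.sum_congr rfl fun p _ => ?_
  dsimp only; rw [trc_scale]; rw [← pow_mul, mul_comm 2 p, pow_mul]; ring

lemma G1_sc (γ : ℕ → ℝ) (K : ℕ) (q : ℝ) :
    G1 (trc (gammaScale γ q) K) 1 = q ^ 2 * nuD1 (trc γ K) (q ^ 2) := by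
  rw [← nuD1_one, nuD1_trc, nuD1_trc]
  unfold sS1
  rw [Finset.mul_sum]
  refine Finset.sum_congr rfl fun p _ => ?_
  dsimp only; rw [trc_scale]
  rcases p with _ | p
  · simp
  · simp only [Nat.add_sub_cancel]; ring

lemma trc_dom {γ : ℕ → ℝ} (hγ : GammaDecay γ) (K : ℕ) {q : ℝ} (hq0 : 0 ≤ q) (hq : q ≤ 1) :
    trc (gammaScale γ q) K ∈ Dom γ := by
  intro p
  rw [trc_scale]
  have h0 := hγ.1 p
  have h1 := pow_nonneg hq0 p
  have h2 := pow_le_one₀ hq0 hq (n := p)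
  unfold trc
  split_ifs
  · exact ⟨by positivity, mul_le_of_le_one_right h0 h2⟩
  · simpa using h0

lemma trunc_prob {γ : ℕ → ℝ} (hγ : GammaDecay γ) (K : ℕ) {β u x q η : ℝ} (hq0 : 0 < q) (hq : q < 1)
    (hm : Mixed (trc (gammaScale γ q) K)) (hu : u ≠ 0)
    (hA : β ^ 2 * nuD2 (trc γ K) 1 * (1 - q ^ 2) ^ 2 < 1) (hη : 0 < η)
    (hF : ∀ᶠ δ in nhdsWithin (0:ℝ) (Ioi 0), ∀ r ∈ Ioo (-1:ℝ) 1, ∃ a b S,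
      Fc (trc (gammaScale γ q) K) u x δ r a b S ≤ η) :
    ∃ N0 : ℕ, ∀ N ≥ N0, ee (-(N * (21 * η))) ≤ stdGaussian (EN N K)
      {J | ee (N * (1/2 * β ^ 2 * (nuF (trc γ K) 1 - nuF (trc γ K) (q ^ 2)
          - nuD1 (trc γ K) (q ^ 2) * (1 - q ^ 2)) - β * u + 1/2 * Real.log (1 - q^2) - 3 * η)) ≤
        ∫⁻ τ, ee (-β * √N * inner ℝ J (feat N K (trc γ K) (τ : VN N))) ∂(unifSphere N)} := by
  have hc := trc_dom hγ K hq0.le hq.le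
  have hg := good_of hγ hc hm
  have e1 : G1 (trc (gammaScale γ q) K) 1 / q ^ 2 = nuD1 (trc γ K) (q ^ 2) := by
    rw [G1_sc]; field_simp
  obtain ⟨δ0, hδ0, h⟩ := key_prop (K0 := G0 (trc (gammaScale γ q) K)) (K1 := G1 (trc (gammaScale γ q) K))
    (K2 := G2 (trc (gammaScale γ q) K)) (F := nuF (trc γ K)) (P := fun t => nuF (trc γ K) (q * t))
    (Q := fun t => q * nuD1 (trc γ K) (q * t)) (β := β) (u := u) (x := x) (q := q)
    (a := nuD2 (trc γ K) 1) (η := η) hg.p0 hg.p1 hg.hd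
    (cont_nuF_trc γ K) ((cont_nuF_trc γ K).comp (by fun_prop))
    (continuous_const.mul ((cont_nuD1_trc γ K).comp (by fun_prop)))
    (Ksq_pos hg hu).le (fun r hr => mu_lt hγ hc hm hr) hq0 hq
    (by rw [G0_sc, pow_two]) (by rw [G1_sc, pow_two]; ring)
    (by
      rw [nuD2_trc]
      refine Finset.sum_nonneg fun p _ => ?_
      positivity) hA
    (fun s hs => by
      rw [e1, G0_sc]
      refine tay_trc γ K s (q^2) (abs_le.2 hs) ?_
      rw [abs_of_nonneg (by positivity)]
      exact pow_le_one₀ hq0.le hq.le) hη rfl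
  obtain ⟨δ, hδ, hδp, hδ1⟩ := (hF.and (eventually_mem_nhdsWithin.and
    ((eventually_lt_nhds hδ0).filter_mono nhdsWithin_le_nhds))).exists
  obtain ⟨N0, hN0⟩ := h δ hδp hδ1 hδ
  refine ⟨N0, fun N hN => ?_⟩
  have h5 := hN0 N hN (EN N K) (mkMod N K γ q)
  rw [e1, G0_sc] at h5
  exact h5

/-- simple truncation -/
def tr1 (γ : ℕ → ℝ) (K : ℕ) : ℕ → ℝ := fun p => if p < K then γ p else 0

lemma ser_tr (h : ℕ → ℝ → ℝ) (γ : ℕ → ℝ) (K : ℕ) (t : ℝ) : Ser h (trc γ K) t = Ser h (tr1 γ K) t := by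
  unfold Ser
  congr 1; ext p
  split_ifs with h2
  · unfold trc tr1; simp [h2]
  · rfl

lemma tr1_tendsto (γ : ℕ → ℝ) : Tendsto (tr1 γ) atTop (nhds γ) := by
  rw [tendsto_pi_nhds]
  intro p
  refine tendsto_const_nhds.congr' ?_
  filter_upwards [eventually_gt_atTop p] with K hK
  unfold tr1; rw [if_pos hK]

lemma tr1_dom {γ c : ℕ → ℝ} (hc : c ∈ Dom γ) (K : ℕ) : tr1 c K ∈ Dom γ := by
  intro p
  unfold tr1
  have := hc p
  split_ifs
  · exact this
  · exact ⟨le_rfl, this.1.trans this.2⟩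

lemma ser_tr_tendsto {γ : ℕ → ℝ} (hγ : GammaDecay γ) {h : ℕ → ℝ → ℝ} (hh : HB h) {t : ℝ}
    (ht : t ∈ Icc (-1:ℝ) 1) : Tendsto (fun K => Ser h (trc γ K) t) atTop (nhds (Ser h γ t)) := by
  simp only [ser_tr]
  have h1 := ser_continuousOn hγ hh (γ, t) ⟨Dom_self hγ, ht⟩
  have h2 : Tendsto (fun K => (tr1 γ K, t)) atTop (nhdsWithin (γ, t) (Dom γ ×ˢ Icc (-1:ℝ) 1)) := by
    refine tendsto_nhdsWithin_iff.2 ⟨(tr1_tendsto γ).prodMk_nhds tendsto_const_nhds, ?_⟩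
    exact Eventually.of_forall fun K => ⟨tr1_dom (Dom_self hγ) K, ht⟩
  have h3 : Tendsto (fun z : (ℕ → ℝ) × ℝ => Ser h z.1 z.2)
      (nhdsWithin (γ, t) (Dom γ ×ˢ Icc (-1:ℝ) 1)) (nhds (Ser h γ t)) := h1
  have h4 := h3.comp h2
  simp only [Function.comp_def] at h4
  exact h4

lemma nuF_tr_tendsto {γ : ℕ → ℝ} (hγ : GammaDecay γ) {t : ℝ} (ht : t ∈ Icc (-1:ℝ) 1) :
    Tendsto (fun K => nuF (trc γ K) t) atTop (nhds (nuF γ t)) := by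
  simp only [nuF_eq]
  exact (ser_tr_tendsto hγ HB_h0 ht).const_mul _

lemma nuD1_tr_tendsto {γ : ℕ → ℝ} (hγ : GammaDecay γ) {t : ℝ} (ht : t ∈ Icc (-1:ℝ) 1) :
    Tendsto (fun K => nuD1 (trc γ K) t) atTop (nhds (nuD1 γ t)) := by
  simp only [nuD1_eq]
  exact (ser_tr_tendsto hγ HB_h1 ht).const_mul _

lemma nuD2_tr_tendsto {γ : ℕ → ℝ} (hγ : GammaDecay γ) {t : ℝ} (ht : t ∈ Icc (-1:ℝ) 1) :
    Tendsto (fun K => nuD2 (trc γ K) t) atTop (nhds (nuD2 γ t)) := by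
  simp only [nuD2_eq]
  exact (ser_tr_tendsto hγ HB_h2 ht)

lemma Reg_trc {γ c : ℕ → ℝ} {u x η : ℝ} (hc : c ∈ Dom γ)
    (h : Reg γ (c, u, x) (Ioo (-1) 1)) (hη : 0 < η) :
    ∀ᶠ K in atTop, ∀ᶠ δ in nhdsWithin (0:ℝ) (Ioi 0), ∀ r ∈ Ioo (-1:ℝ) 1, ∃ a b S,
      Fc (trc c K) u x δ r a b S ≤ η := by
  have h1 := h η hη
  have h2 : Tendsto (fun K => ((tr1 c K, u, x) : ZZ)) atTop (nhdsWithin ((c, u, x) : ZZ) (DS γ)) := by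
    refine tendsto_nhdsWithin_iff.2 ⟨(tr1_tendsto c).prodMk_nhds tendsto_const_nhds, ?_⟩
    exact Eventually.of_forall fun K => ⟨tr1_dom hc K, trivial⟩
  have h3 := h2.eventually h1.curry
  filter_upwards [h3] with K hK
  filter_upwards [hK] with δ hδ r hr
  obtain ⟨a, b, S, hF⟩ := hδ r hr
  refine ⟨a, b, S, ?_⟩
  unfold Fc G0 G1 G2 at hF ⊢
  simp only [ser_tr]
  exact hF

lemma Mixed_trc {c : ℕ → ℝ} (h : Mixed c) : ∀ᶠ K in atTop, Mixed (trc c K) := by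
  obtain ⟨p, q, hp, hq, hpq, h1, h2⟩ := h
  filter_upwards [eventually_gt_atTop p, eventually_gt_atTop q] with K hK hK'
  refine ⟨p, q, hp, hq, hpq, ?_, ?_⟩
  · unfold trc; rw [if_pos ⟨hK, hp⟩]; exact h1
  · unfold trc; rw [if_pos ⟨hK', hq⟩]; exact h2

lemma alphaSq_zero (γ : ℕ → ℝ) (q : ℝ) : alphaSq γ 0 q = nuF γ (q ^ 2) := by
  unfold alphaSq nuF
  rw [pow_zero, one_mul]
  congr 1; ext p
  simp [pow_mul]

lemma alphaSq_one (γ : ℕ → ℝ) (q : ℝ) : alphaSq γ 1 q = nuD1 γ (q ^ 2) * (1 - q ^ 2) := by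
  unfold alphaSq nuD1
  rw [pow_one, mul_comm]
  congr 1; congr 1; ext p
  simp [pow_mul]

lemma tMinus_bd {y g : ℝ} (hg : 0 < g) (hy : 2 * √g < y) :
    4 * ((y - √(y ^ 2 - 4 * g)) / (4 * g)) ^ 2 * g < 1 := by
  have hs : 0 < √g := Real.sqrt_pos.2 hg
  have hs2 : √g ^ 2 = g := Real.sq_sqrt hg.le
  obtain ⟨s, hsd⟩ : ∃ s, s = √g := ⟨_, rfl⟩
  rw [← hsd] at hs hy hs2
  have h1 : 0 < y ^ 2 - 4 * g := by nlinarith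
  have h2 : y - 2 * s < √(y ^ 2 - 4 * g) := by
    refine Real.lt_sqrt_of_sq_lt ?_
    nlinarith
  have h3 : √(y ^ 2 - 4 * g) ≤ y := by
    refine Real.sqrt_le_iff.2 ⟨by linarith, by linarith⟩
  obtain ⟨w, hw⟩ : ∃ w, w = y - √(y ^ 2 - 4 * g) := ⟨_, rfl⟩
  rw [← hw]
  have h4 : 0 ≤ w := by linarith
  have h5 : w < 2 * s := by linarith
  have h6 : w ^ 2 < 4 * g := by nlinarith
  have h7 : 4 * (w / (4 * g)) ^ 2 * g = w ^ 2 / (4 * g) := by field_simp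
  rw [h7, div_lt_one (by positivity)]
  exact h6

lemma scale_dom {γ : ℕ → ℝ} (hγ : GammaDecay γ) {q : ℝ} (hq0 : 0 ≤ q) (hq : q ≤ 1) :
    gammaScale γ q ∈ Dom γ := by
  intro p
  have h0 := hγ.1 p
  have h1 := pow_nonneg hq0 p
  have h2 := pow_le_one₀ hq0 hq (n := p)
  exact ⟨mul_nonneg h0 h1, mul_le_of_le_one_right h0 h2⟩

lemma Mixed_scale {γ : ℕ → ℝ} (h : Mixed γ) {q : ℝ} (hq : 0 < q) : Mixed (gammaScale γ q) := by
  obtain ⟨a, b, ha, hb, hab, h1, h2⟩ := h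
  refine ⟨a, b, ha, hb, hab, ?_, ?_⟩
  · exact mul_ne_zero h1 (by positivity)
  · exact mul_ne_zero h2 (by positivity)

lemma params {γ : ℕ → ℝ} (hγ : GammaDecay γ) (hM : ConditionM γ) {qstar : ℝ → ℝ}
    (hqs : IsQStar γ qstar) :
    ∀ᶠ β in atTop, qstar β ∈ Ioo (0:ℝ) 1 ∧ ∃ x, E0q γ (qstar β) ≠ 0 ∧
      Reg γ (gammaScale γ (qstar β), -(E0q γ (qstar β)), x) (Ioo (-1) 1) ∧
      β ^ 2 * nuD2 γ 1 * (1 - qstar β ^ 2) ^ 2 < 1 := by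
  have hm := hM.1
  have hg := good_of hγ (Dom_self hγ) hm
  obtain ⟨U, X, hO⟩ := exists_opt hg
  have hX := opt_x_lt hg hO hM.2.1
  have hx0 := x0_eq hg hO
  have hqin : ∀ᶠ β in atTop, qstar β ∈ Ioo (0:ℝ) 1 := hqs.1.mono fun _ h => h.1
  have hlim := hqs.2
  have hq1 : Tendsto qstar atTop (nhds 1) := by
    have h1 : Tendsto (fun β : ℝ => β⁻¹ * (β * (1 - qstar β))) atTop (nhds (0 * tMinus γ)) :=
      tendsto_inv_atTop_zero.mul hlim
    have h2 : Tendsto (fun β : ℝ => 1 - β⁻¹ * (β * (1 - qstar β))) atTop (nhds (1 - 0 * tMinus γ)) :=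
      tendsto_const_nhds.sub h1
    rw [zero_mul, sub_zero] at h2
    refine h2.congr' ?_
    filter_upwards [eventually_gt_atTop (0:ℝ)] with β hβ
    field_simp; ring
  have hc : Tendsto (fun β => gammaScale γ (qstar β)) atTop (nhdsWithin γ (Dom γ)) := by
    refine tendsto_nhdsWithin_iff.2 ⟨?_, ?_⟩
    · rw [tendsto_pi_nhds]
      intro p
      have := (hq1.pow p).const_mul (γ p)
      rw [one_pow, mul_one] at this
      exact this
    · filter_upwards [hqin] with β hβ
      exact scale_dom hγ hβ.1.le hβ.2.le
  have h1m : (1:ℝ) ∈ Icc (-1 : ℝ) 1 := by simp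
  have hser : ∀ h : ℕ → ℝ → ℝ, HB h → Tendsto (fun β => Ser h (gammaScale γ (qstar β)) 1) atTop
      (nhds (Ser h γ 1)) := by
    intro h hh
    have h3 : Tendsto (fun z : (ℕ → ℝ) × ℝ => Ser h z.1 z.2)
      (nhdsWithin (γ, 1) (Dom γ ×ˢ Icc (-1:ℝ) 1)) (nhds (Ser h γ 1)) :=
        ser_continuousOn hγ hh (γ, 1) ⟨Dom_self hγ, h1m⟩
    have h2 : Tendsto (fun β => (gammaScale γ (qstar β), (1:ℝ))) atTop
        (nhdsWithin (γ, 1) (Dom γ ×ˢ Icc (-1:ℝ) 1)) := by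
      refine tendsto_nhdsWithin_iff.2 ⟨(tendsto_nhds_of_tendsto_nhdsWithin hc).prodMk_nhds tendsto_const_nhds, ?_⟩
      exact (tendsto_nhdsWithin_iff.1 hc).2.mono fun β h => ⟨h, h1m⟩
    have h4 := h3.comp h2
    simp only [Function.comp_def] at h4
    exact h4
  have hgood : ∀ β, qstar β ∈ Ioo (0:ℝ) 1 → Good (G0 (gammaScale γ (qstar β)) 1)
      (G1 (gammaScale γ (qstar β)) 1) (G2 (gammaScale γ (qstar β)) 1) := fun β hβ =>
    good_of hγ (scale_dom hγ hβ.1.le hβ.2.le) (Mixed_scale hm hβ.1)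
  have hex : ∀ β, ∃ z : ℝ × ℝ, qstar β ∈ Ioo (0:ℝ) 1 → IsOpt (G0 (gammaScale γ (qstar β)) 1)
      (G1 (gammaScale γ (qstar β)) 1) (G2 (gammaScale γ (qstar β)) 1) z.1 z.2 := by
    intro β
    by_cases h : qstar β ∈ Ioo (0:ℝ) 1
    · obtain ⟨u, x, h1⟩ := exists_opt (hgood β h)
      exact ⟨(u, x), fun _ => h1⟩
    · exact ⟨0, fun h' => absurd h' h⟩
  choose z hz using hex
  have hzt : Tendsto (fun β => ((z β).1, (z β).2)) atTop (nhds (U, X)) :=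
    opt_tendsto hg (hser _ HB_h0) (hser _ HB_h1) (hser _ HB_h2)
      (hqin.mono fun β h => hgood β h) (hqin.mono fun β h => hz β h) hO
  have hall : Tendsto (fun β => ((gammaScale γ (qstar β), (z β).1, (z β).2) : ZZ)) atTop
      (nhdsWithin ((γ, U, X) : ZZ) (DS γ)) := by
    refine tendsto_nhdsWithin_iff.2 ⟨(tendsto_nhds_of_tendsto_nhdsWithin hc).prodMk_nhds hzt, ?_⟩
    exact (tendsto_nhdsWithin_iff.1 hc).2.mono fun β h => ⟨h, trivial⟩
  have hA := hall.eventually (lemmaA hγ hm hM hO)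
  have hB : ∀ᶠ β in atTop, β ^ 2 * nuD2 γ 1 * (1 - qstar β ^ 2) ^ 2 < 1 := by
    have h1 : Tendsto (fun β => (β * (1 - qstar β)) ^ 2 * (1 + qstar β) ^ 2 * nuD2 γ 1) atTop
        (nhds (tMinus γ ^ 2 * (1 + 1) ^ 2 * nuD2 γ 1)) :=
      ((hlim.pow 2).mul ((hq1.const_add 1).pow 2)).mul_const _
    have h2 : tMinus γ ^ 2 * (1 + 1) ^ 2 * nuD2 γ 1 < 1 := by
      have hh := tMinus_bd (y := x0 γ) (g := G2 γ 1) hg.p2 (by linarith)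
      unfold tMinus
      rw [nuD2_one]
      linarith
    filter_upwards [h1.eventually_lt_const h2] with β hβ
    calc _ = _ := by ring
      _ < 1 := hβ
  filter_upwards [hA, hB, hqin] with β h1 h2 h3
  have hE : -(E0q γ (qstar β)) = (z β).1 := E0_eq (hgood β h3) (hz β h3)
  refine ⟨h3, (z β).2, ?_, ?_, h2⟩
  · have := (hz β h3).neg (hgood β h3)
    intro h0
    rw [h0] at hE; linarith
  · rw [hE]; exact h1 (hz β h3).zero

/-- the truncated statement -/
lemma trunc_main {γ : ℕ → ℝ} (hγ : GammaDecay γ) (hM : ConditionM γ) {β q x η : ℝ}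
    (hq : q ∈ Ioo (0:ℝ) 1) (hE : E0q γ q ≠ 0) (hR : Reg γ (gammaScale γ q, -(E0q γ q), x) (Ioo (-1) 1))
    (hB : β ^ 2 * nuD2 γ 1 * (1 - q ^ 2) ^ 2 < 1) (hη : 0 < η) :
    ∀ᶠ K in atTop, ∃ N0 : ℕ, ∀ N ≥ N0, ee (-(N * (21 * η))) ≤ stdGaussian (EN N K)
      {J | ee (N * (LambdaZ γ β (-(E0q γ q)) q - 4 * η)) ≤
        ∫⁻ τ, ee (-β * √N * inner ℝ J (feat N K (trc γ K) (τ : VN N))) ∂(unifSphere N)} := by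
  have h1m : (1:ℝ) ∈ Icc (-1 : ℝ) 1 := by simp
  have hqm : q ^ 2 ∈ Icc (-1 : ℝ) 1 := ⟨by nlinarith [sq_nonneg q], pow_le_one₀ hq.1.le hq.2.le⟩
  have e1 : ∀ᶠ K in atTop, β ^ 2 * nuD2 (trc γ K) 1 * (1 - q ^ 2) ^ 2 < 1 :=
    (((nuD2_tr_tendsto hγ h1m).const_mul (β ^ 2)).mul_const _).eventually_lt_const hB
  have e2 := Mixed_trc (Mixed_scale hM.1 hq.1)
  have e3 := Reg_trc (scale_dom hγ hq.1.le hq.2.le) hR hη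
  have e4 := (((((nuF_tr_tendsto hγ h1m).sub (nuF_tr_tendsto hγ hqm)).sub
    ((nuD1_tr_tendsto hγ hqm).mul_const (1 - q ^ 2))).const_mul (1/2 * β ^ 2)))
  have e5 := e4.eventually_const_lt (u := 1 / 2 * β ^ 2 * (nuF γ 1 - nuF γ (q ^ 2) - nuD1 γ (q ^ 2) * (1 - q ^ 2)) - η)
    (by linarith)
  filter_upwards [e1, e2, e3, e5] with K h1 h2 h3 h5
  obtain ⟨N0, h⟩ := trunc_prob hγ K (β := β) (u := -(E0q γ q)) (x := x) hq.1 hq.2 h2 (neg_ne_zero.2 hE) h1 hη h3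
  refine ⟨N0, fun N hN => (h N hN).trans (measure_mono ?_)⟩
  intro J hJ
  rw [Set.mem_ofPred_eq] at hJ ⊢
  refine le_trans ?_ hJ
  refine ee_mono ?_
  refine mul_le_mul_of_nonneg_left ?_ (Nat.cast_nonneg N)
  unfold LambdaZ
  rw [alphaSq_zero, alphaSq_one]
  linarith

section conc
variable {E : Type} [NormedAddCommGroup E] [InnerProductSpace ℝ E] [FiniteDimensional ℝ E]
  [MeasurableSpace E] [BorelSpace E]

lemma gauss_lin (a : E) : ∫⁻ J, ee (inner ℝ J a) ∂(stdGaussian E) = ee (1/2 * ‖a‖ ^ 2) := by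
  have h := lemmaG (ι := Fin 0) (e := fun _ => (0:E)) (by
    rw [orthonormal_iff_ite]; intro i; exact i.elim0) (fun _ => 0) (fun _ => 0) (fun i => i.elim0) a
  simpa using h

lemma rot_inv (θ : ℝ) : ((stdGaussian E).prod (stdGaussian E)).map
    (ContinuousLinearMap.rotation θ) = (stdGaussian E).prod (stdGaussian E) := by
  refine IsGaussian.map_rotation_eq_self ?_ θ
  exact integral_id_stdGaussian

lemma rot_lint (θ : ℝ) {f : E × E → ℝ≥0∞} (hf : Measurable f) :
    ∫⁻ z, f (Real.cos θ • z.1 + Real.sin θ • z.2, -Real.sin θ • z.1 + Real.cos θ • z.2)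
      ∂((stdGaussian E).prod (stdGaussian E)) = ∫⁻ z, f z ∂((stdGaussian E).prod (stdGaussian E)) := by
  conv_rhs => rw [← rot_inv (E := E) θ]
  rw [lintegral_map hf (by fun_prop)]
  simp only [ContinuousLinearMap.rotation_apply]

lemma exp_norm_lim (C : ℝ) (t : ℕ → ℝ) (ht : Tendsto t atTop (nhds 0)) :
    Tendsto (fun n => ∫⁻ x, ee (t n * C * ‖x‖) ∂(stdGaussian E)) atTop (nhds 1) := by
  obtain ⟨c, hc, hi⟩ := IsGaussian.exists_integrable_exp_sq (stdGaussian E)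
  have hb : ∫⁻ x, ee (c * ‖x‖ ^ 2 + (|C|) ^ 2 / c) ∂(stdGaussian E) ≠ ⊤ := by
    simp only [ee_add]
    rw [lintegral_mul_const' _ _ (ee_ne_top _)]
    refine ENNReal.mul_ne_top ?_ (ee_ne_top _)
    exact hi.lintegral_lt_top.ne
  have h1 : (1 : ℝ≥0∞) = ∫⁻ x : E, ee (0 * C * ‖x‖) ∂(stdGaussian E) := by simp [ee_zero]
  rw [h1]
  refine tendsto_lintegral_filter_of_dominated_convergence _ ?_ ?_ hb ?_
  · refine Eventually.of_forall fun n => ?_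
    exact measurable_ee.comp (by fun_prop)
  · have : ∀ᶠ n in atTop, |t n| < 1 := by
      have := ht.abs.eventually_lt_const (u := 1) (by simp)
      exact this
    filter_upwards [this] with n hn
    refine Eventually.of_forall fun x => ee_mono ?_
    have e1 : t n * C * ‖x‖ ≤ |C| * ‖x‖ := by
      refine mul_le_mul_of_nonneg_right ?_ (norm_nonneg x)
      calc t n * C ≤ |t n * C| := le_abs_self _
        _ = |t n| * |C| := abs_mul _ _
        _ ≤ 1 * |C| := by gcongr
        _ = |C| := one_mul _
    have e2 : |C| * ‖x‖ ≤ c * ‖x‖ ^ 2 + |C| ^ 2 / c := by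
      have h3 : 0 ≤ (c * ‖x‖ - |C|) ^ 2 := sq_nonneg _
      have h4 : 0 ≤ |C| * ‖x‖ := by positivity
      have h5 : c * (c * ‖x‖ ^ 2 + |C| ^ 2 / c) = c ^ 2 * ‖x‖ ^ 2 + |C| ^ 2 := by field_simp
      have h6 : c * (|C| * ‖x‖) ≤ c * (c * ‖x‖ ^ 2 + |C| ^ 2 / c) := by
        rw [h5]; nlinarith
      exact le_of_mul_le_mul_left h6 hc
    linarith
  · refine Eventually.of_forall fun x => ?_
    refine (continuous_ee.tendsto _).comp ?_
    exact (ht.mul_const C).mul_const ‖x‖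

lemma one_step {F : E → ℝ} {v : E → E} (hF : Measurable F) {L : ℝ}
    (hL : ∀ x, ‖v x‖ ≤ L) (hsub : ∀ x y, F x - F y ≤ inner ℝ (v x) (x - y)) {l : ℝ} (hl : 0 ≤ l) (h : ℝ) :
    ∫⁻ z : E × E, ee (l * (F z.1 - F (Real.cos h • z.1 + Real.sin h • z.2)))
      ∂((stdGaussian E).prod (stdGaussian E))
      ≤ ee (1/2 * (l * h * L) ^ 2) * ∫⁻ x, ee (l * h ^ 2 * L * ‖x‖) ∂(stdGaussian E) := by
  have hL0 : 0 ≤ L := (norm_nonneg _).trans (hL 0)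
  rw [lintegral_prod _ (by
    refine (measurable_ee.comp ?_).aemeasurable
    fun_prop), ← lintegral_const_mul' _ _ (ee_ne_top _)]
  refine lintegral_mono fun x => ?_
  have h1 : ∀ y, ee (l * (F x - F (Real.cos h • x + Real.sin h • y)))
      ≤ ee (l * (1 - Real.cos h) * inner ℝ (v x) x) * ee (inner ℝ y (-(l * Real.sin h) • v x)) := by
    intro y
    rw [← ee_add]
    refine ee_mono ?_
    have := mul_le_mul_of_nonneg_left (hsub x (Real.cos h • x + Real.sin h • y)) hl
    refine this.trans (le_of_eq ?_)
    rw [inner_sub_right, inner_add_right, real_inner_smul_right, real_inner_smul_right,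
      real_inner_smul_right, real_inner_comm y (v x)]
    ring
  refine (lintegral_mono h1).trans ?_
  rw [lintegral_const_mul' _ _ (ee_ne_top _), gauss_lin, ← ee_add, ← ee_add]
  refine ee_mono ?_
  rw [norm_smul, mul_pow, Real.norm_eq_abs, sq_abs]
  have hs : Real.sin h ^ 2 ≤ h ^ 2 := by
    have := Real.abs_sin_le_abs (x := h)
    rw [← sq_abs, ← sq_abs h]; gcongr
  have hc : 1 - Real.cos h ≤ h ^ 2 := by
    have := Real.one_sub_sq_div_two_le_cos (x := h)
    nlinarith [sq_nonneg h]
  have hc0 : 0 ≤ 1 - Real.cos h := by linarith [Real.cos_le_one h]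
  have i1 : l * (1 - Real.cos h) * inner ℝ (v x) x ≤ l * h ^ 2 * L * ‖x‖ := by
    calc l * (1 - Real.cos h) * inner ℝ (v x) x ≤ l * (1 - Real.cos h) * (‖v x‖ * ‖x‖) := by
          refine mul_le_mul_of_nonneg_left (real_inner_le_norm _ _) (by positivity)
      _ ≤ l * h ^ 2 * (L * ‖x‖) := by
          have := hL x
          gcongr
      _ = _ := by ring
  have i2 : (-(l * Real.sin h)) ^ 2 * ‖v x‖ ^ 2 ≤ (l * h * L) ^ 2 := by
    calc (-(l * Real.sin h)) ^ 2 * ‖v x‖ ^ 2 = l ^ 2 * (Real.sin h ^ 2 * ‖v x‖ ^ 2) := by ring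
      _ ≤ l ^ 2 * (h ^ 2 * L ^ 2) := by
        have := hL x
        gcongr
      _ = _ := by ring
  linarith

lemma conc_exp {F : E → ℝ} {v : E → E} (hF : Measurable F) {L : ℝ}
    (hL : ∀ x, ‖v x‖ ≤ L) (hsub : ∀ x y, F x - F y ≤ inner ℝ (v x) (x - y)) {l : ℝ} (hl : 0 ≤ l) :
    ∫⁻ z : E × E, ee (l * (F z.1 - F z.2)) ∂((stdGaussian E).prod (stdGaussian E))
      ≤ ee (1/2 * (l * (Real.pi / 2) * L) ^ 2) := by
  have hfin : ∀ n : ℕ, 0 < n → ∫⁻ z : E × E, ee (l * (F z.1 - F z.2)) ∂((stdGaussian E).prod (stdGaussian E))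
      ≤ ee (1/2 * (l * (Real.pi / 2) * L) ^ 2) *
        ∫⁻ x, ee ((Real.pi / 2) ^ 2 / n * (l * L) * ‖x‖) ∂(stdGaussian E) := by
    intro n hn
    have hn0 : (0:ℝ) < n := by exact_mod_cast hn
    obtain ⟨h, hh⟩ : ∃ h, h = Real.pi / 2 / n := ⟨_, rfl⟩
    have hnh : n * h = Real.pi / 2 := by rw [hh]; field_simp
    obtain ⟨X, hX⟩ : ∃ X : ℕ → E × E → E, X = fun (k : ℕ) (z : E × E) => Real.cos ((k:ℝ) * h) • z.1 + Real.sin ((k:ℝ) * h) • z.2 := ⟨_, rfl⟩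
    have hXm : ∀ k, Measurable (X k) := by intro k; rw [hX]; fun_prop
    have hX0 : ∀ z, X 0 z = z.1 := by intro z; rw [hX]; simp
    have hXn : ∀ z, X n z = z.2 := by
      intro z; rw [hX]; dsimp only; rw [hnh, Real.cos_pi_div_two, Real.sin_pi_div_two]; simp
    have hstep : ∀ k, ∫⁻ z, ee (l * n * (F (X k z) - F (X (k+1) z))) ∂((stdGaussian E).prod (stdGaussian E))
        ≤ ee (1/2 * (l * n * h * L) ^ 2) * ∫⁻ x, ee (l * n * h ^ 2 * L * ‖x‖) ∂(stdGaussian E) := by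
      intro k
      have h1 := one_step hF hL hsub (l := l * n) (by positivity) h
      rw [← rot_lint (k * h) (by
        refine measurable_ee.comp ?_
        fun_prop)] at h1
      refine le_trans (le_of_eq ?_) h1
      refine lintegral_congr fun z => ?_
      rw [hX]
      dsimp only
      congr 4
      rw [smul_add, smul_add, smul_smul, smul_smul, smul_smul, smul_smul]
      push_cast
      rw [add_mul, one_mul, add_comm (k * h) h, Real.cos_add, Real.sin_add]
      module
    have hprod : ∀ z : E × E, ee (l * (F z.1 - F z.2)) =
        ∏ k ∈ Finset.range n, ee (l * n * (F (X k z) - F (X (k+1) z))) ^ ((1:ℝ) / n) := by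
      intro z
      have : ∀ k, ee (l * n * (F (X k z) - F (X (k+1) z))) ^ ((1:ℝ) / n) = ee (l * (F (X k z) - F (X (k+1) z))) := by
        intro k
        unfold ee
        rw [ENNReal.ofReal_rpow_of_pos (Real.exp_pos _), ← Real.exp_mul]
        congr 2; field_simp
      simp only [this]
      rw [← ee_sum, ← Finset.mul_sum, Finset.sum_range_sub' (fun k => F (X k z)), hX0, hXn]
    simp only [hprod]
    refine (ENNReal.lintegral_prod_norm_pow_le (Finset.range n) (fun k _ => ?_) ?_ ?_).trans ?_
    · refine (measurable_ee.comp ?_).aemeasurable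
      exact ((hF.comp (hXm k)).sub (hF.comp (hXm (k+1)))).const_mul _
    · simp; field_simp
    · intro k _; positivity
    · refine (Finset.prod_le_prod' fun k _ => ENNReal.rpow_le_rpow (hstep k) (by positivity)).trans ?_
      rw [Finset.prod_const, Finset.card_range, ← ENNReal.rpow_natCast, ← ENNReal.rpow_mul,
        one_div_mul_cancel hn0.ne', ENNReal.rpow_one]
      refine le_of_eq ?_
      have e1 : l * n * h * L = l * (Real.pi / 2) * L := by rw [← hnh]; ring
      have e2 : l * n * h ^ 2 * L = (Real.pi / 2) ^ 2 / n * (l * L) := by rw [← hnh]; field_simp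
      rw [e1, e2]
  have hlim := exp_norm_lim (E := E) (l * L) (fun n : ℕ => (Real.pi / 2) ^ 2 / n)
    (tendsto_const_div_atTop_nhds_zero_nat _)
  have hlim2 := ENNReal.Tendsto.const_mul (a := ee (1/2 * (l * (Real.pi / 2) * L) ^ 2)) hlim (Or.inr (ee_ne_top _))
  rw [mul_one] at hlim2
  refine ge_of_tendsto hlim2 ?_
  filter_upwards [eventually_gt_atTop 0] with n hn
  exact hfin n hn

lemma conc_meas {F : E → ℝ} {v : E → E} (hF : Measurable F) {L : ℝ}
    (hL : ∀ x, ‖v x‖ ≤ L) (hsub : ∀ x y, F x - F y ≤ inner ℝ (v x) (x - y)) {l : ℝ} (hl : 0 ≤ l) (a b : ℝ) :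
    ee (l * (b - a)) * (stdGaussian E {x | b ≤ F x} * stdGaussian E {x | F x ≤ a})
      ≤ ee (1/2 * (l * (Real.pi / 2) * L) ^ 2) := by
  have m1 : MeasurableSet {x | b ≤ F x} := measurableSet_le measurable_const hF
  have m2 : MeasurableSet {x | F x ≤ a} := measurableSet_le hF measurable_const
  rw [← Measure.prod_prod, ← setLIntegral_const]
  refine le_trans ?_ (conc_exp hF hL hsub hl)
  refine le_trans ?_ (setLIntegral_le_lintegral ({x | b ≤ F x} ×ˢ {x | F x ≤ a}) _)
  refine setLIntegral_mono' (m1.prod m2) ?_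
  rintro ⟨x, y⟩ ⟨h1, h2⟩
  refine ee_mono (mul_le_mul_of_nonneg_left ?_ hl)
  simp only [Set.mem_ofPred_eq] at h1 h2
  dsimp only
  linarith

end conc

section part
variable {E : Type} [NormedAddCommGroup E] [InnerProductSpace ℝ E] [FiniteDimensional ℝ E]
  [MeasurableSpace E] [BorelSpace E]
variable {α : Type} [TopologicalSpace α] [CompactSpace α] [MeasurableSpace α] [OpensMeasurableSpace α]
  (ρ : Measure α) [IsProbabilityMeasure ρ] {a : α → E}

lemma cpt_int {G : Type} [NormedAddCommGroup G] [SecondCountableTopology G] {f : α → G} (hf : Continuous f) : Integrable f ρ := by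
  obtain ⟨C, hC⟩ := (isCompact_univ (X := α)).exists_bound_of_continuousOn hf.continuousOn
  borelize G
  exact Integrable.of_bound hf.measurable.aestronglyMeasurable C (Eventually.of_forall fun x => hC x trivial)

/-- log partition function -/
def lpf (ρ : Measure α) (a : α → E) (x : E) : ℝ := Real.log (∫ τ, rexp (inner ℝ x (a τ)) ∂ρ)

lemma pf_pos (ha : Continuous a) (x : E) : 0 < ∫ τ, rexp (inner ℝ x (a τ)) ∂ρ :=
  integral_exp_pos (cpt_int ρ (by fun_prop))

lemma lpf_sub (ha : Continuous a) {L : ℝ} (hL : ∀ τ, ‖a τ‖ ≤ L) :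
    ∃ v : E → E, (∀ x, ‖v x‖ ≤ L) ∧ ∀ x y, lpf ρ a x - lpf ρ a y ≤ inner ℝ (v x) (x - y) := by
  refine ⟨fun x => (∫ τ, rexp (inner ℝ x (a τ)) ∂ρ)⁻¹ • ∫ τ, rexp (inner ℝ x (a τ)) • a τ ∂ρ, fun x => ?_, fun x y => ?_⟩
  · have hp := pf_pos ρ ha x
    rw [norm_smul, norm_inv, Real.norm_of_nonneg hp.le, inv_mul_le_iff₀ hp, ← integral_mul_const]
    refine norm_integral_le_of_norm_le (cpt_int ρ (by fun_prop)) (Eventually.of_forall fun τ => ?_)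
    rw [norm_smul, Real.norm_of_nonneg (Real.exp_pos _).le]
    exact mul_le_mul_of_nonneg_left (hL τ) (Real.exp_pos _).le
  · have hp := pf_pos ρ ha x
    have hpy := pf_pos ρ ha y
    obtain ⟨Z, hZ⟩ : ∃ Z, Z = ∫ τ, rexp (inner ℝ x (a τ)) ∂ρ := ⟨_, rfl⟩
    obtain ⟨V, hV⟩ : ∃ V, V = ∫ τ, rexp (inner ℝ x (a τ)) • a τ ∂ρ := ⟨_, rfl⟩
    obtain ⟨m, hm⟩ : ∃ m, m = inner ℝ (Z⁻¹ • V) (y - x) := ⟨_, rfl⟩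
    dsimp only
    rw [← hZ, ← hV]
    rw [← hZ] at hp
    have hxy : x - y = -(y - x) := by abel
    rw [hxy, inner_neg_right, ← hm]
    have hVi : inner ℝ (y - x) V = Z * m := by
      rw [hm, real_inner_smul_left, real_inner_comm V]
      field_simp
    have hVi2 : ∫ τ, rexp (inner ℝ x (a τ)) * inner ℝ (y - x) (a τ) ∂ρ = Z * m := by
      rw [← hVi, hV, ← integral_inner (cpt_int ρ (by fun_prop))]
      refine integral_congr_ae (Eventually.of_forall fun τ => ?_)
      simp only [real_inner_smul_right]
    have key : rexp m * Z ≤ ∫ τ, rexp (inner ℝ y (a τ)) ∂ρ := by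
      have e1 : rexp m * Z = ∫ τ, (rexp m * (1 - m) * rexp (inner ℝ x (a τ))
          + rexp m * (rexp (inner ℝ x (a τ)) * inner ℝ (y - x) (a τ))) ∂ρ := by
        rw [integral_add (cpt_int ρ (by fun_prop)) (cpt_int ρ (by fun_prop)), integral_const_mul, integral_const_mul,
          hVi2, ← hZ]
        ring
      rw [e1]
      refine integral_mono (cpt_int ρ (by fun_prop)) (cpt_int ρ (by fun_prop)) fun τ => ?_
      dsimp only
      have h1 := Real.add_one_le_exp (inner ℝ (y - x) (a τ) - m)
      have h2 : inner ℝ y (a τ) = inner ℝ x (a τ) + m + (inner ℝ (y - x) (a τ) - m) := by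
        rw [inner_sub_left]; ring
      rw [h2, Real.exp_add, Real.exp_add]
      have h3 := mul_le_mul_of_nonneg_left h1 (mul_pos (Real.exp_pos (inner ℝ x (a τ))) (Real.exp_pos m)).le
      linarith
    unfold lpf
    rw [← hZ]
    have h4 := Real.log_le_log (by positivity) key
    rw [Real.log_mul (Real.exp_pos m).ne' hp.ne', Real.log_exp] at h4
    linarith

lemma lpf_meas (ha : Continuous a) {L : ℝ} (hL : ∀ τ, ‖a τ‖ ≤ L) : Measurable (lpf ρ a) := by
  obtain ⟨v, h1, h2⟩ := lpf_sub ρ ha hL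
  have h3 : ∀ x y, lpf ρ a x - lpf ρ a y ≤ L * ‖x - y‖ := fun x y =>
    (h2 x y).trans ((real_inner_le_norm _ _).trans (mul_le_mul_of_nonneg_right (h1 x) (norm_nonneg _)))
  have : LipschitzWith (Real.toNNReal L) (lpf ρ a) := by
    refine LipschitzWith.of_dist_le_mul fun x y => ?_
    rw [Real.dist_eq, dist_eq_norm, Real.coe_toNNReal _ ((norm_nonneg _).trans (h1 0))]
    refine abs_le.2 ⟨?_, h3 x y⟩
    have := h3 y x
    rw [norm_sub_rev] at this
    linarith
  exact this.continuous.measurable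

lemma lpf_ee (ha : Continuous a) (x : E) :
    ∫⁻ τ, ee (inner ℝ x (a τ)) ∂ρ = ee (lpf ρ a x) := by
  unfold ee lpf
  rw [Real.exp_log (pf_pos ρ ha x), ofReal_integral_eq_lintegral_ofReal (cpt_int ρ (by fun_prop))
    (Eventually.of_forall fun τ => (Real.exp_pos _).le)]

lemma ee_le_iff {a b : ℝ} : ee a ≤ ee b ↔ a ≤ b := by
  unfold ee
  rw [ENNReal.ofReal_le_ofReal_iff (Real.exp_pos _).le, Real.exp_le_exp]

lemma conc_Z (ha : Continuous a) {L : ℝ} (hL : ∀ τ, ‖a τ‖ ≤ L) {l : ℝ} (hl : 0 ≤ l) (s t : ℝ) :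
    ee (l * (t - s)) * (stdGaussian E {x | ee t ≤ ∫⁻ τ, ee (inner ℝ x (a τ)) ∂ρ} *
      stdGaussian E {x | ∫⁻ τ, ee (inner ℝ x (a τ)) ∂ρ ≤ ee s})
      ≤ ee (1/2 * (l * (Real.pi / 2) * L) ^ 2) := by
  obtain ⟨v, h1, h2⟩ := lpf_sub ρ ha hL
  have := conc_meas (lpf_meas ρ ha hL) h1 h2 hl s t
  simp only [lpf_ee ρ ha, ee_le_iff]
  exact this
end part

lemma unif_prob {N : ℕ} (hN : 0 < N) : IsProbabilityMeasure (unifSphere N) := ⟨unif_univ hN⟩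

lemma nuF_trc_le {γ : ℕ → ℝ} (hγ : GammaDecay γ) (K : ℕ) : nuF (trc γ K) 1 ≤ nuF γ 1 := by
  have h1m : (1:ℝ) ∈ Icc (-1 : ℝ) 1 := by simp
  rw [nuF_one, nuF_one]
  unfold G0
  rw [ser_tr]
  unfold Ser
  refine Summable.tsum_le_tsum (fun p => ?_) (ser_summable hγ HB_h0 (tr1_dom (Dom_self hγ) K) h1m)
    (ser_summable hγ HB_h0 (Dom_self hγ) h1m)
  split_ifs
  · simp only [h0, one_pow, mul_one]
    have h1 := tr1_dom (Dom_self hγ) K p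
    have := h1.1
    have := h1.2
    gcongr
  · exact le_rfl

lemma feat_norm (N K : ℕ) (γ : ℕ → ℝ) (τ : Metric.sphere (0 : VN N) 1) :
    ‖feat N K (trc γ K) (τ : VN N)‖ ^ 2 = nuF (trc γ K) 1 := by
  have hτ : ‖(τ : VN N)‖ = 1 := by simp
  rw [← real_inner_self_eq_norm_sq, inner_feat, real_inner_self_eq_norm_sq, hτ, nuF_trc]
  simp only [pow_two, mul_one]

lemma trunc_conc {γ : ℕ → ℝ} (hγ : GammaDecay γ) (hn : nuF γ 1 = 1) (hM : ConditionM γ) {β q x ε : ℝ}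
    (hq : q ∈ Ioo (0:ℝ) 1) (hE : E0q γ q ≠ 0) (hR : Reg γ (gammaScale γ q, -(E0q γ q), x) (Ioo (-1) 1))
    (hB : β ^ 2 * nuD2 γ 1 * (1 - q ^ 2) ^ 2 < 1) (hε : 0 < ε) :
    ∃ κ > 0, ∀ᶠ K in atTop, ∃ N0 : ℕ, ∀ N ≥ N0, stdGaussian (EN N K)
      {J | ∫⁻ τ, ee (-β * √N * inner ℝ J (feat N K (trc γ K) (τ : VN N))) ∂(unifSphere N)
        ≤ ee (N * (LambdaZ γ β (-(E0q γ q)) q - ε))} ≤ ee (-(N * κ)) := by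
  obtain ⟨B, hBd⟩ : ∃ B, B = Real.pi ^ 2 * β ^ 2 / 8 + 1 := ⟨_, rfl⟩
  have hB0 : 0 < B := by rw [hBd]; positivity
  obtain ⟨θ, hθ⟩ : ∃ θ, θ = ε / (4 * B) := ⟨_, rfl⟩
  have hθ0 : 0 < θ := by rw [hθ]; positivity
  have hθB : θ * B = ε / 4 := by rw [hθ]; field_simp
  obtain ⟨η, hηd⟩ : ∃ η, η = min (ε / 8) (θ * ε / 168) := ⟨_, rfl⟩
  have hη : 0 < η := by rw [hηd]; positivity
  have hη1 : η ≤ ε / 8 := by rw [hηd]; exact min_le_left _ _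
  have hη2 : η ≤ θ * ε / 168 := by rw [hηd]; exact min_le_right _ _
  refine ⟨θ * ε / 8, by positivity, ?_⟩
  filter_upwards [trunc_main hγ hM hq hE hR hB hη] with K hK
  obtain ⟨N0, hN0⟩ := hK
  refine ⟨max N0 1, fun N hN => ?_⟩
  have h1 := hN0 N (le_trans (le_max_left _ _) hN)
  have hNp : 0 < N := lt_of_lt_of_le one_pos (le_trans (le_max_right _ _) hN)
  haveI := unif_prob hNp
  have hca : Continuous fun τ : Metric.sphere (0 : VN N) 1 => (-β * √N) • feat N K (trc γ K) (τ : VN N) := by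
    have := (feat_contDiff N K (trc γ K)).continuous
    fun_prop
  have hLa : ∀ τ : Metric.sphere (0 : VN N) 1, ‖(-β * √N) • feat N K (trc γ K) (τ : VN N)‖ ≤ |β| * √N := by
    intro τ
    have e1 : ‖feat N K (trc γ K) (τ : VN N)‖ ≤ 1 := by
      rw [← sq_le_one_iff₀ (norm_nonneg _), feat_norm]
      exact (nuF_trc_le hγ K).trans hn.le
    rw [norm_smul, norm_mul, norm_neg, Real.norm_eq_abs, Real.norm_of_nonneg (Real.sqrt_nonneg _)]
    exact mul_le_of_le_one_right (by positivity) e1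
  have h2 := conc_Z (unifSphere N) hca hLa hθ0.le (N * (LambdaZ γ β (-(E0q γ q)) q - ε))
    (N * (LambdaZ γ β (-(E0q γ q)) q - 4 * η))
  simp only [real_inner_smul_right] at h2
  obtain ⟨b, hb⟩ : ∃ b, b = stdGaussian (EN N K) {J | ∫⁻ τ, ee (-β * √N * inner ℝ J (feat N K (trc γ K) (τ : VN N))) ∂(unifSphere N)
        ≤ ee (N * (LambdaZ γ β (-(E0q γ q)) q - ε))} := ⟨_, rfl⟩
  rw [← hb] at h2 ⊢
  have h3 : ee (N * (LambdaZ γ β (-(E0q γ q)) q - 4 * η) * θ - N * (LambdaZ γ β (-(E0q γ q)) q - ε) * θ - N * (21 * η)) * b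
      ≤ ee (1/2 * (θ * (Real.pi / 2) * (|β| * √N)) ^ 2) := by
    refine le_trans ?_ h2
    refine le_trans ?_ (le_of_eq (mul_assoc _ _ _))
    refine mul_le_mul_left ?_ b
    refine le_trans (le_of_eq ?_) (mul_le_mul_right h1 _)
    rw [← ee_add]; congr 1; ring
  have h4 : 1/2 * (θ * (Real.pi / 2) * (|β| * √N)) ^ 2 = N * (θ ^ 2 * (B - 1)) := by
    have : (θ * (Real.pi / 2) * (|β| * √N)) ^ 2 = θ ^ 2 * Real.pi ^ 2 / 4 * (|β| ^ 2 * √N ^ 2) := by ring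
    rw [this, Real.sq_sqrt (Nat.cast_nonneg N), sq_abs, hBd]; ring
  rw [h4] at h3
  have h5 : ee (N * (θ * ε / 8) + N * (θ ^ 2 * (B - 1))) * b ≤ ee (N * (θ ^ 2 * (B - 1))) := by
    refine le_trans (mul_le_mul_left (ee_mono ?_) b) h3
    have : N * (θ * ε / 8 + θ ^ 2 * (B - 1)) ≤ N * ((ε - 4 * η) * θ - 21 * η) := by
      refine mul_le_mul_of_nonneg_left ?_ (Nat.cast_nonneg N)
      have e1 : θ ^ 2 * B = θ * ε / 4 := by
        calc θ ^ 2 * B = θ * (θ * B) := by ring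
          _ = _ := by rw [hθB]; ring
      have e2 : 0 ≤ θ ^ 2 := sq_nonneg θ
      have e3 : η * θ ≤ ε / 8 * θ := mul_le_mul_of_nonneg_right hη1 hθ0.le
      linarith
    linarith
  rw [ee_add, mul_comm (ee _) (ee _), mul_assoc] at h5
  have h6 : ee (N * (θ * ε / 8)) * b ≤ 1 := by
    rw [← ENNReal.mul_le_mul_iff_right (ee_ne_zero _) (ee_ne_top _), mul_one]
    exact h5
  calc b = ee (-(N * (θ * ε / 8))) * (ee (N * (θ * ε / 8)) * b) := by
        rw [← mul_assoc, ← ee_add, neg_add_cancel, ee_zero, one_mul]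
    _ ≤ ee (-(N * (θ * ε / 8))) * 1 := mul_le_mul_right h6 _
    _ = _ := mul_one _

section transfer
variable {ΩS : Type*} [MeasurableSpace ΩS]

/-- index embedding -/
def ixE (N M : ℕ) (i : Ix N M) : Idx := (N, ⟨(i.1 : ℕ), fun k => (i.2 k : ℕ)⟩)

lemma ixE_inj (N M : ℕ) : Function.Injective (ixE N M) := by
  rintro ⟨⟨p, hp⟩, i⟩ ⟨⟨q, hq⟩, j⟩ h
  simp only [ixE, Prod.mk.injEq, true_and] at h
  obtain ⟨h1, h2⟩ := Sigma.mk.inj_iff.1 h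
  subst h1
  rw [heq_eq_eq] at h2
  congr 1
  funext k
  exact Fin.ext (congrFun h2 k)

/-- disorder vector -/
def JV (J : Idx → ΩS → ℝ) (N M : ℕ) (ω : ΩS) : EN N M := WithLp.toLp 2 fun i => J (ixE N M i) ω

/-- pure p-spin polynomial -/
def UU (J : Idx → ΩS → ℝ) (N p : ℕ) (ω : ΩS) (x : VN N) : ℝ :=
  ∑ i : Fin p → Fin N, J (N, ⟨p, fun k => (i k : ℕ)⟩) ω * ∏ k, x (i k)

lemma JV_meas {J : Idx → ΩS → ℝ} (hm : ∀ i, Measurable (J i)) (N M : ℕ) : Measurable (JV J N M) := by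
  unfold JV
  exact (WithLp.measurable_toLp 2 _).comp (measurable_pi_iff.2 fun i => hm _)

lemma JV_law {P : Measure ΩS} [IsProbabilityMeasure P] {J : Idx → ΩS → ℝ}
    (hJ : StdGaussianDisorder J P) (N M : ℕ) : P.map (JV J N M) = stdGaussian (EN N M) := by
  obtain ⟨h1, h2, h3⟩ := hJ
  have h4 := h2.precomp (ixE_inj N M)
  rw [iIndepFun_iff_map_fun_eq_pi_map (fun i => (h1 _).aemeasurable)] at h4
  simp only [h3] at h4
  rw [← map_pi_eq_stdGaussian, ← h4, Measure.map_map (WithLp.measurable_toLp 2 _)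
    (measurable_pi_iff.2 fun i => h1 _)]
  rfl

lemma JV_inner (J : Idx → ΩS → ℝ) (N M : ℕ) (g : ℕ → ℝ) (ω : ΩS) (x : VN N) :
    inner ℝ (JV J N M ω) (feat N M g x) = ∑ p ∈ Finset.range M, g p * UU J N p ω x := by
  rw [PiLp.inner_apply, Fintype.sum_sigma,
    ← Fin.sum_univ_eq_sum_range (fun p => g p * UU J N p ω x)]
  refine Finset.sum_congr rfl fun p _ => ?_
  unfold UU
  rw [Finset.mul_sum]
  refine Finset.sum_congr rfl fun i _ => ?_
  simp only [JV, feat, ixE]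
  simp
  ring

lemma UU_meas {J : Idx → ΩS → ℝ} (hm : ∀ i, Measurable (J i)) (N p : ℕ) :
    Measurable fun z : ΩS × Metric.sphere (0 : VN N) 1 => UU J N p z.1 (z.2 : VN N) := by
  unfold UU
  refine Finset.measurable_sum _ fun i _ => ((hm _).comp measurable_fst).mul ?_
  refine Finset.measurable_prod _ fun k _ => ?_
  have : Continuous fun y : Metric.sphere (0 : VN N) 1 => (y : VN N) (i k) := by fun_prop
  exact this.measurable.comp measurable_snd

lemma ham_eq (γ : ℕ → ℝ) (J : Idx → ΩS → ℝ) {N : ℕ} (hN : 0 < N) (ω : ΩS) (x : VN N) :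
    HamN γ J N ω (√N • x) = ∑' p : ℕ, √N * ((if 2 ≤ p then γ p else 0) * UU J N p ω x) := by
  unfold HamN
  refine tsum_congr fun p => ?_
  split_ifs with h
  · have h1 : (Real.sqrt ((N:ℝ) ^ (p - 1)))⁻¹ * (√N) ^ p = √N := by
      have : Real.sqrt ((N:ℝ) ^ (p - 1)) = √N ^ (p - 1) := by
        rw [Real.sqrt_eq_iff_mul_self_eq (by positivity) (by positivity), ← mul_pow,
          Real.mul_self_sqrt (Nat.cast_nonneg N)]
      have hs : 0 < √(N:ℝ) := Real.sqrt_pos.2 (Nat.cast_pos.2 hN)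
      obtain ⟨m, rfl⟩ : ∃ m, p = m + 1 := ⟨p - 1, by omega⟩
      rw [this, Nat.add_sub_cancel, pow_succ]
      field_simp
    unfold UU
    rw [Finset.mul_sum, Finset.mul_sum, Finset.mul_sum]
    refine Finset.sum_congr rfl fun i _ => ?_
    have h2 : ∏ k, (√(N:ℝ) • x) (i k) = √N ^ p * ∏ k, x (i k) := by
      simp [Finset.prod_mul_distrib]
    rw [h2]
    calc _ = ((Real.sqrt ((N:ℝ) ^ (p - 1)))⁻¹ * (√N) ^ p) * (γ p * (J (N, ⟨p, fun k => (i k : ℕ)⟩) ω * ∏ k, x (i k))) := by ring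
      _ = _ := by rw [h1]
  · simp

lemma gexp {P : Measure ΩS} [IsProbabilityMeasure P] {J : Idx → ΩS → ℝ}
    (hJ : StdGaussianDisorder J P) (N M : ℕ) (g : ℕ → ℝ) (c : ℝ) (x : Metric.sphere (0 : VN N) 1) :
    ∫⁻ ω, ee (c * ∑ p ∈ Finset.range M, g p * UU J N p ω (x : VN N)) ∂P
      = ee (1/2 * (c ^ 2 * ∑ p ∈ Finset.range M, g p ^ 2)) := by
  have h1 := gauss_lin (c • feat N M g (x : VN N))
  rw [← JV_law hJ, lintegral_map (by
    have := measurable_ee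
    fun_prop) (JV_meas hJ.1 N M)] at h1
  simp only [real_inner_smul_right, JV_inner] at h1
  rw [h1, norm_smul, mul_pow, Real.norm_eq_abs, sq_abs, ← real_inner_self_eq_norm_sq, inner_feat]
  have hx : ‖(x : VN N)‖ = 1 := by simp
  rw [real_inner_self_eq_norm_sq, hx]
  unfold sS0
  simp [pow_two]

/-- independence of head and tail -/
lemma head_tail {P : Measure ΩS} [IsProbabilityMeasure P] {J : Idx → ΩS → ℝ}
    (hJ : StdGaussianDisorder J P) {N K M : ℕ} (hKM : K ≤ M) {g : ℕ → ℝ} (hg : ∀ p < K, g p = 0)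
    (c : ℝ) (x : Metric.sphere (0 : VN N) 1) {G : EN N K → ℝ≥0∞} (hG : Measurable G) :
    ∫⁻ ω, G (JV J N K ω) * ee (c * ∑ p ∈ Finset.range M, g p * UU J N p ω (x : VN N)) ∂P
      = (∫⁻ ω, G (JV J N K ω) ∂P) * ee (1/2 * (c ^ 2 * ∑ p ∈ Finset.range M, g p ^ 2)) := by
  rw [← gexp hJ N M g c x]
  have hi := hJ.2.1.precomp (ixE_inj N M)
  classical
  obtain ⟨S, hS⟩ : ∃ S : Finset (Ix N M), S = Finset.univ.filter fun i => (i.1 : ℕ) < K := ⟨_, rfl⟩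
  obtain ⟨T, hT⟩ : ∃ T : Finset (Ix N M), T = Finset.univ.filter fun i => ¬ (i.1 : ℕ) < K := ⟨_, rfl⟩
  have hST : Disjoint S T := by rw [hS, hT]; exact Finset.disjoint_filter_filter_not _ _ _
  have h1 := iIndepFun.indepFun_finset S T hST hi (fun i => hJ.1 _)
  obtain ⟨φ, hφ⟩ : ∃ φ : (S → ℝ) → EN N K, φ = fun s => WithLp.toLp 2 fun i : Ix N K =>
    s ⟨(⟨⟨(i.1:ℕ), lt_of_lt_of_le i.1.2 hKM⟩, i.2⟩ : Ix N M), by rw [hS]; simp⟩ := ⟨_, rfl⟩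
  have hφm : Measurable φ := by
    rw [hφ]
    exact (WithLp.measurable_toLp 2 _).comp (measurable_pi_iff.2 fun i => measurable_pi_apply _)
  have e1 : ∀ ω, JV J N K ω = φ (fun i : S => J (ixE N M i) ω) := by
    intro ω; rw [hφ]; rfl
  obtain ⟨ψ, hψ⟩ : ∃ ψ : (T → ℝ) → ℝ, ψ = fun t => ∑ i : T, t i * feat N M g (x : VN N) (i : Ix N M) := ⟨_, rfl⟩
  have hψm : Measurable ψ := by
    rw [hψ]
    exact Finset.measurable_sum _ fun i _ => (measurable_pi_apply i).mul_const _
  have e2 : ∀ ω, ∑ p ∈ Finset.range M, g p * UU J N p ω (x : VN N) = ψ (fun i : T => J (ixE N M i) ω) := by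
    intro ω
    rw [← JV_inner, hψ, PiLp.inner_apply]
    dsimp only
    rw [Finset.sum_coe_sort T (fun i => J (ixE N M i) ω * feat N M g (x : VN N) i), hT, Finset.sum_filter]
    refine Finset.sum_congr rfl fun i _ => ?_
    split_ifs with h
    · have : g (i.1 : ℕ) = 0 := hg _ h
      simp [feat, this]
    · simp [JV, mul_comm]
  simp only [e1, e2]
  have h2 := h1.comp (φ := fun s => G (φ s)) (ψ := fun t => ee (c * ψ t)) (hG.comp hφm)
    (measurable_ee.comp (hψm.const_mul c))
  have h3 := lintegral_mul_eq_lintegral_mul_lintegral_of_indepFun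
    ((hG.comp hφm).comp (measurable_pi_iff.2 fun i : S => hJ.1 (ixE N M i)))
    ((measurable_ee.comp (hψm.const_mul c)).comp (measurable_pi_iff.2 fun i : T => hJ.1 (ixE N M i))) h2
  exact h3
end transfer

section transfer2
variable {ΩS : Type*} [MeasurableSpace ΩS]

/-- nonzero coefficients -/
def gg (γ : ℕ → ℝ) (p : ℕ) : ℝ := if 2 ≤ p then γ p else 0

lemma gg_nonneg {γ : ℕ → ℝ} (hγ : GammaDecay γ) (p : ℕ) : 0 ≤ gg γ p := by
  unfold gg; split_ifs
  · exact hγ.1 p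
  · exact le_rfl

lemma gg_summable {γ : ℕ → ℝ} (hγ : GammaDecay γ) : Summable (gg γ) := by
  obtain ⟨ρ, h0, h1, h2⟩ := hγ.2
  refine Summable.of_norm_bounded_eventually_nat (g := fun p => ρ ^ p) (summable_geometric_of_lt_one h0.le h1) ?_
  filter_upwards [h2] with p hp
  rw [Real.norm_of_nonneg (gg_nonneg hγ p)]
  unfold gg; split_ifs
  · exact hp
  · positivity

lemma nuF_gg (γ : ℕ → ℝ) : nuF γ 1 = ∑' p, gg γ p ^ 2 := by
  unfold nuF gg
  refine tsum_congr fun p => ?_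
  split_ifs <;> simp

lemma gg2_summable {γ : ℕ → ℝ} (hγ : GammaDecay γ) : Summable fun p => gg γ p ^ 2 := by
  have h := gg_summable hγ
  have h2 := h.mul_of_nonneg h (fun p => gg_nonneg hγ p) (fun p => gg_nonneg hγ p)
  have h3 := h2.comp_injective (i := fun p : ℕ => (p, p)) (fun a b h => (Prod.mk.inj h).1)
  refine h3.congr fun p => ?_
  simp [pow_two]

lemma gg_sum_le {γ : ℕ → ℝ} (hγ : GammaDecay γ) (M : ℕ) :
    ∑ p ∈ Finset.range M, gg γ p ^ 2 ≤ nuF γ 1 := by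
  rw [nuF_gg]
  exact (gg2_summable hγ).sum_le_tsum _ fun p _ => sq_nonneg _

lemma trc_gg (γ : ℕ → ℝ) {K p : ℕ} (h : p < K) : trc γ K p = gg γ p := by
  unfold trc gg; simp [h]

lemma nuF_trc_gg (γ : ℕ → ℝ) (K : ℕ) : nuF (trc γ K) 1 = ∑ p ∈ Finset.range K, gg γ p ^ 2 := by
  rw [nuF_trc]; unfold sS0
  refine Finset.sum_congr rfl fun p hp => ?_
  dsimp only
  rw [trc_gg γ (Finset.mem_range.1 hp)]; simp

/-- tail coefficients -/
def tg (γ : ℕ → ℝ) (K p : ℕ) : ℝ := if p < K then 0 else gg γ p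

lemma split_sum (γ : ℕ → ℝ) {K M : ℕ} (h : K ≤ M) (f : ℕ → ℝ) :
    ∑ p ∈ Finset.range M, gg γ p * f p
      = ∑ p ∈ Finset.range K, gg γ p * f p + ∑ p ∈ Finset.range M, tg γ K p * f p := by
  have e1 : ∑ p ∈ Finset.range K, gg γ p * f p = ∑ p ∈ Finset.range M, if p < K then gg γ p * f p else 0 := by
    rw [← Finset.sum_filter]
    refine Finset.sum_congr ?_ fun _ _ => rfl
    ext p; simp; omega
  rw [e1, ← Finset.sum_add_distrib]
  refine Finset.sum_congr rfl fun p _ => ?_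
  unfold tg; split_ifs <;> simp

lemma tg_sum_le {γ : ℕ → ℝ} (hγ : GammaDecay γ) {K M : ℕ} (h : K ≤ M) :
    ∑ p ∈ Finset.range M, tg γ K p ^ 2 ≤ nuF γ 1 - nuF (trc γ K) 1 := by
  have h1 := split_sum γ h (gg γ)
  have h2 : ∀ p, tg γ K p * gg γ p = tg γ K p ^ 2 := by
    intro p; unfold tg; split_ifs <;> simp [pow_two]
  simp only [h2, ← pow_two] at h1
  have := gg_sum_le hγ M
  rw [nuF_trc_gg]; linarith

variable {P : Measure ΩS} [IsProbabilityMeasure P] {J : Idx → ΩS → ℝ} {γ : ℕ → ℝ} {N : ℕ}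

lemma UU_abs (hJ : StdGaussianDisorder J P) (p : ℕ) (x : Metric.sphere (0 : VN N) 1) :
    ∫⁻ ω, ‖UU J N p ω (x : VN N)‖ₑ ∂P ≤ 2 * ee (1/2) := by
  have h1 : ∀ c : ℝ, c ^ 2 = 1 → ∫⁻ ω, ee (c * UU J N p ω (x : VN N)) ∂P = ee (1/2) := by
    intro c hc
    have := gexp hJ N (p + 1) (fun j => if j = p then 1 else 0) c x
    simpa [hc] using this
  have hm : Measurable fun ω => UU J N p ω (x : VN N) :=
    (UU_meas hJ.1 N p).comp (measurable_id.prodMk measurable_const)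
  calc ∫⁻ ω, ‖UU J N p ω (x : VN N)‖ₑ ∂P
      ≤ ∫⁻ ω, (ee (1 * UU J N p ω (x : VN N)) + ee (-1 * UU J N p ω (x : VN N))) ∂P := by
        refine lintegral_mono fun ω => ?_
        rw [← ofReal_norm_eq_enorm, Real.norm_eq_abs]
        unfold ee
        rw [← ENNReal.ofReal_add (Real.exp_pos _).le (Real.exp_pos _).le]
        refine ENNReal.ofReal_le_ofReal ?_
        generalize UU J N p ω (x : VN N) = u
        have a1 := Real.add_one_le_exp (1 * u)
        have a2 := Real.add_one_le_exp (-1 * u)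
        have a3 := Real.exp_pos (1 * u)
        have a4 := Real.exp_pos (-1 * u)
        rcases abs_cases u with h | h <;> linarith
    _ = 2 * ee (1/2) := by
        have hm1 : Measurable fun ω => ee (1 * UU J N p ω (x : VN N)) := measurable_ee.comp (hm.const_mul 1)
        rw [lintegral_add_left hm1, h1 1 (by norm_num), h1 (-1) (by norm_num),
          two_mul]

lemma conv_ae (hγ : GammaDecay γ) (hJ : StdGaussianDisorder J P) (x : Metric.sphere (0 : VN N) 1) :
    ∀ᵐ ω ∂P, Summable fun p => √N * (gg γ p * UU J N p ω (x : VN N)) := by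
  have hm : ∀ p, Measurable fun ω => UU J N p ω (x : VN N) := fun p =>
    (UU_meas hJ.1 N p).comp (measurable_id.prodMk measurable_const)
  have h1 : ∫⁻ ω, ∑' p, ‖gg γ p * UU J N p ω (x : VN N)‖ₑ ∂P ≠ ∞ := by
    rw [lintegral_tsum (fun p => ((hm p).const_mul _).enorm.aemeasurable)]
    have h2 : ∀ p, ∫⁻ ω, ‖gg γ p * UU J N p ω (x : VN N)‖ₑ ∂P ≤ ENNReal.ofReal (gg γ p) * (2 * ee (1/2)) := by
      intro p
      simp only [enorm_mul]
      rw [lintegral_const_mul _ (hm p).enorm, Real.enorm_of_nonneg (gg_nonneg hγ p)]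
      exact mul_le_mul_right (UU_abs hJ p x) _
    refine ne_top_of_le_ne_top ?_ (ENNReal.tsum_le_tsum h2)
    rw [ENNReal.tsum_mul_right, ← ENNReal.ofReal_tsum_of_nonneg (gg_nonneg hγ) (gg_summable hγ)]
    exact ENNReal.mul_ne_top ENNReal.ofReal_ne_top (ENNReal.mul_ne_top (by norm_num) (ee_ne_top _))
  filter_upwards [ae_lt_top (Measurable.ennreal_tsum fun p => ((hm p).const_mul _).enorm) h1] with ω hω
  refine Summable.mul_left _ ?_
  exact Summable.of_norm (by
    have := ENNReal.summable_toReal hω.ne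
    simpa using this)

/-- limiting exponent -/
def XX (γ : ℕ → ℝ) (J : Idx → ΩS → ℝ) (N : ℕ) (β : ℝ) (z : ΩS × Metric.sphere (0 : VN N) 1) : ℝ :=
  -β * HamN γ J N z.1 (√N • (z.2 : VN N))

/-- truncated exponent -/
def XM (γ : ℕ → ℝ) (J : Idx → ΩS → ℝ) (N : ℕ) (β : ℝ) (M : ℕ) (z : ΩS × Metric.sphere (0 : VN N) 1) : ℝ :=
  (-β * √N) * ∑ p ∈ Finset.range M, gg γ p * UU J N p z.1 (z.2 : VN N)

lemma XM_meas (hm : ∀ i, Measurable (J i)) (β : ℝ) (M : ℕ) : Measurable (XM γ J N β M) := by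
  unfold XM
  exact (Finset.measurable_sum _ fun p _ => (UU_meas hm N p).const_mul _).const_mul _

lemma XM_tendsto (hN : 0 < N) {β : ℝ} {z : ΩS × Metric.sphere (0 : VN N) 1}
    (h : Summable fun p => √N * (gg γ p * UU J N p z.1 (z.2 : VN N))) :
    Tendsto (fun M => XM γ J N β M z) atTop (nhds (XX γ J N β z)) := by
  have h1 := h.hasSum.tendsto_sum_nat.const_mul (-β)
  unfold XX XM
  rw [ham_eq γ J hN]
  unfold gg at h1 ⊢
  refine h1.congr fun M => ?_
  rw [← Finset.mul_sum]; ring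

lemma XX_meas (hN : 0 < N) (hm : ∀ i, Measurable (J i)) (β : ℝ) : Measurable (XX γ J N β) := by
  classical
  obtain ⟨A, hA⟩ : ∃ A : Set (ΩS × Metric.sphere (0 : VN N) 1),
    A = {z | ∑' p, ‖√N * (gg γ p * UU J N p z.1 (z.2 : VN N))‖ₑ ≠ ∞} := ⟨_, rfl⟩
  have hAm : MeasurableSet A := by
    rw [hA]
    have : Measurable fun z : ΩS × Metric.sphere (0 : VN N) 1 => ∑' p, ‖√N * (gg γ p * UU J N p z.1 (z.2 : VN N))‖ₑ :=
      Measurable.ennreal_tsum fun p => (((UU_meas hm N p).const_mul _).const_mul _).enorm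
    exact (measurableSet_eq_fun this measurable_const).compl
  have hAs : ∀ z, z ∈ A ↔ Summable fun p => √N * (gg γ p * UU J N p z.1 (z.2 : VN N)) := by
    intro z
    rw [hA, Set.mem_ofPred_eq]
    constructor
    · intro h
      refine Summable.of_norm ?_
      have := ENNReal.summable_toReal h
      simpa using this
    · intro h
      have := h.norm.tsum_ofReal_ne_top
      simpa only [ofReal_norm_eq_enorm] using this
  refine measurable_of_tendsto_metrizable (f := fun M => A.indicator (XM γ J N β M))
    (fun M => (XM_meas hm β M).indicator hAm) ?_
  rw [tendsto_pi_nhds]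
  intro z
  by_cases hz : z ∈ A
  · simp only [Set.indicator_of_mem hz]
    exact XM_tendsto hN ((hAs z).1 hz)
  · simp only [Set.indicator_of_notMem hz]
    have : XX γ J N β z = 0 := by
      unfold XX
      have h2 : HamN γ J N z.1 (√N • (z.2 : VN N)) = 0 := by
        rw [ham_eq γ J hN]
        refine tsum_eq_zero_of_not_summable ?_
        exact fun h => hz ((hAs z).2 h)
      rw [h2, mul_zero]
    rw [this]; exact tendsto_const_nhds
end transfer2

section transfer3
variable {ΩS : Type*} [MeasurableSpace ΩS]
variable {P : Measure ΩS} [IsProbabilityMeasure P] {J : Idx → ΩS → ℝ} {γ : ℕ → ℝ} {N : ℕ}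

/-- full partition function in ENNReal -/
def ZF (γ : ℕ → ℝ) (J : Idx → ΩS → ℝ) (N : ℕ) (β : ℝ) (ω : ΩS) : ℝ≥0∞ :=
  ∫⁻ τ, ee (XX γ J N β (ω, τ)) ∂(unifSphere N)

/-- truncated partition function -/
def ZK (γ : ℕ → ℝ) (N : ℕ) (β : ℝ) (K : ℕ) (v : EN N K) : ℝ≥0∞ :=
  ∫⁻ τ, ee (-β * √N * inner ℝ v (feat N K (trc γ K) (τ : VN N))) ∂(unifSphere N)

lemma XM_inner (β : ℝ) (K : ℕ) (ω : ΩS) (τ : Metric.sphere (0 : VN N) 1) :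
    -β * √N * inner ℝ (JV J N K ω) (feat N K (trc γ K) (τ : VN N)) = XM γ J N β K (ω, τ) := by
  rw [JV_inner]; unfold XM
  congr 1
  refine Finset.sum_congr rfl fun p hp => ?_
  rw [trc_gg γ (Finset.mem_range.1 hp)]

lemma Xhead_meas (γ : ℕ → ℝ) (N : ℕ) (β : ℝ) (K : ℕ) :
    Measurable fun z : EN N K × Metric.sphere (0 : VN N) 1 =>
      ee (-β * √N * inner ℝ z.1 (feat N K (trc γ K) (z.2 : VN N))) := by
  refine measurable_ee.comp ?_
  have := (feat_contDiff N K (trc γ K)).continuous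
  have h : Continuous fun z : EN N K × Metric.sphere (0 : VN N) 1 =>
      -β * √N * inner ℝ z.1 (feat N K (trc γ K) (z.2 : VN N)) := by fun_prop
  exact h.measurable

lemma ZK_meas (hN : 0 < N) (β : ℝ) (K : ℕ) : Measurable (ZK γ N β K) := by
  have := unif_prob hN
  exact (Xhead_meas γ N β K).lintegral_prod_right'

lemma ZK_pos (hN : 0 < N) (β : ℝ) (K : ℕ) (v : EN N K) : ∃ l, ZK γ N β K v = ee l := by
  have := unif_prob hN
  have hca : Continuous fun τ : Metric.sphere (0 : VN N) 1 => (-β * √N) • feat N K (trc γ K) (τ : VN N) := by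
    have := (feat_contDiff N K (trc γ K)).continuous
    fun_prop
  have h := lpf_ee (unifSphere N) hca v
  simp only [real_inner_smul_right] at h
  exact ⟨_, h⟩

lemma ZF_fin (hN : 0 < N) (hγ : GammaDecay γ) (hJ : StdGaussianDisorder J P) (β : ℝ) :
    ∀ᵐ ω ∂P, ZF γ J N β ω < ∞ := by
  have := unif_prob hN
  have hm : Measurable fun z => ee (XX γ J N β z) := measurable_ee.comp (XX_meas hN hJ.1 β)
  have hZm : Measurable (ZF γ J N β) := hm.lintegral_prod_right'
  refine ae_lt_top hZm ?_
  unfold ZF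
  rw [lintegral_lintegral_swap hm.aemeasurable]
  refine ne_top_of_le_ne_top (b := ee (1/2 * ((-β * √N) ^ 2 * nuF γ 1))) (ee_ne_top _) ?_
  have key : ∀ τ, ∫⁻ ω, ee (XX γ J N β (ω, τ)) ∂P ≤ ee (1/2 * ((-β * √N) ^ 2 * nuF γ 1)) := by
    intro τ
    have hXM : ∀ M, Measurable fun ω => ee (XM γ J N β M (ω, τ)) := fun M =>
      measurable_ee.comp ((XM_meas hJ.1 β M).comp (measurable_id.prodMk measurable_const))
    have e1 : ∫⁻ ω, ee (XX γ J N β (ω, τ)) ∂P = ∫⁻ ω, liminf (fun M => ee (XM γ J N β M (ω, τ))) atTop ∂P := by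
      refine lintegral_congr_ae ?_
      filter_upwards [conv_ae hγ hJ τ] with ω hω
      have h1 := XM_tendsto (β := β) (z := (ω, τ)) hN hω
      exact ((continuous_ee.tendsto _).comp h1).liminf_eq.symm
    rw [e1]
    refine (lintegral_liminf_le hXM).trans ?_
    refine liminf_le_of_le ⟨0, by simp⟩ fun b hb => ?_
    obtain ⟨M, hM⟩ := hb.exists
    refine hM.trans ?_
    unfold XM
    rw [gexp hJ]
    refine ee_mono ?_
    have := gg_sum_le hγ M
    gcongr
  refine (lintegral_mono key).trans ?_
  simp

/-- Cauchy–Schwarz -/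
lemma CS_Z (hN : 0 < N) {X Y : Metric.sphere (0 : VN N) 1 → ℝ} (hX : Measurable X) (hY : Measurable Y) :
    (∫⁻ τ, ee (Y τ) ∂(unifSphere N)) * (∫⁻ τ, ee (Y τ) ∂(unifSphere N))
      ≤ (∫⁻ τ, ee (X τ) ∂(unifSphere N)) * ∫⁻ τ, ee (2 * Y τ - X τ) ∂(unifSphere N) := by
  have h := ENNReal.lintegral_mul_norm_pow_le (μ := unifSphere N) (f := fun τ => ee (X τ))
    (g := fun τ => ee (2 * Y τ - X τ)) (measurable_ee.comp hX).aemeasurable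
    (measurable_ee.comp ((hY.const_mul 2).sub hX)).aemeasurable (p := 1/2) (q := 1/2) (by norm_num) (by norm_num)
    (by norm_num)
  have e : ∀ x : ℝ, ee x ^ (1/2 : ℝ) = ee (x / 2) := by
    intro x
    unfold ee
    rw [ENNReal.ofReal_rpow_of_nonneg (Real.exp_pos _).le (by norm_num), ← Real.exp_mul]
    congr 2; ring
  have e2 : ∀ τ, ee (X τ) ^ (1/2 : ℝ) * ee (2 * Y τ - X τ) ^ (1/2 : ℝ) = ee (Y τ) := by
    intro τ; rw [e, e, ← ee_add]; congr 1; ring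
  simp only [e2] at h
  refine (mul_le_mul' h h).trans (le_of_eq ?_)
  rw [← ENNReal.mul_rpow_of_nonneg _ _ (by norm_num), ← ENNReal.rpow_add_of_nonneg _ _ (by norm_num) (by norm_num)]
  norm_num

set_option maxHeartbeats 1600000 in
lemma tail_int (hN : 0 < N) (hγ : GammaDecay γ) (hJ : StdGaussianDisorder J P) (β : ℝ) (K : ℕ)
    (τ : Metric.sphere (0 : VN N) 1) :
    ∫⁻ ω, (ZK γ N β K (JV J N K ω))⁻¹ * ee (2 * XM γ J N β K (ω, τ) - XX γ J N β (ω, τ)) ∂P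
      ≤ (∫⁻ ω, (ZK γ N β K (JV J N K ω))⁻¹ * ee (XM γ J N β K (ω, τ)) ∂P) *
        ee (1/2 * (β ^ 2 * N * (nuF γ 1 - nuF (trc γ K) 1))) := by
  have hJm : Measurable fun ω => JV J N K ω := JV_meas hJ.1 N K
  have hXM : ∀ M, Measurable fun ω => XM γ J N β M (ω, τ) := fun M =>
      (XM_meas hJ.1 β M).comp (measurable_id.prodMk measurable_const)
  have hZm : Measurable fun ω => (ZK γ N β K (JV J N K ω))⁻¹ := ((ZK_meas hN β K).comp hJm).inv
  have hm : ∀ M, Measurable fun ω => (ZK γ N β K (JV J N K ω))⁻¹ * ee (2 * XM γ J N β K (ω, τ) - XM γ J N β M (ω, τ)) :=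
    fun M => hZm.mul (measurable_ee.comp (((hXM K).const_mul 2).sub (hXM M)))
  have e1 : ∫⁻ ω, (ZK γ N β K (JV J N K ω))⁻¹ * ee (2 * XM γ J N β K (ω, τ) - XX γ J N β (ω, τ)) ∂P
      = ∫⁻ ω, liminf (fun M => (ZK γ N β K (JV J N K ω))⁻¹ * ee (2 * XM γ J N β K (ω, τ) - XM γ J N β M (ω, τ))) atTop ∂P := by
    refine lintegral_congr_ae ?_
    filter_upwards [conv_ae hγ hJ τ] with ω hω
    have h1 := XM_tendsto (β := β) (z := (ω, τ)) hN hω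
    have h2 := (continuous_ee.tendsto _).comp (h1.const_sub (2 * XM γ J N β K (ω, τ)))
    have h3 := ENNReal.Tendsto.const_mul (a := (ZK γ N β K (JV J N K ω))⁻¹) h2 (Or.inl (ee_ne_zero _))
    exact h3.liminf_eq.symm
  rw [e1]
  refine (lintegral_liminf_le hm).trans ?_
  refine liminf_le_of_le ⟨0, by simp⟩ fun b hb => ?_
  obtain ⟨M, hM, hKM⟩ := (hb.and (eventually_ge_atTop K)).exists
  refine hM.trans ?_
  have e2 : ∀ ω, (ZK γ N β K (JV J N K ω))⁻¹ * ee (2 * XM γ J N β K (ω, τ) - XM γ J N β M (ω, τ))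
      = ((ZK γ N β K (JV J N K ω))⁻¹ * ee (-β * √N * inner ℝ (JV J N K ω) (feat N K (trc γ K) (τ : VN N)))) *
        ee ((β * √N) * ∑ p ∈ Finset.range M, tg γ K p * UU J N p ω (τ : VN N)) := by
    intro ω
    rw [mul_assoc, ← ee_add, XM_inner]
    congr 2
    unfold XM
    rw [split_sum γ hKM (fun p => UU J N p ω (τ : VN N))]
    ring
  simp only [e2]
  have hG : Measurable fun v : EN N K => (ZK γ N β K v)⁻¹ * ee (-β * √N * inner ℝ v (feat N K (trc γ K) (τ : VN N))) :=
    by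
      refine (ZK_meas hN β K).inv.mul (measurable_ee.comp ?_)
      have : Continuous fun v : EN N K => -β * √N * inner ℝ v (feat N K (trc γ K) (τ : VN N)) := by fun_prop
      exact this.measurable
  have h5 := head_tail hJ (N := N) hKM (g := tg γ K) (fun p hp => by unfold tg; rw [if_pos hp]) (β * √N) τ hG
  rw [h5]
  simp only [XM_inner]
  refine mul_le_mul_right (ee_mono ?_) _
  rw [mul_pow, Real.sq_sqrt (Nat.cast_nonneg N)]
  have := tg_sum_le hγ hKM
  gcongr

set_option maxHeartbeats 1600000 in
lemma transfer (hN : 0 < N) (hγ : GammaDecay γ) (hJ : StdGaussianDisorder J P) (β : ℝ) (K : ℕ) (s : ℝ) :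
    P {ω | ZF γ J N β ω < ee (-s) * ZK γ N β K (JV J N K ω)}
      ≤ ee (-s + 1/2 * (β ^ 2 * N * (nuF γ 1 - nuF (trc γ K) 1))) := by
  have := unif_prob hN
  have hJm : Measurable fun ω => JV J N K ω := JV_meas hJ.1 N K
  have hXMz := XM_meas (γ := γ) (N := N) hJ.1 β K
  have hXXz := XX_meas (γ := γ) (N := N) hN hJ.1 β
  have hZm : Measurable fun ω => (ZK γ N β K (JV J N K ω))⁻¹ := ((ZK_meas hN β K).comp hJm).inv
  have hf : Measurable fun z : ΩS × Metric.sphere (0 : VN N) 1 =>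
      (ZK γ N β K (JV J N K z.1))⁻¹ * ee (2 * XM γ J N β K z - XX γ J N β z) :=
    (hZm.comp measurable_fst).mul (measurable_ee.comp ((hXMz.const_mul 2).sub hXXz))
  have hf2 : Measurable fun z : ΩS × Metric.sphere (0 : VN N) 1 =>
      (ZK γ N β K (JV J N K z.1))⁻¹ * ee (XM γ J N β K z) :=
    (hZm.comp measurable_fst).mul (measurable_ee.comp hXMz)
  obtain ⟨W, hW⟩ : ∃ W : ΩS → ℝ≥0∞, W = fun ω => ∫⁻ τ, (ZK γ N β K (JV J N K ω))⁻¹ *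
    ee (2 * XM γ J N β K (ω, τ) - XX γ J N β (ω, τ)) ∂(unifSphere N) := ⟨_, rfl⟩
  have hWm : Measurable W := by rw [hW]; exact hf.lintegral_prod_right'
  have hWi : ∫⁻ ω, W ω ∂P ≤ ee (1/2 * (β ^ 2 * N * (nuF γ 1 - nuF (trc γ K) 1))) := by
    rw [hW]
    dsimp only
    rw [lintegral_lintegral_swap hf.aemeasurable]
    refine (lintegral_mono fun τ => tail_int hN hγ hJ β K τ).trans ?_
    rw [lintegral_mul_const' _ _ (ee_ne_top _)]
    refine mul_le_of_le_one_left' ?_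
    rw [← lintegral_lintegral_swap hf2.aemeasurable]
    have : ∀ ω, ∫⁻ τ, (ZK γ N β K (JV J N K ω))⁻¹ * ee (XM γ J N β K (ω, τ)) ∂(unifSphere N) ≤ 1 := by
      intro ω
      obtain ⟨l, hl⟩ := ZK_pos (γ := γ) hN β K (JV J N K ω)
      rw [lintegral_const_mul' _ _ (by rw [hl]; exact ENNReal.inv_ne_top.2 (ee_ne_zero _))]
      have e : ∫⁻ τ, ee (XM γ J N β K (ω, τ)) ∂(unifSphere N) = ZK γ N β K (JV J N K ω) := by
        unfold ZK; simp only [XM_inner]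
      rw [e]
      exact ENNReal.inv_mul_le_one _
    refine (lintegral_mono this).trans ?_
    simp
  have hsub : {ω | ZF γ J N β ω < ee (-s) * ZK γ N β K (JV J N K ω)} ⊆ {ω | ee s ≤ W ω} := by
    intro ω hω
    rw [Set.mem_ofPred_eq] at hω ⊢
    obtain ⟨l, hl⟩ := ZK_pos (γ := γ) hN β K (JV J N K ω)
    have hXω : Measurable fun τ => XX γ J N β (ω, τ) := hXXz.comp (measurable_const.prodMk measurable_id)
    have hYω : Measurable fun τ => XM γ J N β K (ω, τ) := hXMz.comp (measurable_const.prodMk measurable_id)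
    have h1 := CS_Z hN hXω hYω
    have e : ∫⁻ τ, ee (XM γ J N β K (ω, τ)) ∂(unifSphere N) = ZK γ N β K (JV J N K ω) := by
        unfold ZK; simp only [XM_inner]
    have eW : W ω = (ee l)⁻¹ * ∫⁻ τ, ee (2 * XM γ J N β K (ω, τ) - XX γ J N β (ω, τ)) ∂(unifSphere N) := by
      rw [hW]; dsimp only
      rw [hl, lintegral_const_mul' _ _ (ENNReal.inv_ne_top.2 (ee_ne_zero _))]
    rw [e, hl] at h1
    rw [hl] at hω
    rw [eW]
    generalize (∫⁻ τ, ee (2 * XM γ J N β K (ω, τ) - XX γ J N β (ω, τ)) ∂(unifSphere N)) = w at h1 ⊢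
    have h2 : ee l * ee l ≤ (ee (-s) * ee l) * w := h1.trans (mul_le_mul_left hω.le _)
    have h3 : ee s * ee l ≤ w := by
      have h4 := mul_le_mul_right h2 (ee (s - l))
      have e5 : ee (s - l) * (ee l * ee l) = ee s * ee l := by
        rw [← ee_add, ← ee_add, ← ee_add]; congr 1; ring
      have e6 : ee (s - l) * (ee (-s) * ee l * w) = w := by
        rw [← mul_assoc, ← ee_add, ← ee_add]
        have : s - l + (-s + l) = 0 := by ring
        rw [this, ee_zero, one_mul]
      rwa [e5, e6] at h4
    rw [mul_comm, ← div_eq_mul_inv]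
    exact (ENNReal.le_div_iff_mul_le (Or.inl (ee_ne_zero _)) (Or.inl (ee_ne_top _))).2 h3
  refine (measure_mono hsub).trans ?_
  have hMk := mul_meas_ge_le_lintegral (μ := P) hWm (ee s)
  have h7 := mul_le_mul_right (hMk.trans hWi) (ee (-s))
  rw [← mul_assoc, ← ee_add, ← ee_add, neg_add_cancel, ee_zero, one_mul] at h7
  exact h7
end transfer3

section finalpart
variable {ΩS : Type*} [MeasurableSpace ΩS]
variable {P : Measure ΩS} [IsProbabilityMeasure P] {J : Idx → ΩS → ℝ} {γ : ℕ → ℝ} {N : ℕ}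

lemma ZN_eq (hN : 0 < N) (hm : ∀ i, Measurable (J i)) (β : ℝ) (ω : ΩS) :
    ZN γ J N β ω = (ZF γ J N β ω).toReal := by
  have hX : Measurable fun τ => XX γ J N β (ω, τ) :=
    (XX_meas hN hm β).comp (measurable_const.prodMk measurable_id)
  unfold ZN ZF
  rw [integral_eq_lintegral_of_nonneg_ae (Eventually.of_forall fun τ => (Real.exp_pos _).le)]
  · rfl
  · exact (Real.measurable_exp.comp hX).aestronglyMeasurable

lemma ZN_log (hN : 0 < N) (hm : ∀ i, Measurable (J i)) {β : ℝ} {ω : ΩS} (hf : ZF γ J N β ω < ∞) {L : ℝ}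
    (h : ee (N * L) ≤ ZF γ J N β ω) : L ≤ (1 / N : ℝ) * Real.log (ZN γ J N β ω) := by
  have h1 : rexp (N * L) ≤ ZN γ J N β ω := by
    rw [ZN_eq hN hm]
    have := ENNReal.toReal_mono hf.ne h
    unfold ee at this
    rwa [ENNReal.toReal_ofReal (Real.exp_pos _).le] at this
  have h2 := Real.log_le_log (Real.exp_pos _) h1
  rw [Real.log_exp] at h2
  have hNp : (0:ℝ) < N := Nat.cast_pos.2 hN
  rw [one_div, ← div_eq_inv_mul, le_div_iff₀ hNp, mul_comm]
  exact h2

lemma bad_bound (hN : 0 < N) (hγ : GammaDecay γ) (hJ : StdGaussianDisorder J P) {β ε L κ : ℝ} {K : ℕ}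
    (hK : β ^ 2 * (nuF γ 1 - nuF (trc γ K) 1) ≤ ε / 2)
    (hZ : stdGaussian (EN N K) {v | ZK γ N β K v ≤ ee (N * (L - ε / 2))} ≤ ee (-(N * κ))) :
    P {ω | (1 / N : ℝ) * Real.log (ZN γ J N β ω) < L - ε} ≤ ee (-(N * κ)) + ee (-(N * (ε / 4))) := by
  have hms : MeasurableSet {v | ZK γ N β K v ≤ ee (N * (L - ε / 2))} :=
    measurableSet_le (ZK_meas hN β K) measurable_const
  rw [← JV_law hJ, Measure.map_apply (JV_meas hJ.1 N K) hms] at hZ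
  have hT := transfer hN hγ hJ β K (N * (ε / 2))
  have hF : P {ω | ¬ ZF γ J N β ω < ∞} = 0 := ae_iff.1 (ZF_fin hN hγ hJ β)
  have hsub : {ω | (1 / N : ℝ) * Real.log (ZN γ J N β ω) < L - ε} ⊆
      (JV J N K ⁻¹' {v | ZK γ N β K v ≤ ee (N * (L - ε / 2))} ∪
        {ω | ZF γ J N β ω < ee (-(N * (ε / 2))) * ZK γ N β K (JV J N K ω)}) ∪ {ω | ¬ ZF γ J N β ω < ∞} := by
    intro ω hω
    by_contra hc
    rw [Set.mem_union, Set.mem_union, not_or, not_or] at hc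
    obtain ⟨⟨c1, c2⟩, c3⟩ := hc
    rw [Set.mem_preimage, Set.mem_ofPred_eq, not_le] at c1
    rw [Set.mem_ofPred_eq, not_lt] at c2
    rw [Set.mem_ofPred_eq, not_not] at c3
    rw [Set.mem_ofPred_eq] at hω
    refine absurd (ZN_log hN hJ.1 c3 (L := L - ε) ?_) (not_le.2 hω)
    refine le_trans ?_ c2
    refine le_trans (le_of_eq ?_) (mul_le_mul_right c1.le _)
    rw [← ee_add]; congr 1; ring
  refine (measure_mono hsub).trans ((measure_union_le _ _).trans ?_)
  rw [hF, add_zero]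
  refine (measure_union_le _ _).trans (add_le_add hZ (hT.trans (ee_mono ?_)))
  have := mul_le_mul_of_nonneg_left hK (Nat.cast_nonneg (α := ℝ) N)
  linarith
end finalpart

lemma final_bound {ΩS : Type*} [MeasurableSpace ΩS] (P : Measure ΩS) [IsProbabilityMeasure P]
    (γ : ℕ → ℝ) (hγ : GammaDecay γ) (hnorm : nuF γ 1 = 1) (hM : ConditionM γ)
    (J : Idx → ΩS → ℝ) (hJ : StdGaussianDisorder J P)
    (qstar : ℝ → ℝ) (hqstar : IsQStar γ qstar) :
    ∃ β0 : ℝ, ∀ β ≥ β0, ∀ ε > (0 : ℝ), ∃ c > (0 : ℝ), ∃ C > (0 : ℝ), ∀ N : ℕ,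
      P {ω : ΩS | (1 / N : ℝ) * Real.log (ZN γ J N β ω)
          < LambdaZ γ β (-(E0q γ (qstar β))) (qstar β) - ε}
        ≤ ENNReal.ofReal (C * Real.exp (-c * N)) := by
  obtain ⟨β0, hβ0⟩ := eventually_atTop.1 (params hγ hM hqstar)
  refine ⟨β0, fun β hβ ε hε => ?_⟩
  obtain ⟨hq, x, hE, hR, hB⟩ := hβ0 β hβ
  obtain ⟨κ, hκ, hev⟩ := trunc_conc hγ hnorm hM hq hE hR hB (half_pos hε)
  have ht : Tendsto (fun K => β ^ 2 * (nuF γ 1 - nuF (trc γ K) 1)) atTop (nhds 0) := by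
    have h1 := (nuF_tr_tendsto hγ (t := 1) (by simp)).const_sub (nuF γ 1)
    have h2 := h1.const_mul (β ^ 2)
    rwa [sub_self, mul_zero] at h2
  obtain ⟨K, hK, hKt⟩ := (hev.and (ht.eventually (gt_mem_nhds (half_pos hε)))).exists
  obtain ⟨N0, hN0⟩ := hK
  obtain ⟨c, hc⟩ : ∃ c, c = min κ (ε / 4) := ⟨_, rfl⟩
  have hc0 : 0 < c := by rw [hc]; positivity
  have hc1 : c ≤ κ := by rw [hc]; exact min_le_left _ _
  have hc2 : c ≤ ε / 4 := by rw [hc]; exact min_le_right _ _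
  refine ⟨c, hc0, 2 * rexp (c * (N0 + 1)), by positivity, fun N => ?_⟩
  have hNn : (0:ℝ) ≤ N := Nat.cast_nonneg N
  by_cases hN : N0 + 1 ≤ N
  · have h1 := hN0 N (by omega)
    refine (bad_bound (by omega) hγ hJ hKt.le h1).trans ?_
    have a1 : ee (-(N * κ)) ≤ ee (-c * N) := ee_mono (by
      have := mul_le_mul_of_nonneg_left hc1 hNn
      linarith)
    have a2 : ee (-(N * (ε / 4))) ≤ ee (-c * N) := ee_mono (by
      have := mul_le_mul_of_nonneg_left hc2 hNn
      linarith)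
    refine (add_le_add a1 a2).trans ?_
    unfold ee
    rw [← ENNReal.ofReal_add (Real.exp_pos _).le (Real.exp_pos _).le]
    refine ENNReal.ofReal_le_ofReal ?_
    have h2 : 1 ≤ rexp (c * (N0 + 1)) := Real.one_le_exp (by positivity)
    have h3 := mul_le_mul_of_nonneg_right h2 (Real.exp_pos (-c * N)).le
    linarith
  · refine prob_le_one.trans ?_
    rw [← ENNReal.ofReal_one]
    refine ENNReal.ofReal_le_ofReal ?_
    rw [mul_assoc, ← Real.exp_add]
    have h4 : (N:ℝ) ≤ N0 + 1 := by
      have : N ≤ N0 + 1 := by omega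
      exact_mod_cast this
    have h5 := mul_le_mul_of_nonneg_left h4 hc0.le
    have h6 : 1 ≤ rexp (c * (N0 + 1) + -c * N) := Real.one_le_exp (by linarith)
    linarith

/-- (Lower bound on the free energy.) -/
theorem free_energy_lower_bound
    {ΩS : Type*} [MeasurableSpace ΩS] (P : Measure ΩS) [IsProbabilityMeasure P]
    (γ : ℕ → ℝ) (hγ : GammaDecay γ) (hnorm : nuF γ 1 = 1) (hM : ConditionM γ)
    (J : Idx → ΩS → ℝ) (hJ : StdGaussianDisorder J P)
    (qstar : ℝ → ℝ) (hqstar : IsQStar γ qstar) :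
    ∃ β0 : ℝ, ∀ β ≥ β0, ∀ ε > (0 : ℝ), ∃ c > (0 : ℝ), ∃ C > (0 : ℝ), ∀ N : ℕ,
      P {ω : ΩS | (1 / N : ℝ) * Real.log (ZN γ J N β ω)
          < LambdaZ γ β (-(E0q γ (qstar β))) (qstar β) - ε}
        ≤ ENNReal.ofReal (C * Real.exp (-c * N)) := by
  exact final_bound P γ hγ hnorm hM J hJ qstar hqstar

end SpinGlass
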